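/- Let p be an odd prime, K = ℂ_p, π ∈ K with π^{p-1} = −p, κ ∈ K with (κπ)^{p-1} = p, and A an n×n nonnegative integer matrix with 0 < det A < p whose reduction is Berglund–Hübsch over the residue field of K. Then the twisted Frobenius TFr_A = Fr_A ∘ (κπ)^{(p-1)(#_A − #^∨_A)/2} is a chain map C^†_A(K) → C^†_A(K), and on cohomology H(Δ^A) ∘ H(TFr_A) = H(TFr_{A^T}) ∘ H(Δ^A) as maps H(C^†_A(K)) → H(C^†_{A^T}(K)). -/

import Mathlib

open scoped BigOperators TensorProduct
open Matrix Classical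

noncomputable section

/-- The invertible-type polynomial `W_A = ∑ i, ∏ j, x_j ^ A i j`. -/
def Wpoly (F : Type) [Field F] {ι : Type} [Fintype ι] (A : Matrix ι ι ℕ) :
    MvPolynomial ι F :=
  ∑ i, ∏ j, MvPolynomial.X j ^ A i j

/-- `A` is a Berglund–Hübsch matrix over the field `F`. -/
def IsBH (F : Type) [Field F] {ι : Type} [Fintype ι] [LinearOrder ι]
    (A : Matrix ι ι ℕ) : Prop :=
  (A.map ((↑) : ℕ → ℚ)).det ≠ 0 ∧
  (ringChar F = 0 ∨ ((A.map ((↑) : ℕ → ℤ)).det < (ringChar F : ℤ))) ∧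
  (∃ q : ι → ℚ, (∀ j, 0 < q j) ∧ ∀ i, (∑ j, (A i j : ℚ) * q j) = 1) ∧
  RingTheory.Sequence.IsRegular (MvPolynomial ι F)
    ((Finset.univ.sort (· ≤ ·)).map fun i => MvPolynomial.pderiv i (Wpoly F A))

/-- The model for the exterior algebra `⋀(Fⁿ)`: the free `F`-module on the standard
basis monomials `e_S = e_{s_1} ∧ … ∧ e_{s_k}`, `s_1 < … < s_k`, indexed by finite sets. -/
abbrev ExtV (F : Type) (ι : Type) := Finset ι → F

/-- Exterior multiplication by `e_i` on `⋀(Fⁿ)`. -/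
def mulE (F : Type) [Field F] {ι : Type} [LinearOrder ι] (i : ι) :
    ExtV F ι →ₗ[F] ExtV F ι where
  toFun f S := if i ∈ S then (-1 : F) ^ (S.filter (· < i)).card * f (S.erase i) else 0
  map_add' f g := by
    funext S
    by_cases h : i ∈ S <;> simp [h, mul_add]
  map_smul' a f := by
    funext S
    by_cases h : i ∈ S <;> simp [h, mul_left_comm]

/-- Contraction `e_i^∨` on `⋀(Fⁿ)`. -/
def contrE (F : Type) [Field F] {ι : Type} [LinearOrder ι] (i : ι) :
    ExtV F ι →ₗ[F] ExtV F ι where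
  toFun f S := if i ∈ S then 0 else (-1 : F) ^ (S.filter (· < i)).card * f (insert i S)
  map_add' f g := by
    funext S
    by_cases h : i ∈ S <;> simp [h, mul_add]
  map_smul' a f := by
    funext S
    by_cases h : i ∈ S <;> simp [h, mul_left_comm]

/-- `E_{A,i} = π ∑_j A_{ij} e_j`. -/
def EA (F : Type) [Field F] {ι : Type} [Fintype ι] [LinearOrder ι]
    (π : F) (A : Matrix ι ι ℕ) (i : ι) : ExtV F ι →ₗ[F] ExtV F ι :=
  π • ∑ j, (A i j : F) • mulE F j

/-- `E^∨_{A,i} = π⁻¹ ∑_j (A⁻¹)_{ji} e_j^∨`, the inverse matrix being computed over `F`. -/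
def EAdual (F : Type) [Field F] {ι : Type} [Fintype ι] [LinearOrder ι]
    (π : F) (A : Matrix ι ι ℕ) (i : ι) : ExtV F ι →ₗ[F] ExtV F ι :=
  π⁻¹ • ∑ j, ((A.map ((↑) : ℕ → F))⁻¹ j i) • contrE F j

/-- The element `E_{Aᵀ,1} E_{Aᵀ,2} ⋯ E_{Aᵀ,n} (1) ∈ ⋀(Fⁿ)`. -/
def starTop (F : Type) [Field F] {ι : Type} [Fintype ι] [LinearOrder ι]
    (π : F) (A : Matrix ι ι ℕ) : ExtV F ι :=
  (Finset.univ.sort (· ≤ ·)).foldr (fun i v => EA F π Aᵀ i v)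
    (Pi.single (∅ : Finset ι) (1 : F))

/-- Borisov's duality operator `*^A`, defined on the standard basis by
`*^A(e_{i_1} ∧ … ∧ e_{i_k}) = E^∨_{Aᵀ,i_1} ⋯ E^∨_{Aᵀ,i_k}(E_{Aᵀ,1} ⋯ E_{Aᵀ,n}(1))`. -/
def starA (F : Type) [Field F] {ι : Type} [Fintype ι] [LinearOrder ι]
    (π : F) (A : Matrix ι ι ℕ) : ExtV F ι →ₗ[F] ExtV F ι :=
  (Pi.basisFun F (Finset ι)).constr F fun S =>
    (S.sort (· ≤ ·)).foldr (fun i v => EAdual F π Aᵀ i v) (starTop F π A)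

/-- Index of a monomial `x^γ y^λ`. -/
abbrev MonIdx (ι : Type) := (ι → ℕ) × (ι → ℕ)

/-- The matrix `A` viewed over `ℚ`. -/
def Aq {ι : Type} [Fintype ι] [LinearOrder ι] (A : Matrix ι ι ℕ) : Matrix ι ι ℚ :=
  A.map ((↑) : ℕ → ℚ)

/-- The row vector `λ A⁻ᵀ`, computed over `ℚ`. -/
def lamRow {ι : Type} [Fintype ι] [LinearOrder ι] (A : Matrix ι ι ℕ) (lam : ι → ℕ) :
    ι → ℚ :=
  Matrix.vecMul (fun i => (lam i : ℚ)) ((Aq A)ᵀ)⁻¹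

/-- The row vector `γ A⁻¹`, computed over `ℚ`. -/
def gamRow {ι : Type} [Fintype ι] [LinearOrder ι] (A : Matrix ι ι ℕ) (gam : ι → ℕ) :
    ι → ℚ :=
  Matrix.vecMul (fun i => (gam i : ℚ)) (Aq A)⁻¹

/-- The allowed monomials `x^γ y^λ` of `R_A`: `(λA⁻ᵀ)_i ≥ 0` for all `i`, and
`γ A⁻¹ λᵀ = 0`. -/
def OKA {ι : Type} [Fintype ι] [LinearOrder ι] (A : Matrix ι ι ℕ) (m : MonIdx ι) : Prop :=
  (∀ i, 0 ≤ lamRow A m.2 i) ∧ (gamRow A m.1 ⬝ᵥ fun i => ((m.2 i : ℚ))) = 0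

/-- The allowed monomial indices of `R_A`. -/
abbrev AMon {n : ℕ} (A : Matrix (Fin n) (Fin n) ℕ) : Type := {m : MonIdx (Fin n) // OKA A m}

/-- Index set for coefficients of elements of `R_A ⊗ ⋀(Kⁿ)`. -/
abbrev BIdx {n : ℕ} (A : Matrix (Fin n) (Fin n) ℕ) : Type := AMon A × Finset (Fin n)

/-- The full coefficient space of (possibly infinite) series supported on the allowed
monomials of `R_A`. -/
abbrev RFull (K : Type) {n : ℕ} (A : Matrix (Fin n) (Fin n) ℕ) : Type := AMon A → K

/-- The full coefficient space of (possibly infinite) series in `R_A ⊗ ⋀(Kⁿ)`. -/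
abbrev BFull (K : Type) {n : ℕ} (A : Matrix (Fin n) (Fin n) ℕ) : Type := BIdx A → K

/-- Diagonal operator with weight `w`. -/
def diagOp {K : Type} [Field K] {α : Type} (w : α → K) : (α → K) →ₗ[K] (α → K) where
  toFun c a := w a * c a
  map_add' c c' := by funext a; simp [mul_add]
  map_smul' r c := by funext a; simp [mul_left_comm]

/-- The "transpose" of a partially defined index map: `(pullOp σ c) b = c (σ b)`,
with the convention that missing values contribute `0`. -/
def pullOp {K : Type} [Field K] {α β : Type} (σ : β → Option α) :
    (α → K) →ₗ[K] (β → K) where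
  toFun c b := ((σ b).map c).getD 0
  map_add' c c' := by funext b; cases h : σ b <;> simp [h]
  map_smul' r c := by funext b; cases h : σ b <;> simp [h]

/-- The tensor product `T ⊗ L` of a coefficientwise operator `T` on series and an
operator `L` on the (finite-dimensional) exterior algebra. -/
def tmap {K : Type} [Field K] {n : ℕ} {α β : Type}
    (T : (α → K) →ₗ[K] (β → K)) (L : ExtV K (Fin n) →ₗ[K] ExtV K (Fin n)) :
    (α × Finset (Fin n) → K) →ₗ[K] (β × Finset (Fin n) → K) where
  toFun c q := ∑ S : Finset (Fin n), L (Pi.single S 1) q.2 * T (fun m => c (m, S)) q.1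
  map_add' c c' := by
    funext q
    have h : ∀ S : Finset (Fin n), T (fun m => c (m, S) + c' (m, S))
        = T (fun m => c (m, S)) + T (fun m => c' (m, S)) := fun S =>
      map_add T (fun m => c (m, S)) (fun m => c' (m, S))
    simp only [Pi.add_apply]
    simp only [h, Pi.add_apply, mul_add, Finset.sum_add_distrib]
  map_smul' r c := by
    funext q
    have h : ∀ S : Finset (Fin n), T (fun m => r * c (m, S))
        = r • T (fun m => c (m, S)) := fun S =>
      _root_.map_smul T r (fun m => c (m, S))
    simp only [Pi.smul_apply, smul_eq_mul, RingHom.id_apply]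
    simp only [h, Pi.smul_apply, smul_eq_mul, Finset.mul_sum, mul_left_comm]

/-- `φ_{A,i} = π ∑_j A_{ji} x^{e_j A}·`, acting on coefficients of series. -/
def phiF (K : Type) [Field K] {n : ℕ} (π : K) (A : Matrix (Fin n) (Fin n) ℕ) (i : Fin n) :
    RFull K A →ₗ[K] RFull K A :=
  π • ∑ j, (A j i : K) • pullOp (fun m' : AMon A =>
    if h : (∀ k, A j k ≤ m'.1.1 k) ∧ OKA A ((fun k => m'.1.1 k - A j k), m'.1.2)
    then some ⟨((fun k => m'.1.1 k - A j k), m'.1.2), h.2⟩ else none)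

/-- `ψ^∨_{A,i} = y^{e_i Aᵀ}·`, acting on coefficients of series. -/
def psidualF (K : Type) [Field K] {n : ℕ} (A : Matrix (Fin n) (Fin n) ℕ) (i : Fin n) :
    RFull K A →ₗ[K] RFull K A :=
  pullOp (fun m' : AMon A =>
    if h : (∀ j, A j i ≤ m'.1.2 j) ∧ OKA A (m'.1.1, fun j => m'.1.2 j - A j i)
    then some ⟨(m'.1.1, fun j => m'.1.2 j - A j i), h.2⟩ else none)

/-- `θ_{A,i} + φ_{A,i}`. -/
def dxF (K : Type) [Field K] {n : ℕ} (π : K) (A : Matrix (Fin n) (Fin n) ℕ) (i : Fin n) :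
    RFull K A →ₗ[K] RFull K A :=
  diagOp (fun m => (m.1.1 i : K)) + phiF K π A i

/-- `T^∨_{A,i} + ψ^∨_{A,i}`. -/
def dyF (K : Type) [Field K] {n : ℕ} (π : K) (A : Matrix (Fin n) (Fin n) ℕ) (i : Fin n) :
    RFull K A →ₗ[K] RFull K A :=
  diagOp (fun m => π⁻¹ * ((lamRow A m.1.2 i : ℚ) : K)) + psidualF K A i

/-- The differential `d_A + d^∨_A` on series. -/
def dFull (K : Type) [Field K] {n : ℕ} (π : K) (A : Matrix (Fin n) (Fin n) ℕ) :
    BFull K A →ₗ[K] BFull K A :=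
  (∑ i, tmap (dxF K π A i) (mulE K i)) + ∑ i, tmap (dyF K π A i) (contrE K i)

/-- The total degree `|γ| + |λ|` of a monomial. -/
def degMon {n : ℕ} (m : MonIdx (Fin n)) : ℕ := (∑ i, m.1 i) + ∑ i, m.2 i

/-- Overconvergence (à la Dwork–Monsky) of a series: there is `M > 0` with
`ord_p(coefficient) ≥ M(|γ|+|λ|)`, i.e. `‖coefficient‖ ≤ p^{-M(|γ|+|λ|)}`, for all but
finitely many monomials. -/
def OvercR {K : Type} [NontriviallyNormedField K] {n : ℕ} {A : Matrix (Fin n) (Fin n) ℕ}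
    (p : ℕ) (c : RFull K A) : Prop :=
  ∃ M : ℝ, 0 < M ∧
    {m : AMon A | ¬ ‖c m‖ ≤ (p : ℝ) ^ (-(M * (degMon m.1 : ℝ)))}.Finite

/-- Overconvergence of an element of `B^†_A(K)`. -/
def OvercB {K : Type} [NontriviallyNormedField K] {n : ℕ} {A : Matrix (Fin n) (Fin n) ℕ}
    (p : ℕ) (c : BFull K A) : Prop :=
  ∃ M : ℝ, 0 < M ∧
    {q : BIdx A | ¬ ‖c q‖ ≤ (p : ℝ) ^ (-(M * (degMon q.1.1 : ℝ)))}.Finite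

/-- Polynomial (finitely supported) elements of `B_A(K)`. -/
def FinSuppB {K : Type} [Field K] {n : ℕ} {A : Matrix (Fin n) (Fin n) ℕ}
    (c : BFull K A) : Prop :=
  (Function.support c).Finite

/-- The condition `(γA⁻¹)_i ≥ 0` for all `i` cutting out `S_A ⊆ R_A`. -/
def gamOK {n : ℕ} (A : Matrix (Fin n) (Fin n) ℕ) (q : BIdx A) : Prop :=
  ∀ i, 0 ≤ gamRow A q.1.1.1 i

/-- Membership in the subcomplex `C_A(K) = S_A(K) ⊗ ⋀(Kⁿ)` (polynomial version). -/
def CFin {K : Type} [Field K] {n : ℕ} {A : Matrix (Fin n) (Fin n) ℕ}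
    (c : BFull K A) : Prop :=
  FinSuppB c ∧ ∀ q, c q ≠ 0 → gamOK A q

/-- Membership in the subcomplex `C^†_A(K) = S^†_A(K) ⊗ ⋀(Kⁿ)` (overconvergent
version). -/
def COver {K : Type} [NontriviallyNormedField K] {n : ℕ} {A : Matrix (Fin n) (Fin n) ℕ}
    (p : ℕ) (c : BFull K A) : Prop :=
  OvercB p c ∧ ∀ q, c q ≠ 0 → gamOK A q

/-- The eigenvalue of `Q^∨_A = ∑ i, Q^∨_{A,i}` on the basis monomial indexed by `q`:
the number of `i ∉ S` with `(λA⁻ᵀ)_i ≠ 0`. -/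
def qexpDual {n : ℕ} (A : Matrix (Fin n) (Fin n) ℕ) (q : BIdx A) : ℕ :=
  (Finset.univ.filter fun i => i ∉ q.2 ∧ lamRow A q.1.1.2 i ≠ 0).card

/-- The eigenvalue of `Q_A = ∑ i, Q_{A,i}` on the basis monomial indexed by `q`. -/
def qexpQ {n : ℕ} (A : Matrix (Fin n) (Fin n) ℕ) (q : BIdx A) : ℕ :=
  q.2.card + qexpDual A q

/-- The diagonal operator `p^{Q_A}`. -/
def pQdiag (K : Type) [Field K] {n : ℕ} (p : ℕ) (A : Matrix (Fin n) (Fin n) ℕ) :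
    BFull K A →ₗ[K] BFull K A :=
  diagOp fun q => (p : K) ^ (qexpQ A q)

/-- The diagonal operator `p^{Q^∨_A}`. -/
def pQdualdiag (K : Type) [Field K] {n : ℕ} (p : ℕ) (A : Matrix (Fin n) (Fin n) ℕ) :
    BFull K A →ₗ[K] BFull K A :=
  diagOp fun q => (p : K) ^ (qexpDual A q)

/-- The diagonal operator `p^{Q_A + Q^∨_A}`. -/
def pQQdualdiag (K : Type) [Field K] {n : ℕ} (p : ℕ) (A : Matrix (Fin n) (Fin n) ℕ) :
    BFull K A →ₗ[K] BFull K A :=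
  diagOp fun q => (p : K) ^ (qexpQ A q + qexpDual A q)

/-- The diagonal operator `p^{2·Q^∨_A}`. -/
def pQdual2diag (K : Type) [Field K] {n : ℕ} (p : ℕ) (A : Matrix (Fin n) (Fin n) ℕ) :
    BFull K A →ₗ[K] BFull K A :=
  diagOp fun q => (p : K) ^ (2 * qexpDual A q)

/-- The diagonal operator `p^{2·ext − n}` (where `ext` is the exterior degree). -/
def pExtDiag (K : Type) [Field K] {n : ℕ} (p : ℕ) (A : Matrix (Fin n) (Fin n) ℕ) :
    BFull K A →ₗ[K] BFull K A :=
  diagOp fun q => (p : K) ^ (2 * (q.2.card : ℤ) - (n : ℤ))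

/-- `Θ'_A : x^γ y^λ ↦ x^{pγ} y^{pλ}`, acting on coefficients of series. -/
def ThetaPrimeF (K : Type) [Field K] {n : ℕ} (p : ℕ) (A : Matrix (Fin n) (Fin n) ℕ) :
    RFull K A →ₗ[K] RFull K (p • A) :=
  pullOp fun m' : AMon (p • A) =>
    if h : OKA A ((fun i => m'.1.1 i / p), (fun i => m'.1.2 i / p)) ∧
        (∀ i, p ∣ m'.1.1 i ∧ p ∣ m'.1.2 i)
    then some ⟨((fun i => m'.1.1 i / p), (fun i => m'.1.2 i / p)), h.1⟩ else none

/-- `Fr'_A = (Θ'_A ⊗ Id) ∘ p^{Q_A} : B^†_A(K) → B^†_{pA}(K)`. -/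
def FrPrime (K : Type) [Field K] {n : ℕ} (p : ℕ)
    (A : Matrix (Fin n) (Fin n) ℕ) : BFull K A →ₗ[K] BFull K (p • A) :=
  (tmap (ThetaPrimeF K p A) LinearMap.id).comp (pQdiag K p A)

/-- The coefficients of the Dwork exponential `exp(π(t^p − t)) = ∑ d_m t^m`:
`d_m = ∑_{a + pb = m} (−1)^a π^{a+b}/(a! b!)`. -/
def dworkCoef (K : Type) [Field K] (p : ℕ) (π : K) (m : ℕ) : K :=
  ∑ ab ∈ Finset.range (m + 1) ×ˢ Finset.range (m + 1),
    if ab.1 + p * ab.2 = m then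
      ((-1 : K) ^ ab.1 * π ^ (ab.1 + ab.2)) / ((ab.1.factorial : K) * (ab.2.factorial : K))
    else 0

/-- The coefficient of `x^δ` in `Z_A(x) = exp(π(W_{pA}(x) − W_A(x)))
= ∏_i exp(π((x^{e_iA})^p − x^{e_iA}))`. -/
def Zcoef (K : Type) [Field K] {n : ℕ} (p : ℕ) (π : K) (A : Matrix (Fin n) (Fin n) ℕ)
    (δ : Fin n → ℕ) : K :=
  ∑ k ∈ Fintype.piFinset (fun _ : Fin n => Finset.range ((∑ j, δ j) + 1)),
    if ∀ j, (∑ i, k i * A i j) = δ j then ∏ i, dworkCoef K p π (k i) else 0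

/-- `Θ''_A`: multiplication by `Z_A(x) Z_{Aᵀ}(y)`, as a map `R^†_{pA}(K) → R^†_A(K)`
(computed on coefficients; monomials violating the support conditions are set to `0`). -/
def ZmulF (K : Type) [Field K] {n : ℕ} (p : ℕ) (π : K) (A : Matrix (Fin n) (Fin n) ℕ) :
    RFull K (p • A) →ₗ[K] RFull K A where
  toFun c m' :=
    ∑ δ ∈ Fintype.piFinset (fun _ : Fin n => Finset.range ((∑ j, m'.1.1 j) + 1)),
      ∑ ε ∈ Fintype.piFinset (fun _ : Fin n => Finset.range ((∑ j, m'.1.2 j) + 1)),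
        Zcoef K p π A δ * Zcoef K p π Aᵀ ε *
          (if h : (∀ k, δ k ≤ m'.1.1 k) ∧ (∀ k, ε k ≤ m'.1.2 k) ∧
              OKA (p • A) ((fun k => m'.1.1 k - δ k), (fun k => m'.1.2 k - ε k))
          then c ⟨((fun k => m'.1.1 k - δ k), (fun k => m'.1.2 k - ε k)), h.2.2⟩ else 0)
  map_add' c c' := by
    funext m'
    have key : ∀ (P : Prop) (hP : Decidable P) (f g : P → K),
        (dite P (fun h => f h + g h) (fun _ => (0 : K)))
          = dite P f (fun _ => 0) + dite P g (fun _ => 0) := by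
      intro P hP f g; split <;> simp
    simp only [Pi.add_apply, key, mul_add, Finset.sum_add_distrib]
  map_smul' r c := by
    funext m'
    have key : ∀ (P : Prop) (hP : Decidable P) (f : P → K),
        (dite P (fun h => r * f h) (fun _ => (0 : K))) = r * dite P f (fun _ => 0) := by
      intro P hP f; split <;> simp
    simp only [Pi.smul_apply, smul_eq_mul, RingHom.id_apply, key, Finset.mul_sum,
      mul_left_comm]

/-- `Fr''_A = (Θ''_A ⊗ Id) ∘ p^{Q^∨_{pA}} : B^†_{pA}(K) → B^†_A(K)`. -/
def FrDoublePrime (K : Type) [Field K] {n : ℕ} (p : ℕ) (π : K)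
    (A : Matrix (Fin n) (Fin n) ℕ) : BFull K (p • A) →ₗ[K] BFull K A :=
  (tmap (ZmulF K p π A) LinearMap.id).comp (pQdualdiag K p (p • A))

/-- The Frobenius endomorphism `Fr_A = ((Θ''_A ∘ Θ'_A) ⊗ Id) ∘ p^{Q_A + Q^∨_A}`. -/
def FrFull (K : Type) [Field K] {n : ℕ} (p : ℕ) (π : K)
    (A : Matrix (Fin n) (Fin n) ℕ) : BFull K A →ₗ[K] BFull K A :=
  (tmap ((ZmulF K p π A).comp (ThetaPrimeF K p A)) LinearMap.id).comp (pQQdualdiag K p A)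

/-- The transposition map `D^A : x^γ y^λ ↦ x^λ y^γ` on coefficients of series. -/
def DAmapF (K : Type) [Field K] {n : ℕ} (A : Matrix (Fin n) (Fin n) ℕ) :
    RFull K A →ₗ[K] RFull K Aᵀ :=
  pullOp fun m' : AMon Aᵀ =>
    if h : OKA A (m'.1.2, m'.1.1) then some ⟨(m'.1.2, m'.1.1), h⟩ else none

/-- Berglund–Hübsch duality `Δ^A = D^A ⊗ *^A` on series. -/
def DeltaF (K : Type) [Field K] {n : ℕ} (π : K) (A : Matrix (Fin n) (Fin n) ℕ) :
    BFull K A →ₗ[K] BFull K Aᵀ :=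
  tmap (DAmapF K A) (starA K π A)

/-- `Q̂_{A,i} = P̂_{A,i} ⊗ E_{A,i} E^∨_{A,i}` (the projection `P̂_{A,i}` is onto
monomials with `(γA⁻¹)_i ≠ 0`). -/
def QhatFull (K : Type) [Field K] {n : ℕ} (π : K) (A : Matrix (Fin n) (Fin n) ℕ)
    (i : Fin n) : BFull K A →ₗ[K] BFull K A :=
  tmap (diagOp fun m : AMon A => if gamRow A m.1.1 i = 0 then (0 : K) else 1)
    ((EA K π A i).comp (EAdual K π A i))

/-- `p^{−2Q̂_A} = ∏_i (Id + (p⁻² − 1) Q̂_{A,i})` (the `Q̂_{A,i}` are commuting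
idempotents). -/
def pQhatInvDiag (K : Type) [Field K] {n : ℕ} (p : ℕ) (π : K)
    (A : Matrix (Fin n) (Fin n) ℕ) : BFull K A →ₗ[K] BFull K A :=
  ((List.finRange n).map fun i =>
    LinearMap.id + ((p : K) ^ (-2 : ℤ) - 1) • QhatFull K π A i).foldr
    (fun f g => f.comp g) LinearMap.id

/-- `#_A`: the number of indices `i` with `(γA⁻¹)_i ∉ ℤ`. -/
def hashA {n : ℕ} (A : Matrix (Fin n) (Fin n) ℕ) (q : BIdx A) : ℤ :=
  ((Finset.univ.filter fun i => ¬ ∃ z : ℤ, gamRow A q.1.1.1 i = (z : ℚ)).card : ℤ)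

/-- `#^∨_A`: the number of indices `i` with `(λA⁻ᵀ)_i ∉ ℤ`. -/
def hashAdual {n : ℕ} (A : Matrix (Fin n) (Fin n) ℕ) (q : BIdx A) : ℤ :=
  ((Finset.univ.filter fun i => ¬ ∃ z : ℤ, lamRow A q.1.1.2 i = (z : ℚ)).card : ℤ)

/-- The diagonal twist `(κπ)^{(p−1)(#_A − #^∨_A)/2}`. -/
def TwistDiag (K : Type) [Field K] {n : ℕ} (p : ℕ) (κ π : K)
    (A : Matrix (Fin n) (Fin n) ℕ) : BFull K A →ₗ[K] BFull K A :=
  diagOp fun q => (κ * π) ^ ((((p : ℤ) - 1) / 2) * (hashA A q - hashAdual A q))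

/-- The twisted Frobenius `TFr_A = Fr_A ∘ (κπ)^{(p−1)(#_A − #^∨_A)/2}`. -/
def TFrFull (K : Type) [Field K] {n : ℕ} (p : ℕ) (κ π : K)
    (A : Matrix (Fin n) (Fin n) ℕ) : BFull K A →ₗ[K] BFull K A :=
  (FrFull K p π A).comp (TwistDiag K p κ π A)
end

set_option linter.unusedSectionVars false

namespace BH

section Clifford
variable {F : Type} [Field F] {ι : Type} [LinearOrder ι]

theorem mulE_apply (i : ι) (f : ExtV F ι) (S : Finset ι) :
    mulE F i f S = if i ∈ S then (-1 : F) ^ (S.filter (· < i)).card * f (S.erase i) else 0 := rfl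

theorem contrE_apply (i : ι) (f : ExtV F ι) (S : Finset ι) :
    contrE F i f S
      = if i ∈ S then 0 else (-1 : F) ^ (S.filter (· < i)).card * f (insert i S) := rfl

theorem sign_erase {i j : ι} {S : Finset ι} (hj : j ∈ S) :
    (-1 : F) ^ ((S.erase j).filter (· < i)).card
      = (if j < i then -1 else 1) * (-1 : F) ^ (S.filter (· < i)).card := by
  rw [Finset.filter_erase]
  by_cases h : j < i
  · have hm : j ∈ S.filter (· < i) := by simp [hj, h]
    have := Finset.card_erase_add_one hm
    rw [← this, pow_succ]; simp [h]
  · rw [Finset.erase_eq_of_notMem (by simp [h])]; simp [h]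

theorem sign_insert {i j : ι} {S : Finset ι} (hj : j ∉ S) :
    (-1 : F) ^ ((insert j S).filter (· < i)).card
      = (if j < i then -1 else 1) * (-1 : F) ^ (S.filter (· < i)).card := by
  rw [Finset.filter_insert]
  by_cases h : j < i
  · rw [if_pos h, Finset.card_insert_of_notMem (by simp [hj]), pow_succ]; simp [h]
  · simp [h]

theorem mulE_anticomm (i j : ι) (v : ExtV F ι) :
    mulE F i (mulE F j v) + mulE F j (mulE F i v) = 0 := by
  funext S
  simp only [Pi.add_apply, Pi.zero_apply, mulE_apply, Finset.mem_erase]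
  rcases eq_or_ne i j with rfl | hij
  · simp
  by_cases hi : i ∈ S
  · by_cases hj : j ∈ S
    · rw [if_pos hi, if_pos ⟨hij.symm, hj⟩, if_pos hj, if_pos ⟨hij, hi⟩, sign_erase hi,
        sign_erase hj, Finset.erase_right_comm]
      rcases lt_or_gt_of_ne hij with h | h
      · simp only [h, h.not_gt, if_true, if_false]; ring
      · simp only [h, h.not_gt, if_true, if_false]; ring
    · simp [hj]
  · simp [hi]

theorem contrE_anticomm (i j : ι) (v : ExtV F ι) :
    contrE F i (contrE F j v) + contrE F j (contrE F i v) = 0 := by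
  funext S
  simp only [Pi.add_apply, Pi.zero_apply, contrE_apply, Finset.mem_insert]
  rcases eq_or_ne i j with rfl | hij
  · simp
  by_cases hi : i ∈ S
  · simp [hi]
  · by_cases hj : j ∈ S
    · simp [hj]
    · rw [if_neg hi, if_neg (by simp [hij.symm, hj]), if_neg hj, if_neg (by simp [hij, hi]),
        sign_insert hi, sign_insert hj, Finset.insert_comm]
      rcases lt_or_gt_of_ne hij with h | h
      · simp only [h, h.not_gt, if_true, if_false]; ring
      · simp only [h, h.not_gt, if_true, if_false]; ring

theorem neg_one_pow_mul_self (k : ℕ) : (-1 : F) ^ k * (-1) ^ k = 1 := by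
  rw [← mul_pow]; simp

theorem mulE_contrE (i j : ι) (v : ExtV F ι) :
    mulE F i (contrE F j v) + contrE F j (mulE F i v) = if i = j then v else 0 := by
  funext S
  simp only [Pi.add_apply, mulE_apply, contrE_apply, Finset.mem_insert,
    Finset.mem_erase]
  rcases eq_or_ne i j with rfl | hij
  · by_cases hi : i ∈ S
    · simp only [hi, if_true, Finset.insert_erase hi, ne_eq, not_true, false_and, if_false,
        add_zero, Finset.filter_erase]
      rw [Finset.erase_eq_of_notMem (by simp), ← mul_assoc, neg_one_pow_mul_self, one_mul]
    · simp only [hi, if_false, zero_add, true_or, if_true, Finset.erase_insert hi]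
      rw [Finset.filter_insert, if_neg (lt_irrefl _), ← mul_assoc, neg_one_pow_mul_self, one_mul]
  · simp only [hij, if_false, Pi.zero_apply, false_or]
    by_cases hi : i ∈ S
    · by_cases hj : j ∈ S
      · simp [hj, hij.symm]
      · rw [if_pos hi, if_neg (by simp [hj]), if_neg hj, if_pos hi, sign_erase hi, sign_insert hj,
          Finset.erase_insert_of_ne hij.symm]
        rcases lt_or_gt_of_ne hij with h | h
        · simp only [h, h.not_gt, if_true, if_false]; ring
        · simp only [h, h.not_gt, if_true, if_false]; ring
    · simp [hi]

theorem mulE_single (i : ι) (S : Finset ι) :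
    mulE F i (Pi.single S 1)
      = if i ∈ S then 0 else (-1 : F) ^ (S.filter (· < i)).card • Pi.single (insert i S) 1 := by
  funext T
  rw [mulE_apply]
  by_cases hi : i ∈ S
  · rw [if_pos hi]
    split_ifs with hT
    · rw [Pi.single_eq_of_ne, mul_zero]; rfl
      rintro rfl; simp at hi
    · rfl
  · rw [if_neg hi]
    by_cases hT : i ∈ T
    · rw [if_pos hT]
      by_cases h : T = insert i S
      · subst h
        simp [Finset.erase_insert hi, Finset.filter_insert]
      · rw [Pi.single_eq_of_ne, mul_zero, Pi.smul_apply, Pi.single_eq_of_ne h, smul_zero]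
        rintro rfl; exact h (Finset.insert_erase hT).symm
    · rw [if_neg hT, Pi.smul_apply, Pi.single_eq_of_ne, smul_zero]
      rintro rfl; simp at hT

theorem contrE_single (i : ι) (S : Finset ι) :
    contrE F i (Pi.single S 1)
      = if i ∈ S then (-1 : F) ^ (S.filter (· < i)).card • Pi.single (S.erase i) 1 else 0 := by
  funext T
  rw [contrE_apply]
  by_cases hi : i ∈ S
  · rw [if_pos hi]
    by_cases hT : i ∈ T
    · rw [if_pos hT, Pi.smul_apply, Pi.single_eq_of_ne, smul_zero]
      rintro rfl; simp at hT
    · rw [if_neg hT]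
      by_cases h : T = S.erase i
      · subst h
        rw [Finset.insert_erase hi, Finset.filter_erase, Finset.erase_eq_of_notMem (by simp)]
        simp
      · rw [Pi.single_eq_of_ne, mul_zero, Pi.smul_apply, Pi.single_eq_of_ne h, smul_zero]
        rintro rfl; exact h (Finset.erase_insert hT).symm
  · rw [if_neg hi]
    split_ifs with hT
    · rfl
    · rw [Pi.single_eq_of_ne, mul_zero]; rfl
      rintro rfl; simp at hi

end Clifford

section Star
variable {F : Type} [Field F] {ι : Type} [Fintype ι] [LinearOrder ι]
variable (π : F) (A : Matrix ι ι ℕ)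

theorem EA_apply (i : ι) (v : ExtV F ι) :
    EA F π A i v = π • ∑ j, (A i j : F) • mulE F j v := by
  simp [EA, LinearMap.sum_apply]

theorem EAdual_apply (i : ι) (v : ExtV F ι) :
    EAdual F π A i v = π⁻¹ • ∑ j, ((A.map ((↑) : ℕ → F))⁻¹ j i) • contrE F j v := by
  simp [EAdual, LinearMap.sum_apply]

theorem EA_anticomm (i j : ι) (v : ExtV F ι) :
    EA F π A i (EA F π A j v) + EA F π A j (EA F π A i v) = 0 := by
  simp only [EA_apply, map_smul, map_sum, Finset.smul_sum, smul_smul]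
  rw [Finset.sum_comm, ← Finset.sum_add_distrib]
  refine Finset.sum_eq_zero fun k _ => ?_
  rw [← Finset.sum_add_distrib]
  refine Finset.sum_eq_zero fun l _ => ?_
  have := mulE_anticomm k l v
  rw [add_eq_zero_iff_eq_neg] at this
  rw [this, smul_neg, add_eq_zero_iff_eq_neg]
  congr 2; ring_nf

theorem EAdual_anticomm (i j : ι) (v : ExtV F ι) :
    EAdual F π A i (EAdual F π A j v) + EAdual F π A j (EAdual F π A i v) = 0 := by
  simp only [EAdual_apply, map_smul, map_sum, Finset.smul_sum, smul_smul]
  rw [Finset.sum_comm, ← Finset.sum_add_distrib]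
  refine Finset.sum_eq_zero fun k _ => ?_
  rw [← Finset.sum_add_distrib]
  refine Finset.sum_eq_zero fun l _ => ?_
  have := contrE_anticomm k l v
  rw [add_eq_zero_iff_eq_neg] at this
  rw [this, smul_neg, add_eq_zero_iff_eq_neg]
  congr 2; ring_nf

theorem EA_contrE (i k : ι) (v : ExtV F ι) :
    EA F π A i (contrE F k v) + contrE F k (EA F π A i v) = (π * (A i k : F)) • v := by
  simp only [EA_apply, map_smul, map_sum]
  rw [← smul_add, ← Finset.sum_add_distrib, mul_smul]
  congr 1
  simp only [← smul_add, mulE_contrE]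
  simp

theorem EA_EAdual (hπ : π ≠ 0) (hA : (A.map ((↑) : ℕ → F)).det ≠ 0) (i j : ι) (v : ExtV F ι) :
    EA F π A i (EAdual F π A j v) + EAdual F π A j (EA F π A i v) = if i = j then v else 0 := by
  rw [EAdual_apply, EAdual_apply]
  simp only [map_smul, map_sum]
  rw [← smul_add, ← Finset.sum_add_distrib]
  simp only [← smul_add, EA_contrE, smul_smul, ← Finset.sum_smul]
  have h : ∑ k, (A.map ((↑) : ℕ → F))⁻¹ k j * (π * (A i k : F))
      = π * (A.map ((↑) : ℕ → F) * (A.map ((↑) : ℕ → F))⁻¹) i j := by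
    rw [Matrix.mul_apply, Finset.mul_sum]
    refine Finset.sum_congr rfl fun k _ => ?_
    simp only [Matrix.map_apply]; ring
  rw [h, Matrix.mul_nonsing_inv _ (isUnit_iff_ne_zero.mpr hA), ← mul_assoc, inv_mul_cancel₀ hπ,
    one_mul, Matrix.one_apply]
  split_ifs <;> simp

theorem starA_single (S : Finset ι) :
    starA F π A (Pi.single S 1)
      = (S.sort (· ≤ ·)).foldr (fun i v => EAdual F π Aᵀ i v) (starTop F π A) := by
  have := (Pi.basisFun F (Finset ι)).constr_basis F
    (fun S => (S.sort (· ≤ ·)).foldr (fun i v => EAdual F π Aᵀ i v) (starTop F π A)) S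
  rwa [Pi.basisFun_apply] at this

/-- Inserting an operator into an ordered product of pairwise anticommuting operators. -/
theorem foldr_anticomm_not_mem (T : ι → ExtV F ι →ₗ[F] ExtV F ι)
    (hT : ∀ i j v, T i (T j v) + T j (T i v) = 0) (w : ExtV F ι) (i : ι) (S : Finset ι)
    (hi : i ∉ S) :
    T i ((S.sort (· ≤ ·)).foldr (fun i v => T i v) w)
      = (-1 : F) ^ (S.filter (· < i)).card •
        ((insert i S).sort (· ≤ ·)).foldr (fun i v => T i v) w := by
  induction S using Finset.induction_on_min with
  | empty => simp
  | insert a S ha ih =>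
    have haS : a ∉ S := fun h => lt_irrefl _ (ha a h)
    rw [Finset.mem_insert, not_or] at hi
    have hs : ((insert a S).sort (· ≤ ·)) = a :: S.sort (· ≤ ·) :=
      Finset.sort_insert _ (fun b hb => (ha b hb).le) haS
    rcases lt_or_gt_of_ne hi.1 with h | h
    · have h2 : ((insert i (insert a S)).sort (· ≤ ·)) = i :: (insert a S).sort (· ≤ ·) := by
        refine Finset.sort_insert _ (fun b hb => ?_) (by simp [hi.1, hi.2])
        rcases Finset.mem_insert.1 hb with rfl | hb
        · exact h.le
        · exact (h.trans (ha b hb)).le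
      have h3 : (insert a S).filter (· < i) = ∅ := by
        ext b
        simp only [Finset.mem_filter, Finset.mem_insert, Finset.notMem_empty, iff_false, not_and,
          not_lt]
        rintro (rfl | hb)
        · exact h.le
        · exact (h.trans (ha b hb)).le
      rw [h2, h3]; simp
    · have h2 : ((insert i (insert a S)).sort (· ≤ ·)) = a :: (insert i S).sort (· ≤ ·) := by
        rw [Finset.insert_comm]
        refine Finset.sort_insert _ (fun b hb => ?_) (by simp [Ne.symm hi.1, haS])
        rcases Finset.mem_insert.1 hb with rfl | hb
        · exact h.le
        · exact (ha b hb).le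
      rw [h2, hs, List.foldr_cons, List.foldr_cons, eq_neg_of_add_eq_zero_left (hT i a _),
        ih hi.2, map_smul, sign_insert haS, if_pos h]
      simp

theorem foldr_anticomm_mem (T : ι → ExtV F ι →ₗ[F] ExtV F ι)
    (hT : ∀ i j v, T i (T j v) + T j (T i v) = 0) (hT0 : ∀ i v, T i (T i v) = 0)
    (w : ExtV F ι) (i : ι) (S : Finset ι) (hi : i ∈ S) :
    T i ((S.sort (· ≤ ·)).foldr (fun i v => T i v) w) = 0 := by
  have h := foldr_anticomm_not_mem T hT w i (S.erase i) (Finset.notMem_erase i S)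
  rw [Finset.insert_erase hi] at h
  have h2 := congrArg (T i) h
  rw [hT0, map_smul] at h2
  exact ((smul_eq_zero.1 h2.symm).resolve_left (pow_ne_zero _ (by simp)))

theorem EA_sq [CharZero F] (i : ι) (v : ExtV F ι) : EA F π A i (EA F π A i v) = 0 := by
  have h := EA_anticomm π A i i v
  rw [← two_smul F] at h
  exact (smul_eq_zero.1 h).resolve_left two_ne_zero

theorem EAdual_sq [CharZero F] (i : ι) (v : ExtV F ι) :
    EAdual F π A i (EAdual F π A i v) = 0 := by
  have h := EAdual_anticomm π A i i v
  rw [← two_smul F] at h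
  exact (smul_eq_zero.1 h).resolve_left two_ne_zero

theorem starA_mulE [CharZero F] (i : ι) (v : ExtV F ι) :
    starA F π A (mulE F i v) = EAdual F π Aᵀ i (starA F π A v) := by
  suffices h : (starA F π A).comp (mulE F i) = (EAdual F π Aᵀ i).comp (starA F π A) from
    LinearMap.congr_fun h v
  refine (Pi.basisFun F (Finset ι)).ext fun S => ?_
  rw [Pi.basisFun_apply, LinearMap.comp_apply, LinearMap.comp_apply, mulE_single, starA_single]
  by_cases hi : i ∈ S
  · rw [if_pos hi, map_zero, foldr_anticomm_mem _ (EAdual_anticomm π Aᵀ) (EAdual_sq π Aᵀ) _ _ _ hi]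
  · rw [if_neg hi, map_smul, starA_single,
      foldr_anticomm_not_mem _ (EAdual_anticomm π Aᵀ) _ _ _ hi]

theorem foldr_dual (T U : ι → ExtV F ι →ₗ[F] ExtV F ι)
    (hT : ∀ i j v, T i (U j v) + U j (T i v) = if i = j then v else 0) (w : ExtV F ι) (i : ι)
    (hw : T i w = 0) (S : Finset ι) :
    T i ((S.sort (· ≤ ·)).foldr (fun i v => U i v) w)
      = if i ∈ S then (-1 : F) ^ (S.filter (· < i)).card •
        ((S.erase i).sort (· ≤ ·)).foldr (fun i v => U i v) w else 0 := by
  induction S using Finset.induction_on_min with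
  | empty => simpa using hw
  | insert a S ha ih =>
    have haS : a ∉ S := fun h => lt_irrefl _ (ha a h)
    have hs : ((insert a S).sort (· ≤ ·)) = a :: S.sort (· ≤ ·) :=
      Finset.sort_insert _ (fun b hb => (ha b hb).le) haS
    rw [hs, List.foldr_cons, eq_sub_of_add_eq (hT i a _), ih]
    by_cases hia : i = a
    · subst hia
      rw [if_pos rfl, if_neg haS, map_zero, sub_zero, if_pos (Finset.mem_insert_self _ _),
        Finset.erase_insert haS, Finset.filter_insert, if_neg (lt_irrefl _)]
      have : S.filter (· < i) = ∅ := by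
        ext b; simp only [Finset.mem_filter, Finset.notMem_empty, iff_false, not_and, not_lt]
        exact fun hb => (ha b hb).le
      simp [this]
    · rw [if_neg hia, zero_sub]
      by_cases hi : i ∈ S
      · rw [if_pos hi, if_pos (Finset.mem_insert_of_mem hi), map_smul, sign_insert haS,
          if_pos (ha i hi), Finset.erase_insert_of_ne (Ne.symm hia),
          Finset.sort_insert _ (fun b hb => (ha b (Finset.mem_of_mem_erase hb)).le)
            (by simp [haS])]
        simp
      · rw [if_neg hi, if_neg (by simp [hia, hi])]; simp

theorem EA_starTop [CharZero F] (i : ι) : EA F π Aᵀ i (starTop F π A) = 0 :=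
  foldr_anticomm_mem _ (EA_anticomm π Aᵀ) (EA_sq π Aᵀ) _ _ _ (Finset.mem_univ i)

theorem starA_contrE [CharZero F] (hπ : π ≠ 0) (hA : (A.map ((↑) : ℕ → F)).det ≠ 0) (i : ι)
    (v : ExtV F ι) :
    starA F π A (contrE F i v) = EA F π Aᵀ i (starA F π A v) := by
  have hA' : (Aᵀ.map ((↑) : ℕ → F)).det ≠ 0 := by
    rwa [Matrix.transpose_map, Matrix.det_transpose]
  suffices h : (starA F π A).comp (contrE F i) = (EA F π Aᵀ i).comp (starA F π A) from
    LinearMap.congr_fun h v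
  refine (Pi.basisFun F (Finset ι)).ext fun S => ?_
  rw [Pi.basisFun_apply, LinearMap.comp_apply, LinearMap.comp_apply, contrE_single, starA_single,
    foldr_dual _ _ (EA_EAdual π Aᵀ hπ hA') _ _ (EA_starTop π A i)]
  by_cases hi : i ∈ S
  · rw [if_pos hi, if_pos hi, map_smul, starA_single]
  · rw [if_neg hi, if_neg hi, map_zero]

end Star

/-- The combinatorial data of a complex with differential `∑ k, ε k (x k / P + shift by s k)` on
`Λ`-valued functions on `Z`, where functions are restricted to the region in which the coordinates
`x k` are nonnegative and adjacent coordinates are not both positive. -/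
structure KSys (K Λ Q Z : Type) [Field K] [AddCommGroup Λ] [Module K Λ] [Fintype Q]
    [DecidableEq Q] [AddCommGroup Z] where
  s : Q → Z
  x : Q → Z →+ ℚ
  adj : Q → Q → Prop
  ε : Q → Λ →ₗ[K] Λ
  εv : Q → Λ →ₗ[K] Λ
  P : K
  P_ne : P ≠ 0
  x_s : ∀ k k', x k (s k') = if k = k' then 1 else 0
  adj_symm : ∀ k k', adj k k' → adj k' k
  adj_irrefl : ∀ k, ¬ adj k k
  anti : ∀ k k', ¬ adj k k' → ∀ v, ε k (ε k' v) + ε k' (ε k v) = 0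
  dual : ∀ k k' v, ε k (εv k' v) + εv k' (ε k v) = if k = k' then v else 0

namespace KSys

variable {K Λ Q Z : Type} [Field K] [CharZero K] [AddCommGroup Λ] [Module K Λ] [Fintype Q]
  [DecidableEq Q] [AddCommGroup Z] (S : KSys K Λ Q Z)

def ok (z : Z) : Prop :=
  (∀ k, 0 ≤ S.x k z) ∧ ∀ k k', S.adj k k' → S.x k z = 0 ∨ S.x k' z = 0

def Supp (F : Z → Λ) : Prop := ∀ z, F z ≠ 0 → S.ok z

def L (k : Q) (F : Z → Λ) (z : Z) : Λ := ((S.x k z : K) / S.P) • F z + F (z - S.s k)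

noncomputable def D : (Z → Λ) →ₗ[K] (Z → Λ) where
  toFun F z := if S.ok z then ∑ k, S.ε k (((S.x k z : K) / S.P) • F z + F (z - S.s k)) else 0
  map_add' F G := by
    funext z
    simp only [Pi.add_apply]
    split_ifs
    · rw [← Finset.sum_add_distrib]
      refine Finset.sum_congr rfl fun k _ => ?_
      rw [← map_add, smul_add]; congr 1; abel
    · simp
  map_smul' a F := by
    funext z
    simp only [Pi.smul_apply, RingHom.id_apply]
    split_ifs
    · rw [Finset.smul_sum]
      refine Finset.sum_congr rfl fun k _ => ?_
      rw [← map_smul, smul_add, smul_comm]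
    · simp

variable {S}

theorem D_ok (F : Z → Λ) {z : Z} (hz : S.ok z) : S.D F z = ∑ k, S.ε k (S.L k F z) :=
  if_pos hz

theorem D_not_ok (F : Z → Λ) {z : Z} (hz : ¬ S.ok z) : S.D F z = 0 := if_neg hz

theorem D_supp (F : Z → Λ) : S.Supp (S.D F) := fun _ h => by
  by_contra hz; exact h (D_not_ok F hz)

theorem Supp.zero {F : Z → Λ} (hF : S.Supp F) {z : Z} (hz : ¬ S.ok z) : F z = 0 := by
  by_contra h; exact hz (hF z h)

theorem Supp.sub {F G : Z → Λ} (hF : S.Supp F) (hG : S.Supp G) : S.Supp (F - G) := by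
  intro z h
  by_contra hz
  exact h (by simp [hF.zero hz, hG.zero hz])

theorem x_sub (k k' : Q) (z : Z) :
    S.x k (z - S.s k') = S.x k z - if k = k' then 1 else 0 := by
  rw [map_sub, S.x_s]

theorem x_add (k k' : Q) (z : Z) :
    S.x k (z + S.s k') = S.x k z + if k = k' then 1 else 0 := by
  rw [map_add, S.x_s]

theorem x_sub_self (k : Q) (z : Z) : S.x k (z - S.s k) = S.x k z - 1 := by simp [x_sub]

theorem x_add_self (k : Q) (z : Z) : S.x k (z + S.s k) = S.x k z + 1 := by simp [x_add]

theorem x_sub_ne {k k' : Q} (h : k ≠ k') (z : Z) : S.x k (z - S.s k') = S.x k z := by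
  simp [x_sub, h]

theorem x_add_ne {k k' : Q} (h : k ≠ k') (z : Z) : S.x k (z + S.s k') = S.x k z := by
  simp [x_add, h]

theorem ε_sq (k : Q) (v : Λ) : S.ε k (S.ε k v) = 0 := by
  have h := S.anti k k (S.adj_irrefl k) v
  rw [← two_smul K] at h
  exact (smul_eq_zero.1 h).resolve_left two_ne_zero

theorem ε_comm {k k' : Q} (h : ¬ S.adj k k') (v : Λ) : S.ε k (S.ε k' v) = -S.ε k' (S.ε k v) :=
  eq_neg_of_add_eq_zero_left (S.anti k k' h v)

theorem ε_εv {k k' : Q} (h : k ≠ k') (v : Λ) : S.ε k (S.εv k' v) = -S.εv k' (S.ε k v) := by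
  have := S.dual k k' v
  rw [if_neg h] at this
  exact eq_neg_of_add_eq_zero_left this

theorem ε_εv_self (k : Q) (v : Λ) : S.ε k (S.εv k v) = v - S.εv k (S.ε k v) := by
  have := S.dual k k v
  rw [if_pos rfl] at this
  exact eq_sub_of_add_eq this

theorem ok_sub {z : Z} (hz : S.ok z) {k : Q} (h : 1 ≤ S.x k z) : S.ok (z - S.s k) := by
  refine ⟨fun k' => ?_, fun i j hij => ?_⟩
  · rw [x_sub]; split_ifs with hk
    · subst hk; linarith
    · simpa using hz.1 k'
  · have hne : i ≠ j := fun e => S.adj_irrefl i (e ▸ hij)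
    rcases eq_or_ne i k with rfl | hi
    · right; rw [x_sub_ne hne.symm]
      exact (hz.2 _ _ hij).resolve_left (by linarith)
    · rw [x_sub_ne hi]
      rcases eq_or_ne j k with rfl | hj
      · left; exact (hz.2 _ _ hij).resolve_right (by linarith)
      · rw [x_sub_ne hj]; exact hz.2 _ _ hij

theorem one_le_of_ok_sub {z : Z} {k : Q} (h : S.ok (z - S.s k)) : 1 ≤ S.x k z := by
  have := h.1 k
  rw [x_sub_self] at this; linarith

/-- Shifting up along a coordinate that is already positive stays in the region. -/
theorem ok_add {z : Z} (hz : S.ok z) {k : Q} (h : 0 < S.x k z) : S.ok (z + S.s k) := by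
  refine ⟨fun k' => ?_, fun i j hij => ?_⟩
  · rw [x_add]; have := hz.1 k'; split_ifs <;> linarith
  · have hne : i ≠ j := fun e => S.adj_irrefl i (e ▸ hij)
    rcases eq_or_ne i k with rfl | hi
    · right; rw [x_add_ne hne.symm]
      exact (hz.2 _ _ hij).resolve_left (by linarith)
    · rw [x_add_ne hi]
      rcases eq_or_ne j k with rfl | hj
      · left; exact (hz.2 _ _ hij).resolve_right (by linarith)
      · rw [x_add_ne hj]; exact hz.2 _ _ hij

theorem Supp.sub_shift {F : Z → Λ} (hF : S.Supp F) {z : Z} {k : Q} (h : S.x k z < 1) :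
    F (z - S.s k) = 0 := by
  by_contra hne
  exact absurd (one_le_of_ok_sub (hF _ hne)) (not_le.2 h)

theorem D_sq {F : Z → Λ} (hF : S.Supp F) : S.D (S.D F) = 0 := by
  funext z
  by_cases hz : S.ok z
  swap
  · exact D_not_ok _ hz
  have key : ∀ k, S.D F (z - S.s k) = ∑ k', S.ε k' (S.L k' F (z - S.s k)) := by
    intro k
    by_cases h : S.ok (z - S.s k)
    · exact D_ok F h
    · rw [D_not_ok F h]
      refine (Finset.sum_eq_zero fun k' _ => ?_).symm
      have h1 : S.x k z < 1 := by
        by_contra h1; exact h (ok_sub hz (not_lt.1 h1))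
      have h2 : F (z - S.s k - S.s k') = 0 := by
        rw [sub_right_comm]
        apply hF.sub_shift
        rw [x_sub]; split_ifs <;> linarith
      simp [L, hF.zero h, h2]
  set M : Q → Q → Λ := fun k k' =>
    ((S.x k z : K) / S.P) • S.L k' F z + S.L k' F (z - S.s k) with hM
  have h1 : S.D (S.D F) z = ∑ k, ∑ k', S.ε k (S.ε k' (M k k')) := by
    rw [D_ok _ hz]
    refine Finset.sum_congr rfl fun k _ => ?_
    rw [← map_sum, L, D_ok F hz, key, Finset.smul_sum, ← Finset.sum_add_distrib]
    congr 1
    refine Finset.sum_congr rfl fun k' _ => ?_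
    rw [hM]; simp only [map_add, map_smul]
  have symm : ∀ k k', k ≠ k' → M k k' = M k' k := by
    intro k k' hkk
    simp only [hM, L, x_sub_ne hkk, x_sub_ne hkk.symm, smul_add, smul_smul,
      sub_right_comm z (S.s k')]
    rw [mul_comm]; abel
  have zero : ∀ k k', S.adj k k' → M k k' = 0 := by
    intro k k' hkk
    have hne : k ≠ k' := fun e => S.adj_irrefl k (e ▸ hkk)
    have A1 : ∀ k k', k ≠ k' → S.x k z = 0 →
        F (z - S.s k) = 0 ∧ F (z - S.s k' - S.s k) = 0 := fun k k' hne h0 =>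
      ⟨hF.sub_shift (by rw [h0]; norm_num),
        hF.sub_shift (by rw [x_sub_ne hne, h0]; norm_num)⟩
    simp only [hM, L, x_sub_ne hne.symm]
    rcases hz.2 _ _ hkk with h0 | h0
    · obtain ⟨a, b⟩ := A1 k k' hne h0
      rw [sub_right_comm, a, b, h0]; simp
    · obtain ⟨a, b⟩ := A1 k' k hne.symm h0
      rw [a, b, h0]; simp
  have h2 : (2 : K) • (∑ k, ∑ k', S.ε k (S.ε k' (M k k'))) = 0 := by
    rw [two_smul]
    nth_rewrite 2 [Finset.sum_comm]
    rw [← Finset.sum_add_distrib]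
    refine Finset.sum_eq_zero fun k _ => ?_
    rw [← Finset.sum_add_distrib]
    refine Finset.sum_eq_zero fun k' _ => ?_
    rcases eq_or_ne k k' with rfl | hne
    · simp [ε_sq]
    · rw [symm k' k hne.symm]
      by_cases ha : S.adj k k'
      · simp [zero k k' ha]
      · exact S.anti k k' ha _
  rw [h1]
  exact (smul_eq_zero.1 h2).resolve_left two_ne_zero

theorem D_contr (κ : Q) (G : Z → Λ) {z : Z} (hz : S.ok z) :
    S.D (fun w => S.εv κ (G w)) z = S.L κ G z - S.εv κ (S.D G z) := by
  rw [D_ok _ hz, D_ok _ hz, map_sum, eq_sub_iff_add_eq, ← Finset.sum_add_distrib]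
  have : ∀ k, S.ε k (S.L k (fun w => S.εv κ (G w)) z) + S.εv κ (S.ε k (S.L k G z))
      = if k = κ then S.L k G z else 0 := by
    intro k
    rw [← S.dual k κ]
    simp [L]
  simp [this]

theorem L_comm {k κ : Q} (h : k ≠ κ) (G : Z → Λ) (z : Z) :
    ((S.x k z : K) / S.P) • S.L κ G z + S.L κ G (z - S.s k)
      = ((S.x κ z : K) / S.P) • S.L k G z + S.L k G (z - S.s κ) := by
  simp only [L, x_sub_ne h, x_sub_ne h.symm, smul_add, smul_smul, sub_right_comm z (S.s κ)]
  rw [mul_comm]; abel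

section Reduce

variable {κ : Q} {c g : Z → Λ}

theorem L_D_of_rec (hrec : ∀ w, 1 < S.x κ w → c w = S.L κ g w) {w : Z} (hw : S.ok w)
    (h1 : 1 < S.x κ w) :
    S.L κ (S.D g) w = S.D c w - S.ε κ (c (w - S.s κ) - S.L κ g (w - S.s κ)) := by
  have hw' : S.ok (w - S.s κ) := ok_sub hw h1.le
  rw [L, D_ok g hw, D_ok g hw', D_ok c hw, eq_sub_iff_add_eq, Finset.smul_sum,
    ← Finset.sum_add_distrib, ← Finset.add_sum_erase _ _ (Finset.mem_univ κ),
    ← Finset.add_sum_erase _ _ (Finset.mem_univ κ), add_right_comm]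
  congr 1
  · rw [← map_smul, ← map_add, ← map_add]
    congr 1
    conv_rhs => rw [L, hrec w h1]
    abel
  · refine Finset.sum_congr rfl fun k hk => ?_
    have hk : k ≠ κ := Finset.ne_of_mem_erase hk
    rw [← map_smul, ← map_add, ← L_comm hk]
    congr 1
    conv_rhs => rw [L, hrec w h1, hrec (w - S.s k) (by rwa [x_sub_ne hk.symm])]

theorem reduce_zero (hg0 : ∀ w, S.x κ w ≤ 0 → g w = 0) {z : Z} (h : S.x κ z ≤ 0) :
    (c - S.D (fun w => S.εv κ (g w))) z = c z := by
  have : S.D (fun w => S.εv κ (g w)) z = 0 := by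
    by_cases hz : S.ok z
    · rw [D_ok _ hz]
      refine Finset.sum_eq_zero fun k _ => ?_
      rw [L, hg0 z h, hg0 (z - S.s k)]
      · simp
      · rw [x_sub]; split_ifs <;> linarith
    · exact D_not_ok _ hz
  simp [this]

theorem reduce_large (hc : S.Supp c) (hrec : ∀ w, 1 < S.x κ w → c w = S.L κ g w)
    (hDg : ∀ w, 1 < S.x κ w → S.D g w = 0) {z : Z} (h : 1 < S.x κ z) :
    (c - S.D (fun w => S.εv κ (g w))) z = 0 := by
  by_cases hz : S.ok z
  · rw [Pi.sub_apply, D_contr κ g hz, hrec z h, hDg z h]; simp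
  · simp [D_not_ok _ hz, hc.zero hz]

theorem reduce_mid (hc : S.Supp c) (hg : S.Supp g) (hcc : S.D c = 0)
    (hg0 : ∀ w, S.x κ w ≤ 0 → g w = 0)
    (hrec : ∀ w, 1 < S.x κ w → c w = S.L κ g w)
    (hDg : ∀ w, 1 < S.x κ w → S.D g w = 0) {z : Z} (h0 : 0 < S.x κ z) (h : S.x κ z ≤ 1) :
    (c - S.D (fun w => S.εv κ (g w))) z
      = S.ε κ (S.εv κ (c z - ((S.x κ z : K) / S.P) • g z)) := by
  by_cases hz : S.ok z
  · have hL : S.L κ g z = ((S.x κ z : K) / S.P) • g z := by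
      rw [L, hg0 (z - S.s κ) (by rw [x_sub_self]; linarith), add_zero]
    have hw1 : 1 < S.x κ (z + S.s κ) := by rw [x_add_self]; linarith
    have := L_D_of_rec hrec (ok_add hz h0) hw1
    rw [L, hDg _ hw1, add_sub_cancel_right, hcc, hL] at this
    simp only [smul_zero, zero_add, Pi.zero_apply, zero_sub] at this
    rw [Pi.sub_apply, D_contr κ g hz, hL, this, ε_εv_self, map_neg]
    abel
  · simp [D_not_ok _ hz, hc.zero hz, hg.zero hz]

end Reduce

end KSys

namespace KSys

section Families

variable {K Λ Q Z : Type} [Field K] [CharZero K] [AddCommGroup Λ] [Module K Λ] [Fintype Q]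
  [DecidableEq Q] [AddCommGroup Z]

/-- A family of submodules compatible with dividing by the variable of index `κ`. -/
structure Good (S : KSys K Λ Q Z) (κ : Q) (U : Z → Submodule K Λ) : Prop where
  shift : ∀ z, S.ok z → 0 < S.x κ z → U (z + S.s κ) ≤ U z
  ε_mem : ∀ z, S.ok z → 0 < S.x κ z → ∀ v ∈ U z, S.ε κ v ∈ U z
  εv_mem : ∀ z, S.ok z → 0 < S.x κ z → ∀ v ∈ U z, S.εv κ v ∈ U z

/-- The shape of a function that has been reduced with respect to the index `κ`. -/
noncomputable def Red (S : KSys K Λ Q Z) (κ : Q) (z : Z) : Submodule K Λ :=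
  if S.x κ z ≤ 0 then ⊤ else if S.x κ z ≤ 1 then LinearMap.ker (S.ε κ) else ⊥

theorem good_red (S : KSys K Λ Q Z) {κ κ' : Q} (h : κ ≠ κ') : S.Good κ (S.Red κ') where
  shift z _ _ := by simp [Red, x_add_ne h.symm]
  ε_mem z hz h0 v hv := by
    unfold Red at hv ⊢
    split_ifs at hv ⊢ with h1 h2
    · trivial
    · rw [LinearMap.mem_ker] at hv ⊢
      have : ¬ S.adj κ' κ := fun ha => by
        rcases hz.2 _ _ ha with e | e <;> linarith
      rw [ε_comm this, hv]; simp
    · simp_all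
  εv_mem z hz h0 v hv := by
    unfold Red at hv ⊢
    split_ifs at hv ⊢ with h1 h2
    · trivial
    · rw [LinearMap.mem_ker] at hv ⊢
      rw [ε_εv h.symm, hv]; simp
    · simp_all

end Families

variable {K Λ Q Z : Type} [NontriviallyNormedField K] [CompleteSpace K] [CharZero K]
  [NormedAddCommGroup Λ] [NormedSpace K Λ] [FiniteDimensional K Λ] [Fintype Q]
  [DecidableEq Q] [AddCommGroup Z]

/-- A degree together with the estimates that make division by the variables converge. -/
structure Growth (S : KSys K Λ Q Z) (deg : Z →+ ℤ) : Prop where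
  deg_s : ∀ k, 1 ≤ deg (S.s k)
  norm_x : ∀ k z, ‖(S.x k z : K)‖ ≤ 1
  prod : ∃ c : ℝ, ∀ k z (m : ℕ), ‖∏ i ∈ Finset.range m, ((S.x k z : K) + (i + 1))‖
    ≤ c * (m + 1) * ‖S.P‖ ^ m

def OC (S : KSys K Λ Q Z) (deg : Z →+ ℤ) (F : Z → Λ) : Prop :=
  ∃ r C : ℝ, 0 < r ∧ r < 1 ∧ 0 ≤ C ∧ ∀ z, S.ok z → ‖F z‖ ≤ C * r ^ deg z

variable {S : KSys K Λ Q Z} {deg : Z →+ ℤ}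

theorem OC.comp {F : Z → Λ} (hF : S.OC deg F) (T : Λ →ₗ[K] Λ) :
    S.OC deg (fun z => T (F z)) := by
  obtain ⟨r, C, h0, h1, hC, h⟩ := hF
  refine ⟨r, ‖LinearMap.toContinuousLinearMap T‖ * C, h0, h1, by positivity, fun z hz => ?_⟩
  refine ((LinearMap.toContinuousLinearMap T).le_opNorm (F z)).trans ?_
  rw [mul_assoc]
  exact mul_le_mul_of_nonneg_left (h z hz) (norm_nonneg _)

theorem OC.add {F G : Z → Λ} (hd : ∀ z, S.ok z → 0 ≤ deg z) (hF : S.OC deg F)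
    (hG : S.OC deg G) : S.OC deg (F + G) := by
  obtain ⟨r, C, h0, h1, hC, h⟩ := hF
  obtain ⟨r', C', h0', h1', hC', h'⟩ := hG
  refine ⟨max r r', C + C', lt_max_of_lt_left h0, max_lt h1 h1', by positivity, fun z hz => ?_⟩
  refine (norm_add_le _ _).trans ?_
  rw [add_mul]
  refine add_le_add ((h z hz).trans ?_) ((h' z hz).trans ?_)
  · exact mul_le_mul_of_nonneg_left (zpow_le_zpow_left₀ (hd z hz) h0.le (le_max_left _ _)) hC
  · exact mul_le_mul_of_nonneg_left (zpow_le_zpow_left₀ (hd z hz) h0'.le (le_max_right _ _)) hC'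

theorem OC.sum {α : Type} (s : Finset α) {F : α → Z → Λ} (hd : ∀ z, S.ok z → 0 ≤ deg z)
    (hF : ∀ a ∈ s, S.OC deg (F a)) : S.OC deg (fun z => ∑ a ∈ s, F a z) := by
  induction s using Finset.induction_on with
  | empty => exact ⟨1/2, 0, by norm_num, by norm_num, le_rfl, by simp⟩
  | insert a s ha ih =>
    have := OC.add hd (hF a (Finset.mem_insert_self _ _))
      (ih fun b hb => hF b (Finset.mem_insert_of_mem hb))
    convert this using 1
    funext z; simp [Finset.sum_insert ha]

theorem OC.L {F : Z → Λ} (hd : ∀ z, S.ok z → 0 ≤ deg z) (hS : S.Growth deg) (hF : S.OC deg F)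
    (hs : S.Supp F) (k : Q) : S.OC deg (S.L k F) := by
  obtain ⟨r, C, h0, h1, hC, h⟩ := hF
  refine OC.add (F := fun z => ((S.x k z : K) / S.P) • F z) (G := fun z => F (z - S.s k)) hd
    ⟨r, ‖S.P‖⁻¹ * C, h0, h1, by positivity, fun z hz => ?_⟩
    ⟨r, C * r ^ (-deg (S.s k)), h0, h1, by positivity, fun z hz => ?_⟩
  · rw [norm_smul, norm_div, mul_assoc, div_eq_inv_mul]
    refine mul_le_mul ?_ (h z hz) (norm_nonneg _) (by positivity)
    exact mul_le_of_le_one_right (by positivity) (hS.norm_x k z)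
  · by_cases hz' : S.ok (z - S.s k)
    · refine (h _ hz').trans (le_of_eq ?_)
      rw [map_sub, sub_eq_neg_add, zpow_add₀ h0.ne', mul_assoc]
    · change ‖F (z - S.s k)‖ ≤ _
      rw [hs.zero hz', norm_zero]; positivity

theorem OC.D {F : Z → Λ} (hd : ∀ z, S.ok z → 0 ≤ deg z) (hS : S.Growth deg) (hF : S.OC deg F)
    (hs : S.Supp F) : S.OC deg (S.D F) := by
  obtain ⟨r, C, h0, h1, hC, h⟩ := OC.sum (S := S) Finset.univ
    (F := fun k z => S.ε k (S.L k F z)) hd fun k _ => (OC.L hd hS hF hs k).comp _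
  refine ⟨r, C, h0, h1, hC, fun z hz => ?_⟩
  rw [D_ok F hz]; exact h z hz

section Div

variable (S) in
/-- The `m`-th term of the formal division of `c` by the variable of index `κ`. -/
noncomputable def divTerm (κ : Q) (c : Z → Λ) (z : Z) (m : ℕ) : Λ :=
  ((-1) ^ m * (∏ i ∈ Finset.range m, ((S.x κ z : K) + (i + 1))) / S.P ^ m) •
    c (z + (m + 1) • S.s κ)

variable (S) in
noncomputable def divF (κ : Q) (c : Z → Λ) (z : Z) : Λ :=
  if S.ok z ∧ 0 < S.x κ z then ∑' m, S.divTerm κ c z m else 0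

theorem ok_add_nsmul {z : Z} (hz : S.ok z) {κ : Q} (h : 0 < S.x κ z) (m : ℕ) :
    S.ok (z + m • S.s κ) ∧ 0 < S.x κ (z + m • S.s κ) := by
  induction m with
  | zero => simpa using ⟨hz, h⟩
  | succ m ih =>
    rw [succ_nsmul, ← add_assoc]
    refine ⟨ok_add ih.1 ih.2, ?_⟩
    rw [x_add_self]; linarith [ih.2]

theorem zpow_shift_le {r : ℝ} (h0 : 0 < r) (h1 : r < 1) (hS : S.Growth deg) (z : Z) (κ : Q)
    (m : ℕ) : r ^ deg (z + m • S.s κ) ≤ r ^ deg z * r ^ m := by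
  rw [map_add, zpow_add₀ h0.ne', map_nsmul]
  refine mul_le_mul_of_nonneg_left ?_ (by positivity)
  rw [← zpow_natCast r m]
  refine zpow_le_zpow_right_of_le_one₀ h0 h1.le ?_
  rw [nsmul_eq_mul]
  nlinarith [hS.deg_s κ]

theorem norm_coef_le {c0 : ℝ} {κ : Q} {z : Z} {m : ℕ}
    (hc0 : ‖∏ i ∈ Finset.range m, ((S.x κ z : K) + (i + 1))‖ ≤ c0 * (m + 1) * ‖S.P‖ ^ m) :
    ‖((-1) ^ m * (∏ i ∈ Finset.range m, ((S.x κ z : K) + (i + 1))) / S.P ^ m : K)‖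
      ≤ c0 * (m + 1) := by
  have : 0 < ‖S.P‖ := norm_pos_iff.2 S.P_ne
  rw [norm_div, norm_mul, norm_pow, norm_neg, norm_one, one_pow, one_mul, norm_pow,
    div_le_iff₀ (by positivity)]
  exact hc0

theorem summable_succ_mul_pow {r : ℝ} (h0 : 0 < r) (h1 : r < 1) :
    Summable fun m : ℕ => ((m : ℝ) + 1) * r ^ m := by
  have a := summable_pow_mul_geometric_of_norm_lt_one 1 (r := r) (by
    rw [Real.norm_of_nonneg h0.le]; exact h1)
  have b := summable_geometric_of_lt_one h0.le h1
  refine (a.add b).congr fun m => ?_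
  simp; ring

theorem norm_divTerm_le (hS : S.Growth deg) {c : Z → Λ} {r C c0 : ℝ} (h0 : 0 < r) (h1 : r < 1)
    (hC : 0 ≤ C) (h : ∀ z, S.ok z → ‖c z‖ ≤ C * r ^ deg z)
    (hc0 : ∀ k z (m : ℕ), ‖∏ i ∈ Finset.range m, ((S.x k z : K) + (i + 1))‖
      ≤ c0 * (m + 1) * ‖S.P‖ ^ m) {κ : Q} {z : Z} (hz : S.ok z) (hx : 0 < S.x κ z) (m : ℕ) :
    ‖S.divTerm κ c z m‖ ≤ (c0 * C * r ^ deg z) * (((m : ℝ) + 1) * r ^ m) := by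
  have hc0' : 0 ≤ c0 := by
    have := hc0 κ z 0
    simp at this; linarith
  rw [divTerm, norm_smul]
  calc _ ≤ (c0 * (m + 1)) * (C * (r ^ deg z * r ^ m)) := by
        refine mul_le_mul (norm_coef_le (hc0 κ z m)) ?_ (norm_nonneg _) (by positivity)
        refine (h _ (ok_add_nsmul hz hx _).1).trans (mul_le_mul_of_nonneg_left ?_ hC)
        refine (zpow_shift_le h0 h1 hS z κ (m + 1)).trans ?_
        refine mul_le_mul_of_nonneg_left ?_ (by positivity)
        exact pow_le_pow_of_le_one h0.le h1.le (Nat.le_succ m)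
    _ = _ := by ring

theorem summable_divTerm (hS : S.Growth deg) {c : Z → Λ} (hc : S.OC deg c) {κ : Q} {z : Z}
    (hz : S.ok z) (hx : 0 < S.x κ z) : Summable (S.divTerm κ c z) := by
  have : CompleteSpace Λ := FiniteDimensional.complete K Λ
  obtain ⟨r, C, h0, h1, hC, h⟩ := hc
  obtain ⟨c0, hc0⟩ := hS.prod
  exact Summable.of_norm_bounded ((summable_succ_mul_pow h0 h1).mul_left _)
    fun m => norm_divTerm_le hS h0 h1 hC h hc0 hz hx m

theorem divF_supp (κ : Q) (c : Z → Λ) : S.Supp (S.divF κ c) := fun z h => by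
  by_contra hz
  exact h (if_neg fun a => hz a.1)

theorem divF_OC (hS : S.Growth deg) {c : Z → Λ} (hc : S.OC deg c) (κ : Q) :
    S.OC deg (S.divF κ c) := by
  obtain ⟨r, C, h0, h1, hC, h⟩ := hc
  obtain ⟨c0, hc0⟩ := hS.prod
  have hs := summable_succ_mul_pow h0 h1
  set M := ∑' m : ℕ, ((m : ℝ) + 1) * r ^ m
  have hM : 0 ≤ M := tsum_nonneg fun m => by positivity
  refine ⟨r, |c0| * C * M, h0, h1, by positivity, fun z hz => ?_⟩
  unfold divF
  split_ifs with hx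
  · refine (tsum_of_norm_bounded (hs.hasSum.mul_left _)
      fun m => norm_divTerm_le hS h0 h1 hC h hc0 hz hx.2 m).trans ?_
    have : c0 ≤ |c0| := le_abs_self _
    calc c0 * C * r ^ deg z * M ≤ |c0| * C * r ^ deg z * M := by gcongr
      _ = _ := by ring
  · rw [norm_zero]; positivity

theorem divF_rec (hS : S.Growth deg) {c : Z → Λ} (hc : S.OC deg c) (hs : S.Supp c) {κ : Q}
    {w : Z} (hw : 1 < S.x κ w) : c w = S.L κ (S.divF κ c) w := by
  have hx0 : 0 < S.x κ (w - S.s κ) := by rw [x_sub_self]; linarith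
  by_cases hok : S.ok w
  · have hok' : S.ok (w - S.s κ) := ok_sub hok hw.le
    have e : ∀ m, S.divTerm κ c (w - S.s κ) (m + 1)
        = -(((S.x κ w : K) / S.P) • S.divTerm κ c w m) := by
      intro m
      rw [divTerm, divTerm, Finset.prod_range_succ', smul_smul, ← neg_smul]
      congr 1
      · have hp : S.P ≠ 0 := S.P_ne
        have e2 : ∀ i : ℕ, ((S.x κ (w - S.s κ) : ℚ) : K) + ((i + 1 : ℕ) + 1)
            = (S.x κ w : K) + (i + 1) := by
          intro i; rw [x_sub_self]; push_cast; ring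
        simp only [e2]
        rw [x_sub_self]
        push_cast
        field_simp
        ring
      · congr 1
        rw [succ_nsmul (S.s κ) (m + 1)]; abel
    rw [L, divF, divF, if_pos ⟨hok, by linarith⟩, if_pos ⟨hok', hx0⟩,
      (summable_divTerm hS hc hok' hx0).tsum_eq_zero_add]
    simp only [e]
    rw [tsum_neg, (summable_divTerm hS hc hok (zero_lt_one.trans hw)).tsum_const_smul]
    simp [divTerm]
  · have hok' : ¬ S.ok (w - S.s κ) := fun h => hok (by simpa using ok_add h hx0)
    rw [L, hs.zero hok, (divF_supp κ c).zero hok, (divF_supp κ c).zero hok']; simp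

theorem divF_mem {c : Z → Λ} {κ : Q}
    {U : Z → Submodule K Λ} (hU : S.Good κ U) (hc : ∀ z, c z ∈ U z) (z : Z) :
    S.divF κ c z ∈ U z := by
  unfold divF
  split_ifs with h
  · have hmem : ∀ m, S.divTerm κ c z m ∈ U z := by
      intro m
      refine (U z).smul_mem _ ?_
      have : ∀ m : ℕ, U (z + m • S.s κ) ≤ U z := by
        intro m
        induction m with
        | zero => simp
        | succ m ih =>
          rw [succ_nsmul, ← add_assoc]
          have := ok_add_nsmul h.1 h.2 m
          exact (hU.shift _ this.1 this.2).trans ih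
      exact this (m + 1) (hc _)
    exact tsum_mem (Submodule.closed_of_finiteDimensional (U z)) hmem
  · exact (U z).zero_mem

theorem zero_of_rec (hS : S.Growth deg) {h : Z → Λ} (hs : S.Supp h) (ho : S.OC deg h) {κ : Q}
    {t : ℚ} (ht : 0 ≤ t) (hL : ∀ w, S.ok w → t + 1 < S.x κ w → S.L κ h w = 0) {z : Z}
    (hz : t < S.x κ z) : h z = 0 := by
  by_cases hok : S.ok z
  swap
  · exact hs.zero hok
  have e : ∀ m : ℕ, h z = ((-1) ^ m * (∏ i ∈ Finset.range m, ((S.x κ z : K) + (i + 1)))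
      / S.P ^ m) • h (z + m • S.s κ) := by
    intro m
    induction m with
    | zero => simp
    | succ m ih =>
      have h1 := ok_add_nsmul hok (ht.trans_lt hz) (m + 1)
      have hx : S.x κ (z + (m + 1) • S.s κ) = S.x κ z + (m + 1) := by
        rw [map_add, map_nsmul, S.x_s]; simp
      have := hL _ h1.1 (by rw [hx]; have : (0 : ℚ) ≤ m := m.cast_nonneg; linarith)
      rw [L, hx] at this
      have e2 : z + (m + 1) • S.s κ - S.s κ = z + m • S.s κ := by
        rw [succ_nsmul]; abel
      rw [e2] at this
      rw [ih, eq_neg_of_add_eq_zero_right this, ← neg_smul, smul_smul]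
      congr 1
      have hp : S.P ≠ 0 := S.P_ne
      rw [Finset.prod_range_succ]
      push_cast
      field_simp
      ring
  obtain ⟨r, C, h0, h1, hC, hb⟩ := ho
  obtain ⟨c0, hc0⟩ := hS.prod
  have hc0' : 0 ≤ c0 := by
    have := hc0 κ z 0
    simp at this; linarith
  have bound : ∀ m : ℕ, ‖h z‖ ≤ (c0 * C * r ^ deg z) * (((m : ℝ) + 1) * r ^ m) := by
    intro m
    rw [e m, norm_smul]
    calc _ ≤ (c0 * (m + 1)) * (C * (r ^ deg z * r ^ m)) := by
          refine mul_le_mul (norm_coef_le (hc0 κ z m)) ?_ (norm_nonneg _) (by positivity)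
          refine (hb _ (ok_add_nsmul hok (ht.trans_lt hz) _).1).trans
            (mul_le_mul_of_nonneg_left ?_ hC)
          exact zpow_shift_le h0 h1 hS z κ m
      _ = _ := by ring
  have lim := (summable_succ_mul_pow h0 h1).tendsto_atTop_zero.const_mul (c0 * C * r ^ deg z)
  rw [mul_zero] at lim
  exact norm_le_zero_iff.1 (ge_of_tendsto' lim bound)

end Div

/-- One step of the reduction: after subtracting a coboundary, a cocycle is reduced with respect
to the index `κ`. -/
theorem exists_reduce_step (hd : ∀ z, S.ok z → 0 ≤ deg z) (hS : S.Growth deg) {c : Z → Λ}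
    (hs : S.Supp c) (hc : S.OC deg c) (hD : S.D c = 0) (κ : Q) :
    ∃ b, S.Supp b ∧ S.OC deg b ∧ (∀ z, (c - S.D b) z ∈ S.Red κ z) ∧
      ∀ U, S.Good κ U → (∀ z, c z ∈ U z) → (∀ z, b z ∈ U z) ∧ ∀ z, (c - S.D b) z ∈ U z := by
  set g := S.divF κ c with hg
  have gs : S.Supp g := divF_supp κ c
  have go : S.OC deg g := divF_OC hS hc κ
  have g0 : ∀ w, S.x κ w ≤ 0 → g w = 0 := fun w hw => if_neg fun h => by linarith [h.2]
  have hrec : ∀ w, 1 < S.x κ w → c w = S.L κ g w := fun w hw => divF_rec hS hc hs hw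
  have hDg : ∀ w, 1 < S.x κ w → S.D g w = 0 := fun w hw =>
    zero_of_rec hS (D_supp g) (OC.D hd hS go gs) zero_le_one (fun w hw h2 => by
      rw [L_D_of_rec hrec hw (by linarith), hD,
        hrec (w - S.s κ) (by rw [x_sub_self]; linarith)]
      simp) hw
  refine ⟨fun z => S.εv κ (g z), fun z hz => gs z fun h => hz (by simp [h]), go.comp _, ?_, ?_⟩
  · intro z
    unfold Red
    split_ifs with h1 h2
    · trivial
    · rw [reduce_mid hs gs hD g0 hrec hDg (not_le.1 h1) h2]
      exact ε_sq κ _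
    · rw [reduce_large hs hrec hDg (not_le.1 h2)]; simp
  · intro U hU hcU
    have gU : ∀ z, g z ∈ U z := divF_mem hU hcU
    refine ⟨fun z => ?_, fun z => ?_⟩
    · by_cases h : S.ok z ∧ 0 < S.x κ z
      · exact hU.εv_mem z h.1 h.2 _ (gU z)
      · have : g z = 0 := if_neg h
        simp [this]
    · by_cases hz : S.ok z
      · rcases le_or_gt (S.x κ z) 0 with h1 | h1
        · rw [reduce_zero g0 h1]; exact hcU z
        rcases le_or_gt (S.x κ z) 1 with h2 | h2
        · rw [reduce_mid hs gs hD g0 hrec hDg h1 h2]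
          exact hU.ε_mem z hz h1 _ (hU.εv_mem z hz h1 _
            ((U z).sub_mem (hcU z) ((U z).smul_mem _ (gU z))))
        · rw [reduce_large hs hrec hDg h2]; exact (U z).zero_mem
      · rw [Pi.sub_apply, hs.zero hz, D_not_ok _ hz]; simp

/-- Every cocycle is cohomologous to one which is reduced with respect to all indices in `T`. -/
theorem exists_reduce (hd : ∀ z, S.ok z → 0 ≤ deg z) (hS : S.Growth deg) {c : Z → Λ}
    (hs : S.Supp c) (hc : S.OC deg c) (hD : S.D c = 0) (T : Finset Q) :
    ∃ b, S.Supp b ∧ S.OC deg b ∧ (∀ κ ∈ T, ∀ z, (c - S.D b) z ∈ S.Red κ z) ∧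
      ∀ U, (∀ κ ∈ T, S.Good κ U) → (∀ z, c z ∈ U z) →
        (∀ z, b z ∈ U z) ∧ ∀ z, (c - S.D b) z ∈ U z := by
  induction T using Finset.induction_on with
  | empty =>
    refine ⟨0, fun z h => absurd rfl h, ⟨1/2, 0, by norm_num, by norm_num, le_rfl, by simp⟩,
      by simp, fun U _ h => ⟨by simp, by simpa using h⟩⟩
  | insert κ T hκ ih =>
    obtain ⟨b, b1, b2, b3, b4⟩ := ih
    have hs' : S.Supp (c - S.D b) := hs.sub (D_supp b)
    have hc' : S.OC deg (c - S.D b) := by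
      have := OC.add hd hc ((OC.D hd hS b2 b1).comp (-LinearMap.id))
      convert this using 1
      funext z; simp [sub_eq_add_neg]
    have hD' : S.D (c - S.D b) = 0 := by rw [map_sub, hD, D_sq b1, sub_zero]
    obtain ⟨b', b1', b2', b3', b4'⟩ := exists_reduce_step hd hS hs' hc' hD' κ
    have e : c - S.D (b + b') = c - S.D b - S.D b' := by rw [map_add, sub_sub]
    refine ⟨b + b', fun z h => ?_, OC.add hd b2 b2', ?_, ?_⟩
    · by_contra hz
      exact h (by simp [b1.zero hz, b1'.zero hz])
    · intro κ' hκ' z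
      rw [e]
      rcases Finset.mem_insert.1 hκ' with rfl | hT
      · exact b3' z
      · have hne : κ ≠ κ' := fun h => hκ (h ▸ hT)
        exact (b4' _ (S.good_red hne) (b3 κ' hT)).2 z
    · intro U hU hcU
      obtain ⟨h1, h2⟩ := b4 U (fun k hk => hU k (Finset.mem_insert_of_mem hk)) hcU
      obtain ⟨h3, h4⟩ := b4' U (hU κ (Finset.mem_insert_self _ _)) h2
      rw [e]
      exact ⟨fun z => (U z).add_mem (h1 z) (h3 z), h4⟩

end KSys

namespace KSys

variable {K Λ Q Z : Type} [Field K] [CharZero K] [AddCommGroup Λ] [Module K Λ] [Fintype Q]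
  [DecidableEq Q] [AddCommGroup Z] {S : KSys K Λ Q Z}

/-- Functions that are reduced with respect to all indices. -/
structure Min (S : KSys K Λ Q Z) (F : Z → Λ) : Prop where
  supp : S.Supp F
  red : ∀ κ z, F z ∈ S.Red κ z

theorem Min.le_one {F : Z → Λ} (hF : S.Min F) {κ : Q} {z : Z} (h : F z ≠ 0) : S.x κ z ≤ 1 := by
  by_contra h1
  have := hF.red κ z
  rw [Red, if_neg (by linarith), if_neg h1] at this
  exact h (by simpa using this)

theorem Min.ε_eq {F : Z → Λ} (hF : S.Min F) {κ : Q} {z : Z} (h : 0 < S.x κ z) :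
    S.ε κ (F z) = 0 := by
  by_cases h0 : F z = 0
  · rw [h0, map_zero]
  · have := hF.red κ z
    rwa [Red, if_neg (not_le.2 h), if_pos (hF.le_one h0), LinearMap.mem_ker] at this

theorem min_iff {F : Z → Λ} : S.Min F ↔ S.Supp F ∧ (∀ κ z, F z ≠ 0 → S.x κ z ≤ 1) ∧
    ∀ κ z, 0 < S.x κ z → S.ε κ (F z) = 0 := by
  refine ⟨fun h => ⟨h.supp, fun κ z => h.le_one, fun κ z => h.ε_eq⟩, fun h => ⟨h.1, fun κ z => ?_⟩⟩
  unfold Red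
  split_ifs with h1 h2
  · trivial
  · exact h.2.2 κ z (not_le.1 h1)
  · by_contra h3
    exact h2 (h.2.1 κ z (by simpa using h3))

theorem Min.sub {F G : Z → Λ} (hF : S.Min F) (hG : S.Min G) : S.Min (F - G) :=
  ⟨hF.supp.sub hG.supp, fun κ z => (S.Red κ z).sub_mem (hF.red κ z) (hG.red κ z)⟩

theorem Min.add {F G : Z → Λ} (hF : S.Min F) (hG : S.Min G) : S.Min (F + G) :=
  ⟨fun z h => by
    by_contra hz
    exact h (by simp [hF.supp.zero hz, hG.supp.zero hz]),
    fun κ z => (S.Red κ z).add_mem (hF.red κ z) (hG.red κ z)⟩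

theorem Min.zero : S.Min (0 : Z → Λ) := ⟨fun _ h => absurd rfl h, fun κ z => (S.Red κ z).zero_mem⟩

theorem Min.ε_sub {F : Z → Λ} (hF : S.Min F) {κ : Q} {z : Z} (h : S.x κ z ≠ 1) :
    S.ε κ (F (z - S.s κ)) = 0 := by
  rcases lt_or_gt_of_ne h with h | h
  · rw [hF.supp.sub_shift h, map_zero]
  · exact hF.ε_eq (by rw [x_sub_self]; linarith)

theorem Min.D_eq {F : Z → Λ} (hF : S.Min F) {z : Z} (hz : S.ok z) :
    S.D F z = ∑ k, S.ε k (F (z - S.s k)) := by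
  rw [D_ok F hz]
  refine Finset.sum_congr rfl fun k _ => ?_
  rw [L, map_add, map_smul]
  rcases (hz.1 k).eq_or_lt with h | h
  · rw [← h]; simp
  · rw [hF.ε_eq h]; simp

theorem ok_shift {z : Z} (hz : S.ok z) {κ : Q} (h : ∀ k, S.adj k κ → S.x k z = 0) :
    S.ok (z + S.s κ) := by
  refine ⟨fun k' => ?_, fun i j hij => ?_⟩
  · rw [x_add]; have := hz.1 k'; split_ifs <;> linarith
  · have hne : i ≠ j := fun e => S.adj_irrefl i (e ▸ hij)
    rcases eq_or_ne i κ with rfl | hi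
    · right; rw [x_add_ne hne.symm]; exact h _ (S.adj_symm _ _ hij)
    · rw [x_add_ne hi]
      rcases eq_or_ne j κ with rfl | hj
      · left; exact h _ hij
      · rw [x_add_ne hj]; exact hz.2 _ _ hij

theorem adj_zero_of_ok_add {z : Z} {κ : Q} (h : S.ok (z + S.s κ)) (hx : 0 ≤ S.x κ z) {k : Q}
    (hk : S.adj k κ) : S.x k z = 0 := by
  have hne : k ≠ κ := fun e => S.adj_irrefl _ (e ▸ hk)
  have := h.2 _ _ hk
  rw [x_add_ne hne, x_add_self] at this
  exact this.resolve_right (by linarith)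

theorem Min.D {F : Z → Λ} (hF : S.Min F) : S.Min (S.D F) := by
  refine min_iff.2 ⟨D_supp F, fun κ z h => ?_, fun κ z h => ?_⟩
  · by_contra h1
    have h1 := not_le.1 h1
    by_cases hz : S.ok z
    swap
    · exact h (D_not_ok F hz)
    apply h
    rw [hF.D_eq hz]
    refine Finset.sum_eq_zero fun k _ => ?_
    rcases eq_or_ne κ k with rfl | hne
    · exact hF.ε_sub h1.ne'
    · by_cases h0 : F (z - S.s k) = 0
      · rw [h0, map_zero]
      · have := hF.le_one (κ := κ) h0
        rw [x_sub_ne hne] at this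
        linarith
  · by_cases hz : S.ok z
    swap
    · rw [D_not_ok F hz, map_zero]
    rw [hF.D_eq hz, map_sum]
    refine Finset.sum_eq_zero fun k _ => ?_
    rcases eq_or_ne κ k with rfl | hne
    · exact ε_sq _ _
    · by_cases h1 : S.x k z = 1
      · have : ¬ S.adj κ k := fun ha => by
          rcases hz.2 _ _ ha with e | e <;> linarith
        rw [ε_comm this, hF.ε_eq (by rwa [x_sub_ne hne])]; simp
      · rw [hF.ε_sub h1, map_zero]

/-- The shape of a reduced function after elimination of the index `κ`. -/
structure Elim (S : KSys K Λ Q Z) (κ : Q) (F : Z → Λ) : Prop where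
  one : ∀ z, S.x κ z = 1 → F z = 0
  zero : ∀ z, S.x κ z = 0 → S.ok (z + S.s κ) → S.ε κ (F z) = 0

/-- A pair of families of submodules compatible with the elimination of `κ`. -/
structure GoodPair (S : KSys K Λ Q Z) (κ : Q) (U U' : Z → Submodule K Λ) : Prop where
  εv_mem : ∀ z, S.x κ z = 0 → ∀ v ∈ U (z + S.s κ), S.εv κ v ∈ U' z
  ε_mem : ∀ k z, S.x k z = 1 → ∀ v ∈ U' (z - S.s k), S.ε k v ∈ U z

variable (S) in
noncomputable def elimB (κ : Q) (c : Z → Λ) (z : Z) : Λ :=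
  if S.x κ z = 0 then S.εv κ (c (z + S.s κ)) else 0

section ElimStep

variable {κ : Q} {c : Z → Λ}

theorem elimB_min (hc : S.Min c) : S.Min (S.elimB κ c) := by
  have hne0 : ∀ z, S.elimB κ c z ≠ 0 → S.x κ z = 0 ∧ c (z + S.s κ) ≠ 0 := by
    intro z h
    unfold elimB at h
    split_ifs at h with h0
    · exact ⟨h0, fun h1 => h (by rw [h1, map_zero])⟩
    · exact absurd rfl h
  refine min_iff.2 ⟨fun z h => ?_, fun k z h => ?_, fun k z h => ?_⟩
  · obtain ⟨h0, h1⟩ := hne0 z h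
    have := ok_sub (hc.supp _ h1) (k := κ) (by rw [x_add_self]; linarith)
    simpa using this
  · obtain ⟨h0, h1⟩ := hne0 z h
    rcases eq_or_ne k κ with rfl | hk
    · rw [h0]; exact zero_le_one
    · rw [← x_add_ne hk]; exact hc.le_one h1
  · unfold elimB
    split_ifs with h0
    · rcases eq_or_ne k κ with rfl | hk
      · linarith
      · rw [ε_εv hk, hc.ε_eq (by rwa [x_add_ne hk]), map_zero, neg_zero]
    · simp

theorem elim_one (hc : S.Min c) {z : Z} (h : S.x κ z = 1) :
    (c - S.D (S.elimB κ c)) z = 0 := by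
  by_cases hz : S.ok z
  swap
  · simp [hc.supp.zero hz, D_not_ok _ hz]
  rw [Pi.sub_apply, (elimB_min hc).D_eq hz, Finset.sum_eq_single κ]
  · rw [elimB, if_pos (by rw [x_sub_self, h, sub_self]), sub_add_cancel, ε_εv_self,
      hc.ε_eq (by rw [h]; exact zero_lt_one)]
    simp
  · intro k _ hk
    rw [elimB, if_neg (by rw [x_sub_ne hk.symm, h]; exact one_ne_zero), map_zero]
  · simp

theorem elim_mid (hc : S.Min c) {z : Z} (h0 : S.x κ z ≠ 0) (h1 : S.x κ z ≠ 1) :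
    (c - S.D (S.elimB κ c)) z = c z := by
  by_cases hz : S.ok z
  swap
  · simp [D_not_ok _ hz]
  rw [Pi.sub_apply, (elimB_min hc).D_eq hz, Finset.sum_eq_zero, sub_zero]
  intro k _
  rw [elimB, if_neg, map_zero]
  rw [x_sub]; split_ifs
  · exact fun h => h1 (by linarith)
  · simpa using h0

theorem elim_zero (hc : S.Min c) {z : Z} (hz : S.ok z) (h0 : S.x κ z = 0) :
    (c - S.D (S.elimB κ c)) z
      = c z + S.εv κ (∑ k ∈ Finset.univ.erase κ, S.ε k (c (z + S.s κ - S.s k))) := by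
  rw [Pi.sub_apply, (elimB_min hc).D_eq hz, ← Finset.add_sum_erase _ _ (Finset.mem_univ κ),
    (elimB_min hc).ε_sub (by rw [h0]; exact zero_ne_one), zero_add, sub_eq_add_neg,
    map_sum, ← Finset.sum_neg_distrib]
  congr 1
  refine Finset.sum_congr rfl fun k hk => ?_
  have hk := Finset.ne_of_mem_erase hk
  rw [elimB, if_pos (by rw [x_sub_ne hk.symm, h0]), ε_εv hk, neg_neg,
    sub_add_eq_add_sub]

theorem elim_zero_ok (hc : S.Min c) {z : Z} (h0 : S.x κ z = 0) (hz' : S.ok (z + S.s κ))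
    (hD : S.D c (z + S.s κ) = 0) :
    (c - S.D (S.elimB κ c)) z = S.ε κ (S.εv κ (c z)) := by
  have hz : S.ok z := by
    have := ok_sub hz' (k := κ) (by rw [x_add_self, h0]; norm_num)
    simpa using this
  rw [hc.D_eq hz', ← Finset.add_sum_erase _ _ (Finset.mem_univ κ), add_sub_cancel_right] at hD
  rw [elim_zero hc hz h0, eq_neg_of_add_eq_zero_right hD, ε_εv_self, map_neg, sub_eq_add_neg]

theorem elim_self (hc : S.Min c) (hD : ∀ z, S.x κ z = 1 → S.D c z = 0) :
    S.Elim κ (c - S.D (S.elimB κ c)) where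
  one _ h := elim_one hc h
  zero z h hz := by
    rw [elim_zero_ok hc h hz (hD _ (by rw [x_add_self, h, zero_add])), ε_sq]

theorem elim_other (hc : S.Min c) {κ' : Q} (hne : κ' ≠ κ) (hadj : ¬ S.adj κ' κ)
    (he : S.Elim κ' c) : S.Elim κ' (c - S.D (S.elimB κ c)) where
  one z h := by
    by_cases hz : S.ok z
    swap
    · simp [hc.supp.zero hz, D_not_ok _ hz]
    by_cases h1 : S.x κ z = 1
    · exact elim_one hc h1
    by_cases h0 : S.x κ z = 0
    swap
    · rw [elim_mid hc h0 h1]; exact he.one z h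
    rw [elim_zero hc hz h0, he.one z h, Finset.sum_eq_zero, map_zero, zero_add]
    intro k hk
    have hk := Finset.ne_of_mem_erase hk
    rcases eq_or_ne κ' k with rfl | hk'
    · by_cases hz' : S.ok (z + S.s κ)
      · refine he.zero _ ?_ (by simpa using hz')
        rw [x_sub_self, x_add_ne hne, h, sub_self]
      · rw [hc.supp.zero, map_zero]
        intro hw
        refine hz' (ok_shift hz fun k hka => ?_)
        have hkκ : k ≠ κ := fun e => S.adj_irrefl _ (e ▸ hka)
        have hkκ' : k ≠ κ' := fun e => hadj (e ▸ hka)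
        have := hw.2 _ _ hka
        rw [x_sub_ne hkκ', x_add_ne hkκ, x_sub_ne hne.symm, x_add_self] at this
        exact this.resolve_right (by linarith)
    · rw [he.one, map_zero]
      rw [x_sub_ne hk', x_add_ne hne, h]
  zero z h hz' := by
    have hz : S.ok z := by
      have := ok_sub hz' (k := κ') (by rw [x_add_self, h]; norm_num)
      simpa using this
    by_cases h1 : S.x κ z = 1
    · rw [elim_one hc h1, map_zero]
    by_cases h0 : S.x κ z = 0
    swap
    · rw [elim_mid hc h0 h1]; exact he.zero z h hz'
    rw [elim_zero hc hz h0, map_add, he.zero z h hz', zero_add, ε_εv hne, map_sum,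
      Finset.sum_eq_zero, map_zero, neg_zero]
    intro k hk
    have hk := Finset.ne_of_mem_erase hk
    by_cases hw : S.ok (z + S.s κ - S.s k)
    swap
    · rw [hc.supp.zero hw]; simp
    have hk1 : 1 ≤ S.x k z := by
      have := one_le_of_ok_sub hw
      rwa [x_add_ne hk] at this
    have hkk' : k ≠ κ' := fun e => by rw [e, h] at hk1; linarith
    have hka : ¬ S.adj κ' k := fun ha => by
      have := adj_zero_of_ok_add hz' h.ge (S.adj_symm _ _ ha)
      linarith
    rw [ε_comm hka, he.zero, map_zero, neg_zero]
    · rw [x_sub_ne hkk'.symm, x_add_ne hne, h]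
    · refine ok_shift hw fun k2 hk2 => ?_
      have h2κ : k2 ≠ κ := fun e => hadj (S.adj_symm _ _ (e ▸ hk2))
      have h2k : k2 ≠ k := fun e => hka (S.adj_symm _ _ (e ▸ hk2))
      rw [x_sub_ne h2k, x_add_ne h2κ]
      exact adj_zero_of_ok_add hz' h.ge hk2

theorem elim_mem (hc : S.Min c) {U U' : Z → Submodule K Λ} (hU : S.GoodPair κ U U')
    (hcU : ∀ z, c z ∈ U z) :
    (∀ z, S.elimB κ c z ∈ U' z) ∧ ∀ z, (c - S.D (S.elimB κ c)) z ∈ U z := by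
  have hb : ∀ z, S.elimB κ c z ∈ U' z := by
    intro z
    unfold elimB
    split_ifs with h
    · exact hU.εv_mem z h _ (hcU _)
    · exact (U' z).zero_mem
  refine ⟨hb, fun z => (U z).sub_mem (hcU z) ?_⟩
  by_cases hz : S.ok z
  · rw [(elimB_min hc).D_eq hz]
    refine (U z).sum_mem fun k _ => ?_
    by_cases hk : S.x k z = 1
    · exact hU.ε_mem k z hk _ (hb _)
    · rw [(elimB_min hc).ε_sub hk]; exact (U z).zero_mem
  · rw [D_not_ok _ hz]; exact (U z).zero_mem

end ElimStep

/-- Simultaneous elimination of pairwise nonadjacent indices. -/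
theorem exists_elim {c : Z → Λ} (hc : S.Min c) (T : Finset Q)
    (hT : ∀ κ ∈ T, ∀ κ' ∈ T, ¬ S.adj κ κ') (hD : ∀ κ ∈ T, ∀ z, S.x κ z = 1 → S.D c z = 0) :
    ∃ b, S.Min b ∧ (∀ κ ∈ T, S.Elim κ (c - S.D b)) ∧
      ∀ U U', (∀ κ ∈ T, S.GoodPair κ U U') → (∀ z, c z ∈ U z) →
        (∀ z, b z ∈ U' z) ∧ ∀ z, (c - S.D b) z ∈ U z := by
  induction T using Finset.induction_on with
  | empty => exact ⟨0, Min.zero, by simp, fun U U' _ h => ⟨by simp, by simpa using h⟩⟩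
  | insert κ T hκ ih =>
    obtain ⟨b, b1, b2, b3⟩ := ih
      (fun k hk k' hk' => hT k (Finset.mem_insert_of_mem hk) k' (Finset.mem_insert_of_mem hk'))
      (fun k hk => hD k (Finset.mem_insert_of_mem hk))
    have hc' : S.Min (c - S.D b) := hc.sub b1.D
    have hDc : S.D (c - S.D b) = S.D c := by rw [map_sub, D_sq b1.supp, sub_zero]
    have e : c - S.D (b + S.elimB κ (c - S.D b))
        = c - S.D b - S.D (S.elimB κ (c - S.D b)) := by rw [map_add, sub_sub]
    refine ⟨b + S.elimB κ (c - S.D b), b1.add (elimB_min hc'), ?_, ?_⟩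
    · intro κ' hκ'
      rw [e]
      rcases Finset.mem_insert.1 hκ' with rfl | hk
      · refine elim_self hc' ?_
        rw [hDc]; exact hD _ (Finset.mem_insert_self _ _)
      · exact elim_other hc' (fun h => hκ (h ▸ hk))
          (hT _ (Finset.mem_insert_of_mem hk) _ (Finset.mem_insert_self _ _)) (b2 _ hk)
    · intro U U' hU hcU
      obtain ⟨h1, h2⟩ := b3 U U' (fun k hk => hU k (Finset.mem_insert_of_mem hk)) hcU
      obtain ⟨h3, h4⟩ := elim_mem hc' (hU κ (Finset.mem_insert_self _ _)) h2
      rw [e]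
      exact ⟨fun z => (U' z).add_mem (h1 z) (h3 z), h4⟩

end KSys

section Coord

variable {n : ℕ} (A : Matrix (Fin n) (Fin n) ℕ)

/-- The coordinates of an integer vector with respect to the rows of `A`. -/
noncomputable def crd (j : Fin n) : (Fin n → ℤ) →+ ℚ where
  toFun γ := Matrix.vecMul (fun i => (γ i : ℚ)) (Aq A)⁻¹ j
  map_zero' := by
    have : (fun i : Fin n => (((0 : Fin n → ℤ) i : ℤ) : ℚ)) = 0 := by funext i; simp
    rw [this, Matrix.zero_vecMul]; rfl
  map_add' γ γ' := by
    have : (fun i => (((γ + γ') i : ℤ) : ℚ)) = (fun i => (γ i : ℚ)) + fun i => (γ' i : ℚ) := by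
      funext i; simp
    rw [this, Matrix.add_vecMul]; rfl

/-- The rows of `A` as integer vectors. -/
def row (j : Fin n) : Fin n → ℤ := fun k => A j k

theorem crd_apply (j : Fin n) (γ : Fin n → ℤ) :
    crd A j γ = Matrix.vecMul (fun i => (γ i : ℚ)) (Aq A)⁻¹ j := rfl

variable {A}

theorem crd_row (hA : (Aq A).det ≠ 0) (j i : Fin n) :
    crd A j (row A i) = if j = i then 1 else 0 := by
  have h : (fun k => ((row A i k : ℤ) : ℚ)) = (Aq A) i := by
    funext k; simp [row, Aq]
  rw [crd_apply, h]
  have := congrFun (congrFun (Matrix.mul_nonsing_inv (Aq A) (isUnit_iff_ne_zero.2 hA)) i) j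
  rw [Matrix.mul_apply_eq_vecMul] at this
  rw [this, Matrix.one_apply]
  simp [eq_comm]

theorem sum_crd_mul (hA : (Aq A).det ≠ 0) (γ : Fin n → ℤ) (k : Fin n) :
    ∑ j, crd A j γ * A j k = (γ k : ℚ) := by
  have : Matrix.vecMul (Matrix.vecMul (fun i => (γ i : ℚ)) (Aq A)⁻¹) (Aq A) k = γ k := by
    rw [Matrix.vecMul_vecMul, Matrix.nonsing_inv_mul _ (isUnit_iff_ne_zero.2 hA),
      Matrix.vecMul_one]
  rw [← this]
  rfl

variable (A) in
/-- The coordinates multiplied by the determinant, which are integers. -/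
noncomputable def adc (j : Fin n) : (Fin n → ℤ) →+ ℤ where
  toFun γ := Matrix.vecMul γ (A.map ((↑) : ℕ → ℤ)).adjugate j
  map_zero' := by rw [Matrix.zero_vecMul]; rfl
  map_add' γ γ' := by rw [Matrix.add_vecMul]; rfl

theorem det_Aq (A : Matrix (Fin n) (Fin n) ℕ) :
    (Aq A).det = (((A.map ((↑) : ℕ → ℤ)).det : ℤ) : ℚ) := by
  have h : Aq A = (A.map ((↑) : ℕ → ℤ)).map (Int.castRingHom ℚ) := by
    ext i j; simp [Aq]
  rw [h, ← RingHom.mapMatrix_apply, ← RingHom.map_det]; rfl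

theorem adc_eq (hA : (Aq A).det ≠ 0) (j : Fin n) (γ : Fin n → ℤ) :
    (adc A j γ : ℚ) = (Aq A).det * crd A j γ := by
  have h : Aq A = (A.map ((↑) : ℕ → ℤ)).map (Int.castRingHom ℚ) := by
    ext i j; simp [Aq]
  have h2 : (Aq A).adjugate = (A.map ((↑) : ℕ → ℤ)).adjugate.map (Int.castRingHom ℚ) := by
    rw [h, ← RingHom.mapMatrix_apply, ← RingHom.map_adjugate]; rfl
  rw [crd_apply, Matrix.inv_def, Ring.inverse_eq_inv', Matrix.vecMul_smul, Pi.smul_apply, smul_eq_mul,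
    mul_inv_cancel_left₀ hA, h2]
  simp [adc, Matrix.vecMul, dotProduct]

end Coord

section System

variable {K : Type} [Field K] [CharZero K] {n : ℕ}

theorem det_cast {A : Matrix (Fin n) (Fin n) ℕ} (hA : (Aq A).det ≠ 0) :
    (A.map ((↑) : ℕ → K)).det ≠ 0 := by
  have h : A.map ((↑) : ℕ → K) = (Aq A).map (Rat.castHom K) := by
    ext i j; simp [Aq]
  rw [h, ← RingHom.mapMatrix_apply, ← RingHom.map_det]
  simpa using hA

theorem Aq_transpose (A : Matrix (Fin n) (Fin n) ℕ) : Aq Aᵀ = (Aq A)ᵀ := rfl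

theorem det_Aq_transpose {A : Matrix (Fin n) (Fin n) ℕ} (hA : (Aq A).det ≠ 0) :
    (Aq Aᵀ).det ≠ 0 := by
  rwa [Aq_transpose, Matrix.det_transpose]

theorem EA_mulE (π : K) (A : Matrix (Fin n) (Fin n) ℕ) (i k : Fin n) (v : ExtV K (Fin n)) :
    EA K π A i (mulE K k v) + mulE K k (EA K π A i v) = 0 := by
  simp only [EA_apply, map_smul, map_sum]
  rw [← smul_add, ← Finset.sum_add_distrib, Finset.sum_eq_zero, smul_zero]
  intro j _
  rw [← smul_add, mulE_anticomm, smul_zero]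

theorem EAdual_contrE (π : K) (A : Matrix (Fin n) (Fin n) ℕ) (i k : Fin n)
    (v : ExtV K (Fin n)) :
    contrE K k (EAdual K π A i v) + EAdual K π A i (contrE K k v) = 0 := by
  simp only [EAdual_apply, map_smul, map_sum]
  rw [← smul_add, ← Finset.sum_add_distrib, Finset.sum_eq_zero, smul_zero]
  intro j _
  rw [← smul_add, contrE_anticomm, smul_zero]

/-- The system of shifts and operators describing the complex of `A`. -/
noncomputable def sys {π : K} (hπ : π ≠ 0) {A : Matrix (Fin n) (Fin n) ℕ}
    (hA : (Aq A).det ≠ 0) :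
    KSys K (ExtV K (Fin n)) (Fin n ⊕ Fin n) ((Fin n → ℤ) × (Fin n → ℤ)) where
  s := Sum.elim (fun j => (row A j, 0)) fun i => (0, row Aᵀ i)
  x := Sum.elim (fun j => (crd A j).comp (AddMonoidHom.fst _ _))
    fun i => (crd Aᵀ i).comp (AddMonoidHom.snd _ _)
  adj k k' := (∃ j i, A j i ≠ 0 ∧ k = Sum.inl j ∧ k' = Sum.inr i) ∨
    ∃ j i, A j i ≠ 0 ∧ k = Sum.inr i ∧ k' = Sum.inl j
  ε := Sum.elim (EA K π A) (contrE K)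
  εv := Sum.elim (EAdual K π A) (mulE K)
  P := π
  P_ne := hπ
  x_s k k' := by
    rcases k with j | i <;> rcases k' with j' | i'
    · simp [crd_row hA]
    · simp
    · simp
    · simp [crd_row (det_Aq_transpose hA)]
  adj_symm := by
    rintro k k' (⟨j, i, h, rfl, rfl⟩ | ⟨j, i, h, rfl, rfl⟩)
    · exact Or.inr ⟨j, i, h, rfl, rfl⟩
    · exact Or.inl ⟨j, i, h, rfl, rfl⟩
  adj_irrefl := by
    rintro k (⟨j, i, h, h1, h2⟩ | ⟨j, i, h, h1, h2⟩) <;> rw [h1] at h2 <;> simp at h2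
  anti k k' h v := by
    rcases k with j | i <;> rcases k' with j' | i'
    · exact EA_anticomm π A j j' v
    · have h0 : A j i' = 0 := by
        by_contra h0; exact h (Or.inl ⟨j, i', h0, rfl, rfl⟩)
      simp only [Sum.elim_inl, Sum.elim_inr]
      rw [EA_contrE, h0]; simp
    · have h0 : A j' i = 0 := by
        by_contra h0; exact h (Or.inr ⟨j', i, h0, rfl, rfl⟩)
      simp only [Sum.elim_inl, Sum.elim_inr]
      rw [add_comm, EA_contrE, h0]; simp
    · exact contrE_anticomm i i' v
  dual k k' v := by
    rcases k with j | i <;> rcases k' with j' | i'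
    · simpa using EA_EAdual π A hπ (det_cast hA) j j' v
    · simpa using EA_mulE π A j i' v
    · simpa using EAdual_contrE π A j' i v
    · have := mulE_contrE (F := K) i' i v
      simp only [Sum.elim_inr, Sum.inr.injEq]
      rw [add_comm, this]
      simp [eq_comm]

variable {π : K} (hπ : π ≠ 0) {A : Matrix (Fin n) (Fin n) ℕ} (hA : (Aq A).det ≠ 0)

theorem sys_ok_iff (z : (Fin n → ℤ) × (Fin n → ℤ)) : (sys hπ hA).ok z ↔
    (∀ j, 0 ≤ crd A j z.1) ∧ (∀ i, 0 ≤ crd Aᵀ i z.2) ∧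
      ∀ j i, A j i ≠ 0 → crd A j z.1 = 0 ∨ crd Aᵀ i z.2 = 0 := by
  constructor
  · rintro ⟨h1, h2⟩
    exact ⟨fun j => h1 (Sum.inl j), fun i => h1 (Sum.inr i),
      fun j i h => h2 (Sum.inl j) (Sum.inr i) (Or.inl ⟨j, i, h, rfl, rfl⟩)⟩
  · rintro ⟨h1, h2, h3⟩
    refine ⟨?_, ?_⟩
    · rintro (j | i)
      · exact h1 j
      · exact h2 i
    · rintro k k' (⟨j, i, h, rfl, rfl⟩ | ⟨j, i, h, rfl, rfl⟩)
      · exact h3 j i h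
      · exact (h3 j i h).symm

end System

section Model

variable {K : Type} [Field K] [CharZero K] {n : ℕ} (π : K) (A : Matrix (Fin n) (Fin n) ℕ)
  (V : Finset (Fin n))

/-- The rows of `A` supported on `V`. -/
noncomputable def rowsIn : Finset (Fin n) := Finset.univ.filter fun j => ∀ k, k ∉ V → A j k = 0

theorem mem_rowsIn {j : Fin n} : j ∈ rowsIn A V ↔ ∀ k, k ∉ V → A j k = 0 := by
  simp [rowsIn]

/-- The operator `π⁻¹ a_j + (shift by the `j`-th row)` on functions of `γ`. -/
noncomputable def opT (j : Fin n) :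
    ((Fin n → ℤ) → ExtV K (Fin n)) →ₗ[K] ((Fin n → ℤ) → ExtV K (Fin n)) where
  toFun H γ := ((crd A j γ : K) / π) • H γ + if j ∈ rowsIn A V then H (γ - row A j) else 0
  map_add' H H' := by
    funext γ
    simp only [Pi.add_apply, smul_add]
    split_ifs
    · abel
    · simp
  map_smul' a H := by
    funext γ
    simp only [Pi.smul_apply, RingHom.id_apply, smul_add, smul_comm a]
    split_ifs <;> simp

/-- The differential on functions of `γ` for a fixed minimal `λ`. -/
noncomputable def DR :
    ((Fin n → ℤ) → ExtV K (Fin n)) →ₗ[K] ((Fin n → ℤ) → ExtV K (Fin n)) :=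
  ∑ j, (LinearMap.compLeft (EA K π A j) (Fin n → ℤ)).comp (opT π A V j)

theorem DR_apply (H : (Fin n → ℤ) → ExtV K (Fin n)) (γ : Fin n → ℤ) :
    DR π A V H γ = ∑ j, EA K π A j (opT π A V j H γ) := by
  simp [DR, LinearMap.sum_apply, Finset.sum_apply]

/-- The allowed monomials with fixed minimal `λ`. -/
def RS (γ : Fin n → ℤ) (S : Finset (Fin n)) : Prop :=
  (∀ k, 0 ≤ γ k) ∧ (∀ k, k ∉ V → γ k = 0) ∧ S ⊆ V ∧ ∀ k ∈ S, 0 < γ k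

/-- The forms supported on a family of basis elements. -/
def formsOn (K : Type) [Field K] {n : ℕ} (P : Finset (Fin n) → Prop) :
    Submodule K (ExtV K (Fin n)) where
  carrier := {v | ∀ S, v S ≠ 0 → P S}
  zero_mem' S h := absurd rfl h
  add_mem' {v w} hv hw S h := by
    by_cases h1 : v S = 0
    · refine hw S fun h2 => h ?_
      rw [Pi.add_apply, h1, h2, add_zero]
    · exact hv S h1
  smul_mem' a v hv S h := hv S fun h1 => h (by rw [Pi.smul_apply, h1, smul_zero])

theorem mulE_mem_formsOn {P P' : Finset (Fin n) → Prop} {k : Fin n} {v : ExtV K (Fin n)}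
    (hv : v ∈ formsOn K P) (h : ∀ S, k ∉ S → P S → P' (insert k S)) :
    mulE K k v ∈ formsOn K P' := by
  intro S hS
  rw [mulE_apply] at hS
  split_ifs at hS with hk
  · have := h (S.erase k) (Finset.notMem_erase k S) (hv _ fun h0 => hS (by rw [h0, mul_zero]))
    rwa [Finset.insert_erase hk] at this
  · exact absurd rfl hS

theorem contrE_mem_formsOn {P P' : Finset (Fin n) → Prop} {k : Fin n} {v : ExtV K (Fin n)}
    (hv : v ∈ formsOn K P) (h : ∀ S, k ∉ S → P (insert k S) → P' S) :
    contrE K k v ∈ formsOn K P' := by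
  intro S hS
  rw [contrE_apply] at hS
  split_ifs at hS with hk
  · exact absurd rfl hS
  · exact h S hk (hv _ fun h0 => hS (by rw [h0, mul_zero]))

theorem EA_mem_formsOn {P P' : Finset (Fin n) → Prop} {j : Fin n} {v : ExtV K (Fin n)}
    (hv : v ∈ formsOn K P) (h : ∀ k S, A j k ≠ 0 → k ∉ S → P S → P' (insert k S)) :
    EA K π A j v ∈ formsOn K P' := by
  rw [EA_apply]
  refine (formsOn K P').smul_mem _ ((formsOn K P').sum_mem fun k _ => ?_)
  by_cases hk : A j k = 0
  · rw [hk, Nat.cast_zero, zero_smul]; exact (formsOn K P').zero_mem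
  · exact (formsOn K P').smul_mem _ (mulE_mem_formsOn hv fun S => h k S hk)

theorem EAdual_mem_formsOn {P P' : Finset (Fin n) → Prop} {j : Fin n} {v : ExtV K (Fin n)}
    (hv : v ∈ formsOn K P) (h : ∀ k S, k ∉ S → P (insert k S) → P' S) :
    EAdual K π A j v ∈ formsOn K P' := by
  rw [EAdual_apply]
  exact (formsOn K P').smul_mem _ ((formsOn K P').sum_mem fun k _ =>
    (formsOn K P').smul_mem _ (contrE_mem_formsOn hv fun S => h k S))

/-- Functions supported on allowed monomials. -/
def RSupp (H : (Fin n → ℤ) → ExtV K (Fin n)) : Prop := ∀ γ, H γ ∈ formsOn K (RS V γ)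

theorem RS_add_row {γ : Fin n → ℤ} {S : Finset (Fin n)} (h : RS V γ S) {j : Fin n}
    (hj : j ∈ rowsIn A V) : RS V (γ + row A j) S := by
  obtain ⟨h1, h2, h3, h4⟩ := h
  have hr : ∀ k, 0 ≤ row A j k := fun k => Int.natCast_nonneg _
  refine ⟨fun k => add_nonneg (h1 k) (hr k), fun k hk => ?_, h3, fun k hk => ?_⟩
  · rw [Pi.add_apply, h2 k hk, row, (mem_rowsIn A V).1 hj k hk]; simp
  · exact add_pos_of_pos_of_nonneg (h4 k hk) (hr k)

theorem RS_insert {γ : Fin n → ℤ} {S : Finset (Fin n)} (h : RS V γ S) {k : Fin n}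
    (hk : γ k ≠ 0) : RS V γ (insert k S) := by
  obtain ⟨h1, h2, h3, h4⟩ := h
  refine ⟨h1, h2, ?_, ?_⟩
  · refine Finset.insert_subset ?_ h3
    by_contra hkV; exact hk (h2 k hkV)
  · intro i hi
    rcases Finset.mem_insert.1 hi with rfl | hi
    · exact lt_of_le_of_ne (h1 i) hk.symm
    · exact h4 i hi

theorem RS_erase {γ : Fin n → ℤ} {S : Finset (Fin n)} {k : Fin n} (h : RS V γ (insert k S)) :
    RS V γ S :=
  ⟨h.1, h.2.1, (Finset.subset_insert k S).trans h.2.2.1,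
    fun i hi => h.2.2.2 i (Finset.mem_insert_of_mem hi)⟩

variable {A}

theorem sum_crd_EA (hA : (Aq A).det ≠ 0) (hπ : π ≠ 0) (γ : Fin n → ℤ) (v : ExtV K (Fin n)) :
    ∑ j, ((crd A j γ : K) / π) • EA K π A j v = ∑ k, (γ k : K) • mulE K k v := by
  simp only [EA_apply, Finset.smul_sum, smul_smul]
  rw [Finset.sum_comm]
  refine Finset.sum_congr rfl fun k _ => ?_
  rw [← Finset.sum_smul]
  congr 1
  have := congrArg (Rat.cast : ℚ → K) (sum_crd_mul hA γ k)
  push_cast at this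
  rw [← this]
  refine Finset.sum_congr rfl fun j _ => ?_
  field_simp

theorem DR_eq (hA : (Aq A).det ≠ 0) (hπ : π ≠ 0) (H : (Fin n → ℤ) → ExtV K (Fin n))
    (γ : Fin n → ℤ) : DR π A V H γ = ∑ k, (γ k : K) • mulE K k (H γ)
      + ∑ j ∈ rowsIn A V, EA K π A j (H (γ - row A j)) := by
  rw [DR_apply, ← sum_crd_EA π hA hπ, ← Finset.sum_filter_add_sum_filter_not Finset.univ
    (fun j => j ∈ rowsIn A V) fun j => EA K π A j (opT π A V j H γ)]
  rw [← Finset.sum_filter_add_sum_filter_not Finset.univ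
    (fun j => j ∈ rowsIn A V) fun j => ((crd A j γ : K) / π) • EA K π A j (H γ)]
  have e : Finset.univ.filter (fun j => j ∈ rowsIn A V) = rowsIn A V := by ext; simp
  rw [e, add_right_comm, ← Finset.sum_add_distrib]
  congr 1
  · refine Finset.sum_congr rfl fun j hj => ?_
    simp [opT, hj]
  · refine Finset.sum_congr rfl fun j hj => ?_
    simp [opT, (Finset.mem_filter.1 hj).2]

theorem RSupp.DR (hA : (Aq A).det ≠ 0) (hπ : π ≠ 0) {H : (Fin n → ℤ) → ExtV K (Fin n)}
    (hH : RSupp V H) : RSupp V (DR π A V H) := by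
  intro γ
  rw [DR_eq π V hA hπ]
  refine (formsOn K _).add_mem ((formsOn K _).sum_mem fun k _ => ?_)
    ((formsOn K _).sum_mem fun j hj => ?_)
  · by_cases hk : γ k = 0
    · rw [hk, Int.cast_zero, zero_smul]; exact (formsOn K _).zero_mem
    · exact (formsOn K _).smul_mem _ (mulE_mem_formsOn (hH γ) fun S _ h => RS_insert V h hk)
  · refine EA_mem_formsOn π A (hH _) fun k S hk _ h => RS_insert V ?_ ?_
    · simpa using RS_add_row A V h hj
    · have := h.1 k
      have h2 : 0 < row A j k := Int.natCast_pos.2 (Nat.pos_of_ne_zero hk)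
      rw [Pi.sub_apply] at this
      exact fun h0 => by omega

theorem opT_comm (hA : (Aq A).det ≠ 0) {i j : Fin n} (h : i ≠ j)
    (H : (Fin n → ℤ) → ExtV K (Fin n)) :
    opT π A V i (opT π A V j H) = opT π A V j (opT π A V i H) := by
  have hx : ∀ γ, crd A i (γ - row A j) = crd A i γ := fun γ => by
    rw [map_sub, crd_row hA, if_neg h, sub_zero]
  have hx' : ∀ γ, crd A j (γ - row A i) = crd A j γ := fun γ => by
    rw [map_sub, crd_row hA, if_neg h.symm, sub_zero]
  funext γ
  simp only [opT, LinearMap.coe_mk, AddHom.coe_mk, smul_add, smul_smul, hx, hx',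
    sub_right_comm γ (row A j)]
  rw [mul_comm]
  split_ifs <;> try simp only [smul_zero, add_zero]
  all_goals abel

theorem opT_comp (j : Fin n) (T : ExtV K (Fin n) →ₗ[K] ExtV K (Fin n))
    (H : (Fin n → ℤ) → ExtV K (Fin n)) (γ : Fin n → ℤ) :
    opT π A V j (fun w => T (H w)) γ = T (opT π A V j H γ) := by
  simp only [opT, LinearMap.coe_mk, AddHom.coe_mk, map_add, map_smul]
  split_ifs <;> simp

theorem opT_sum {α : Type} (s : Finset α) (j : Fin n)
    (H : α → (Fin n → ℤ) → ExtV K (Fin n)) :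
    opT π A V j (fun w => ∑ a ∈ s, H a w) = fun γ => ∑ a ∈ s, opT π A V j (H a) γ := by
  have : (fun w => ∑ a ∈ s, H a w) = ∑ a ∈ s, H a := by funext w; simp
  rw [this, map_sum]; funext γ; simp

theorem DR_DR (hA : (Aq A).det ≠ 0) (H : (Fin n → ℤ) → ExtV K (Fin n)) :
    DR π A V (DR π A V H) = 0 := by
  funext γ
  have e : DR π A V H = fun w => ∑ j, EA K π A j (opT π A V j H w) := by
    funext w; exact DR_apply π A V H w
  have h1 : DR π A V (DR π A V H) γ
      = ∑ i, ∑ j, EA K π A i (EA K π A j (opT π A V i (opT π A V j H) γ)) := by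
    rw [DR_apply]
    refine Finset.sum_congr rfl fun i _ => ?_
    rw [e, opT_sum, map_sum]
    refine Finset.sum_congr rfl fun j _ => ?_
    rw [opT_comp]
  have h2 : (2 : K) • DR π A V (DR π A V H) γ = 0 := by
    rw [two_smul, h1]
    nth_rewrite 2 [Finset.sum_comm]
    rw [← Finset.sum_add_distrib]
    refine Finset.sum_eq_zero fun i _ => ?_
    rw [← Finset.sum_add_distrib]
    refine Finset.sum_eq_zero fun j _ => ?_
    rcases eq_or_ne i j with rfl | hne
    · simp [EA_sq]
    · rw [opT_comm π V hA hne]; exact EA_anticomm π A i j _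
  exact (smul_eq_zero.1 h2).resolve_left two_ne_zero

theorem DR_EAdual (hA : (Aq A).det ≠ 0) (hπ : π ≠ 0) (j : Fin n)
    (H : (Fin n → ℤ) → ExtV K (Fin n)) (γ : Fin n → ℤ) :
    DR π A V (fun w => EAdual K π A j (H w)) γ
      = opT π A V j H γ - EAdual K π A j (DR π A V H γ) := by
  rw [DR_apply, DR_apply, map_sum, eq_sub_iff_add_eq, ← Finset.sum_add_distrib]
  have : ∀ k, EA K π A k (opT π A V k (fun w => EAdual K π A j (H w)) γ)
      + EAdual K π A j (EA K π A k (opT π A V k H γ))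
      = if k = j then opT π A V k H γ else 0 := by
    intro k
    rw [opT_comp]
    exact EA_EAdual π A hπ (det_cast hA) k j _
  simp [this]

/-- The embedding of functions of `γ` as functions supported at a single `λ`. -/
noncomputable def emb (lam : Fin n → ℤ) :
    ((Fin n → ℤ) → ExtV K (Fin n)) →ₗ[K] ((Fin n → ℤ) × (Fin n → ℤ) → ExtV K (Fin n)) where
  toFun H z := if z.2 = lam then H z.1 else 0
  map_add' H H' := by funext z; simp only [Pi.add_apply]; split_ifs <;> simp
  map_smul' a H := by funext z; simp only [Pi.smul_apply, RingHom.id_apply]; split_ifs <;> simp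

theorem emb_apply (lam : Fin n → ℤ) (H : (Fin n → ℤ) → ExtV K (Fin n))
    (z : (Fin n → ℤ) × (Fin n → ℤ)) : emb lam H z = if z.2 = lam then H z.1 else 0 := rfl

/-- `V` is the set of vanishing coordinates of the minimal element `lam`. -/
structure IsMin (A : Matrix (Fin n) (Fin n) ℕ) (V : Finset (Fin n)) (lam : Fin n → ℤ) :
    Prop where
  nonneg : ∀ i, 0 ≤ crd Aᵀ i lam
  lt_one : ∀ i, crd Aᵀ i lam < 1
  mem_iff : ∀ i, i ∈ V ↔ crd Aᵀ i lam = 0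

/-- Nonnegativity of the coordinates on the support. -/
def NonnegOn (A : Matrix (Fin n) (Fin n) ℕ) (T : Finset (Fin n))
    (H : (Fin n → ℤ) → ExtV K (Fin n)) : Prop :=
  ∀ γ, H γ ≠ 0 → ∀ j ∈ T, 0 ≤ crd A j γ

theorem crd_eq_zero_of (hA : (Aq A).det ≠ 0) {γ : Fin n → ℤ} (h : ∀ j, 0 ≤ crd A j γ)
    {k : Fin n} (hk : γ k = 0) {j : Fin n} (hj : A j k ≠ 0) : crd A j γ = 0 := by
  have h1 := sum_crd_mul hA γ k
  rw [hk, Int.cast_zero, Finset.sum_eq_zero_iff_of_nonneg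
    fun i _ => mul_nonneg (h i) (Nat.cast_nonneg _)] at h1
  exact (mul_eq_zero.1 (h1 j (Finset.mem_univ j))).resolve_right (by exact_mod_cast hj)

theorem coord_eq_zero_of (hA : (Aq A).det ≠ 0) {γ : Fin n → ℤ} {k : Fin n}
    (h : ∀ j, A j k ≠ 0 → crd A j γ = 0) : γ k = 0 := by
  have h1 := sum_crd_mul hA γ k
  rw [Finset.sum_eq_zero] at h1
  · exact_mod_cast h1.symm
  · intro j _
    by_cases hj : A j k = 0
    · rw [hj]; simp
    · rw [h j hj, zero_mul]

theorem sys_ok_min (hA : (Aq A).det ≠ 0) (hπ : π ≠ 0) {lam : Fin n → ℤ} (hl : IsMin A V lam)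
    {γ : Fin n → ℤ} : (sys hπ hA).ok (γ, lam) ↔
      (∀ j, 0 ≤ crd A j γ) ∧ ∀ k, k ∉ V → γ k = 0 := by
  rw [sys_ok_iff]
  constructor
  · rintro ⟨h1, h2, h3⟩
    refine ⟨h1, fun k hk => coord_eq_zero_of hA fun j hj => (h3 j k hj).resolve_right ?_⟩
    exact fun h => hk ((hl.mem_iff k).2 h)
  · rintro ⟨h1, h2⟩
    refine ⟨h1, hl.nonneg, fun j i hji => ?_⟩
    by_cases hi : i ∈ V
    · exact Or.inr ((hl.mem_iff i).1 hi)
    · exact Or.inl (crd_eq_zero_of hA h1 (h2 i hi) hji)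

theorem contrE_eq_zero {P : Finset (Fin n) → Prop} {v : ExtV K (Fin n)} (hv : v ∈ formsOn K P)
    {i : Fin n} (h : ∀ S, P S → i ∉ S) : contrE K i v = 0 := by
  have := contrE_mem_formsOn (P' := fun _ => False) hv
    fun S _ hP => h _ hP (Finset.mem_insert_self _ _)
  funext S
  by_contra hS
  exact this S hS

theorem emb_supp (hA : (Aq A).det ≠ 0) (hπ : π ≠ 0) {lam : Fin n → ℤ} (hl : IsMin A V lam)
    {H : (Fin n → ℤ) → ExtV K (Fin n)} (hH : RSupp V H) (h0 : NonnegOn A Finset.univ H) :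
    (sys hπ hA).Supp (emb lam H) := by
  rintro ⟨γ, l⟩ h
  simp only [emb_apply] at h
  split_ifs at h with hl'
  · subst hl'
    obtain ⟨S, hS⟩ := Function.ne_iff.1 h
    exact (sys_ok_min π V hA hπ hl).2
      ⟨fun j => h0 γ h j (Finset.mem_univ j), (hH γ S hS).2.1⟩
  · exact absurd rfl h

theorem D_emb (hA : (Aq A).det ≠ 0) (hπ : π ≠ 0) {lam : Fin n → ℤ} (hl : IsMin A V lam)
    {H : (Fin n → ℤ) → ExtV K (Fin n)} (hH : RSupp V H) (h0 : NonnegOn A Finset.univ H) :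
    (sys hπ hA).D (emb lam H) = emb lam (DR π A V H) := by
  have hs := emb_supp π V hA hπ hl hH h0
  funext ⟨γ, l⟩
  have hRS : ∀ γ, H γ ≠ 0 → ∀ k, k ∉ V → γ k = 0 := fun γ h => by
    obtain ⟨S, hS⟩ := Function.ne_iff.1 h
    exact (hH γ S hS).2.1
  by_cases hz : (sys hπ hA).ok (γ, l)
  · rw [KSys.D_ok _ hz, Fintype.sum_sum_type, Finset.sum_eq_zero (s := Finset.univ)
      (f := fun i => (sys hπ hA).ε (Sum.inr i) _), add_zero]
    · rw [emb_apply]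
      split_ifs with hl'
      · simp only at hl'
        subst hl'
        rw [DR_apply]
        refine Finset.sum_congr rfl fun j _ => ?_
        change EA K π A j (((crd A j γ : K) / π) • emb l H (γ, l)
          + emb l H (γ - row A j, l - 0)) = _
        rw [emb_apply, emb_apply, if_pos rfl, if_pos (sub_zero l)]
        simp only [opT, LinearMap.coe_mk, AddHom.coe_mk]
        split_ifs with hj
        · rfl
        · congr 2
          by_contra hne
          rw [mem_rowsIn] at hj
          push Not at hj
          obtain ⟨k, hk, hjk⟩ := hj
          have h1 := hRS _ hne k hk
          have h2 := ((sys_ok_min π V hA hπ hl).1 hz).2 k hk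
          rw [Pi.sub_apply, h2, row] at h1
          omega
      · refine Finset.sum_eq_zero fun j _ => ?_
        change EA K π A j (((crd A j γ : K) / π) • emb lam H (γ, l)
          + emb lam H (γ - row A j, l - 0)) = _
        rw [emb_apply, emb_apply, if_neg hl', if_neg (by rwa [sub_zero])]
        simp
    · intro i _
      change contrE K i (((crd Aᵀ i l : K) / π) • emb lam H (γ, l)
          + emb lam H (γ - 0, l - row Aᵀ i)) = _
      rw [emb_apply, emb_apply, sub_zero, map_add, map_smul]
      simp only
      have t1 : ((crd Aᵀ i l : K) / π) • contrE K i (if l = lam then H γ else 0) = 0 := by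
        split_ifs with hl'
        · subst hl'
          by_cases hi : i ∈ V
          · rw [(hl.mem_iff i).1 hi]; simp
          · rw [contrE_eq_zero (hH γ) fun S hS hiS => hi (hS.2.2.1 hiS), smul_zero]
        · simp
      rw [t1, zero_add]
      split_ifs with hl'
      · refine contrE_eq_zero (hH γ) fun S hS hiS => ?_
        have hb : crd Aᵀ i l = crd Aᵀ i lam + 1 := by
          rw [← hl', map_sub, crd_row (det_Aq_transpose hA)]; simp
        have h3 := ((sys_ok_iff hπ hA _).1 hz).2.2
        have : γ i = 0 := coord_eq_zero_of hA fun j hj => (h3 j i hj).resolve_right (by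
          simp only; rw [hb]; have := hl.nonneg i; intro h; linarith)
        exact absurd (hS.2.2.2 i hiS) (by rw [this]; exact lt_irrefl _)
      · exact map_zero _
  · rw [KSys.D_not_ok _ hz, emb_apply]
    split_ifs with hl'
    swap
    · rfl
    simp only at hl'
    subst hl'
    rw [sys_ok_min π V hA hπ hl] at hz
    symm
    rw [DR_apply]
    refine Finset.sum_eq_zero fun j _ => ?_
    have e1 : H γ = 0 := by
      by_contra h
      exact hz ⟨fun j => h0 γ h j (Finset.mem_univ j), hRS γ h⟩
    have e2 : (if j ∈ rowsIn A V then H (γ - row A j) else 0) = 0 := by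
      split_ifs with hj
      · by_contra h
        refine hz ⟨fun i => ?_, fun k hk => ?_⟩
        · have := h0 _ h i (Finset.mem_univ i)
          rw [map_sub, crd_row hA] at this
          split_ifs at this <;> linarith
        · have := hRS _ h k hk
          rw [Pi.sub_apply, row, (mem_rowsIn A V).1 hj k hk] at this
          simpa using this
      · rfl
    simp [opT, e1, e2]

end Model

section Koszul

variable {K : Type} [Field K] [CharZero K] {n : ℕ} (π : K) (A : Matrix (Fin n) (Fin n) ℕ)
  (V : Finset (Fin n))

/-- The translation of a function by an integer vector. -/
def shf (m : Fin n → ℤ) :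
    ((Fin n → ℤ) → ExtV K (Fin n)) →ₗ[K] ((Fin n → ℤ) → ExtV K (Fin n)) where
  toFun H γ := H (γ - m)
  map_add' _ _ := rfl
  map_smul' _ _ := rfl

theorem shf_apply (m : Fin n → ℤ) (H : (Fin n → ℤ) → ExtV K (Fin n)) (γ : Fin n → ℤ) :
    shf m H γ = H (γ - m) := rfl

/-- The Koszul differential of the rows supported on `V`. -/
noncomputable def phi :
    ((Fin n → ℤ) → ExtV K (Fin n)) →ₗ[K] ((Fin n → ℤ) → ExtV K (Fin n)) :=
  ∑ j ∈ rowsIn A V, (LinearMap.compLeft (EA K π A j) (Fin n → ℤ)).comp (shf (row A j))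

theorem phi_apply (H : (Fin n → ℤ) → ExtV K (Fin n)) (γ : Fin n → ℤ) :
    phi π A V H γ = ∑ j ∈ rowsIn A V, EA K π A j (H (γ - row A j)) := by
  simp [phi, LinearMap.sum_apply, Finset.sum_apply, shf_apply]

theorem phi_ne {H : (Fin n → ℤ) → ExtV K (Fin n)} {γ : Fin n → ℤ} {S : Finset (Fin n)}
    (h : phi π A V H γ S ≠ 0) : ∃ j ∈ rowsIn A V, ∃ k ∈ S, A j k ≠ 0 ∧
      H (γ - row A j) (S.erase k) ≠ 0 := by
  rw [phi_apply, Finset.sum_apply] at h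
  obtain ⟨j, hj, h⟩ := Finset.exists_ne_zero_of_sum_ne_zero h
  rw [EA_apply, Pi.smul_apply, Finset.sum_apply] at h
  obtain ⟨k, -, h⟩ := Finset.exists_ne_zero_of_sum_ne_zero (right_ne_zero_of_smul h)
  rw [Pi.smul_apply, mulE_apply] at h
  split_ifs at h with hk
  · refine ⟨j, hj, k, hk, fun h0 => h (by rw [h0]; simp), fun h0 => h (by rw [h0]; simp)⟩
  · simp at h

theorem phi_phi (H : (Fin n → ℤ) → ExtV K (Fin n)) : phi π A V (phi π A V H) = 0 := by
  funext γ
  have h1 : phi π A V (phi π A V H) γ = ∑ i ∈ rowsIn A V, ∑ j ∈ rowsIn A V,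
      EA K π A i (EA K π A j (H (γ - row A i - row A j))) := by
    rw [phi_apply]
    refine Finset.sum_congr rfl fun i _ => ?_
    rw [phi_apply, map_sum]
  have h2 : (2 : K) • phi π A V (phi π A V H) γ = 0 := by
    rw [two_smul, h1]
    nth_rewrite 2 [Finset.sum_comm]
    rw [← Finset.sum_add_distrib]
    refine Finset.sum_eq_zero fun i _ => ?_
    rw [← Finset.sum_add_distrib]
    refine Finset.sum_eq_zero fun j _ => ?_
    rw [sub_right_comm γ (row A j)]
    exact EA_anticomm π A i j _
  exact (smul_eq_zero.1 h2).resolve_left two_ne_zero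

/-- An exponent vector as an integer vector. -/
def ivec (m : Fin n →₀ ℕ) : Fin n → ℤ := fun k => m k

/-- The action of a polynomial on functions by translations. -/
noncomputable def act (f : (Fin n → ℤ) → ExtV K (Fin n)) (γ : Fin n → ℤ) :
    MvPolynomial (Fin n) K →ₗ[K] ExtV K (Fin n) :=
  (MvPolynomial.basisMonomials (Fin n) K).constr K fun m => f (γ - ivec m)

theorem act_monomial (f : (Fin n → ℤ) → ExtV K (Fin n)) (γ : Fin n → ℤ) (m : Fin n →₀ ℕ)
    (a : K) : act f γ (MvPolynomial.monomial m a) = a • f (γ - ivec m) := by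
  have h : MvPolynomial.monomial m a = a • (MvPolynomial.basisMonomials (Fin n) K) m := by
    simp [MvPolynomial.smul_monomial]
  rw [h, map_smul, act, Module.Basis.constr_basis]

theorem act_eq_sum (f : (Fin n → ℤ) → ExtV K (Fin n)) (γ : Fin n → ℤ)
    (c : MvPolynomial (Fin n) K) :
    act f γ c = ∑ m ∈ c.support, c.coeff m • f (γ - ivec m) := by
  conv_lhs => rw [c.as_sum]
  rw [map_sum]
  simp only [act_monomial]

/-- The rows of `A` as exponent vectors. -/
noncomputable def frow (j : Fin n) : Fin n →₀ ℕ := Finsupp.equivFunOnFinite.symm (A j)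

theorem ivec_frow (j : Fin n) : ivec (frow A j) = row A j := by
  funext k; simp [ivec, frow, row]

theorem ivec_add (m m' : Fin n →₀ ℕ) : ivec (m + m') = ivec m + ivec m' := by
  funext k; simp [ivec]

theorem ivec_single (i : Fin n) (N : ℕ) :
    ivec (Finsupp.single i N) = Pi.single i (N : ℤ) := by
  funext k
  rcases eq_or_ne k i with rfl | h
  · simp [ivec]
  · simp [ivec, h]

/-- The partial derivatives of the part of `W_A` supported on `V`. -/
noncomputable def pdV (k : Fin n) : MvPolynomial (Fin n) K :=
  ∑ j ∈ rowsIn A V, MvPolynomial.monomial (frow A j - Finsupp.single k 1) (A j k : K)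

/-- The regularity of the critical locus at the origin, in an effective form. -/
def KosReg (K : Type) [Field K] {n : ℕ} (A : Matrix (Fin n) (Fin n) ℕ)
    (V : Finset (Fin n)) : Prop :=
  ∀ i ∈ V, ∃ N : ℕ, ∃ c : Fin n → MvPolynomial (Fin n) K,
    ∑ k ∈ V, c k * pdV A V k = MvPolynomial.X i ^ N

/-- The contraction homotopy attached to a vector field. -/
noncomputable def iot (i : Fin n) (N : ℕ) (c : Fin n → MvPolynomial (Fin n) K)
    (f : (Fin n → ℤ) → ExtV K (Fin n)) (γ : Fin n → ℤ) : ExtV K (Fin n) :=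
  ∑ k ∈ V, contrE K k (act f (γ + Pi.single k 1 + Pi.single i (N : ℤ)) (c k))

theorem iot_ne {i : Fin n} {N : ℕ} {c : Fin n → MvPolynomial (Fin n) K}
    {f : (Fin n → ℤ) → ExtV K (Fin n)} {γ : Fin n → ℤ} {S : Finset (Fin n)}
    (h : iot V i N c f γ S ≠ 0) : ∃ k ∈ V, k ∉ S ∧ ∃ m : Fin n →₀ ℕ,
      f (γ + Pi.single k 1 + Pi.single i (N : ℤ) - ivec m) (insert k S) ≠ 0 := by
  rw [iot, Finset.sum_apply] at h
  obtain ⟨k, hk, h⟩ := Finset.exists_ne_zero_of_sum_ne_zero h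
  rw [contrE_apply] at h
  split_ifs at h with hS
  · exact absurd rfl h
  · have h := right_ne_zero_of_mul h
    rw [act_eq_sum, Finset.sum_apply] at h
    obtain ⟨m, -, h⟩ := Finset.exists_ne_zero_of_sum_ne_zero h
    exact ⟨k, hk, hS, m, fun h0 => h (by rw [Pi.smul_apply, h0, smul_zero])⟩

theorem act_phi (f : (Fin n → ℤ) → ExtV K (Fin n)) (γ : Fin n → ℤ)
    (c : MvPolynomial (Fin n) K) :
    act (phi π A V f) γ c = ∑ j ∈ rowsIn A V, EA K π A j (act f (γ - row A j) c) := by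
  simp only [act_eq_sum, phi_apply, Finset.smul_sum, map_sum, map_smul]
  rw [Finset.sum_comm]
  simp only [sub_right_comm]

theorem act_mul_pdV (f : (Fin n → ℤ) → ExtV K (Fin n)) (γ : Fin n → ℤ) (k : Fin n)
    (c : MvPolynomial (Fin n) K) :
    act f γ (c * pdV A V k)
      = ∑ j ∈ rowsIn A V, (A j k : K) • act f (γ + Pi.single k 1 - row A j) c := by
  rw [pdV, Finset.mul_sum, map_sum]
  refine Finset.sum_congr rfl fun j _ => ?_
  by_cases hjk : A j k = 0
  · simp [hjk]
  induction c using MvPolynomial.induction_on' with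
  | monomial m a =>
    rw [MvPolynomial.monomial_mul, act_monomial, act_monomial, smul_smul, mul_comm]
    congr 2
    have hle : Finsupp.single k 1 ≤ frow A j := by
      rw [Finsupp.single_le_iff]; simpa [frow] using Nat.one_le_iff_ne_zero.2 hjk
    have : ivec (frow A j - Finsupp.single k 1) = row A j - Pi.single k 1 := by
      rw [← ivec_frow, eq_sub_iff_add_eq, show (Pi.single k 1 : Fin n → ℤ)
        = ivec (Finsupp.single k 1) by rw [ivec_single]; simp, ← ivec_add,
        tsub_add_cancel_of_le hle]
    rw [ivec_add, this]; abel
  | add p q hp hq => rw [add_mul, map_add, hp, hq, map_add, smul_add]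

theorem phi_iot {i : Fin n} {N : ℕ} {c : Fin n → MvPolynomial (Fin n) K}
    (hc : ∑ k ∈ V, c k * pdV A V k = MvPolynomial.X i ^ N)
    (f : (Fin n → ℤ) → ExtV K (Fin n)) (γ : Fin n → ℤ) :
    phi π A V (iot V i N c f) γ + iot V i N c (phi π A V f) γ = π • f γ := by
  have h1 : phi π A V (iot V i N c f) γ = ∑ k ∈ V, ∑ j ∈ rowsIn A V, EA K π A j
      (contrE K k (act f (γ + Pi.single k 1 + Pi.single i (N : ℤ) - row A j) (c k))) := by
    rw [phi_apply, Finset.sum_comm]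
    refine Finset.sum_congr rfl fun j _ => ?_
    rw [iot, map_sum]
    refine Finset.sum_congr rfl fun k _ => ?_
    congr 4; abel
  have h2 : iot V i N c (phi π A V f) γ = ∑ k ∈ V, ∑ j ∈ rowsIn A V, contrE K k (EA K π A j
      (act f (γ + Pi.single k 1 + Pi.single i (N : ℤ) - row A j) (c k))) := by
    rw [iot]
    refine Finset.sum_congr rfl fun k _ => ?_
    rw [act_phi, map_sum]
  rw [h1, h2, ← Finset.sum_add_distrib]
  simp only [← Finset.sum_add_distrib, EA_contrE]
  have h3 : ∀ k ∈ V, ∑ j ∈ rowsIn A V, (π * (A j k : K)) •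
      act f (γ + Pi.single k 1 + Pi.single i (N : ℤ) - row A j) (c k)
      = π • act f (γ + Pi.single i (N : ℤ)) (c k * pdV A V k) := fun k _ => by
    rw [act_mul_pdV, Finset.smul_sum]
    refine Finset.sum_congr rfl fun j _ => ?_
    rw [smul_smul, add_right_comm γ]
  rw [Finset.sum_congr rfl h3, ← Finset.smul_sum, ← map_sum, hc, MvPolynomial.X_pow_eq_monomial,
    act_monomial, ivec_single, add_sub_cancel_right, one_smul]

end Koszul

section LocalCohomology

variable {K : Type} [Field K] [CharZero K] {n : ℕ} {π : K} {A : Matrix (Fin n) (Fin n) ℕ}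
  {V : Finset (Fin n)}

/-- The exponent of a form in terms of coordinate differentials. -/
def dl (γ : Fin n → ℤ) (S : Finset (Fin n)) (k : Fin n) : ℤ := γ k - if k ∈ S then 1 else 0

/-- The function is supported on a set of basis forms. -/
def On (P : (Fin n → ℤ) → Finset (Fin n) → Prop) (f : (Fin n → ℤ) → ExtV K (Fin n)) : Prop :=
  ∀ γ S, f γ S ≠ 0 → P γ S

/-- The projection onto a set of basis forms. -/
noncomputable def pr (P : (Fin n → ℤ) → Finset (Fin n) → Prop)
    (f : (Fin n → ℤ) → ExtV K (Fin n)) : (Fin n → ℤ) → ExtV K (Fin n) :=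
  fun γ S => if P γ S then f γ S else 0

/-- Nonnegative exponents outside `T`. -/
def PosOut (V T : Finset (Fin n)) (γ : Fin n → ℤ) (S : Finset (Fin n)) : Prop :=
  ∀ k ∈ V, k ∉ T → 0 ≤ dl γ S k

/-- Negative exponents on `T`. -/
def NegOn (T : Finset (Fin n)) (γ : Fin n → ℤ) (S : Finset (Fin n)) : Prop :=
  ∀ k ∈ T, dl γ S k < 0

/-- Sets of basis forms stable under the Koszul differential in both directions. -/
def Inv (A : Matrix (Fin n) (Fin n) ℕ) (V : Finset (Fin n))
    (W : (Fin n → ℤ) → Finset (Fin n) → Prop) : Prop :=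
  ∀ γ S, ∀ j ∈ rowsIn A V, ∀ k ∈ S, A j k ≠ 0 → (W (γ - row A j) (S.erase k) ↔ W γ S)

theorem On.mono {P P' : (Fin n → ℤ) → Finset (Fin n) → Prop}
    {f : (Fin n → ℤ) → ExtV K (Fin n)} (h : On P f) (h' : ∀ γ S, P γ S → P' γ S) : On P' f :=
  fun γ S hf => h' γ S (h γ S hf)

theorem On.sub {P : (Fin n → ℤ) → Finset (Fin n) → Prop}
    {f g : (Fin n → ℤ) → ExtV K (Fin n)} (hf : On P f) (hg : On P g) : On P (f - g) := by
  intro γ S h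
  by_cases h1 : f γ S = 0
  · refine hg γ S fun h2 => h ?_
    rw [Pi.sub_apply, Pi.sub_apply, h1, h2, sub_zero]
  · exact hf γ S h1

theorem On.smul {P : (Fin n → ℤ) → Finset (Fin n) → Prop}
    {f : (Fin n → ℤ) → ExtV K (Fin n)} (hf : On P f) (a : K) : On P (a • f) :=
  fun γ S h => hf γ S (right_ne_zero_of_mul h)

theorem On.pr {P P' : (Fin n → ℤ) → Finset (Fin n) → Prop}
    {f : (Fin n → ℤ) → ExtV K (Fin n)} (h : On P f) : On P (pr P' f) := by
  intro γ S h1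
  unfold BH.pr at h1
  split_ifs at h1
  · exact h γ S h1
  · exact absurd rfl h1

theorem on_pr {P : (Fin n → ℤ) → Finset (Fin n) → Prop} (f : (Fin n → ℤ) → ExtV K (Fin n)) :
    On P (pr P f) := by
  intro γ S h1
  unfold BH.pr at h1
  split_ifs at h1 with h2
  · exact h2
  · exact absurd rfl h1

theorem pr_of {P : (Fin n → ℤ) → Finset (Fin n) → Prop} {f : (Fin n → ℤ) → ExtV K (Fin n)}
    {γ : Fin n → ℤ} {S : Finset (Fin n)} (h : P γ S) : pr P f γ S = f γ S := if_pos h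

theorem pr_of_not {P : (Fin n → ℤ) → Finset (Fin n) → Prop}
    {f : (Fin n → ℤ) → ExtV K (Fin n)} {γ : Fin n → ℤ} {S : Finset (Fin n)} (h : ¬ P γ S) :
    pr P f γ S = 0 := if_neg h

theorem pr_add_pr_not (P : (Fin n → ℤ) → Finset (Fin n) → Prop)
    (f : (Fin n → ℤ) → ExtV K (Fin n)) : pr P f + pr (fun γ S => ¬ P γ S) f = f := by
  funext γ S
  by_cases h : P γ S <;> simp [pr, h]

theorem dl_phi {γ : Fin n → ℤ} {S : Finset (Fin n)} {j k : Fin n} (hk : k ∈ S)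
    (hA : A j k ≠ 0) (l : Fin n) : dl (γ - row A j) (S.erase k) l ≤ dl γ S l := by
  have h0 : (0 : ℤ) ≤ row A j l := Int.natCast_nonneg _
  unfold dl
  rcases eq_or_ne l k with rfl | h
  · have h1 : (0 : ℤ) < row A j l := Int.natCast_pos.2 (Nat.pos_of_ne_zero hA)
    simp [hk]; omega
  · simp [h]; omega

theorem dl_iot {γ : Fin n → ℤ} {S : Finset (Fin n)} {k i : Fin n} (hk : k ∉ S) (N : ℕ)
    (m : Fin n →₀ ℕ) {l : Fin n} (hl : l ≠ i) :
    dl (γ + Pi.single k 1 + Pi.single i (N : ℤ) - ivec m) (insert k S) l ≤ dl γ S l := by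
  have h0 : (0 : ℤ) ≤ ivec m l := Int.natCast_nonneg _
  unfold dl
  rcases eq_or_ne l k with rfl | h
  · simp [hk, hl]; omega
  · simp [h, hl]; omega

theorem On.phi_pos {T : Finset (Fin n)} {f : (Fin n → ℤ) → ExtV K (Fin n)}
    (h : On (PosOut V T) f) : On (PosOut V T) (phi π A V f) := by
  intro γ S hS
  obtain ⟨j, -, k, hk, hA, h1⟩ := phi_ne π A V hS
  exact fun l hl hlT => (h _ _ h1 l hl hlT).trans (dl_phi hk hA l)

theorem On.phi_card {d : ℤ} {f : (Fin n → ℤ) → ExtV K (Fin n)}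
    (h : On (fun _ S => (S.card : ℤ) = d) f) :
    On (fun _ S => (S.card : ℤ) = d + 1) (phi π A V f) := by
  intro γ S hS
  obtain ⟨j, -, k, hk, -, h1⟩ := phi_ne π A V hS
  rw [← h _ _ h1, ← Finset.card_erase_add_one hk]; push_cast; rfl

theorem On.phi_inv {W : (Fin n → ℤ) → Finset (Fin n) → Prop} (hW : Inv A V W)
    {f : (Fin n → ℤ) → ExtV K (Fin n)} (h : On W f) : On W (phi π A V f) := by
  intro γ S hS
  obtain ⟨j, hj, k, hk, hA, h1⟩ := phi_ne π A V hS
  exact (hW γ S j hj k hk hA).1 (h _ _ h1)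

theorem phi_van_neg {T : Finset (Fin n)} {f : (Fin n → ℤ) → ExtV K (Fin n)}
    (h : ∀ γ S, NegOn T γ S → f γ S = 0) (γ : Fin n → ℤ) (S : Finset (Fin n))
    (hT : NegOn T γ S) : phi π A V f γ S = 0 := by
  by_contra hS
  obtain ⟨j, -, k, hk, hA, h1⟩ := phi_ne π A V hS
  exact h1 (h _ _ fun l hl => (dl_phi hk hA l).trans_lt (hT l hl))

theorem phi_congr_neg {T : Finset (Fin n)} {f g : (Fin n → ℤ) → ExtV K (Fin n)}
    (h : ∀ γ S, NegOn T γ S → f γ S = g γ S) {γ : Fin n → ℤ} {S : Finset (Fin n)}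
    (hT : NegOn T γ S) : phi π A V f γ S = phi π A V g γ S := by
  have := phi_van_neg (π := π) (A := A) (V := V) (f := f - g) (T := T)
    (fun γ S hS => by rw [Pi.sub_apply, Pi.sub_apply, h γ S hS, sub_self]) γ S hT
  rwa [map_sub, Pi.sub_apply, Pi.sub_apply, sub_eq_zero] at this

theorem phi_pr {W : (Fin n → ℤ) → Finset (Fin n) → Prop} (hW : Inv A V W)
    (f : (Fin n → ℤ) → ExtV K (Fin n)) : phi π A V (pr W f) = pr W (phi π A V f) := by
  have hW' : Inv A V fun γ S => ¬ W γ S :=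
    fun γ S j hj k hk hA => not_congr (hW γ S j hj k hk hA)
  funext γ S
  by_cases h : W γ S
  · rw [pr_of h]
    conv_rhs => rw [← pr_add_pr_not W f, map_add]
    rw [Pi.add_apply, Pi.add_apply]
    have : phi π A V (pr (fun γ S => ¬ W γ S) f) γ S = 0 := by
      by_contra h1
      exact (on_pr (P := fun γ S => ¬ W γ S) f).phi_inv hW' γ S h1 h
    rw [this, add_zero]
  · rw [pr_of_not h]
    by_contra h1
    exact h ((on_pr f).phi_inv hW γ S h1)

theorem On.iot_pos {T : Finset (Fin n)} {f : (Fin n → ℤ) → ExtV K (Fin n)} {i : Fin n} {N : ℕ}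
    {c : Fin n → MvPolynomial (Fin n) K} (h : On (PosOut V T) f) :
    On (PosOut V (insert i T)) (iot V i N c f) := by
  intro γ S hS
  obtain ⟨k, -, hk, m, h1⟩ := iot_ne V hS
  intro l hl hlT
  rw [Finset.mem_insert, not_or] at hlT
  exact (h _ _ h1 l hl hlT.2).trans (dl_iot hk N m hlT.1)

theorem On.iot_card {d : ℤ} {f : (Fin n → ℤ) → ExtV K (Fin n)} {i : Fin n} {N : ℕ}
    {c : Fin n → MvPolynomial (Fin n) K} (h : On (fun _ S => (S.card : ℤ) = d) f) :
    On (fun _ S => (S.card : ℤ) = d - 1) (iot V i N c f) := by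
  intro γ S hS
  obtain ⟨k, -, hk, m, h1⟩ := iot_ne V hS
  have := h _ _ h1
  simp only at this
  rw [Finset.card_insert_of_notMem hk] at this
  push_cast at this
  linarith

theorem iot_van_neg {T : Finset (Fin n)} {f : (Fin n → ℤ) → ExtV K (Fin n)} {i : Fin n} {N : ℕ}
    {c : Fin n → MvPolynomial (Fin n) K} (hi : i ∉ T)
    (h : ∀ γ S, NegOn T γ S → f γ S = 0) (γ : Fin n → ℤ) (S : Finset (Fin n))
    (hT : NegOn T γ S) : iot V i N c f γ S = 0 := by
  by_contra hS
  obtain ⟨k, -, hk, m, h1⟩ := iot_ne V hS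
  exact h1 (h _ _ fun l hl => (dl_iot hk N m (ne_of_mem_of_not_mem hl hi)).trans_lt (hT l hl))

variable (π A V) in
/-- Exactness in degree `d` of the part of the local cohomology complex attached to `T`. -/
def LCExact (W : (Fin n → ℤ) → Finset (Fin n) → Prop) (T : Finset (Fin n)) (d : ℤ) : Prop :=
  ∀ ω : (Fin n → ℤ) → ExtV K (Fin n), On (PosOut V T) ω → On (fun γ S => NegOn T γ S) ω →
    On W ω → On (fun _ S => (S.card : ℤ) = d) ω →
    (∀ γ S, NegOn T γ S → phi π A V ω γ S = 0) →
    ∃ η : (Fin n → ℤ) → ExtV K (Fin n), On (PosOut V T) η ∧ On (fun γ S => NegOn T γ S) η ∧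
      On W η ∧ On (fun _ S => (S.card : ℤ) = d - 1) η ∧
      ∀ γ S, NegOn T γ S → phi π A V η γ S = ω γ S

theorem LCExact.of_insert (hπ : π ≠ 0) (hreg : KosReg K A V)
    {W : (Fin n → ℤ) → Finset (Fin n) → Prop} (hW : Inv A V W) {T : Finset (Fin n)} {i : Fin n}
    (hiV : i ∈ V) (hi : i ∉ T) {d : ℤ} (h : LCExact π A V W (insert i T) (d - 1)) :
    LCExact π A V W T d := by
  intro ω hpos hneg hω hd hz
  obtain ⟨N, c, hc⟩ := hreg i hiV
  set η0 := π⁻¹ • iot V i N c ω with hη0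
  have h0 : ∀ γ S, NegOn T γ S → phi π A V η0 γ S = ω γ S := by
    intro γ S hS
    have h1 := congrFun (phi_iot π A V hc ω γ) S
    rw [Pi.add_apply, iot_van_neg hi hz γ S hS, add_zero] at h1
    rw [hη0, map_smul, Pi.smul_apply, Pi.smul_apply, h1, Pi.smul_apply,
      inv_smul_smul₀ hπ]
  set η1 := pr (NegOn T) (pr W η0) with hη1
  have p1 : On (PosOut V (insert i T)) η1 := ((hpos.iot_pos).smul _).pr.pr
  have d1 : On (fun _ S => (S.card : ℤ) = d - 1) η1 := ((hd.iot_card).smul _).pr.pr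
  have w1 : On W η1 := (on_pr η0).pr
  have n1 : On (NegOn T) η1 := on_pr _
  have e1 : ∀ γ S, NegOn T γ S → phi π A V η1 γ S = ω γ S := by
    intro γ S hS
    rw [phi_congr_neg (g := pr W η0) (fun γ S h => pr_of h) hS, phi_pr hW]
    by_cases hWS : W γ S
    · rw [pr_of hWS, h0 γ S hS]
    · rw [pr_of_not hWS]
      by_contra h2; exact hWS (hω γ S (Ne.symm h2))
  set ηn := pr (fun γ S => dl γ S i < 0) η1 with hηn
  set ηp := pr (fun γ S => ¬ dl γ S i < 0) η1 with hηp
  have hsum : ηn + ηp = η1 := pr_add_pr_not _ _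
  have pp : On (PosOut V T) ηp := by
    intro γ S hS l hl hlT
    rcases eq_or_ne l i with rfl | hne
    · exact not_lt.1 ((on_pr η1 : On (fun γ S => ¬ dl γ S l < 0) _) γ S hS)
    · exact (p1.pr : On _ ηp) γ S hS l hl (by simp [hne, hlT])
  have nn : On (NegOn (insert i T)) ηn := by
    intro γ S hS l hl
    rcases Finset.mem_insert.1 hl with rfl | hl
    · exact (on_pr η1 : On (fun γ S => dl γ S l < 0) _) γ S hS
    · exact (n1.pr : On _ ηn) γ S hS l hl
  have hlt : ∀ {γ S}, NegOn (insert i T) γ S → NegOn T γ S ∧ dl γ S i < 0 := fun h =>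
    ⟨fun l hl => h l (Finset.mem_insert_of_mem hl), h i (Finset.mem_insert_self _ _)⟩
  have vanP : ∀ {f : (Fin n → ℤ) → ExtV K (Fin n)}, On (PosOut V T) f → ∀ {γ S},
      NegOn (insert i T) γ S → f γ S = 0 := by
    intro f hf γ S hS
    by_contra h2
    have := hf γ S h2 i hiV hi
    linarith [(hlt hS).2]
  obtain ⟨ξ, q1, q2, q3, q4, q5⟩ := h ηn p1.pr nn w1.pr d1.pr (by
    intro γ S hS
    have : ηn = η1 - ηp := by rw [← hsum, add_sub_cancel_right]
    rw [this, map_sub, Pi.sub_apply, Pi.sub_apply, e1 γ S (hlt hS).1, vanP hpos hS,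
      vanP pp.phi_pos hS, sub_zero])
  refine ⟨pr (NegOn T) (η1 - phi π A V ξ), ?_, on_pr _, (w1.sub (q3.phi_inv hW)).pr,
    (d1.sub ?_).pr, ?_⟩
  · intro γ S hS l hl hlT
    have hN := (on_pr _ : On (NegOn T) _) γ S hS
    rw [pr_of hN] at hS
    rcases eq_or_ne l i with rfl | hne
    · by_contra hlt'
      rw [not_le] at hlt'
      have hN' : NegOn (insert l T) γ S := by
        intro k hk
        rcases Finset.mem_insert.1 hk with rfl | hk
        · exact hlt'
        · exact hN k hk
      apply hS
      rw [← hsum, Pi.sub_apply, Pi.sub_apply, q5 γ S hN', Pi.add_apply, Pi.add_apply,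
        vanP pp hN', add_zero, sub_self]
    · exact (p1.sub q1.phi_pos) γ S hS l hl (by simp [hne, hlT])
  · have := q4.phi_card (π := π) (A := A) (V := V)
    rwa [sub_add_cancel] at this
  · intro γ S hS
    rw [phi_congr_neg (g := η1 - phi π A V ξ) (fun γ S h => pr_of h) hS, map_sub, phi_phi,
      sub_zero, e1 γ S hS]

theorem LCExact.of_union (hπ : π ≠ 0) (hreg : KosReg K A V)
    {W : (Fin n → ℤ) → Finset (Fin n) → Prop} (hW : Inv A V W) (U : Finset (Fin n)) :
    ∀ (T : Finset (Fin n)) (d : ℤ), Disjoint T U → U ⊆ V →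
      LCExact π A V W (T ∪ U) (d - U.card) → LCExact π A V W T d := by
  induction U using Finset.induction_on with
  | empty => intro T d _ _ h; simpa using h
  | insert i U hi ih =>
    intro T d hdis hU h
    rw [Finset.disjoint_insert_right] at hdis
    refine LCExact.of_insert hπ hreg hW (hU (Finset.mem_insert_self _ _)) hdis.1
      (ih (insert i T) (d - 1) ?_ ((Finset.subset_insert _ _).trans hU) ?_)
    · rw [Finset.disjoint_insert_left]; exact ⟨hi, hdis.2⟩
    · rw [Finset.card_insert_of_notMem hi] at h
      rw [Finset.insert_union, ← Finset.union_insert]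
      convert h using 1; push_cast; ring

theorem LCExact.of_top (hπ : π ≠ 0) (hreg : KosReg K A V)
    {W : (Fin n → ℤ) → Finset (Fin n) → Prop} (hW : Inv A V W) {d : ℤ}
    (h : LCExact π A V W V (d - V.card)) : LCExact π A V W ∅ d :=
  LCExact.of_union hπ hreg hW V ∅ d (Finset.disjoint_empty_left V) subset_rfl (by simpa using h)

theorem LCExact.of_lt (hπ : π ≠ 0) (hreg : KosReg K A V)
    {W : (Fin n → ℤ) → Finset (Fin n) → Prop} (hW : Inv A V W) {d : ℤ} (hd : d < V.card) :
    LCExact π A V W ∅ d := by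
  refine LCExact.of_top hπ hreg hW fun ω _ _ _ h _ => ?_
  have : ω = 0 := by
    funext γ S
    by_contra h1
    have := h γ S h1
    have := S.card.cast_nonneg (α := ℤ)
    linarith
  subst this
  have h0 : ∀ P : (Fin n → ℤ) → Finset (Fin n) → Prop,
      On P (0 : (Fin n → ℤ) → ExtV K (Fin n)) := fun P γ S h => absurd rfl h
  exact ⟨0, h0 _, h0 _, h0 _, h0 _, fun γ S _ => by rw [map_zero]⟩

end LocalCohomology

section Homogeneous

variable {K : Type} [Field K] [CharZero K] {n : ℕ} {π : K} {A : Matrix (Fin n) (Fin n) ℕ}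
  {V : Finset (Fin n)}

variable (A) in
/-- The sum of the coordinates. -/
noncomputable def sa : (Fin n → ℤ) →+ ℚ := ∑ j, crd A j

theorem sa_apply (γ : Fin n → ℤ) : sa A γ = ∑ j, crd A j γ := by
  simp [sa]

theorem sa_row (hA : (Aq A).det ≠ 0) (i : Fin n) : sa A (row A i) = 1 := by
  simp [sa_apply, crd_row hA]

variable (A) in
/-- The existence of positive weights for which `W_A` is homogeneous. -/
def HasWeights : Prop := ∃ q : Fin n → ℚ, (∀ j, 0 < q j) ∧ ∀ i, (∑ j, (A i j : ℚ) * q j) = 1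

theorem finite_sa_le (hA : (Aq A).det ≠ 0) (hq : HasWeights A) (M : ℚ) :
    {γ : Fin n → ℤ | (∀ k, 0 ≤ γ k) ∧ sa A γ ≤ M}.Finite := by
  obtain ⟨q, hq0, hq1⟩ := hq
  refine (Set.finite_Icc (0 : Fin n → ℤ) fun k => ⌈M / q k⌉).subset ?_
  rintro γ ⟨h0, h1⟩
  refine ⟨h0, fun k => ?_⟩
  have h2 : sa A γ = ∑ k, (γ k : ℚ) * q k := by
    simp only [← sum_crd_mul hA γ, Finset.sum_mul]
    rw [Finset.sum_comm, sa_apply]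
    refine Finset.sum_congr rfl fun j _ => ?_
    simp only [mul_assoc]
    rw [← Finset.mul_sum, hq1, mul_one]
  have h3 : (γ k : ℚ) * q k ≤ M := by
    refine le_trans ?_ (h2 ▸ h1)
    exact Finset.single_le_sum (f := fun k => (γ k : ℚ) * q k)
      (fun i _ => mul_nonneg (by exact_mod_cast h0 i) (hq0 i).le) (Finset.mem_univ k)
  have : (γ k : ℚ) ≤ M / q k := by rwa [le_div_iff₀ (hq0 k)]
  exact_mod_cast this.trans (Int.le_ceil _)

variable (A) in
/-- Congruence modulo the lattice generated by the rows of `A`. -/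
def Cls (γ γ' : Fin n → ℤ) : Prop := ∀ j, ∃ z : ℤ, crd A j γ = crd A j γ' + z

theorem Cls.refl (γ : Fin n → ℤ) : Cls A γ γ := fun _ => ⟨0, by simp⟩

theorem Cls.symm {γ γ' : Fin n → ℤ} (h : Cls A γ γ') : Cls A γ' γ := fun j => by
  obtain ⟨z, hz⟩ := h j
  exact ⟨-z, by rw [hz]; push_cast; ring⟩

theorem Cls.trans {γ γ' γ'' : Fin n → ℤ} (h : Cls A γ γ') (h' : Cls A γ' γ'') :
    Cls A γ γ'' := fun j => by
  obtain ⟨z, hz⟩ := h j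
  obtain ⟨z', hz'⟩ := h' j
  exact ⟨z' + z, by rw [hz, hz']; push_cast; ring⟩

theorem Cls.neg {γ γ' : Fin n → ℤ} (h : Cls A γ γ') : Cls A (-γ) (-γ') := fun j => by
  obtain ⟨z, hz⟩ := h j
  exact ⟨-z, by rw [map_neg, map_neg, hz]; push_cast; ring⟩

theorem cls_sub_row (hA : (Aq A).det ≠ 0) (γ : Fin n → ℤ) (i : Fin n) :
    Cls A (γ - row A i) γ := fun j => by
  refine ⟨if j = i then -1 else 0, ?_⟩
  rw [map_sub, crd_row hA]
  split_ifs <;> push_cast <;> ring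

theorem inv_cls (hA : (Aq A).det ≠ 0) (γ0 : Fin n → ℤ) : Inv A V fun γ _ => Cls A γ γ0 :=
  fun γ _ j _ _ _ _ => ⟨fun h => (cls_sub_row hA γ j).symm.trans h,
    fun h => (cls_sub_row hA γ j).trans h⟩

theorem inv_sa (hA : (Aq A).det ≠ 0) (s : ℚ) :
    Inv A V fun γ S => sa A γ - S.card = s := by
  intro γ S j _ k hk _
  simp only
  rw [map_sub, sa_row hA, ← Finset.card_erase_add_one hk]
  push_cast
  constructor <;> intro h <;> linarith

theorem Inv.and {W W' : (Fin n → ℤ) → Finset (Fin n) → Prop} (h : Inv A V W)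
    (h' : Inv A V W') : Inv A V fun γ S => W γ S ∧ W' γ S :=
  fun γ S j hj k hk hA => and_congr (h γ S j hj k hk hA) (h' γ S j hj k hk hA)

theorem inv_out : Inv A V fun γ S => (∀ k, k ∉ V → γ k = 0) ∧ S ⊆ V := by
  intro γ S j hj k hk hA
  have hr := (mem_rowsIn A V).1 hj
  have hkV : k ∈ V := by by_contra h; exact hA (hr k h)
  refine and_congr (forall_congr' fun l => imp_congr_right fun hl => ?_) ?_
  · rw [Pi.sub_apply, row, hr l hl]; simp
  · rw [← Finset.subset_insert_iff, Finset.insert_eq_of_mem hkV]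

theorem RS_iff {γ : Fin n → ℤ} {S : Finset (Fin n)} : RS V γ S ↔
    PosOut V ∅ γ S ∧ (∀ k, k ∉ V → γ k = 0) ∧ S ⊆ V := by
  constructor
  · rintro ⟨h1, h2, h3, h4⟩
    refine ⟨fun k _ _ => ?_, h2, h3⟩
    unfold dl
    split_ifs with hk
    · have := h4 k hk; omega
    · have := h1 k; omega
  · rintro ⟨h1, h2, h3⟩
    have h4 : ∀ k ∈ V, (if k ∈ S then 1 else 0) ≤ γ k := fun k hk => by
      have := h1 k hk (Finset.notMem_empty k)
      unfold dl at this
      linarith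
    refine ⟨fun k => ?_, h2, h3, fun k hk => ?_⟩
    · by_cases hk : k ∈ V
      · refine le_trans ?_ (h4 k hk); split_ifs <;> simp
      · rw [h2 k hk]
    · have := h4 k (h3 hk)
      rw [if_pos hk] at this; omega

theorem LCExact.exists_eq {W : (Fin n → ℤ) → Finset (Fin n) → Prop} {d : ℤ}
    (hE : LCExact π A V (fun γ S => W γ S ∧ (∀ k, k ∉ V → γ k = 0) ∧ S ⊆ V) ∅ d)
    {H : (Fin n → ℤ) → ExtV K (Fin n)} (hH : RSupp V H) (hHd : On (fun _ S => (S.card : ℤ) = d) H)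
    (hHW : On W H) (h0 : phi π A V H = 0) :
    ∃ η, RSupp V η ∧ On (fun _ S => (S.card : ℤ) = d - 1) η ∧ On W η ∧ phi π A V η = H := by
  have hN : ∀ γ S, NegOn (∅ : Finset (Fin n)) γ S := fun γ S k hk => absurd hk (by simp)
  obtain ⟨η, h1, -, h3, h4, h5⟩ := hE H (fun γ S h => (RS_iff.1 (hH γ S h)).1)
    (fun γ S _ => hN γ S) (fun γ S h => ⟨hHW γ S h, (RS_iff.1 (hH γ S h)).2⟩) hHd
    (fun γ S _ => by rw [h0]; rfl)
  refine ⟨η, fun γ S h => RS_iff.2 ⟨h1 γ S h, (h3 γ S h).2⟩, h4, h3.mono fun γ S h => h.1, ?_⟩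
  funext γ S
  exact h5 γ S (hN γ S)

theorem phi_exact (hπ : π ≠ 0) (hreg : KosReg K A V) {W : (Fin n → ℤ) → Finset (Fin n) → Prop}
    (hW : Inv A V W) {d : ℤ} (hd : d < V.card) {H : (Fin n → ℤ) → ExtV K (Fin n)}
    (hH : RSupp V H) (hHd : On (fun _ S => (S.card : ℤ) = d) H)
    (hHW : On W H) (h0 : phi π A V H = 0) :
    ∃ η, RSupp V η ∧ On (fun _ S => (S.card : ℤ) = d - 1) η ∧ On W η ∧ phi π A V η = H :=
  (LCExact.of_lt hπ hreg (hW.and inv_out) hd).exists_eq hH hHd hHW h0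

/-- The monomial top form `x^γ e_V`. -/
noncomputable def topf (K : Type) [Field K] {n : ℕ} (V : Finset (Fin n)) (γ : Fin n → ℤ) :
    (Fin n → ℤ) → ExtV K (Fin n) := Pi.single γ (Pi.single V 1)

theorem topf_ne {γ μ : Fin n → ℤ} {S : Finset (Fin n)} (h : topf K V γ μ S ≠ 0) :
    μ = γ ∧ S = V := by
  unfold topf at h
  rcases eq_or_ne μ γ with rfl | h1
  · refine ⟨rfl, ?_⟩
    rw [Pi.single_eq_same] at h
    by_contra h2
    exact h (Pi.single_eq_of_ne h2 _)
  · rw [Pi.single_eq_of_ne h1] at h; exact absurd rfl h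

/-- The exponents of top forms. -/
def Top (V : Finset (Fin n)) (γ : Fin n → ℤ) : Prop :=
  (∀ k, k ∉ V → γ k = 0) ∧ ∀ k ∈ V, 0 < γ k

theorem Top.RS {γ : Fin n → ℤ} (h : Top V γ) : RS V γ V :=
  ⟨fun k => by
    by_cases hk : k ∈ V
    · exact (h.2 k hk).le
    · rw [h.1 k hk], h.1, subset_rfl, h.2⟩

theorem rsupp_topf {γ : Fin n → ℤ} (h : Top V γ) : RSupp V (topf K V γ) := by
  intro μ S hS
  obtain ⟨rfl, rfl⟩ := topf_ne hS
  exact h.RS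

theorem pairing_phi {ω η : (Fin n → ℤ) → ExtV K (Fin n)} (hη : {γ | η γ ≠ 0}.Finite)
    (h : ∀ μ, ∀ k ∈ V, η μ (V.erase k) ≠ 0 → phi π A V ω (-μ) {k} = 0) :
    ∑ᶠ μ, ω (-μ) ∅ * phi π A V η μ V = 0 := by
  set sg : Fin n → K := fun k => (-1) ^ (V.filter (· < k)).card with hsg
  have e1 : ∀ μ, ω (-μ) ∅ * phi π A V η μ V = ∑ k ∈ V, ∑ j ∈ rowsIn A V,
      π * A j k * sg k * (ω (-μ) ∅ * η (μ - row A j) (V.erase k)) := by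
    intro μ
    rw [phi_apply, Finset.sum_apply, Finset.sum_comm, Finset.mul_sum]
    refine Finset.sum_congr rfl fun j _ => ?_
    rw [EA_apply, Pi.smul_apply, Finset.sum_apply, smul_eq_mul, Finset.mul_sum, Finset.mul_sum,
      ← Finset.sum_subset (Finset.subset_univ V)]
    · refine Finset.sum_congr rfl fun k hk => ?_
      rw [Pi.smul_apply, mulE_apply, if_pos hk, smul_eq_mul]; ring
    · intro k _ hk
      rw [Pi.smul_apply, mulE_apply, if_neg hk]; simp
  have e2 : ∀ μ, ∀ k, phi π A V ω (-μ) {k}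
      = ∑ j ∈ rowsIn A V, π * A j k * ω (-(μ + row A j)) ∅ := by
    intro μ k
    rw [phi_apply, Finset.sum_apply]
    refine Finset.sum_congr rfl fun j _ => ?_
    rw [EA_apply, Pi.smul_apply, Finset.sum_apply, Finset.sum_eq_single k, Pi.smul_apply,
      mulE_apply, if_pos (Finset.mem_singleton_self k), neg_add, sub_eq_add_neg]
    · have : ({k} : Finset (Fin n)).filter (· < k) = ∅ := by
        ext x; simp only [Finset.mem_filter, Finset.mem_singleton, Finset.notMem_empty, iff_false]
        rintro ⟨rfl, h⟩; exact lt_irrefl _ h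
      rw [this]; simp [mul_assoc]
    · intro l _ hl
      rw [Pi.smul_apply, mulE_apply, if_neg (by simpa using hl)]; simp
    · simp
  have fin : ∀ (k j : Fin n) (c : K), (Function.support fun μ =>
      c * (ω (-μ) ∅ * η (μ - row A j) (V.erase k))).Finite := by
    intro k j c
    refine (hη.image (· + row A j)).subset fun μ hμ => ⟨μ - row A j, fun h0 => hμ ?_, by simp⟩
    simp only; rw [h0]; simp
  have fin' : ∀ (k j : Fin n) (c : K), (Function.support fun μ =>
      c * (ω (-(μ + row A j)) ∅ * η μ (V.erase k))).Finite := by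
    intro k j c
    refine hη.subset fun μ hμ h0 => hμ ?_
    simp only; rw [h0]; simp
  simp only [e1]
  rw [finsum_sum_comm]
  swap
  · intro k _
    refine (Set.Finite.biUnion (rowsIn A V).finite_toSet fun j _ =>
      fin k j (π * A j k * sg k)).subset ?_
    intro μ hμ
    obtain ⟨j, hj, h1⟩ := Finset.exists_ne_zero_of_sum_ne_zero hμ
    exact Set.mem_biUnion hj h1
  refine Finset.sum_eq_zero fun k hk => ?_
  rw [finsum_sum_comm _ _ fun j _ => fin k j _]
  have e3 : ∀ j, ∑ᶠ μ, π * A j k * sg k * (ω (-μ) ∅ * η (μ - row A j) (V.erase k))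
      = ∑ᶠ μ, π * A j k * sg k * (ω (-(μ + row A j)) ∅ * η μ (V.erase k)) := by
    intro j
    rw [← finsum_comp_equiv (Equiv.addRight (row A j))]
    simp
  simp only [e3]
  rw [← finsum_sum_comm _ _ fun j _ => fin' k j _]
  rw [finsum_eq_zero_of_forall_eq_zero]
  intro μ
  have : ∑ j ∈ rowsIn A V, π * A j k * sg k * (ω (-(μ + row A j)) ∅ * η μ (V.erase k))
      = sg k * η μ (V.erase k) * phi π A V ω (-μ) {k} := by
    rw [e2, Finset.mul_sum]
    exact Finset.sum_congr rfl fun j _ => by ring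
  rw [this]
  by_cases h0 : η μ (V.erase k) = 0
  · rw [h0]; simp
  · rw [h μ k hk h0, mul_zero]

theorem topf_exact_of_dual (hA : (Aq A).det ≠ 0) (hπ : π ≠ 0) (hreg : KosReg K A V)
    {γ : Fin n → ℤ} (hγ : Top V γ)
    (hdual : ∀ γ', Top V γ' → Cls A γ' (-γ) → sa A γ' = V.card - sa A γ →
      ∃ η, RSupp V η ∧ {μ | η μ ≠ 0}.Finite ∧ phi π A V η = topf K V γ') :
    ∃ η, RSupp V η ∧ phi π A V η = topf K V γ := by
  set W : (Fin n → ℤ) → Finset (Fin n) → Prop := fun γ1 S =>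
    Cls A γ1 γ ∧ sa A γ1 - S.card = sa A γ - V.card with hWdef
  have hW : Inv A V W := (inv_cls hA γ).and (inv_sa hA _)
  have hE : LCExact π A V (fun γ S => W γ S ∧ (∀ k, k ∉ V → γ k = 0) ∧ S ⊆ V) ∅ V.card := by
    refine LCExact.of_top hπ hreg (hW.and inv_out) fun ω _ hneg hωW hd hz => ?_
    have : ω = 0 := by
      funext γ1 S
      by_contra h1
      have hS : S = ∅ := by simpa using hd γ1 S h1
      subst hS
      obtain ⟨⟨hc, hs⟩, ho, -⟩ := hωW γ1 ∅ h1
      obtain ⟨η, g1, g2, g3⟩ := hdual (-γ1)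
        ⟨fun k hk => by rw [Pi.neg_apply, ho k hk, neg_zero], fun k hk => by
          have := hneg γ1 ∅ h1 k hk
          simp only [dl, Finset.notMem_empty, if_false] at this
          rw [Pi.neg_apply]; linarith⟩ hc.neg (by
          rw [map_neg]; simp at hs; linarith)
      have hp := pairing_phi (π := π) (A := A) (V := V) (ω := ω) g2 (by
        intro μ k hk hne
        refine hz _ _ fun l hl => ?_
        have hRS := g1 μ _ hne
        unfold dl
        rw [Pi.neg_apply]
        rcases eq_or_ne l k with rfl | hlk
        · have := hRS.1 l; simp; omega
        · have := hRS.2.2.2 l (Finset.mem_erase.2 ⟨hlk, hl⟩)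
          simp [hlk]; omega)
      rw [g3, finsum_eq_single _ (-γ1)] at hp
      · rw [neg_neg] at hp
        simp only [topf, Pi.single_eq_same, mul_one] at hp
        exact h1 hp
      · intro μ hμ
        rw [topf, Pi.single_eq_of_ne hμ]; simp
    subst this
    have h0 : ∀ P : (Fin n → ℤ) → Finset (Fin n) → Prop,
        On P (0 : (Fin n → ℤ) → ExtV K (Fin n)) := fun P γ S h => absurd rfl h
    exact ⟨0, h0 _, h0 _, h0 _, h0 _, fun γ S _ => by rw [map_zero]⟩
  obtain ⟨η, h1, -, -, h4⟩ := hE.exists_eq (H := topf K V γ) (rsupp_topf hγ)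
    (fun μ S h => by rw [(topf_ne h).2])
    (fun μ S h => by obtain ⟨rfl, rfl⟩ := topf_ne h; exact ⟨Cls.refl _, rfl⟩) (by
      funext μ S
      by_contra h
      obtain ⟨j, hj, k, hk, hAk, h1⟩ := phi_ne π A V h
      have h2 := (topf_ne h1).2
      have h3 : k ∈ V := by by_contra h3; exact hAk ((mem_rowsIn A V).1 hj k h3)
      rw [← h2] at h3; simp at h3)
  exact ⟨η, h1, h4⟩

end Homogeneous

section Admissible

variable {K : Type} [Field K] [CharZero K] {n : ℕ} {π : K} {A : Matrix (Fin n) (Fin n) ℕ}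
  {V : Finset (Fin n)}

/-- Finitely supported allowed forms of degree `d` with exponents in `C`. -/
structure Adm (V : Finset (Fin n)) (C : (Fin n → ℤ) → Prop) (d : ℤ)
    (H : (Fin n → ℤ) → ExtV K (Fin n)) : Prop where
  rsupp : RSupp V H
  fin : {γ | H γ ≠ 0}.Finite
  card : On (fun _ S => (S.card : ℤ) = d) H
  cls : ∀ γ, H γ ≠ 0 → C γ

variable (A) in
/-- Sets of exponents stable under translation by the rows. -/
def RowInv (C : (Fin n → ℤ) → Prop) : Prop := ∀ γ j, C (γ - row A j) ↔ C γ

theorem rowInv_cls (hA : (Aq A).det ≠ 0) (γ0 : Fin n → ℤ) :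
    RowInv A fun γ => Cls A γ γ0 :=
  fun γ j => ⟨fun h => (cls_sub_row hA γ j).symm.trans h, fun h => (cls_sub_row hA γ j).trans h⟩

variable {C : (Fin n → ℤ) → Prop} {d : ℤ}

theorem Adm.zero : Adm V C d (0 : (Fin n → ℤ) → ExtV K (Fin n)) where
  rsupp γ := (formsOn K _).zero_mem
  fin := by simp
  card _ _ h := absurd rfl h
  cls _ h := absurd rfl h

theorem Adm.sub {H G : (Fin n → ℤ) → ExtV K (Fin n)} (hH : Adm V C d H) (hG : Adm V C d G) :
    Adm V C d (H - G) where
  rsupp γ := (formsOn K _).sub_mem (hH.rsupp γ) (hG.rsupp γ)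
  fin := (hH.fin.union hG.fin).subset fun γ h => by
    by_contra h1
    simp only [Set.mem_union, Set.mem_ofPred_eq, not_or, not_not] at h1
    exact h (by rw [Pi.sub_apply, h1.1, h1.2, sub_zero])
  card := hH.card.sub hG.card
  cls γ h := by
    by_cases h1 : H γ = 0
    · refine hG.cls γ fun h2 => h ?_
      rw [Pi.sub_apply, h1, h2, sub_zero]
    · exact hH.cls γ h1

theorem Adm.smul {H : (Fin n → ℤ) → ExtV K (Fin n)} (hH : Adm V C d H) (a : K) :
    Adm V C d (a • H) where
  rsupp γ := (formsOn K _).smul_mem _ (hH.rsupp γ)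
  fin := hH.fin.subset fun γ h h1 => h (by rw [Pi.smul_apply, h1, smul_zero])
  card := hH.card.smul a
  cls γ h := hH.cls γ fun h1 => h (by rw [Pi.smul_apply, h1, smul_zero])

theorem Adm.add {H G : (Fin n → ℤ) → ExtV K (Fin n)} (hH : Adm V C d H) (hG : Adm V C d G) :
    Adm V C d (H + G) := by
  have := hH.sub (hG.smul (-1))
  rwa [neg_one_smul, sub_neg_eq_add] at this

/-- The restriction of a function to a set of exponents. -/
noncomputable def rst (P : (Fin n → ℤ) → Prop) :
    ((Fin n → ℤ) → ExtV K (Fin n)) →ₗ[K] ((Fin n → ℤ) → ExtV K (Fin n)) where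
  toFun H γ := if P γ then H γ else 0
  map_add' H H' := by funext γ; simp only [Pi.add_apply]; split_ifs <;> simp
  map_smul' a H := by funext γ; simp only [Pi.smul_apply, RingHom.id_apply]; split_ifs <;> simp

theorem rst_apply (P : (Fin n → ℤ) → Prop) (H : (Fin n → ℤ) → ExtV K (Fin n))
    (γ : Fin n → ℤ) : rst P H γ = if P γ then H γ else 0 := rfl

theorem rst_ne {P : (Fin n → ℤ) → Prop} {H : (Fin n → ℤ) → ExtV K (Fin n)}
    {γ : Fin n → ℤ} (h : rst P H γ ≠ 0) : P γ ∧ H γ ≠ 0 := by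
  rw [rst_apply] at h
  split_ifs at h with h1
  · exact ⟨h1, h⟩
  · exact absurd rfl h

theorem Adm.rst {H : (Fin n → ℤ) → ExtV K (Fin n)} (hH : Adm V C d H)
    (P : (Fin n → ℤ) → Prop) : Adm V C d (rst P H) where
  rsupp γ := by
    rw [rst_apply]; split_ifs
    · exact hH.rsupp γ
    · exact (formsOn K _).zero_mem
  fin := hH.fin.subset fun γ h => (rst_ne h).2
  card γ S h := by
    rw [rst_apply] at h
    split_ifs at h
    · exact hH.card γ S h
    · exact absurd rfl h
  cls γ h := hH.cls γ (rst_ne h).2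

theorem EAdual_card {d : ℤ} {v : ExtV K (Fin n)} {j : Fin n}
    (h : ∀ S, v S ≠ 0 → (S.card : ℤ) = d) (S : Finset (Fin n))
    (hS : EAdual K π A j v S ≠ 0) : (S.card : ℤ) = d - 1 := by
  have := EAdual_mem_formsOn π A (P := fun S => (S.card : ℤ) = d)
    (P' := fun S => (S.card : ℤ) = d - 1) (v := v) (j := j) h (fun k S hk h => by
      rw [Finset.card_insert_of_notMem hk] at h; push_cast at h; linarith)
  exact this S hS

theorem EA_card {d : ℤ} {v : ExtV K (Fin n)} {j : Fin n}
    (h : ∀ S, v S ≠ 0 → (S.card : ℤ) = d) (S : Finset (Fin n))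
    (hS : EA K π A j v S ≠ 0) : (S.card : ℤ) = d + 1 := by
  have := EA_mem_formsOn π A (P := fun S => (S.card : ℤ) = d)
    (P' := fun S => (S.card : ℤ) = d + 1) (v := v) (j := j) h (fun k S _ hk h => by
      rw [Finset.card_insert_of_notMem hk]; push_cast; linarith)
  exact this S hS

theorem Adm.EAdual {H : (Fin n → ℤ) → ExtV K (Fin n)} (hH : Adm V C d H) (j : Fin n) :
    Adm V C (d - 1) (fun γ => EAdual K π A j (H γ)) where
  rsupp γ := EAdual_mem_formsOn π A (hH.rsupp γ) fun k S _ h => RS_erase V h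
  fin := hH.fin.subset fun γ h h1 => h (by rw [h1, map_zero])
  card γ S h := EAdual_card (hH.card γ) S h
  cls γ h := hH.cls γ fun h1 => h (by rw [h1, map_zero])

theorem DR_ne {H : (Fin n → ℤ) → ExtV K (Fin n)} {γ : Fin n → ℤ} (h : DR π A V H γ ≠ 0) :
    H γ ≠ 0 ∨ ∃ j ∈ rowsIn A V, H (γ - row A j) ≠ 0 := by
  by_contra hc
  push Not at hc
  refine h ?_
  rw [DR_apply]
  refine Finset.sum_eq_zero fun j _ => ?_
  have : opT π A V j H γ = 0 := by
    simp only [opT, LinearMap.coe_mk, AddHom.coe_mk, hc.1]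
    split_ifs with hj
    · rw [hc.2 j hj]; simp
    · simp
  rw [this, map_zero]

theorem phi_ne' {H : (Fin n → ℤ) → ExtV K (Fin n)} {γ : Fin n → ℤ} (h : phi π A V H γ ≠ 0) :
    ∃ j ∈ rowsIn A V, H (γ - row A j) ≠ 0 := by
  rw [phi_apply] at h
  obtain ⟨j, hj, h⟩ := Finset.exists_ne_zero_of_sum_ne_zero h
  exact ⟨j, hj, fun h0 => h (by rw [h0, map_zero])⟩

theorem Adm.DR (hA : (Aq A).det ≠ 0) (hπ : π ≠ 0) (hC : RowInv A C)
    {H : (Fin n → ℤ) → ExtV K (Fin n)} (hH : Adm V C d H) :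
    Adm V C (d + 1) (DR π A V H) where
  rsupp := hH.rsupp.DR π V hA hπ
  fin := by
    refine (hH.fin.union (Set.Finite.biUnion (rowsIn A V).finite_toSet fun j _ =>
      hH.fin.image (· + row A j))).subset fun γ h => ?_
    rcases DR_ne h with h | ⟨j, hj, h⟩
    · exact Or.inl h
    · exact Or.inr (Set.mem_biUnion hj ⟨_, h, by simp⟩)
  card γ S h := by
    rw [DR_apply, Finset.sum_apply] at h
    obtain ⟨j, -, h⟩ := Finset.exists_ne_zero_of_sum_ne_zero h
    refine EA_card (d := d) (fun S hS => ?_) S h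
    simp only [opT, LinearMap.coe_mk, AddHom.coe_mk, Pi.add_apply] at hS
    by_contra hd
    apply hS
    have e : ∀ γ, H γ S = 0 := fun γ => by by_contra h; exact hd (hH.card γ S h)
    rw [Pi.smul_apply, e]
    split_ifs
    · rw [e]; simp
    · simp
  cls γ h := by
    rcases DR_ne h with h | ⟨j, _, h⟩
    · exact hH.cls γ h
    · exact (hC γ j).1 (hH.cls _ h)

theorem DR_nonnegOn (hA : (Aq A).det ≠ 0) {T : Finset (Fin n)}
    {H : (Fin n → ℤ) → ExtV K (Fin n)} (hH : NonnegOn A T H) : NonnegOn A T (DR π A V H) := by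
  intro γ h k hk
  rcases DR_ne h with h | ⟨j, _, h⟩
  · exact hH γ h k hk
  · have := hH _ h k hk
    rw [map_sub, crd_row hA] at this
    split_ifs at this <;> linarith

theorem NonnegOn.sub {T : Finset (Fin n)} {H G : (Fin n → ℤ) → ExtV K (Fin n)}
    (hH : NonnegOn A T H) (hG : NonnegOn A T G) : NonnegOn A T (H - G) := by
  intro γ h
  by_cases h1 : H γ = 0
  · refine hG γ fun h2 => h ?_
    rw [Pi.sub_apply, h1, h2, sub_zero]
  · exact hH γ h1

theorem adc_row (hA : (Aq A).det ≠ 0) (j i : Fin n) :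
    adc A j (row A i) = if j = i then (A.map ((↑) : ℕ → ℤ)).det else 0 := by
  have := adc_eq hA j (row A i)
  rw [crd_row hA, det_Aq] at this
  split_ifs at this ⊢
  · exact_mod_cast this.trans (mul_one _)
  · exact_mod_cast this.trans (mul_zero _)

theorem det_Aq_ne (hdet : 0 < (A.map ((↑) : ℕ → ℤ)).det) : (Aq A).det ≠ 0 := by
  rw [det_Aq]; exact_mod_cast hdet.ne'

theorem adc_nonneg (hdet : 0 < (A.map ((↑) : ℕ → ℤ)).det) {j : Fin n} {γ : Fin n → ℤ} :
    0 ≤ adc A j γ ↔ 0 ≤ crd A j γ := by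
  have h1 := adc_eq (det_Aq_ne hdet) j γ
  have h2 : 0 < (Aq A).det := by rw [det_Aq]; exact_mod_cast hdet
  rw [← mul_nonneg_iff_of_pos_left h2, ← h1]
  exact_mod_cast Iff.rfl

theorem exists_nonnegOn_insert (hdet : 0 < (A.map ((↑) : ℕ → ℤ)).det) (hπ : π ≠ 0)
    (hC : RowInv A C) (T : Finset (Fin n)) (j : Fin n) (N : ℕ) :
    ∀ H : (Fin n → ℤ) → ExtV K (Fin n), Adm V C d H → NonnegOn A T H →
      NonnegOn A Finset.univ (DR π A V H) → (∀ γ, H γ ≠ 0 → -(N : ℤ) ≤ adc A j γ) →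
      ∃ ζ, Adm V C (d - 1) ζ ∧ NonnegOn A (insert j T) (H - DR π A V ζ) := by
  have hA := det_Aq_ne hdet
  induction N with
  | zero =>
    intro H hH hT _ hN
    refine ⟨0, Adm.zero, fun γ h k hk => ?_⟩
    rw [map_zero, sub_zero] at h
    rcases Finset.mem_insert.1 hk with rfl | hk
    · rw [← adc_nonneg hdet]; simpa using hN γ h
    · exact hT γ h k hk
  | succ N ih =>
    intro H hH hT hD hN
    set P : (Fin n → ℤ) → Prop := fun γ => adc A j γ = -((N : ℤ) + 1) with hP
    set a : ℚ := -((N : ℚ) + 1) / (Aq A).det with ha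
    have ha0 : a ≠ 0 := div_ne_zero (by have : (0:ℚ) ≤ N := Nat.cast_nonneg N
                                        intro h; linarith) hA
    have hcrd : ∀ γ, P γ → crd A j γ = a := fun γ h => by
      rw [ha, eq_div_iff hA, mul_comm, ← adc_eq hA, h]; push_cast; ring
    set H0 := rst P H with hH0
    have hH0a : Adm V C d H0 := hH.rst P
    set ζ : (Fin n → ℤ) → ExtV K (Fin n) := (π / (a : K)) • fun γ => EAdual K π A j (H0 γ)
      with hζ
    have hζa : Adm V C (d - 1) ζ := (hH0a.EAdual j).smul _
    have hζn : ∀ γ, ζ γ ≠ 0 → H0 γ ≠ 0 := fun γ h h0 => h (by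
      rw [hζ, Pi.smul_apply, h0, map_zero, smul_zero])
    have hdc : ∀ (γ : Fin n → ℤ) i, adc A j (γ - row A i) = adc A j γ
        - if j = i then (A.map ((↑) : ℕ → ℤ)).det else 0 := fun γ i => by
      rw [map_sub, adc_row hA]
    have hlay : ∀ γ, P γ → DR π A V H0 γ = 0 := by
      intro γ hγ
      have e1 : DR π A V H γ = 0 := by
        by_contra h
        have := (adc_nonneg hdet).2 (hD γ h j (Finset.mem_univ j))
        rw [hγ] at this; omega
      rw [← e1, ← sub_eq_zero, ← Pi.sub_apply, ← map_sub]
      by_contra h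
      have hx : ∀ γ', (H0 - H) γ' ≠ 0 → ¬ P γ' ∧ H γ' ≠ 0 := fun γ' h => by
        rw [Pi.sub_apply, hH0, rst_apply] at h
        split_ifs at h with hp
        · simp at h
        · exact ⟨hp, fun h0 => h (by rw [h0, sub_zero])⟩
      rcases DR_ne h with h | ⟨i, _, h⟩
      · exact (hx _ h).1 hγ
      · obtain ⟨h1, h2⟩ := hx _ h
        have h3 := hN _ h2
        rw [hdc] at h3
        split_ifs at h3 with hij
        · rw [hγ] at h3; push_cast at h3; omega
        · apply h1; rw [hP]; simp only; rw [hdc, if_neg hij, sub_zero]; exact hγ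
    have hDζ : ∀ γ, DR π A V ζ γ = (π / (a : K)) • (opT π A V j H0 γ
        - EAdual K π A j (DR π A V H0 γ)) := fun γ => by
      rw [hζ, map_smul, Pi.smul_apply, DR_EAdual π V hA hπ]
    have key : ∀ γ, P γ → (H - DR π A V ζ) γ = 0 := by
      intro γ hγ
      have e0 : H0 γ = H γ := if_pos hγ
      have e1 : opT π A V j H0 γ = ((a : K) / π) • H γ := by
        simp only [opT, LinearMap.coe_mk, AddHom.coe_mk]
        rw [hcrd γ hγ, e0, add_eq_left]
        split_ifs with hj
        · by_contra h
          have h1 : adc A j (γ - row A j) = -((N : ℤ) + 1) := (rst_ne h).1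
          rw [hdc, if_pos rfl, hγ] at h1; omega
        · rfl
      have haK : (a : K) ≠ 0 := by exact_mod_cast ha0
      rw [Pi.sub_apply, hDζ, hlay γ hγ, map_zero, sub_zero, e1, smul_smul, div_mul_div_comm,
        mul_comm (a : K), div_self (mul_ne_zero hπ haK), one_smul, sub_self]
    have hT' : NonnegOn A T (H - DR π A V ζ) := hT.sub (DR_nonnegOn hA fun γ h =>
      hT γ (rst_ne (hζn γ h)).2)
    obtain ⟨ζ', h1, h2⟩ := ih (H - DR π A V ζ)
      (hH.sub (by have := hζa.DR hA hπ hC; rwa [sub_add_cancel] at this)) hT'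
      (by rw [map_sub, DR_DR π V hA, sub_zero]; exact hD) (by
        intro γ h
        have hnP : ¬ P γ := fun hp => h (key γ hp)
        have h1 : -((N : ℤ) + 1) ≤ adc A j γ := by
          by_cases hz : H γ = 0
          · have h2 : DR π A V ζ γ ≠ 0 := fun h2 => h (by rw [Pi.sub_apply, hz, h2, sub_zero])
            rcases DR_ne h2 with h3 | ⟨i, _, h3⟩
            · rw [(rst_ne (hζn _ h3)).1]
            · have h4 : adc A j (γ - row A i) = -((N : ℤ) + 1) := (rst_ne (hζn _ h3)).1
              rw [hdc] at h4
              split_ifs at h4 <;> omega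
          · simpa using hN γ hz
        have : adc A j γ ≠ -((N : ℤ) + 1) := hnP
        omega)
    refine ⟨ζ + ζ', hζa.add h1, ?_⟩
    rwa [map_add, ← sub_sub]

/-- Every finite form with nonnegative differential can be made nonnegative by a coboundary. -/
theorem exists_nonneg (hdet : 0 < (A.map ((↑) : ℕ → ℤ)).det) (hπ : π ≠ 0) (hC : RowInv A C)
    {H : (Fin n → ℤ) → ExtV K (Fin n)} (hH : Adm V C d H)
    (hD : NonnegOn A Finset.univ (DR π A V H)) :
    ∃ ζ, Adm V C (d - 1) ζ ∧ NonnegOn A Finset.univ (H - DR π A V ζ) := by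
  have hA := det_Aq_ne hdet
  suffices h : ∀ T : Finset (Fin n), ∃ ζ, Adm V C (d - 1) ζ ∧
      NonnegOn A T (H - DR π A V ζ) from h _
  intro T
  induction T using Finset.induction_on with
  | empty => exact ⟨0, Adm.zero, fun γ _ k hk => absurd hk (by simp)⟩
  | insert j T hj ih =>
    obtain ⟨ζ, h1, h2⟩ := ih
    have h3 : Adm V C d (H - DR π A V ζ) :=
      hH.sub (by have := h1.DR hA hπ hC; rwa [sub_add_cancel] at this)
    obtain ⟨N, hN⟩ : ∃ N : ℕ, ∀ γ, (H - DR π A V ζ) γ ≠ 0 → -(N : ℤ) ≤ adc A j γ := by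
      obtain ⟨M, hM⟩ := (h3.fin.image fun γ => adc A j γ).bddBelow
      exact ⟨M.natAbs, fun γ h => le_trans (by omega) (hM ⟨γ, h, rfl⟩)⟩
    obtain ⟨ζ', h4, h5⟩ := exists_nonnegOn_insert hdet hπ hC T j N _ h3 h2
      (by rw [map_sub, DR_DR π V hA, sub_zero]; exact hD) hN
    refine ⟨ζ + ζ', h1.add h4, ?_⟩
    rwa [map_add, ← sub_sub]

end Admissible

section Strict

variable {K : Type} [Field K] [CharZero K] {n : ℕ} {π : K} {A : Matrix (Fin n) (Fin n) ℕ}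
  {V : Finset (Fin n)} {C : (Fin n → ℤ) → Prop} {d : ℤ}

theorem sa_nonneg (hA : (Aq A).det ≠ 0) (hq : HasWeights A) {γ : Fin n → ℤ}
    (h0 : ∀ k, 0 ≤ γ k) : 0 ≤ sa A γ := by
  obtain ⟨q, hq0, hq1⟩ := hq
  have h2 : sa A γ = ∑ k, (γ k : ℚ) * q k := by
    simp only [← sum_crd_mul hA γ, Finset.sum_mul]
    rw [Finset.sum_comm, sa_apply]
    refine Finset.sum_congr rfl fun j _ => ?_
    simp only [mul_assoc]
    rw [← Finset.mul_sum, hq1, mul_one]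
  rw [h2]
  exact Finset.sum_nonneg fun k _ => mul_nonneg (by exact_mod_cast h0 k) (hq0 k).le

variable (A) in
/-- The integral weight, `det A` times the sum of the coordinates. -/
noncomputable def wt : (Fin n → ℤ) →+ ℤ := ∑ j, adc A j

theorem wt_eq (hA : (Aq A).det ≠ 0) (γ : Fin n → ℤ) :
    (wt A γ : ℚ) = (Aq A).det * sa A γ := by
  rw [wt, sa_apply, AddMonoidHom.finsetSum_apply, Finset.mul_sum]
  push_cast
  exact Finset.sum_congr rfl fun j _ => adc_eq hA j γ

theorem wt_row (hA : (Aq A).det ≠ 0) (i : Fin n) :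
    wt A (row A i) = (A.map ((↑) : ℕ → ℤ)).det := by
  rw [wt, AddMonoidHom.finsetSum_apply]
  simp [adc_row hA]

theorem RowInv.inv (hC : RowInv A C) : Inv A V fun γ _ => C γ :=
  fun γ _ j _ _ _ _ => hC γ j

theorem DR_eq_phi (hA : (Aq A).det ≠ 0) (hπ : π ≠ 0) {H : (Fin n → ℤ) → ExtV K (Fin n)}
    {γ : Fin n → ℤ} (h : H γ = 0) : DR π A V H γ = phi π A V H γ := by
  rw [DR_eq π V hA hπ, phi_apply, h]
  simp

theorem phi_congr {H G : (Fin n → ℤ) → ExtV K (Fin n)} {γ : Fin n → ℤ}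
    (h : ∀ j, H (γ - row A j) = G (γ - row A j)) : phi π A V H γ = phi π A V G γ := by
  rw [phi_apply, phi_apply]
  exact Finset.sum_congr rfl fun j _ => by rw [h]

theorem exists_layer (hdet : 0 < (A.map ((↑) : ℕ → ℤ)).det) (hπ : π ≠ 0)
    (hq : HasWeights A) (hreg : KosReg K A V) (hC : RowInv A C) (hd : d < V.card)
    {H : (Fin n → ℤ) → ExtV K (Fin n)} (hH : Adm V C d H) {L : ℤ}
    (hL : ∀ γ, H γ ≠ 0 → wt A γ = L) (h0 : phi π A V H = 0) :
    ∃ η, Adm V C (d - 1) η ∧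
      (∀ γ, η γ ≠ 0 → wt A γ = L - (A.map ((↑) : ℕ → ℤ)).det) ∧ phi π A V η = H := by
  have hA := det_Aq_ne hdet
  have hwt : ∀ γ, sa A γ = wt A γ / (Aq A).det := fun γ => by
    rw [wt_eq hA, mul_div_cancel_left₀ _ hA]
  obtain ⟨η, h1, h2, h3, h4⟩ := phi_exact hπ hreg ((hC.inv (V := V)).and
    (inv_sa hA (L / (Aq A).det - d))) hd hH.rsupp hH.card (fun γ S h => by
      have hne : H γ ≠ 0 := fun h0 => h (by rw [h0]; rfl)
      refine ⟨hH.cls γ hne, ?_⟩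
      rw [hwt, hL γ hne, ← hH.card γ S h]; simp) h0
  have hsa : ∀ γ, η γ ≠ 0 → C γ ∧ sa A γ = L / (Aq A).det - 1 ∧ ∀ k, 0 ≤ γ k := by
    intro γ h
    obtain ⟨S, hS⟩ := Function.ne_iff.1 h
    obtain ⟨h5, h6⟩ := h3 γ S hS
    have h7 := h2 γ S hS
    refine ⟨h5, ?_, (h1 γ S hS).1⟩
    have : (S.card : ℚ) = d - 1 := by exact_mod_cast h7
    rw [this] at h6; linarith
  refine ⟨η, ⟨h1, (finite_sa_le hA hq (L / (Aq A).det - 1)).subset fun γ h =>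
    ⟨(hsa γ h).2.2, (hsa γ h).2.1.le⟩, h2, fun γ h => (hsa γ h).1⟩, fun γ h => ?_, h4⟩
  have h5 := wt_eq hA γ
  rw [(hsa γ h).2.1, mul_sub, mul_div_cancel₀ _ hA, mul_one, det_Aq] at h5
  exact_mod_cast h5

theorem exists_lower_aux (hdet : 0 < (A.map ((↑) : ℕ → ℤ)).det) (hπ : π ≠ 0)
    (hq : HasWeights A) (hreg : KosReg K A V) (hC : RowInv A C) (hd : d < V.card) (T : ℤ)
    (N : ℕ) : ∀ H : (Fin n → ℤ) → ExtV K (Fin n), Adm V C d H →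
      (∀ γ, DR π A V H γ ≠ 0 → wt A γ ≤ T) →
      (∀ γ, H γ ≠ 0 → wt A γ ≤ T - (A.map ((↑) : ℕ → ℤ)).det + N) →
      ∃ ξ, Adm V C (d - 1) ξ ∧
        ∀ γ, (H - DR π A V ξ) γ ≠ 0 → wt A γ ≤ T - (A.map ((↑) : ℕ → ℤ)).det := by
  have hA := det_Aq_ne hdet
  set D := (A.map ((↑) : ℕ → ℤ)).det with hDdef
  induction N with
  | zero =>
    intro H _ _ h
    exact ⟨0, Adm.zero, fun γ hγ => by simpa using h γ (by simpa using hγ)⟩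
  | succ N ih =>
    intro H hH hD hN
    set L : ℤ := T - D + N + 1 with hL
    have hsub : ∀ (γ : Fin n → ℤ) j, wt A (γ - row A j) = wt A γ - D := fun γ j => by
      rw [map_sub, wt_row hA]
    have hphi : phi π A V (rst (fun γ => wt A γ = L) H) = 0 := by
      funext γ
      by_contra h
      obtain ⟨j, -, hj⟩ := phi_ne' h
      have h1 := (rst_ne hj).1
      simp only [hsub] at h1
      have h2 : H γ = 0 := by
        by_contra h2; have := hN γ h2; push_cast at this; omega
      have h3 : DR π A V H γ = 0 := by
        by_contra h3; have := hD γ h3; omega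
      apply h
      rw [DR_eq_phi hA hπ h2] at h3
      rw [Pi.zero_apply, ← h3]
      refine phi_congr fun i => ?_
      rw [rst_apply, if_pos (by rw [hsub]; exact h1)]
    obtain ⟨η, h1, h2, h3⟩ := exists_layer hdet hπ hq hreg hC hd (hH.rst _)
      (fun γ h => (rst_ne h).1) hphi
    have hDη : ∀ γ, DR π A V η γ ≠ 0 → wt A γ ≤ L := fun γ h => by
      rcases DR_ne h with h | ⟨j, _, h⟩
      · have := h2 _ h; omega
      · have := h2 _ h; rw [hsub] at this; omega
    have h4 : ∀ γ, (H - DR π A V η) γ ≠ 0 → wt A γ ≤ T - D + N := by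
      intro γ h
      have h5 : wt A γ ≤ L := by
        by_cases hz : H γ = 0
        · exact hDη γ fun h6 => h (by rw [Pi.sub_apply, hz, h6, sub_zero])
        · have := hN γ hz; push_cast at this; omega
      have h6 : wt A γ ≠ L := fun h6 => by
        apply h
        have h7 : η γ = 0 := by by_contra h7; have := h2 γ h7; omega
        rw [Pi.sub_apply, DR_eq_phi hA hπ h7, h3, rst_apply, if_pos h6, sub_self]
      omega
    obtain ⟨ξ, g1, g2⟩ := ih (H - DR π A V η)
      (hH.sub (by have := h1.DR hA hπ hC; rwa [sub_add_cancel] at this))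
      (by rw [map_sub, DR_DR π V hA, sub_zero]; exact hD) h4
    refine ⟨η + ξ, h1.add g1, ?_⟩
    rwa [map_add, ← sub_sub]

/-- A form below top degree can be moved by a coboundary below its differential. -/
theorem exists_lower (hdet : 0 < (A.map ((↑) : ℕ → ℤ)).det) (hπ : π ≠ 0)
    (hq : HasWeights A) (hreg : KosReg K A V) (hC : RowInv A C) (hd : d < V.card) (T : ℤ)
    {H : (Fin n → ℤ) → ExtV K (Fin n)} (hH : Adm V C d H)
    (hD : ∀ γ, DR π A V H γ ≠ 0 → wt A γ ≤ T) :
    ∃ ξ, Adm V C (d - 1) ξ ∧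
      ∀ γ, (H - DR π A V ξ) γ ≠ 0 → wt A γ ≤ T - (A.map ((↑) : ℕ → ℤ)).det := by
  obtain ⟨M, hM⟩ := (hH.fin.image fun γ => wt A γ).bddAbove
  refine exists_lower_aux hdet hπ hq hreg hC hd T
    (M - (T - (A.map ((↑) : ℕ → ℤ)).det)).toNat H hH hD fun γ h => ?_
  have := hM ⟨γ, h, rfl⟩
  simp only at this
  omega

theorem Adm.wt_nonneg (hdet : 0 < (A.map ((↑) : ℕ → ℤ)).det) (hq : HasWeights A)
    {H : (Fin n → ℤ) → ExtV K (Fin n)} (hH : Adm V C d H) {γ : Fin n → ℤ} (h : H γ ≠ 0) :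
    0 ≤ wt A γ := by
  have hA := det_Aq_ne hdet
  obtain ⟨S, hS⟩ := Function.ne_iff.1 h
  have h1 := wt_eq hA γ
  rw [det_Aq] at h1
  have h2 : (0 : ℚ) ≤ wt A γ := by
    rw [h1]
    exact mul_nonneg (by exact_mod_cast hdet.le) (sa_nonneg hA hq (hH.rsupp γ S hS).1)
  exact_mod_cast h2

/-- Closed forms below top degree are exact. -/
theorem exists_DR_eq (hdet : 0 < (A.map ((↑) : ℕ → ℤ)).det) (hπ : π ≠ 0)
    (hq : HasWeights A) (hreg : KosReg K A V) (hC : RowInv A C) (hd : d < V.card)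
    {H : (Fin n → ℤ) → ExtV K (Fin n)} (hH : Adm V C d H) (hD : DR π A V H = 0) :
    ∃ ξ, Adm V C (d - 1) ξ ∧ DR π A V ξ = H := by
  have hA := det_Aq_ne hdet
  obtain ⟨ξ, h1, h2⟩ := exists_lower hdet hπ hq hreg hC hd 0 hH
    (fun γ h => absurd (by rw [hD]; rfl) h)
  refine ⟨ξ, h1, ?_⟩
  have h3 : Adm V C d (H - DR π A V ξ) :=
    hH.sub (by have := h1.DR hA hπ hC; rwa [sub_add_cancel] at this)
  funext γ
  by_contra h
  have h4 : (H - DR π A V ξ) γ ≠ 0 := fun h0 => h (sub_eq_zero.1 h0).symm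
  have h5 := h2 γ h4
  have h6 := h3.wt_nonneg hdet hq h4
  omega

/-- Exact nonnegative forms are differentials of nonnegative forms. -/
theorem exists_nonneg_primitive (hdet : 0 < (A.map ((↑) : ℕ → ℤ)).det) (hπ : π ≠ 0)
    (hC : RowInv A C) {η : (Fin n → ℤ) → ExtV K (Fin n)} (hη : Adm V C (d - 1) η)
    (hD : NonnegOn A Finset.univ (DR π A V η)) :
    ∃ ξ, Adm V C (d - 1) ξ ∧ NonnegOn A Finset.univ ξ ∧ DR π A V ξ = DR π A V η := by
  have hA := det_Aq_ne hdet
  obtain ⟨ζ, h1, h2⟩ := exists_nonneg hdet hπ hC hη hD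
  refine ⟨η - DR π A V ζ, hη.sub (by have := h1.DR hA hπ hC; rwa [sub_add_cancel] at this),
    h2, ?_⟩
  rw [map_sub, DR_DR π V hA, sub_zero]

end Strict

section Components

variable {K : Type} [Field K] [CharZero K] {n : ℕ} {π : K} {A : Matrix (Fin n) (Fin n) ℕ}
  {V : Finset (Fin n)}

/-- The component of exterior degree `d`. -/
noncomputable def cmp (d : ℤ) : ExtV K (Fin n) →ₗ[K] ExtV K (Fin n) where
  toFun v S := if (S.card : ℤ) = d then v S else 0
  map_add' v w := by funext S; simp only [Pi.add_apply]; split_ifs <;> simp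
  map_smul' a v := by funext S; simp only [Pi.smul_apply, RingHom.id_apply]; split_ifs <;> simp

theorem cmp_apply (d : ℤ) (v : ExtV K (Fin n)) (S : Finset (Fin n)) :
    cmp d v S = if (S.card : ℤ) = d then v S else 0 := rfl

theorem cmp_mulE (d : ℤ) (i : Fin n) (v : ExtV K (Fin n)) :
    cmp (d + 1) (mulE K i v) = mulE K i (cmp d v) := by
  funext S
  rw [cmp_apply, mulE_apply, mulE_apply, cmp_apply]
  by_cases hi : i ∈ S
  · have := Finset.card_erase_add_one hi
    have e : ((S.card : ℤ) = d + 1) ↔ ((S.erase i).card : ℤ) = d := by omega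
    simp only [hi, if_true, e]
    split_ifs <;> simp
  · simp [hi]

theorem cmp_contrE (d : ℤ) (i : Fin n) (v : ExtV K (Fin n)) :
    cmp (d - 1) (contrE K i v) = contrE K i (cmp d v) := by
  funext S
  rw [cmp_apply, contrE_apply, contrE_apply, cmp_apply]
  by_cases hi : i ∈ S
  · simp [hi]
  · have := Finset.card_insert_of_notMem hi
    have e : ((S.card : ℤ) = d - 1) ↔ ((insert i S).card : ℤ) = d := by omega
    simp only [hi, if_false, e]
    split_ifs <;> simp

theorem cmp_EA (d : ℤ) (j : Fin n) (v : ExtV K (Fin n)) :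
    cmp (d + 1) (EA K π A j v) = EA K π A j (cmp d v) := by
  simp only [EA_apply, map_smul, map_sum, cmp_mulE]

theorem DR_cmp (d : ℤ) (H : (Fin n → ℤ) → ExtV K (Fin n)) (γ : Fin n → ℤ) :
    DR π A V (fun w => cmp d (H w)) γ = cmp (d + 1) (DR π A V H γ) := by
  rw [DR_apply, DR_apply, map_sum]
  exact Finset.sum_congr rfl fun j _ => by rw [opT_comp, cmp_EA]

theorem phi_cmp (d : ℤ) (H : (Fin n → ℤ) → ExtV K (Fin n)) (γ : Fin n → ℤ) :
    phi π A V (fun w => cmp d (H w)) γ = cmp (d + 1) (phi π A V H γ) := by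
  rw [phi_apply, phi_apply, map_sum]
  exact Finset.sum_congr rfl fun j _ => by rw [cmp_EA]

theorem cmp_mem_formsOn {P : Finset (Fin n) → Prop} {v : ExtV K (Fin n)}
    (hv : v ∈ formsOn K P) (d : ℤ) : cmp d v ∈ formsOn K P := by
  intro S hS
  rw [cmp_apply] at hS
  split_ifs at hS
  · exact hv S hS
  · exact absurd rfl hS

theorem cmp_eq_self {v : ExtV K (Fin n)} {d : ℤ} (h : ∀ S, v S ≠ 0 → (S.card : ℤ) = d) :
    cmp d v = v := by
  funext S
  rw [cmp_apply]
  split_ifs with h1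
  · rfl
  · by_contra h2; exact h1 (h S fun h3 => h2 h3.symm)

theorem card_of_cmp {v : ExtV K (Fin n)} {d : ℤ} {S : Finset (Fin n)} (h : cmp d v S ≠ 0) :
    (S.card : ℤ) = d := by
  rw [cmp_apply] at h
  by_contra h1
  exact h (if_neg h1)

theorem sum_cmp (v : ExtV K (Fin n)) : ∑ d ∈ Finset.range (n + 1), cmp (d : ℤ) v = v := by
  funext S
  rw [Finset.sum_apply, Finset.sum_eq_single S.card]
  · simp [cmp_apply]
  · intro d _ hd
    rw [cmp_apply, if_neg]
    intro h; exact hd (by exact_mod_cast h.symm)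
  · intro h
    exact absurd (Finset.mem_range.2 (Nat.lt_succ_of_le (by simpa using S.card_le_univ))) h

theorem ker_EA_le_card (hA : (Aq A).det ≠ 0) (hπ : π ≠ 0) (I : Finset (Fin n)) :
    ∀ v : ExtV K (Fin n), (∀ j ∈ I, EA K π A j v = 0) →
      v ∈ formsOn K fun S => I.card ≤ S.card := by
  induction I using Finset.induction_on with
  | empty => intro v _ S _; simp
  | insert j I hj ih =>
    intro v hv
    have hu := ih (EAdual K π A j v) fun i hi => by
      have := EA_EAdual π A hπ (det_cast hA) i j v
      rw [hv i (Finset.mem_insert_of_mem hi), map_zero, add_zero, if_neg] at this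
      · exact this
      · rintro rfl; exact hj hi
    have h := EA_EAdual π A hπ (det_cast hA) j j v
    rw [hv j (Finset.mem_insert_self j I), map_zero, add_zero, if_pos rfl] at h
    rw [← h]
    refine EA_mem_formsOn π A hu fun k S _ hk h => ?_
    rw [Finset.card_insert_of_notMem hj, Finset.card_insert_of_notMem hk]
    omega

end Components

section Minimal

variable {K : Type} [Field K] [CharZero K] {n : ℕ} {π : K} {hπ : π ≠ 0}
  {A : Matrix (Fin n) (Fin n) ℕ} {hA : (Aq A).det ≠ 0} {V : Finset (Fin n)}

/-- Reduced functions on which all `y`-variables have been eliminated. -/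
structure MinE (hπ : π ≠ 0) (hA : (Aq A).det ≠ 0)
    (F : (Fin n → ℤ) × (Fin n → ℤ) → ExtV K (Fin n)) : Prop where
  min : (sys hπ hA).Min F
  elim : ∀ i, (sys hπ hA).Elim (Sum.inr i) F

variable {F : (Fin n → ℤ) × (Fin n → ℤ) → ExtV K (Fin n)}

theorem notMem_of_contrE {i : Fin n} {v : ExtV K (Fin n)} (h : contrE K i v = 0)
    {S : Finset (Fin n)} (hS : v S ≠ 0) : i ∉ S := by
  intro hi
  have := congrFun h (S.erase i)
  rw [contrE_apply, if_neg (Finset.notMem_erase i S), Finset.insert_erase hi] at this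
  exact hS ((mul_eq_zero.1 this).resolve_left (pow_ne_zero _ (neg_ne_zero.2 one_ne_zero)))

theorem min_finite (hF : (sys hπ hA).Min F) : {z | F z ≠ 0}.Finite := by
  have key : ∀ {B : Matrix (Fin n) (Fin n) ℕ} (hB : (Aq B).det ≠ 0),
      {γ : Fin n → ℤ | ∀ j, 0 ≤ crd B j γ ∧ crd B j γ ≤ 1}.Finite := by
    intro B hB
    refine (Set.finite_Icc (0 : Fin n → ℤ) fun k => ∑ j, (B j k : ℤ)).subset fun γ h => ?_
    constructor
    · intro k
      have : (0 : ℚ) ≤ γ k := by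
        rw [← sum_crd_mul hB γ k]
        exact Finset.sum_nonneg fun j _ => mul_nonneg (h j).1 (Nat.cast_nonneg _)
      exact_mod_cast this
    · intro k
      have : (γ k : ℚ) ≤ ∑ j, (B j k : ℚ) := by
        rw [← sum_crd_mul hB γ k]
        exact Finset.sum_le_sum fun j _ => mul_le_of_le_one_left (Nat.cast_nonneg _) (h j).2
      exact_mod_cast this
  refine ((key hA).prod (key (det_Aq_transpose hA))).subset fun z hz => ?_
  have h1 := (sys_ok_iff hπ hA z).1 (hF.supp z hz)
  exact ⟨fun j => ⟨h1.1 j, hF.le_one (κ := Sum.inl j) hz⟩,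
    fun i => ⟨h1.2.1 i, hF.le_one (κ := Sum.inr i) hz⟩⟩

theorem MinE.isMin (hF : MinE hπ hA F) {γ lam : Fin n → ℤ} (h : F (γ, lam) ≠ 0) :
    IsMin A (Finset.univ.filter fun i => crd Aᵀ i lam = 0) lam where
  nonneg i := ((sys_ok_iff hπ hA _).1 (hF.min.supp _ h)).2.1 i
  lt_one i := lt_of_le_of_ne (hF.min.le_one (κ := Sum.inr i) h) fun h1 =>
    h ((hF.elim i).one (γ, lam) h1)
  mem_iff i := by simp

theorem MinE.rsupp (hF : MinE hπ hA F) {lam : Fin n → ℤ} (hl : IsMin A V lam) :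
    RSupp V (fun γ => F (γ, lam)) := by
  intro γ S hS
  have hne : F (γ, lam) ≠ 0 := fun h => hS (by simp only; rw [h]; rfl)
  have hok := hF.min.supp _ hne
  obtain ⟨h1, h2⟩ := (sys_ok_min π V hA hπ hl).1 hok
  have hγ : ∀ k, 0 ≤ γ k := fun k => by
    have : (0 : ℚ) ≤ γ k := by
      rw [← sum_crd_mul hA γ k]
      exact Finset.sum_nonneg fun j _ => mul_nonneg (h1 j) (Nat.cast_nonneg _)
    exact_mod_cast this
  have hSV : S ⊆ V := fun i hi => by
    by_contra hV
    have hb : crd Aᵀ i lam ≠ 0 := fun h => hV ((hl.mem_iff i).2 h)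
    exact notMem_of_contrE (hF.min.ε_eq (κ := Sum.inr i) (z := (γ, lam))
      (lt_of_le_of_ne (hl.nonneg i) hb.symm)) hS hi
  refine ⟨hγ, h2, hSV, fun k hk => lt_of_le_of_ne (hγ k) fun h0 => ?_⟩
  have hb := (hl.mem_iff k).1 (hSV hk)
  refine notMem_of_contrE ((hF.elim k).zero (γ, lam) hb ?_) hS hk
  rw [sys_ok_iff] at hok ⊢
  refine ⟨fun j => ?_, fun i => ?_, fun j i hji => ?_⟩
  · change 0 ≤ crd A j (γ + 0)
    rw [add_zero]; exact h1 j
  · change 0 ≤ crd Aᵀ i (lam + row Aᵀ k)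
    rw [map_add, crd_row (det_Aq_transpose hA)]
    have := hl.nonneg i
    split_ifs <;> linarith
  · change crd A j (γ + 0) = 0 ∨ crd Aᵀ i (lam + row Aᵀ k) = 0
    rw [add_zero, map_add, crd_row (det_Aq_transpose hA)]
    by_cases hik : i = k
    · subst hik
      exact Or.inl (crd_eq_zero_of hA h1 h0.symm hji)
    · rw [if_neg hik, add_zero]; exact hok.2.2 j i hji

theorem MinE.nonnegOn (hF : MinE hπ hA F) (lam : Fin n → ℤ) :
    NonnegOn A Finset.univ (fun γ => F (γ, lam)) :=
  fun γ h j _ => ((sys_ok_iff hπ hA _).1 (hF.min.supp (γ, lam) h)).1 j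

theorem MinE.D_apply (hF : MinE hπ hA F) {lam : Fin n → ℤ} (hl : IsMin A V lam)
    (γ : Fin n → ℤ) :
    (sys hπ hA).D F (γ, lam) = DR π A V (fun γ => F (γ, lam)) γ := by
  have e := congrFun (D_emb π V hA hπ hl (hF.rsupp hl) (hF.nonnegOn lam)) (γ, lam)
  rw [emb_apply, if_pos rfl] at e
  rw [← e]
  by_cases hz : (sys hπ hA).ok (γ, lam)
  · rw [KSys.D_ok _ hz, KSys.D_ok _ hz]
    refine Finset.sum_congr rfl fun k _ => ?_
    congr 1
    have h1 : emb lam (fun γ => F (γ, lam)) (γ, lam) = F (γ, lam) := by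
      rw [emb_apply, if_pos rfl]
    unfold KSys.L
    rw [h1]
    congr 1
    rcases k with j | i
    · change F (γ - row A j, lam - 0) = emb lam (fun γ => F (γ, lam)) (γ - row A j, lam - 0)
      rw [emb_apply, sub_zero, if_pos rfl]
    · have h2 : (sys hπ hA).x (Sum.inr i) (γ, lam) < 1 := hl.lt_one i
      rw [hF.min.supp.sub_shift h2, (emb_supp π V hA hπ hl (hF.rsupp hl)
        (hF.nonnegOn lam)).sub_shift h2]
  · rw [KSys.D_not_ok _ hz, KSys.D_not_ok _ hz]

variable (A) in
/-- The number of nonzero coordinates. -/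
noncomputable def rk (γ : Fin n → ℤ) : ℕ := (Finset.univ.filter fun j => crd A j γ ≠ 0).card

variable (A) in
/-- The set of nonintegral coordinates. -/
noncomputable def frs (γ : Fin n → ℤ) : Finset (Fin n) :=
  Finset.univ.filter fun j => ¬ ∃ z : ℤ, crd A j γ = z

theorem Cls.frs_eq {γ γ' : Fin n → ℤ} (h : Cls A γ γ') : frs A γ = frs A γ' := by
  unfold frs
  refine Finset.filter_congr fun j _ => not_congr ?_
  obtain ⟨z, hz⟩ := h j
  rw [hz]
  exact ⟨fun ⟨m, hm⟩ => ⟨m - z, by push_cast; linarith⟩,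
    fun ⟨m, hm⟩ => ⟨m + z, by push_cast; linarith⟩⟩

theorem rk_add_row (hA : (Aq A).det ≠ 0) {γ : Fin n → ℤ} {j : Fin n} (h : crd A j γ = 0) :
    rk A (γ + row A j) = rk A γ + 1 := by
  unfold rk
  rw [← Finset.card_insert_of_notMem (a := j) (by simp [h])]
  congr 1
  ext i
  simp only [Finset.mem_filter, Finset.mem_univ, true_and, Finset.mem_insert, map_add,
    crd_row hA]
  by_cases hij : i = j
  · subst hij; simp [h]
  · simp [hij]

variable (A) in
/-- The forms in the range eliminated by the `x`-variables. -/
noncomputable def highU (K : Type) [Field K] (m : ℤ) (z : (Fin n → ℤ) × (Fin n → ℤ)) :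
    Submodule K (ExtV K (Fin n)) :=
  formsOn K fun S => ((frs A z.1).card : ℤ) < 2 * rk A z.1 - S.card + m

theorem goodPair_highU (j : Fin n) :
    (sys hπ hA).GoodPair (Sum.inl j) (highU A K 0) (highU A K 1) := by
  have hfr : ∀ γ i, frs A (γ + row A i) = frs A γ := fun γ i => by
    have := (cls_sub_row hA (γ + row A i) i).frs_eq
    rw [add_sub_cancel_right] at this
    exact this.symm
  constructor
  · intro z hz v hv
    refine EAdual_mem_formsOn π A hv fun k S hk h => ?_
    change ((frs A (z.1 + row A j)).card : ℤ) < 2 * rk A (z.1 + row A j) - _ + 0 at h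
    have hz' : crd A j z.1 = 0 := hz
    rw [hfr, rk_add_row hA hz', Finset.card_insert_of_notMem hk] at h
    push_cast at h
    linarith
  · rintro (i | i) z hz v hv
    · refine EA_mem_formsOn π A hv fun k S _ hk h => ?_
      change ((frs A (z.1 - row A i)).card : ℤ) < 2 * rk A (z.1 - row A i) - _ + 1 at h
      have h1 : crd A i (z.1 - row A i) = 0 := by
        have hz' : crd A i z.1 = 1 := hz
        rw [map_sub, crd_row hA, hz', if_pos rfl, sub_self]
      have h2 := rk_add_row hA h1
      have h3 := hfr (z.1 - row A i) i
      rw [sub_add_cancel] at h2 h3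
      rw [← h3] at h
      rw [h2, Finset.card_insert_of_notMem hk]
      push_cast
      linarith
    · refine contrE_mem_formsOn hv fun S hk h => ?_
      change ((frs A (z.1 - 0)).card : ℤ) < 2 * rk A (z.1 - 0) - _ + 1 at h
      rw [sub_zero, Finset.card_insert_of_notMem hk] at h
      push_cast at h
      linarith

theorem mem_frs_of {γ : Fin n → ℤ} {j : Fin n} (h0 : 0 ≤ crd A j γ) (h1 : crd A j γ ≤ 1)
    (hn0 : crd A j γ ≠ 0) (hn1 : crd A j γ ≠ 1) : j ∈ frs A γ := by
  simp only [frs, Finset.mem_filter, Finset.mem_univ, true_and]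
  rintro ⟨z, hz⟩
  rw [hz] at h0 h1 hn0 hn1
  have : 0 ≤ z := by exact_mod_cast h0
  have : z ≤ 1 := by exact_mod_cast h1
  have : z ≠ 0 := by exact_mod_cast hn0
  have : z ≠ 1 := by exact_mod_cast hn1
  omega

theorem not_adj_inl : ∀ κ ∈ (Finset.univ.map Function.Embedding.inl : Finset (Fin n ⊕ Fin n)),
    ∀ κ' ∈ (Finset.univ.map Function.Embedding.inl : Finset (Fin n ⊕ Fin n)),
    ¬ (sys hπ hA).adj κ κ' := by
  intro κ h κ' h' ha
  simp only [Finset.mem_map, Finset.mem_univ, true_and] at h h'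
  obtain ⟨a, rfl⟩ := h
  obtain ⟨b, rfl⟩ := h'
  rcases ha with ⟨_, _, _, _, h⟩ | ⟨_, _, _, h, _⟩ <;> simp at h

theorem not_adj_inr : ∀ κ ∈ (Finset.univ.map Function.Embedding.inr : Finset (Fin n ⊕ Fin n)),
    ∀ κ' ∈ (Finset.univ.map Function.Embedding.inr : Finset (Fin n ⊕ Fin n)),
    ¬ (sys hπ hA).adj κ κ' := by
  intro κ h κ' h' ha
  simp only [Finset.mem_map, Finset.mem_univ, true_and] at h h'
  obtain ⟨a, rfl⟩ := h
  obtain ⟨b, rfl⟩ := h'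
  rcases ha with ⟨_, _, _, h, _⟩ | ⟨_, _, _, _, h⟩ <;> simp at h

theorem exists_elim_inr {c : (Fin n → ℤ) × (Fin n → ℤ) → ExtV K (Fin n)}
    (hc : (sys hπ hA).Min c) (hD : ∀ i z, crd Aᵀ i z.2 = 1 → (sys hπ hA).D c z = 0) :
    ∃ b, (sys hπ hA).Min b ∧ MinE hπ hA (c - (sys hπ hA).D b) := by
  obtain ⟨b, h1, h2, -⟩ := KSys.exists_elim hc (Finset.univ.map Function.Embedding.inr)
    not_adj_inr (fun κ hκ z hz => by
      simp only [Finset.mem_map, Finset.mem_univ, true_and] at hκ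
      obtain ⟨i, rfl⟩ := hκ
      exact hD i z hz)
  exact ⟨b, h1, hc.sub h1.D, fun i => h2 _ (by simp)⟩

/-- Reduced closed forms in the high range are exact. -/
theorem exists_of_high {lam : Fin n → ℤ} (hl : IsMin A V lam)
    {w : (Fin n → ℤ) → ExtV K (Fin n)} (hw : RSupp V w) (h0 : NonnegOn A Finset.univ w)
    (hm : (sys hπ hA).Min (emb lam w)) (hD : DR π A V w = 0)
    (hU : ∀ γ S, w γ S ≠ 0 → ((frs A γ).card : ℤ) < 2 * rk A γ - S.card) :
    ∃ h, RSupp V h ∧ {γ | h γ ≠ 0}.Finite ∧ NonnegOn A Finset.univ h ∧ DR π A V h = w := by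
  have hDe : (sys hπ hA).D (emb lam w) = 0 := by rw [D_emb π V hA hπ hl hw h0, hD, map_zero]
  obtain ⟨b, b1, b2, b3⟩ := KSys.exists_elim hm (Finset.univ.map Function.Embedding.inl)
    not_adj_inl (fun κ _ z _ => by rw [hDe]; rfl)
  obtain ⟨-, b4⟩ := b3 (highU A K 0) (highU A K 1) (fun κ hκ => by
    simp only [Finset.mem_map, Finset.mem_univ, true_and] at hκ
    obtain ⟨i, rfl⟩ := hκ
    exact goodPair_highU i) (fun z S hS => by
      rw [emb_apply] at hS
      split_ifs at hS with hz
      · have := hU z.1 S hS; linarith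
      · exact absurd rfl hS)
  have hR : emb lam w - (sys hπ hA).D b = 0 := by
    funext z
    by_contra hne
    have hmin := hm.sub b1.D
    have hok := (sys_ok_iff hπ hA z).1 (hmin.supp z hne)
    have hfr : Finset.univ.filter (fun j => crd A j z.1 ≠ 0) ⊆ frs A z.1 := by
      intro j hj
      refine mem_frs_of (hok.1 j) (hmin.le_one (κ := Sum.inl j) hne) (by simpa using hj) ?_
      exact fun h => hne ((b2 (Sum.inl j) (by simp)).one z h)
    have hk := ker_EA_le_card hA hπ (Finset.univ.filter fun j => crd A j z.1 ≠ 0) _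
      fun j hj => hmin.ε_eq (κ := Sum.inl j) (z := z) (by
        have hj' : crd A j z.1 ≠ 0 := by simpa using hj
        exact lt_of_le_of_ne (hok.1 j) (Ne.symm hj'))
    obtain ⟨S, hS⟩ := Function.ne_iff.1 hne
    have h1 := hk S hS
    have h2 := b4 z S hS
    have h3 := Finset.card_le_card hfr
    unfold rk at h2
    omega
  have hDb : (sys hπ hA).D b = emb lam w := (sub_eq_zero.1 hR).symm
  obtain ⟨b', c1, c2⟩ := exists_elim_inr b1 (fun i z hz => by
    rw [hDb, emb_apply, if_neg]
    rintro rfl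
    exact absurd hz (hl.lt_one i).ne)
  refine ⟨fun γ => (b - (sys hπ hA).D b') (γ, lam), c2.rsupp hl, ?_, c2.nonnegOn lam, ?_⟩
  · refine ((min_finite c2.min).image Prod.fst).subset fun γ h => ⟨(γ, lam), h, rfl⟩
  · funext γ
    rw [← c2.D_apply hl, map_sub, KSys.D_sq c1.supp, sub_zero, hDb, emb_apply, if_pos rfl]

end Minimal

section Top

variable {K : Type} [Field K] [CharZero K] {n : ℕ} {π : K} {A : Matrix (Fin n) (Fin n) ℕ}
  {V : Finset (Fin n)} {C : (Fin n → ℤ) → Prop} {d : ℤ}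

theorem adm_topf {γ : Fin n → ℤ} (h : Top V γ) (hC : C γ) :
    Adm V C V.card (topf K V γ) where
  rsupp := rsupp_topf h
  fin := (Set.finite_singleton γ).subset fun μ hμ => by
    obtain ⟨S, hS⟩ := Function.ne_iff.1 hμ
    exact (topf_ne hS).1
  card := fun μ S hS => by rw [(topf_ne hS).2]
  cls := fun μ hμ => by
    obtain ⟨S, hS⟩ := Function.ne_iff.1 hμ
    exact (topf_ne hS).1 ▸ hC

theorem Adm.eq_zero {H : (Fin n → ℤ) → ExtV K (Fin n)} (hH : Adm V C d H)
    (hd : (V.card : ℤ) < d) : H = 0 := by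
  funext γ S
  by_contra h
  have h1 := hH.card γ S h
  have h2 := Finset.card_le_card (hH.rsupp γ S h).2.2.1
  omega

theorem Adm.top {H : (Fin n → ℤ) → ExtV K (Fin n)} (hH : Adm V C V.card H) {γ : Fin n → ℤ}
    {S : Finset (Fin n)} (h : H γ S ≠ 0) : S = V ∧ Top V γ := by
  obtain ⟨h1, h2, h3, h4⟩ := hH.rsupp γ S h
  have : S = V := Finset.eq_of_subset_of_card_le h3 (by exact_mod_cast (hH.card γ S h).ge)
  exact ⟨this, h2, this ▸ h4⟩

theorem Adm.eq_sum_topf {H : (Fin n → ℤ) → ExtV K (Fin n)} (hH : Adm V C V.card H) :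
    H = ∑ γ ∈ hH.fin.toFinset, H γ V • topf K V γ := by
  funext γ S
  rw [Finset.sum_apply, Finset.sum_apply]
  have e : ∀ μ, (H μ V • topf K V μ) γ S = if μ = γ then (if S = V then H γ S else 0) else 0 := by
    intro μ
    rw [Pi.smul_apply, Pi.smul_apply, topf]
    split_ifs with h1 h2
    · subst h1 h2; simp
    · subst h1; simp [h2]
    · rw [Pi.single_eq_of_ne (Ne.symm h1)]; simp
  simp only [e, Finset.sum_ite_eq']
  by_cases h : H γ S = 0
  · simp [h]
  · rw [if_pos (by simpa using fun h' => h (by simp [h'])), if_pos (hH.top h).1]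

/-- A combination of exact top forms is exact. -/
theorem exists_DR_of_topf {H : (Fin n → ℤ) → ExtV K (Fin n)} (hH : Adm V C V.card H)
    {C' : (Fin n → ℤ) → Prop} (h : ∀ γ, H γ V ≠ 0 → Top V γ →
      ∃ ξ, Adm V C' (V.card - 1) ξ ∧ DR π A V ξ = topf K V γ) :
    ∃ ξ, Adm V C' (V.card - 1) ξ ∧ DR π A V ξ = H := by
  have : ∀ s : Finset (Fin n → ℤ), ∃ ξ, Adm V C' (V.card - 1) ξ ∧
      DR π A V ξ = ∑ γ ∈ s, H γ V • topf K V γ := by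
    intro s
    induction s using Finset.induction_on with
    | empty => exact ⟨0, Adm.zero, by simp⟩
    | insert γ s hγ ih =>
      obtain ⟨ξ, h1, h2⟩ := ih
      by_cases h0 : H γ V = 0
      · exact ⟨ξ, h1, by rw [h2, Finset.sum_insert hγ, h0, zero_smul, zero_add]⟩
      · obtain ⟨ζ, h3, h4⟩ := h γ h0 (hH.top h0).2
        exact ⟨H γ V • ζ + ξ, (h3.smul _).add h1, by
          rw [map_add, map_smul, h2, h4, Finset.sum_insert hγ]⟩
  rw [hH.eq_sum_topf]
  exact this _

theorem adm_cmp_rst {H : (Fin n → ℤ) → ExtV K (Fin n)} (hH : RSupp V H)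
    (hf : {γ | H γ ≠ 0}.Finite) (C : (Fin n → ℤ) → Prop) (d : ℤ) :
    Adm V C d (rst C fun γ => cmp d (H γ)) where
  rsupp γ := by
    rw [rst_apply]
    split_ifs
    · exact cmp_mem_formsOn (hH γ) d
    · exact Submodule.zero_mem _
  fin := hf.subset fun γ h => by
    have := (rst_ne h).2
    exact fun h0 => this (by simp [h0])
  card γ S h := by
    rw [rst_apply] at h
    split_ifs at h
    · exact card_of_cmp h
    · exact absurd rfl h
  cls γ h := (rst_ne h).1

theorem opT_congr {H G : (Fin n → ℤ) → ExtV K (Fin n)} {γ : Fin n → ℤ} (h : H γ = G γ)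
    (h' : ∀ j, H (γ - row A j) = G (γ - row A j)) : DR π A V H γ = DR π A V G γ := by
  rw [DR_apply, DR_apply]
  refine Finset.sum_congr rfl fun j _ => ?_
  simp only [opT, LinearMap.coe_mk, AddHom.coe_mk, h, h']

theorem DR_rst (hC : RowInv A C) (H : (Fin n → ℤ) → ExtV K (Fin n)) :
    DR π A V (rst C H) = rst C (DR π A V H) := by
  funext γ
  rw [rst_apply]
  split_ifs with h
  · refine opT_congr ?_ fun j => ?_
    · rw [rst_apply, if_pos h]
    · rw [rst_apply, if_pos ((hC γ j).2 h)]
  · rw [← Pi.zero_apply (M := fun _ => ExtV K (Fin n)) γ, ← map_zero (DR π A V)]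
    refine opT_congr ?_ fun j => ?_
    · rw [rst_apply, if_neg h]; rfl
    · rw [rst_apply, if_neg fun h' => h ((hC γ j).1 h')]; rfl

theorem phi_rst (hC : RowInv A C) (H : (Fin n → ℤ) → ExtV K (Fin n)) :
    phi π A V (rst C H) = rst C (phi π A V H) := by
  funext γ
  rw [rst_apply]
  split_ifs with h
  · exact phi_congr fun j => by rw [rst_apply, if_pos ((hC γ j).2 h)]
  · rw [← Pi.zero_apply (M := fun _ => ExtV K (Fin n)) γ, ← map_zero (phi π A V)]
    exact phi_congr fun j => by rw [rst_apply, if_neg fun hv => h ((hC γ j).1 hv)]; rfl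

/-- The primitive of a form of exact degree in a class may be taken with the same properties. -/
theorem exists_adm_primitive (hC : RowInv A C) {w h : (Fin n → ℤ) → ExtV K (Fin n)}
    (hw : Adm V C d w) (hh : RSupp V h) (hf : {γ | h γ ≠ 0}.Finite) (e : DR π A V h = w) :
    ∃ ξ, Adm V C (d - 1) ξ ∧ DR π A V ξ = w := by
  refine ⟨_, adm_cmp_rst hh hf C (d - 1), ?_⟩
  rw [DR_rst hC]
  funext γ
  rw [rst_apply, DR_cmp, e, sub_add_cancel, cmp_eq_self (hw.card γ)]
  split_ifs with h
  · rfl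
  · by_contra h0
    exact h (hw.cls γ (Ne.symm h0))

end Top

section Reduction

variable {K : Type} [NontriviallyNormedField K] [CompleteSpace K] [CharZero K] {n : ℕ} {π : K}
  {hπ : π ≠ 0} {A : Matrix (Fin n) (Fin n) ℕ} {hA : (Aq A).det ≠ 0} {V : Finset (Fin n)}
  {C : (Fin n → ℤ) → Prop} {d : ℤ} {deg : (Fin n → ℤ) × (Fin n → ℤ) →+ ℤ}

theorem OC_of_finite {F : (Fin n → ℤ) × (Fin n → ℤ) → ExtV K (Fin n)}
    (hF : {z | F z ≠ 0}.Finite) : (sys hπ hA).OC deg F := by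
  refine ⟨1/2, ∑ z ∈ hF.toFinset, ‖F z‖ * ((1/2 : ℝ) ^ deg z)⁻¹, by norm_num, by norm_num,
    Finset.sum_nonneg fun z _ => by positivity, fun z _ => ?_⟩
  by_cases h : F z = 0
  · rw [h, norm_zero]
    exact mul_nonneg (Finset.sum_nonneg fun z _ => by positivity) (by positivity)
  · have := Finset.single_le_sum (f := fun z => ‖F z‖ * ((1/2 : ℝ) ^ deg z)⁻¹)
      (s := hF.toFinset) (fun z _ => by positivity) (a := z) (by simpa using h)
    refine le_trans (le_of_eq ?_) (mul_le_mul_of_nonneg_right this (by positivity))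
    rw [mul_assoc, inv_mul_cancel₀ (by positivity), mul_one]

/-- An allowed cocycle on the minimal stratum is cohomologous to a reduced one. -/
theorem exists_min_emb (hdeg : ∀ z, (sys hπ hA).ok z → 0 ≤ deg z)
    (hS : (sys hπ hA).Growth deg) (hq : HasWeights A) {lam : Fin n → ℤ} (hl : IsMin A V lam)
    (hC : RowInv A C) {σ : (Fin n → ℤ) → ExtV K (Fin n)} (hσ : Adm V C d σ)
    (h0 : NonnegOn A Finset.univ σ) (hD : DR π A V σ = 0) :
    ∃ h, Adm V C (d - 1) h ∧ NonnegOn A Finset.univ h ∧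
      (sys hπ hA).Min (emb lam (σ - DR π A V h)) := by
  have hDe : (sys hπ hA).D (emb lam σ) = 0 := by rw [D_emb π V hA hπ hl hσ.rsupp h0, hD, map_zero]
  have hfin : {z | emb (K := K) lam σ z ≠ 0}.Finite := by
    refine (hσ.fin.image fun γ => (γ, lam)).subset fun z hz => ?_
    rw [Set.mem_ofPred_eq, emb_apply] at hz
    split_ifs at hz with h
    · exact ⟨z.1, hz, Prod.ext rfl h.symm⟩
    · exact absurd rfl hz
  obtain ⟨M, hM⟩ : ∃ M : ℚ, ∀ γ, σ γ ≠ 0 → sa A γ ≤ M := by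
    obtain ⟨M, hM⟩ := (hσ.fin.image (sa A)).bddAbove
    exact ⟨M, fun γ h => hM ⟨γ, h, rfl⟩⟩
  obtain ⟨b, b1, -, b3, b4⟩ := KSys.exists_reduce hdeg hS
    (emb_supp π V hA hπ hl hσ.rsupp h0) (OC_of_finite hfin) hDe
    (Finset.univ.map Function.Embedding.inl)
  let U : (Fin n → ℤ) × (Fin n → ℤ) → Submodule K (ExtV K (Fin n)) := fun z =>
    formsOn K fun S => z.2 = lam ∧ sa A z.1 ≤ M ∧ C z.1 ∧ RS V z.1 S
  have hgood : ∀ κ ∈ (Finset.univ.map Function.Embedding.inl : Finset (Fin n ⊕ Fin n)),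
      (sys hπ hA).Good κ U := by
    intro κ hκ
    simp only [Finset.mem_map, Finset.mem_univ, true_and] at hκ
    obtain ⟨j, rfl⟩ := hκ
    constructor
    · intro z hz hx v hv S hSv
      obtain ⟨h1, h2, h3, h4⟩ := hv S hSv
      change z.2 + 0 = lam at h1
      change sa A (z.1 + row A j) ≤ M at h2
      change C (z.1 + row A j) at h3
      change RS V (z.1 + row A j) S at h4
      rw [add_zero] at h1
      rw [map_add, sa_row hA] at h2
      have h3' := (hC _ j).2 h3
      rw [add_sub_cancel_right] at h3'
      have hzz : z = (z.1, lam) := Prod.ext rfl h1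
      rw [hzz, sys_ok_min π V hA hπ hl] at hz
      have hcoord : ∀ k, (z.1 k : ℚ) = ∑ i, crd A i z.1 * A i k := fun k =>
        (sum_crd_mul hA z.1 k).symm
      refine ⟨h1, by linarith, h3', fun k => ?_, hz.2, h4.2.2.1, fun k hk => ?_⟩
      · have : (0 : ℚ) ≤ z.1 k := by
          rw [hcoord]
          exact Finset.sum_nonneg fun i _ => mul_nonneg (hz.1 i) (Nat.cast_nonneg _)
        exact_mod_cast this
      · have hx' : 0 < crd A j z.1 := hx
        by_cases hjk : A j k = 0
        · have := h4.2.2.2 k hk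
          simpa [row, hjk] using this
        · have : (0 : ℚ) < z.1 k := by
            rw [hcoord]
            exact Finset.sum_pos' (fun i _ => mul_nonneg (hz.1 i) (Nat.cast_nonneg _))
              ⟨j, Finset.mem_univ _, mul_pos hx' (by exact_mod_cast Nat.pos_of_ne_zero hjk)⟩
          exact_mod_cast this
    · intro z hz hx v hv
      refine EA_mem_formsOn π A hv fun k S hjk hk h => ⟨h.1, h.2.1, h.2.2.1, RS_insert _ h.2.2.2 ?_⟩
      intro hk0
      have hx' : 0 < crd A j z.1 := hx
      exact hx'.ne' (crd_eq_zero_of hA ((sys_ok_iff hπ hA z).1 hz).1 hk0 hjk)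
    · intro z hz hx v hv
      exact EAdual_mem_formsOn π A hv fun k S hk h => ⟨h.1, h.2.1, h.2.2.1, RS_erase _ h.2.2.2⟩
  have hU : ∀ z, emb lam σ z ∈ U z := by
    intro z S hSz
    rw [emb_apply] at hSz
    split_ifs at hSz with h
    · have hne : σ z.1 ≠ 0 := fun h0 => hSz (by rw [h0]; rfl)
      exact ⟨h, hM _ hne, hσ.cls _ hne, hσ.rsupp _ S hSz⟩
    · exact absurd rfl hSz
  obtain ⟨hbU, -⟩ := b4 U hgood hU
  set g : (Fin n → ℤ) → ExtV K (Fin n) := fun γ => b (γ, lam) with hg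
  have hgU : ∀ γ S, g γ S ≠ 0 → sa A γ ≤ M ∧ C γ ∧ RS V γ S := fun γ S h => (hbU (γ, lam) S h).2
  have hgne : ∀ γ, g γ ≠ 0 → sa A γ ≤ M ∧ C γ ∧ ∃ S, RS V γ S := fun γ h => by
    obtain ⟨S, hS⟩ := Function.ne_iff.1 h
    exact ⟨(hgU γ S hS).1, (hgU γ S hS).2.1, S, (hgU γ S hS).2.2⟩
  have hgR : RSupp V g := fun γ S h => (hgU γ S h).2.2
  have hgN : NonnegOn A Finset.univ g := fun γ h j _ => ((sys_ok_iff hπ hA _).1 (b1 _ h)).1 j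
  have hgF : {γ | g γ ≠ 0}.Finite := (finite_sa_le hA hq M).subset fun γ h => by
    obtain ⟨h1, -, S, h2⟩ := hgne γ h
    exact ⟨h2.1, h1⟩
  have hbe : b = emb lam g := by
    funext z S
    rw [emb_apply]
    split_ifs with h
    · rw [hg, ← h]
    · by_contra hne
      exact h (hbU z S hne).1
  have hgeq : rst C (fun γ => cmp (d - 1) (g γ)) = fun γ => cmp (d - 1) (g γ) := by
    funext γ
    rw [rst_apply]
    split_ifs with h
    · rfl
    · by_cases h' : g γ = 0
      · rw [h', map_zero]
      · exact absurd (hgne γ h').2.1 h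
  have hadm := adm_cmp_rst hgR hgF C (d - 1)
  rw [hgeq] at hadm
  have hnn : NonnegOn A Finset.univ fun γ => cmp (d - 1) (g γ) := fun γ h => hgN γ fun h' =>
    h (by change cmp (d - 1) (g γ) = 0; rw [h', map_zero])
  refine ⟨_, hadm, hnn, ?_⟩
  have hw : ∀ γ, (σ - DR π A V fun γ => cmp (d - 1) (g γ)) γ = cmp d ((σ - DR π A V g) γ) := by
    intro γ
    rw [Pi.sub_apply, Pi.sub_apply, map_sub, DR_cmp, sub_add_cancel, cmp_eq_self (hσ.card γ)]
  have hsub : RSupp V (σ - DR π A V fun γ => cmp (d - 1) (g γ)) := fun γ =>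
    (formsOn K _).sub_mem (hσ.rsupp γ) (hadm.rsupp.DR π V hA hπ γ)
  have hnn' := h0.sub (DR_nonnegOn (π := π) (V := V) hA hnn)
  refine ⟨emb_supp π V hA hπ hl hsub hnn', ?_⟩
  rintro (j | i) z
  · have := b3 (Sum.inl j) (by simp) z
    rw [hbe, D_emb π V hA hπ hl hgR hgN, ← map_sub, emb_apply] at this
    rw [emb_apply]
    split_ifs at this ⊢ with hz
    · rw [hw]
      unfold KSys.Red at this ⊢
      split_ifs at this ⊢
      · trivial
      · rw [LinearMap.mem_ker] at this ⊢
        change EA K π A j _ = 0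
        rw [← cmp_EA]
        change EA K π A j _ = 0 at this
        rw [this, map_zero]
      · rw [Submodule.mem_bot] at this ⊢
        rw [this, map_zero]
    · exact Submodule.zero_mem _
  · rw [emb_apply]
    split_ifs with hz
    · have hx : (sys hπ hA).x (Sum.inr i) z = crd Aᵀ i lam := by rw [← hz]; rfl
      unfold KSys.Red
      rw [hx]
      split_ifs with h1 h2
      · trivial
      · refine LinearMap.mem_ker.2 (contrE_eq_zero (hsub z.1) fun S hS hi => ?_)
        exact h1 ((hl.mem_iff i).1 (hS.2.2.1 hi)).le
      · exact absurd (hl.lt_one i).le h2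
    · exact Submodule.zero_mem _

end Reduction

section Threshold

variable {n : ℕ} {A : Matrix (Fin n) (Fin n) ℕ} {V : Finset (Fin n)}

/-- The critical value of the sum of the coordinates in a class. -/
noncomputable def crit (A : Matrix (Fin n) (Fin n) ℕ) (V : Finset (Fin n)) (γ : Fin n → ℤ) : ℚ :=
  V.card / 2 + ∑ j ∈ frs A γ, (Int.fract (crd A j γ) - 1 / 2)

theorem mem_frs {γ : Fin n → ℤ} {j : Fin n} :
    j ∈ frs A γ ↔ Int.fract (crd A j γ) ≠ 0 := by
  rw [frs, Finset.mem_filter, ne_eq, Int.fract_eq_zero_iff, Set.mem_range]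
  simp only [Finset.mem_univ, true_and, eq_comm]

theorem Cls.crit_eq {γ γ' : Fin n → ℤ} (h : Cls A γ γ') : crit A V γ = crit A V γ' := by
  unfold crit
  rw [h.frs_eq]
  congr 1
  refine Finset.sum_congr rfl fun j _ => ?_
  obtain ⟨z, hz⟩ := h j
  rw [hz, Int.fract_add_intCast]

theorem crit_neg (γ : Fin n → ℤ) : crit A V (-γ) = V.card - crit A V γ := by
  have hf : frs A (-γ) = frs A γ := by
    ext j
    rw [mem_frs, mem_frs, map_neg, ne_eq, ne_eq, Int.fract_neg_eq_zero]
  unfold crit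
  rw [hf, Finset.sum_congr rfl fun j hj => by
    rw [map_neg, Int.fract_neg (mem_frs.1 hj)]]
  simp only [Finset.sum_sub_distrib, Finset.sum_const, nsmul_eq_mul]
  ring

theorem sa_sub_crit {γ : Fin n → ℤ} (h0 : ∀ j, 0 ≤ crd A j γ) (h1 : ∀ j, crd A j γ ≤ 1) :
    sa A γ - crit A V γ = rk A γ - ((frs A γ).card + V.card) / 2 := by
  have e : sa A γ = ∑ j ∈ frs A γ, (Int.fract (crd A j γ) - 1) + rk A γ := by
    rw [sa_apply, rk, Finset.card_filter]
    push_cast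
    have : ∑ j ∈ frs A γ, (Int.fract (crd A j γ) - 1)
        = ∑ j, if j ∈ frs A γ then Int.fract (crd A j γ) - 1 else 0 := by simp
    rw [this, ← Finset.sum_add_distrib]
    refine Finset.sum_congr rfl fun j _ => ?_
    split_ifs with h2 h3 h3
    · have hne : crd A j γ ≠ 1 := fun h => mem_frs.1 h2 (by rw [h, Int.fract_one])
      rw [Int.fract_eq_self.2 ⟨h0 j, lt_of_le_of_ne (h1 j) hne⟩]
      ring
    · exact absurd (by rw [not_not.1 h3, Int.fract_zero]) (mem_frs.1 h2)
    · rw [zero_add]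
      by_contra hn
      exact h2 (mem_frs_of (h0 j) (h1 j) h3 hn)
    · rw [not_not.1 h3]; simp
  rw [e, crit]
  simp only [Finset.sum_sub_distrib, Finset.sum_const, nsmul_eq_mul]
  ring

end Threshold

section Exact

variable {K : Type} [NontriviallyNormedField K] [CompleteSpace K] [CharZero K] {n : ℕ} {π : K}
  {hπ : π ≠ 0} {A : Matrix (Fin n) (Fin n) ℕ} {hA : (Aq A).det ≠ 0} {V : Finset (Fin n)}
  {C : (Fin n → ℤ) → Prop} {d : ℤ} {deg : (Fin n → ℤ) × (Fin n → ℤ) →+ ℤ}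

theorem min_emb_rst {lam : Fin n → ℤ} {w : (Fin n → ℤ) → ExtV K (Fin n)}
    (hm : (sys hπ hA).Min (emb lam w)) (P : (Fin n → ℤ) → Prop) :
    (sys hπ hA).Min (emb lam (rst P w)) := by
  have h : ∀ z, emb lam (rst P w) z = emb lam w z ∨ emb lam (rst P w) z = 0 := fun z => by
    rw [emb_apply, emb_apply, rst_apply]
    split_ifs <;> simp
  constructor
  · intro z hz
    rcases h z with e | e
    · exact hm.supp z (e ▸ hz)
    · exact absurd e hz
  · intro κ z
    rcases h z with e | e
    · exact e ▸ hm.red κ z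
    · exact e ▸ Submodule.zero_mem _

theorem min_emb_bounds {lam : Fin n → ℤ} {w : (Fin n → ℤ) → ExtV K (Fin n)}
    (hm : (sys hπ hA).Min (emb lam w)) {γ : Fin n → ℤ} (h : w γ ≠ 0) :
    (∀ j, 0 ≤ crd A j γ) ∧ ∀ j, crd A j γ ≤ 1 := by
  have hw : emb lam w (γ, lam) ≠ 0 := by rwa [emb_apply, if_pos rfl]
  exact ⟨((sys_ok_iff hπ hA _).1 (hm.supp _ hw)).1, fun j => hm.le_one (κ := Sum.inl j) hw⟩

/-- Top forms above the critical value are exact for the Koszul differential. -/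
theorem topf_exact (hdet : 0 < (A.map ((↑) : ℕ → ℤ)).det)
    (hdeg : ∀ z, (sys hπ hA).ok z → 0 ≤ deg z) (hS : (sys hπ hA).Growth deg)
    (hq : HasWeights A) (hreg : KosReg K A V) {lam : Fin n → ℤ} (hl : IsMin A V lam)
    {γ : Fin n → ℤ} (hγ : Top V γ) (hgt : crit A V γ < sa A γ) :
    ∃ η, RSupp V η ∧ {μ | η μ ≠ 0}.Finite ∧ phi π A V η = topf K V γ := by
  set C : (Fin n → ℤ) → Prop := fun μ => Cls A μ γ with hCdef
  have hC : RowInv A C := rowInv_cls hA γ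
  have hT : Adm V C V.card (topf K V γ) := adm_topf hγ (Cls.refl γ)
  have hTD : DR π A V (topf K V γ) = 0 := (hT.DR hA hπ hC).eq_zero (by omega)
  obtain ⟨ζ, hζ, hζn⟩ := exists_nonneg hdet hπ hC hT (by rw [hTD]; exact fun μ h => absurd rfl h)
  have hσ : Adm V C V.card (topf K V γ - DR π A V ζ) := by
    have := hζ.DR hA hπ hC
    rw [sub_add_cancel] at this
    exact hT.sub this
  obtain ⟨h, hh, hhn, hm⟩ := exists_min_emb hdeg hS hq hl hC hσ hζn
    ((hσ.DR hA hπ hC).eq_zero (by omega))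
  set w := topf K V γ - DR π A V ζ - DR π A V h with hw
  have hwA : Adm V C V.card w := by
    have := hh.DR hA hπ hC
    rw [sub_add_cancel] at this
    exact hσ.sub this
  have hwn : NonnegOn A Finset.univ w := fun μ hμ j _ => (min_emb_bounds hm hμ).1 j
  set P : (Fin n → ℤ) → Prop := fun μ => ((frs A μ).card : ℤ) < 2 * rk A μ - V.card with hP
  have hhi := hwA.rst P
  obtain ⟨k, hk1, hk2, -, hk3⟩ := exists_of_high hl hhi.rsupp
    (fun μ hμ => hwn μ (rst_ne hμ).2) (min_emb_rst hm P)
    ((hhi.DR hA hπ hC).eq_zero (by omega)) (fun μ S hS => by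
      have h1 := (rst_ne (P := P) fun h0 => hS (by rw [h0]; rfl)).1
      rw [hhi.card μ S hS]
      exact h1)
  obtain ⟨k', hk', hk'e⟩ := exists_adm_primitive hC hhi hk1 hk2 hk3
  have hη1 : Adm V C (V.card - 1) (ζ + h + k') := (hζ.add hh).add hk'
  have hDη : DR π A V (ζ + h + k') = topf K V γ - rst (fun μ => ¬ P μ) w := by
    rw [map_add, map_add, hk'e, hw]
    funext μ
    simp only [Pi.add_apply, Pi.sub_apply, rst_apply]
    split_ifs
    · simp
    · abel
  have hlow : ∀ μ, rst (fun μ => ¬ P μ) w μ ≠ 0 → wt A μ < wt A γ := by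
    intro μ hμ
    obtain ⟨h1, h2⟩ := rst_ne hμ
    obtain ⟨h3, h4⟩ := min_emb_bounds hm h2
    have h5 := sa_sub_crit (V := V) h3 h4
    rw [(hwA.cls μ h2).crit_eq] at h5
    have h6 : (2 * rk A μ : ℚ) - V.card ≤ (frs A μ).card := by exact_mod_cast not_lt.1 h1
    have h7 : sa A μ < sa A γ := by linarith
    have hdq : (0 : ℚ) < (Aq A).det := by rw [det_Aq]; exact_mod_cast hdet
    have : (wt A μ : ℚ) < wt A γ := by
      rw [wt_eq hA, wt_eq hA]
      exact mul_lt_mul_of_pos_left h7 hdq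
    exact_mod_cast this
  obtain ⟨ξ, hξ, hξl⟩ := exists_lower hdet hπ hq hreg hC (by omega : (V.card : ℤ) - 1 < V.card)
    (wt A γ) hη1 (fun μ hμ => by
      rw [hDη, Pi.sub_apply] at hμ
      by_cases h1 : rst (fun μ => ¬ P μ) w μ = 0
      · rw [h1, sub_zero] at hμ
        obtain ⟨S, hS⟩ := Function.ne_iff.1 hμ
        rw [(topf_ne hS).1]
      · exact (hlow μ h1).le)
  set η2 := ζ + h + k' - DR π A V ξ with hη2
  have hη2A : Adm V C (V.card - 1) η2 := by
    have := hξ.DR hA hπ hC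
    rw [sub_add_cancel] at this
    exact hη1.sub this
  have hDη2 : DR π A V η2 = topf K V γ - rst (fun μ => ¬ P μ) w := by
    rw [hη2, map_sub, DR_DR _ V hA, sub_zero, hDη]
  set L := wt A γ - (A.map ((↑) : ℕ → ℤ)).det with hL
  have hη3 := hη2A.rst fun μ => wt A μ = L
  refine ⟨_, hη3.rsupp, hη3.fin, ?_⟩
  funext μ
  by_cases hμ : wt A μ = wt A γ
  · have e1 : phi π A V (rst (fun μ => wt A μ = L) η2) μ = phi π A V η2 μ :=
      phi_congr fun j => by rw [rst_apply, if_pos (by rw [map_sub, wt_row hA, hμ])]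
    have e2 : η2 μ = 0 := by
      by_contra h0
      have := hξl μ h0
      omega
    rw [e1, ← DR_eq_phi hA hπ e2, hDη2, Pi.sub_apply]
    have : rst (fun μ => ¬ P μ) w μ = 0 := by
      by_contra h0
      exact (hlow μ h0).ne hμ
    rw [this, sub_zero]
  · have e1 : phi π A V (rst (fun μ => wt A μ = L) η2) μ = phi π A V 0 μ :=
      phi_congr fun j => by
        rw [rst_apply, if_neg (by rw [map_sub, wt_row hA]; omega)]; rfl
    rw [e1, map_zero]
    by_contra h0
    obtain ⟨S, hS⟩ := Function.ne_iff.1 (Ne.symm h0)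
    exact hμ (by rw [(topf_ne hS).1])

/-- Top forms below the critical value are exact. -/
theorem topf_eq_DR (hdet : 0 < (A.map ((↑) : ℕ → ℤ)).det)
    (hdeg : ∀ z, (sys hπ hA).ok z → 0 ≤ deg z) (hS : (sys hπ hA).Growth deg)
    (hq : HasWeights A) (hreg : KosReg K A V) {lam : Fin n → ℤ} (hl : IsMin A V lam)
    (N : ℕ) : ∀ γ : Fin n → ℤ, wt A γ < N → Top V γ → sa A γ < crit A V γ →
    ∃ ξ, Adm V (fun _ => True) (V.card - 1) ξ ∧ DR π A V ξ = topf K V γ := by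
  induction N with
  | zero =>
    intro γ h hγ _
    have := (adm_topf (K := K) (C := fun _ => True) hγ trivial).wt_nonneg hdet hq (γ := γ)
      (fun h0 => one_ne_zero (α := K) (by
        have := congrFun h0 V
        simp [topf] at this))
    exact absurd h (by simpa using this)
  | succ N ih =>
    intro γ hN hγ hlt
    obtain ⟨η, hη, hηe⟩ := topf_exact_of_dual hA hπ hreg hγ fun γ' hγ' hc hs =>
      topf_exact hdet hdeg hS hq hreg hl hγ' (by rw [hc.crit_eq, crit_neg, hs]; linarith)
    set L := wt A γ - (A.map ((↑) : ℕ → ℤ)).det with hL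
    set C : (Fin n → ℤ) → Prop := fun μ => Cls A μ γ with hCdef
    have hC : RowInv A C := rowInv_cls hA γ
    have hdq : (0 : ℚ) < (Aq A).det := by rw [det_Aq]; exact_mod_cast hdet
    have hη' : RSupp V (rst (fun μ => wt A μ = L) η) := fun μ => by
      rw [rst_apply]; split_ifs
      · exact hη μ
      · exact Submodule.zero_mem _
    have hfin : {μ | rst (fun μ => wt A μ = L) η μ ≠ 0}.Finite := by
      refine (finite_sa_le hA hq (L / (Aq A).det)).subset fun μ h => ?_
      obtain ⟨h1, h2⟩ := rst_ne h
      obtain ⟨S, hS⟩ := Function.ne_iff.1 h2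
      refine ⟨(hη μ S hS).1, ?_⟩
      rw [le_div_iff₀ hdq, ← h1, wt_eq hA, mul_comm]
    have hA1 := adm_cmp_rst hη' hfin C (V.card - 1)
    set η1 := rst C fun μ => cmp (V.card - 1) (rst (fun μ => wt A μ = L) η μ) with hη1
    have hwt1 : ∀ μ, η1 μ ≠ 0 → wt A μ = L := fun μ h => by
      have h1 := (rst_ne h).2
      exact (rst_ne (P := fun μ => wt A μ = L) (H := η) fun h0 => h1 (by simp [h0])).1
    have hphi : phi π A V η1 = topf K V γ := by
      rw [hη1, phi_rst hC]
      funext μ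
      rw [rst_apply, phi_cmp, sub_add_cancel]
      by_cases hμ : wt A μ = wt A γ
      · have e1 : phi π A V (rst (fun μ => wt A μ = L) η) μ = phi π A V η μ :=
          phi_congr fun j => by rw [rst_apply, if_pos (by rw [map_sub, wt_row hA, hμ])]
        rw [e1, hηe]
        split_ifs with h
        · exact cmp_eq_self fun S hS => by rw [(topf_ne hS).2]
        · by_contra h0
          obtain ⟨S, hS⟩ := Function.ne_iff.1 (Ne.symm h0)
          exact h (by rw [(topf_ne hS).1]; exact Cls.refl γ)
      · have e1 : phi π A V (rst (fun μ => wt A μ = L) η) μ = phi π A V 0 μ :=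
          phi_congr fun j => by
            rw [rst_apply, if_neg (by rw [map_sub, wt_row hA]; omega)]; rfl
        rw [e1, map_zero, Pi.zero_apply, map_zero, ite_self]
        by_contra h0
        obtain ⟨S, hS⟩ := Function.ne_iff.1 (Ne.symm h0)
        exact hμ (by rw [(topf_ne hS).1])
    have hR : Adm V C V.card (topf K V γ - DR π A V η1) := by
      have := hA1.DR hA hπ hC
      rw [sub_add_cancel] at this
      exact (adm_topf (C := C) hγ (Cls.refl γ)).sub this
    have hRwt : ∀ μ, (topf K V γ - DR π A V η1) μ ≠ 0 → wt A μ < wt A γ := by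
      intro μ h
      by_contra hge
      refine h ?_
      have e2 : η1 μ = 0 := by
        by_contra h0
        have := hwt1 μ h0
        omega
      rw [Pi.sub_apply, DR_eq_phi hA hπ e2, hphi, sub_self]
    obtain ⟨ξ, h1, h2⟩ := exists_DR_of_topf (π := π) (A := A) hR (C' := fun _ => True)
      fun μ hμ hT => by
        have hne : (topf K V γ - DR π A V η1) μ ≠ 0 := fun h0 => hμ (by rw [h0]; rfl)
        have h3 := hRwt μ hne
        refine ih μ (by push_cast at hN; omega) hT ?_
        rw [(hR.cls μ hne).crit_eq]
        refine lt_trans ?_ hlt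
        have : (wt A μ : ℚ) < wt A γ := by exact_mod_cast h3
        rw [wt_eq hA, wt_eq hA] at this
        exact lt_of_mul_lt_mul_left this hdq.le
    refine ⟨ξ + η1, h1.add ⟨hA1.rsupp, hA1.fin, hA1.card, fun _ _ => trivial⟩, ?_⟩
    rw [map_add, h2]
    abel

/-- Forms of top degree below the critical value are exact. -/
theorem exists_of_low (hdet : 0 < (A.map ((↑) : ℕ → ℤ)).det)
    (hdeg : ∀ z, (sys hπ hA).ok z → 0 ≤ deg z) (hS : (sys hπ hA).Growth deg)
    (hq : HasWeights A) (hreg : KosReg K A V) {lam : Fin n → ℤ} (hl : IsMin A V lam)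
    {H : (Fin n → ℤ) → ExtV K (Fin n)} (hH : Adm V (fun _ => True) V.card H)
    (hlow : ∀ γ, H γ ≠ 0 → sa A γ < crit A V γ) :
    ∃ ξ, Adm V (fun _ => True) (V.card - 1) ξ ∧ DR π A V ξ = H := by
  refine exists_DR_of_topf hH fun γ hγ hT =>
    topf_eq_DR hdet hdeg hS hq hreg hl ((wt A γ).toNat + 1) γ (by push_cast; omega) hT
      (hlow γ fun h => hγ (by rw [h]; rfl))

end Exact

section Middle

variable {K : Type} [NontriviallyNormedField K] [CompleteSpace K] [CharZero K] {n : ℕ} {π : K}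
  {hπ : π ≠ 0} {A : Matrix (Fin n) (Fin n) ℕ} {hA : (Aq A).det ≠ 0} {V : Finset (Fin n)}
  {deg : (Fin n → ℤ) × (Fin n → ℤ) →+ ℤ}

theorem min_emb_cmp {lam : Fin n → ℤ} {w : (Fin n → ℤ) → ExtV K (Fin n)}
    (hm : (sys hπ hA).Min (emb lam w)) (d : ℤ) :
    (sys hπ hA).Min (emb lam fun γ => cmp d (w γ)) := by
  have h : ∀ z, emb lam (fun γ => cmp d (w γ)) z = cmp d (emb lam w z) := fun z => by
    rw [emb_apply, emb_apply]
    split_ifs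
    · rfl
    · rw [map_zero]
  rw [KSys.min_iff] at hm ⊢
  have hne : ∀ z, emb lam (fun γ => cmp d (w γ)) z ≠ 0 → emb lam w z ≠ 0 := fun z hz h0 =>
    hz (by rw [h, h0, map_zero])
  refine ⟨fun z hz => hm.1 z (hne z hz), fun κ z hz => hm.2.1 κ z (hne z hz), ?_⟩
  rintro (j | i) z hx
  · have := hm.2.2 (Sum.inl j) z hx
    change EA K π A j _ = 0 at this
    change EA K π A j _ = 0
    rw [h, ← cmp_EA, this, map_zero]
  · have := hm.2.2 (Sum.inr i) z hx
    change contrE K i _ = 0 at this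
    change contrE K i _ = 0
    rw [h, ← cmp_contrE, this, map_zero]

/-- Below the middle range, all cohomology on a minimal stratum vanishes. -/
theorem exists_mid_layer (hdet : 0 < (A.map ((↑) : ℕ → ℤ)).det)
    (hdeg : ∀ z, (sys hπ hA).ok z → 0 ≤ deg z) (hS : (sys hπ hA).Growth deg)
    (hq : HasWeights A) (hreg : KosReg K A V) {lam : Fin n → ℤ} (hl : IsMin A V lam)
    {h : (Fin n → ℤ) → ExtV K (Fin n)} (hh : RSupp V h) (hf : {γ | h γ ≠ 0}.Finite)
    (hm : (sys hπ hA).Min (emb lam h)) (hD : DR π A V h = 0) :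
    ∃ ξ, RSupp V ξ ∧ {γ | ξ γ ≠ 0}.Finite ∧ NonnegOn A Finset.univ ξ ∧
      ∀ γ S, (h - DR π A V ξ) γ S ≠ 0 → h γ ≠ 0 ∧ S = V ∧
        2 * rk A γ = V.card + (frs A γ).card := by
  have hCt : RowInv A fun _ => True := fun _ _ => Iff.rfl
  have hcmp : ∀ d : ℤ, Adm V (fun _ => True) d fun γ => cmp d (h γ) := fun d => by
    have := adm_cmp_rst hh hf (fun _ => True) d
    convert this using 1
    funext γ
    rw [rst_apply, if_pos trivial]
  have hDc : ∀ d : ℤ, DR π A V (fun γ => cmp d (h γ)) = 0 := fun d => by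
    funext γ
    rw [DR_cmp, hD]
    exact map_zero _
  have hnn : ∀ d : ℤ, NonnegOn A Finset.univ fun γ => cmp d (h γ) := fun d γ hγ j _ =>
    (min_emb_bounds (min_emb_cmp hm d) hγ).1 j
  set M : (Fin n → ℤ) → Prop := fun γ => 2 * rk A γ = V.card + (frs A γ).card with hM
  set mid := rst M fun γ => cmp V.card (h γ) with hmid
  have key : ∀ d : ℤ, ∃ ξ, RSupp V ξ ∧ {γ | ξ γ ≠ 0}.Finite ∧ NonnegOn A Finset.univ ξ ∧
      DR π A V ξ = (fun γ => cmp d (h γ)) - if d = V.card then mid else 0 := by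
    intro d
    have fin_of : ∀ w : (Fin n → ℤ) → ExtV K (Fin n), NonnegOn A Finset.univ w →
        (∃ ξ, Adm V (fun _ => True) (d - 1) ξ ∧ DR π A V ξ = w) →
        ∃ ξ, RSupp V ξ ∧ {γ | ξ γ ≠ 0}.Finite ∧ NonnegOn A Finset.univ ξ ∧ DR π A V ξ = w := by
      rintro w hw ⟨ξ, h1, h2⟩
      obtain ⟨ζ, h3, h4, h5⟩ := exists_nonneg_primitive hdet hπ hCt h1 (by rwa [h2])
      exact ⟨ζ, h3.rsupp, h3.fin, h4, by rw [h5, h2]⟩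
    rcases lt_trichotomy d V.card with hd | hd | hd
    · rw [if_neg hd.ne, sub_zero]
      exact fin_of _ (hnn d) (exists_DR_eq hdet hπ hq hreg hCt hd (hcmp d) (hDc d))
    · rw [if_pos hd]
      subst hd
      have hc := hcmp V.card
      have hrn : ∀ P, NonnegOn A Finset.univ (rst P fun γ => cmp V.card (h γ)) := fun P γ hγ =>
        hnn _ γ (rst_ne hγ).2
      have hrD : ∀ P, DR π A V (rst P fun γ => cmp V.card (h γ)) = 0 := fun P =>
        ((hc.rst P).DR hA hπ hCt).eq_zero (by omega)
      set Hi : (Fin n → ℤ) → Prop := fun γ => V.card + (frs A γ).card < 2 * rk A γ with hHi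
      set Lo : (Fin n → ℤ) → Prop := fun γ => 2 * rk A γ < V.card + (frs A γ).card with hLo
      obtain ⟨k, hk1, hk2, hk3, hk4⟩ := exists_of_high hl (hc.rst Hi).rsupp (hrn Hi)
        (min_emb_rst (min_emb_cmp hm _) Hi) (hrD Hi) (fun γ S hγ => by
          have h1 : Hi γ := (rst_ne (P := Hi) fun h0 => hγ (by rw [h0]; rfl)).1
          rw [(hc.rst Hi).card γ S hγ]
          simp only [hHi] at h1
          omega)
      obtain ⟨ξ, h1, h2, h3, h4⟩ := fin_of (rst Lo fun γ => cmp V.card (h γ)) (hrn Lo)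
        (exists_of_low hdet hdeg hS hq hreg hl (hc.rst Lo) fun γ hγ => by
          obtain ⟨hγ1, hγ2⟩ := rst_ne hγ
          obtain ⟨b0, b1⟩ := min_emb_bounds (min_emb_cmp hm _) hγ2
          have := sa_sub_crit (V := V) b0 b1
          have : (2 * rk A γ : ℚ) < V.card + (frs A γ).card := by exact_mod_cast hγ1
          linarith)
      refine ⟨k + ξ, fun γ => (formsOn K _).add_mem (hk1 γ) (h1 γ), ?_, ?_, ?_⟩
      · refine (hk2.union h2).subset fun γ hγ => ?_
        by_contra hn
        simp only [Set.mem_union, Set.mem_ofPred_eq, not_or, not_not] at hn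
        exact hγ (by rw [Pi.add_apply, hn.1, hn.2, add_zero])
      · intro γ hγ j hj
        by_cases hkγ : k γ = 0
        · exact h3 γ (fun h0 => hγ (by rw [Pi.add_apply, hkγ, h0, add_zero])) j hj
        · exact hk3 γ hkγ j hj
      · rw [map_add, hk4, h4, hmid]
        funext γ
        simp only [Pi.add_apply, Pi.sub_apply, rst_apply, hHi, hLo, hM]
        rcases lt_trichotomy (2 * rk A γ) (V.card + (frs A γ).card) with e | e | e
        · rw [if_neg e.not_gt, if_pos e, if_neg e.ne]; simp
        · rw [if_neg e.not_gt, if_neg e.not_lt, if_pos e]; simp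
        · rw [if_pos e, if_neg e.not_gt, if_neg e.ne']; simp
    · rw [if_neg hd.ne', sub_zero]
      exact ⟨0, fun γ => Submodule.zero_mem _, by simp, fun γ hγ => absurd rfl hγ, by
        rw [(hcmp d).eq_zero hd, map_zero]⟩
  choose ξ h1 h2 h3 h4 using key
  refine ⟨∑ d ∈ Finset.range (n + 1), ξ d, fun γ => ?_, ?_, ?_, ?_⟩
  · rw [Finset.sum_apply]
    exact Submodule.sum_mem _ fun d _ => h1 d γ
  · refine (Set.Finite.biUnion (Finset.range (n + 1)).finite_toSet fun d _ => h2 d).subset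
      fun γ hγ => ?_
    rw [Set.mem_ofPred_eq, Finset.sum_apply] at hγ
    obtain ⟨d, hd, hne⟩ := Finset.exists_ne_zero_of_sum_ne_zero hγ
    exact Set.mem_biUnion (by simpa using hd) hne
  · intro γ hγ j hj
    rw [Finset.sum_apply] at hγ
    obtain ⟨d, hd, hne⟩ := Finset.exists_ne_zero_of_sum_ne_zero hγ
    exact h3 d γ hne j hj
  · have e : h - DR π A V (∑ d ∈ Finset.range (n + 1), ξ d) = mid := by
      rw [map_sum, Finset.sum_congr rfl fun (d : ℕ) _ => h4 d, Finset.sum_sub_distrib]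
      have e1 : ∑ d ∈ Finset.range (n + 1), (fun γ => cmp (d : ℤ) (h γ)) = h := by
        funext γ
        rw [Finset.sum_apply]
        exact sum_cmp (h γ)
      have e2 : (∑ d ∈ Finset.range (n + 1), if (d : ℤ) = V.card then mid else 0) = mid := by
        simp only [Nat.cast_inj, Finset.sum_ite_eq', Finset.mem_range]
        rw [if_pos]
        have := Finset.card_le_univ V
        rw [Fintype.card_fin] at this
        omega
      rw [e1, e2]
      abel
    intro γ S hγ
    rw [e] at hγ
    obtain ⟨g1, g2⟩ := rst_ne (P := M) fun h0 : mid γ = 0 => hγ (by rw [h0]; rfl)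
    exact ⟨fun h0 => g2 (by simp [h0]), (((hcmp V.card).rst M).top hγ).1, g1⟩

/-- Every reduced cocycle is cohomologous to one concentrated in the middle range. -/
theorem exists_mid (hdet : 0 < (A.map ((↑) : ℕ → ℤ)).det)
    (hdeg : ∀ z, (sys hπ hA).ok z → 0 ≤ deg z) (hS : (sys hπ hA).Growth deg)
    (hq : HasWeights A) (hreg : ∀ V lam, IsMin A V lam → KosReg K A V)
    {c : (Fin n → ℤ) × (Fin n → ℤ) → ExtV K (Fin n)} (hc : MinE hπ hA c)
    (hD : (sys hπ hA).D c = 0) :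
    ∃ b, (sys hπ hA).Supp b ∧ {z | b z ≠ 0}.Finite ∧
      ∀ z S, (c - (sys hπ hA).D b) z S ≠ 0 → (sys hπ hA).ok z ∧ (∀ i, crd Aᵀ i z.2 < 1) ∧
        S = Finset.univ.filter (fun i => crd Aᵀ i z.2 = 0) ∧
        2 * rk A z.1 = S.card + (frs A z.1).card := by
  have hcf := min_finite hc.min
  set Λ := (hcf.image Prod.snd).toFinset with hΛ
  have hmem : ∀ {γ lam}, c (γ, lam) ≠ 0 → lam ∈ Λ := fun {γ lam} h => by
    rw [hΛ, Set.Finite.mem_toFinset]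
    exact ⟨(γ, lam), h, rfl⟩
  let Vf : (Fin n → ℤ) → Finset (Fin n) := fun lam =>
    Finset.univ.filter fun i => crd Aᵀ i lam = 0
  have hmin : ∀ lam ∈ Λ, IsMin A (Vf lam) lam := fun lam h => by
    rw [hΛ, Set.Finite.mem_toFinset] at h
    obtain ⟨⟨γ, l⟩, h1, rfl⟩ := h
    exact hc.isMin h1
  have key : ∀ lam, ∃ ξ, lam ∈ Λ → RSupp (Vf lam) ξ ∧ {γ | ξ γ ≠ 0}.Finite ∧
      NonnegOn A Finset.univ ξ ∧ ∀ γ S, ((fun γ => c (γ, lam)) - DR π A (Vf lam) ξ) γ S ≠ 0 →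
        c (γ, lam) ≠ 0 ∧ S = Vf lam ∧ 2 * rk A γ = (Vf lam).card + (frs A γ).card := by
    intro lam
    by_cases hlam : lam ∈ Λ
    · have hl := hmin lam hlam
      have hf : {γ | c (γ, lam) ≠ 0}.Finite :=
        (hcf.image Prod.fst).subset fun γ h => ⟨(γ, lam), h, rfl⟩
      have hem : ∀ z, emb lam (fun γ => c (γ, lam)) z = c z ∨
          emb lam (fun γ => c (γ, lam)) z = 0 := fun z => by
        rw [emb_apply]
        split_ifs with h
        · left; rw [← h]
        · right; rfl
      have hm : (sys hπ hA).Min (emb lam fun γ => c (γ, lam)) := by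
        constructor
        · intro z hz
          rcases hem z with e | e
          · exact hc.min.supp z (e ▸ hz)
          · exact absurd e hz
        · intro κ z
          rcases hem z with e | e
          · exact e ▸ hc.min.red κ z
          · exact e ▸ Submodule.zero_mem _
      obtain ⟨ξ, h⟩ := exists_mid_layer hdet hdeg hS hq (hreg _ _ hl) hl (hc.rsupp hl) hf hm
        (by funext γ; rw [← hc.D_apply hl, hD]; rfl)
      exact ⟨ξ, fun _ => h⟩
    · exact ⟨0, fun h => absurd h hlam⟩
  choose ξ hξ using key
  refine ⟨∑ lam ∈ Λ, emb lam (ξ lam), fun z hz => ?_, ?_, fun z S hz => ?_⟩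
  · rw [Finset.sum_apply] at hz
    obtain ⟨lam, h1, h2⟩ := Finset.exists_ne_zero_of_sum_ne_zero hz
    obtain ⟨g1, -, g3, -⟩ := hξ lam h1
    exact emb_supp π _ hA hπ (hmin lam h1) g1 g3 z h2
  · refine (Set.Finite.biUnion Λ.finite_toSet fun lam h => (hξ lam h).2.1.image
      fun γ => (γ, lam)).subset fun z hz => ?_
    rw [Set.mem_ofPred_eq, Finset.sum_apply] at hz
    obtain ⟨lam, h1, h2⟩ := Finset.exists_ne_zero_of_sum_ne_zero hz
    rw [emb_apply] at h2
    split_ifs at h2 with h3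
    · exact Set.mem_biUnion h1 ⟨z.1, h2, Prod.ext rfl h3.symm⟩
    · exact absurd rfl h2
  · have e : (sys hπ hA).D (∑ lam ∈ Λ, emb lam (ξ lam)) z
        = if z.2 ∈ Λ then DR π A (Vf z.2) (ξ z.2) z.1 else 0 := by
      rw [map_sum, Finset.sum_apply, Finset.sum_congr rfl fun lam h => by
        rw [D_emb π _ hA hπ (hmin lam h) (hξ lam h).1 (hξ lam h).2.2.1, emb_apply]]
      rw [Finset.sum_ite_eq]
    rw [Pi.sub_apply, e] at hz
    split_ifs at hz with hzΛ
    · obtain ⟨h1, h2, h3⟩ := (hξ z.2 hzΛ).2.2.2 z.1 S hz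
      exact ⟨hc.min.supp z h1, (hmin z.2 hzΛ).lt_one, h2, by rw [h3, h2]⟩
    · rw [sub_zero] at hz
      exact absurd (hmem (γ := z.1) fun h0 => hz (by
        change c z = 0 at h0
        rw [h0]; rfl)) hzΛ

end Middle

section Reduction

variable {K : Type} [NontriviallyNormedField K] [CompleteSpace K] [CharZero K] {n : ℕ} {π : K}
  {hπ : π ≠ 0} {A : Matrix (Fin n) (Fin n) ℕ} {hA : (Aq A).det ≠ 0}
  {deg : (Fin n → ℤ) × (Fin n → ℤ) →+ ℤ}

/-- Every overconvergent cocycle is cohomologous to a finite one in the middle range. -/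
theorem exists_mid_of_cocycle (hdet : 0 < (A.map ((↑) : ℕ → ℤ)).det)
    (hdeg : ∀ z, (sys hπ hA).ok z → 0 ≤ deg z) (hS : (sys hπ hA).Growth deg)
    (hq : HasWeights A) (hreg : ∀ V lam, IsMin A V lam → KosReg K A V)
    {c : (Fin n → ℤ) × (Fin n → ℤ) → ExtV K (Fin n)} (hs : (sys hπ hA).Supp c)
    (hc : (sys hπ hA).OC deg c) (hD : (sys hπ hA).D c = 0) :
    ∃ b, (sys hπ hA).Supp b ∧ (sys hπ hA).OC deg b ∧
      ∀ z S, (c - (sys hπ hA).D b) z S ≠ 0 → (sys hπ hA).ok z ∧ (∀ i, crd Aᵀ i z.2 < 1) ∧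
        S = Finset.univ.filter (fun i => crd Aᵀ i z.2 = 0) ∧
        2 * rk A z.1 = S.card + (frs A z.1).card := by
  obtain ⟨b₁, s₁, o₁, r₁, -⟩ := KSys.exists_reduce hdeg hS hs hc hD Finset.univ
  have m₁ : (sys hπ hA).Min (c - (sys hπ hA).D b₁) :=
    ⟨hs.sub (KSys.D_supp b₁), fun κ z => r₁ κ (Finset.mem_univ _) z⟩
  have d₁ : (sys hπ hA).D (c - (sys hπ hA).D b₁) = 0 := by
    rw [map_sub, hD, KSys.D_sq s₁, sub_zero]
  obtain ⟨b₂, s₂, m₂⟩ := exists_elim_inr m₁ fun i z _ => by rw [d₁]; rfl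
  have d₂ : (sys hπ hA).D (c - (sys hπ hA).D b₁ - (sys hπ hA).D b₂) = 0 := by
    rw [map_sub, d₁, KSys.D_sq s₂.supp, sub_zero]
  obtain ⟨b₃, s₃, f₃, h₃⟩ := exists_mid hdet hdeg hS hq hreg m₂ d₂
  refine ⟨b₁ + b₂ + b₃, fun z h => ?_,
    KSys.OC.add hdeg (KSys.OC.add hdeg o₁ (OC_of_finite (min_finite s₂))) (OC_of_finite f₃), ?_⟩
  · by_contra hz
    exact h (by simp [KSys.Supp.zero s₁ hz, KSys.Supp.zero s₂.supp hz, KSys.Supp.zero s₃ hz])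
  rw [map_add, map_add, ← sub_sub, ← sub_sub]
  exact h₃

end Reduction

section KrullDim

open RingTheory.Sequence Module

theorem supportDim_add_length_le {R : Type*} [CommRing R] [IsNoetherianRing R] (rs : List R) :
    ∀ (M : Type _) [AddCommGroup M] [Module R M] [Module.Finite R M], IsWeaklyRegular M rs →
      supportDim R (M ⧸ Ideal.ofList rs • (⊤ : Submodule R M)) + rs.length ≤ supportDim R M := by
  induction rs with
  | nil =>
    intro M _ _ _ _
    rw [Ideal.ofList_nil, Submodule.bot_smul]
    simpa using (supportDim_eq_of_equiv (Submodule.quotEquivOfEqBot (⊥ : Submodule R M) rfl)).le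
  | cons x rs ih =>
    intro M _ _ _ h
    obtain ⟨h1, h2⟩ := (isWeaklyRegular_cons_iff M _ _).1 h
    have h3 := ih _ h2
    rw [supportDim_eq_of_equiv (Submodule.quotOfListConsSMulTopEquivQuotSMulTopInner M x _)]
    push_cast [List.length_cons]
    rw [← add_assoc]
    refine le_trans (by gcongr) (supportDim_quotSMulTop_succ_le_of_notMem_minimalPrimes
      (M := M) (x := x) fun p hp => h1.notMem_of_mem_minimalPrimes hp)

theorem not_lt_of_isWeaklyRegular {k : Type} [Field k] {n : ℕ}
    {rs : List (MvPolynomial (Fin n) k)} (h : IsWeaklyRegular (MvPolynomial (Fin n) k) rs)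
    (hn : rs.length = n) {P Q : Ideal (MvPolynomial (Fin n) k)} [hP : P.IsPrime] [hQ : Q.IsPrime]
    (hI : Ideal.ofList rs ≤ P) : ¬ P < Q := by
  intro hlt
  have h1 := supportDim_add_length_le rs _ h
  have e : Ideal.ofList rs • (⊤ : Ideal (MvPolynomial (Fin n) k)) = Ideal.ofList rs := by simp
  rw [e, supportDim_quotient_eq_ringKrullDim, supportDim_self_eq_ringKrullDim,
    MvPolynomial.ringKrullDim_of_isNoetherianRing, hn, ringKrullDim_eq_zero_of_field,
    Nat.card_fin, zero_add] at h1
  have h2 : ringKrullDim (MvPolynomial (Fin n) k ⧸ Ideal.ofList rs) ≤ 0 := by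
    by_contra hc
    have hc' : (1 : WithBot ℕ∞) ≤ ringKrullDim (MvPolynomial (Fin n) k ⧸ Ideal.ofList rs) := by
      rw [not_le] at hc
      revert hc
      generalize ringKrullDim (MvPolynomial (Fin n) k ⧸ Ideal.ofList rs) = d
      induction d using WithBot.recBotCoe with
      | bot => simp
      | coe d =>
        intro hd
        have : 0 < d := by exact_mod_cast hd
        exact_mod_cast Order.one_le_iff_pos.2 this
    have h3 : (1 : WithBot ℕ∞) + n ≤ 0 + n := le_trans (by gcongr) (h1.trans (by simp))
    rw [zero_add] at h3
    have h4 : ((1 + n : ℕ) : WithBot ℕ∞) ≤ (n : ℕ) := by exact_mod_cast h3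
    have h5 : 1 + n ≤ n := by exact_mod_cast h4
    omega
  have : Ring.KrullDimLE 0 (MvPolynomial (Fin n) k ⧸ Ideal.ofList rs) := by
    rw [Ring.krullDimLE_iff]; exact_mod_cast h2
  have hmax : (P.map (Ideal.Quotient.mk (Ideal.ofList rs))).IsPrime :=
    Ideal.map_isPrime_of_surjective Ideal.Quotient.mk_surjective (by simpa using hI)
  have hm : (P.map (Ideal.Quotient.mk (Ideal.ofList rs))).IsMaximal := inferInstance
  have hm2 : P.IsMaximal := by
    have := Ideal.comap_isMaximal_of_surjective (Ideal.Quotient.mk (Ideal.ofList rs))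
      Ideal.Quotient.mk_surjective (K := P.map (Ideal.Quotient.mk (Ideal.ofList rs)))
    rwa [Ideal.comap_map_of_surjective' _ Ideal.Quotient.mk_surjective, Ideal.mk_ker,
      sup_eq_left.2 hI] at this
  exact hQ.ne_top (hm2.1.2 Q hlt)

end KrullDim

section Critical

variable {n : ℕ} (A : Matrix (Fin n) (Fin n) ℕ)

/-- The value at `a` of the `k`-th partial derivative of `W_A`. -/
noncomputable def pd {L : Type*} [CommRing L] (k : Fin n) (a : Fin n → L) : L :=
  ∑ j, (A j k : L) * ∏ l, a l ^ (frow A j - Finsupp.single k 1 : Fin n →₀ ℕ) l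

theorem map_pd {L L' : Type*} [CommRing L] [CommRing L'] (f : L →+* L') (k : Fin n)
    (a : Fin n → L) : f (pd A k a) = pd A k fun l => f (a l) := by
  simp [pd]

theorem pderiv_Wpoly (F : Type) [Field F] (k : Fin n) :
    MvPolynomial.pderiv k (Wpoly F A)
      = ∑ j, MvPolynomial.monomial (frow A j - Finsupp.single k 1) (A j k : F) := by
  have h : ∀ j, ∏ l, (MvPolynomial.X l : MvPolynomial (Fin n) F) ^ A j l
      = MvPolynomial.monomial (frow A j) 1 := by
    intro j
    rw [MvPolynomial.monomial_eq, MvPolynomial.C_1, one_mul,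
      Finsupp.prod_fintype _ _ fun _ => pow_zero _]
    rfl
  unfold Wpoly
  rw [map_sum]
  refine Finset.sum_congr rfl fun j _ => ?_
  rw [h, MvPolynomial.pderiv_monomial, one_mul]
  rfl

theorem eval₂_pderiv_Wpoly {F : Type} [Field F] {L : Type*} [CommRing L] (f : F →+* L)
    (k : Fin n) (a : Fin n → L) :
    MvPolynomial.eval₂Hom f a (MvPolynomial.pderiv k (Wpoly F A)) = pd A k a := by
  rw [pderiv_Wpoly, map_sum]
  refine Finset.sum_congr rfl fun j _ => ?_
  rw [MvPolynomial.coe_eval₂Hom, MvPolynomial.eval₂_monomial,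
    Finsupp.prod_fintype _ _ fun _ => pow_zero _, map_natCast]

theorem pd_scale {L : Type*} [CommRing L] {w : Fin n → ℕ} {d : ℕ}
    (hw : ∀ i, ∑ j, A i j * w j = d) (k : Fin n) (s : L) (a : Fin n → L) :
    s ^ w k * pd A k (fun l => s ^ w l * a l) = s ^ d * pd A k a := by
  unfold pd
  rw [Finset.mul_sum, Finset.mul_sum]
  refine Finset.sum_congr rfl fun j _ => ?_
  by_cases h : A j k = 0
  · simp [h]
  have h1 : s ^ w k * ∏ l, (s ^ w l) ^ (frow A j - Finsupp.single k 1 : Fin n →₀ ℕ) l = s ^ d := by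
    rw [← hw j]
    simp_rw [← pow_mul]
    rw [Finset.prod_pow_eq_pow_sum, ← pow_add]
    congr 1
    rw [← Finset.add_sum_erase _ _ (Finset.mem_univ k),
      ← Finset.add_sum_erase _ (fun l => A j l * w l) (Finset.mem_univ k), ← add_assoc]
    congr 1
    · simp only [Finsupp.coe_tsub, Pi.sub_apply, Finsupp.single_eq_same]
      have : A j k = (A j k - 1) + 1 := by omega
      change w k + w k * (A j k - 1) = _
      rw [this]; simp; ring
    · refine Finset.sum_congr rfl fun l hl => ?_
      rw [mul_comm, Finsupp.tsub_apply, Finsupp.single_eq_of_ne (Finset.ne_of_mem_erase hl)]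
      rfl
  simp_rw [mul_pow]
  rw [Finset.prod_mul_distrib, ← h1]
  ring

theorem exists_nat_weights {A : Matrix (Fin n) (Fin n) ℕ} (h : HasWeights A) :
    ∃ (w : Fin n → ℕ) (d : ℕ), (∀ j, 0 < w j) ∧ ∀ i, ∑ j, A i j * w j = d := by
  obtain ⟨q, h0, h1⟩ := h
  have hw : ∀ j, ∃ w : ℕ, 0 < w ∧ (w : ℚ) = q j * ∏ l, ((q l).den : ℚ) := by
    intro j
    refine ⟨(q j).num.toNat * ∏ l ∈ Finset.univ.erase j, (q l).den, ?_, ?_⟩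
    · refine Nat.mul_pos ?_ (Finset.prod_pos fun l _ => (q l).den_pos)
      have := Rat.num_pos.2 (h0 j)
      omega
    · rw [← Finset.mul_prod_erase _ _ (Finset.mem_univ j), ← mul_assoc, Rat.mul_den_eq_num]
      push_cast
      congr 1
      have := Rat.num_pos.2 (h0 j)
      exact_mod_cast Int.toNat_of_nonneg this.le
  choose w hw0 hw1 using hw
  refine ⟨w, ∏ l, (q l).den, hw0, fun i => ?_⟩
  have : ((∑ j, A i j * w j : ℕ) : ℚ) = ((∏ l, (q l).den : ℕ) : ℚ) := by
    push_cast
    simp_rw [hw1, ← mul_assoc]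
    rw [← Finset.sum_mul, h1, one_mul]
  exact_mod_cast this

theorem critical_eq_zero {A : Matrix (Fin n) (Fin n) ℕ} {F : Type} [Field F] (hA : IsBH F A)
    {L : Type*} [Field L] (f : F →+* L) {a : Fin n → L} (ha : ∀ k, pd A k a = 0) : a = 0 := by
  obtain ⟨w, d, hw0, hw⟩ := exists_nat_weights (A := A) hA.2.2.1
  by_contra hne
  obtain ⟨j, hj⟩ : ∃ j, a j ≠ 0 := by
    by_contra! h
    exact hne (funext h)
  set g : MvPolynomial (Fin n) F →+* Polynomial L :=
    MvPolynomial.eval₂Hom (Polynomial.C.comp f) fun l => Polynomial.X ^ w l * Polynomial.C (a l)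
  set g0 : MvPolynomial (Fin n) F →+* L := MvPolynomial.eval₂Hom f fun _ => 0
  have hg : (Polynomial.evalRingHom 0).comp g = g0 := by
    refine MvPolynomial.ringHom_ext (fun r => ?_) fun l => ?_
    · simp [g, g0]
    · simp [g, g0, (hw0 l).ne']
  have hP : (RingHom.ker g).IsPrime := RingHom.ker_isPrime g
  have hQ : (RingHom.ker g0).IsPrime := RingHom.ker_isPrime g0
  refine not_lt_of_isWeaklyRegular (P := RingHom.ker g) (Q := RingHom.ker g0)
    hA.2.2.2.toIsWeaklyRegular (by simp) ?_ (lt_of_le_of_ne ?_ ?_)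
  · refine Ideal.span_le.2 fun r hr => ?_
    simp only [List.mem_map, Set.mem_ofPred_eq] at hr
    obtain ⟨k, -, rfl⟩ := hr
    rw [SetLike.mem_coe, RingHom.mem_ker, eval₂_pderiv_Wpoly]
    have h1 := pd_scale A hw k (Polynomial.X : Polynomial L) fun l => Polynomial.C (a l)
    rw [← map_pd, ha k, map_zero, mul_zero] at h1
    exact (mul_eq_zero.1 h1).resolve_left (pow_ne_zero _ Polynomial.X_ne_zero)
  · intro r hr
    rw [RingHom.mem_ker] at hr ⊢
    rw [← hg, RingHom.comp_apply, hr, map_zero]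
  · intro h
    have h1 : (MvPolynomial.X j : MvPolynomial (Fin n) F) ∈ RingHom.ker g0 := by
      simp [RingHom.mem_ker, g0]
    rw [← h, RingHom.mem_ker] at h1
    simp [g, hj] at h1

end Critical

section CriticalLift

variable {n : ℕ} {A : Matrix (Fin n) (Fin n) ℕ} {p : ℕ} [hp : Fact p.Prime]
  {K : Type} [NontriviallyNormedField K]

/-- Scaling by weights makes the largest coordinate of a nonzero vector a unit. -/
theorem exists_scale (halg : IsAlgClosed K) {w : Fin n → ℕ} (hw : ∀ j, 0 < w j) {a : Fin n → K}
    (ha : a ≠ 0) : ∃ s : K, (∀ l, ‖s ^ w l * a l‖ ≤ 1) ∧ ∃ l, ‖s ^ w l * a l‖ = 1 := by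
  obtain ⟨i, hi⟩ : ∃ i, a i ≠ 0 := by
    by_contra! h
    exact ha (funext h)
  obtain ⟨j, -, hj⟩ := Finset.exists_max_image Finset.univ
    (fun l => ‖a l‖ ^ ((w l : ℝ)⁻¹)) ⟨i, Finset.mem_univ _⟩
  have hpos : ∀ l, (0 : ℝ) < w l := fun l => by exact_mod_cast hw l
  have hj0 : a j ≠ 0 := by
    intro h
    have h1 := hj i (Finset.mem_univ _)
    rw [h, norm_zero, Real.zero_rpow (inv_pos.2 (hpos j)).ne'] at h1
    exact absurd h1 (not_le.2 (Real.rpow_pos_of_pos (norm_pos_iff.2 hi) _))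
  obtain ⟨s, hs⟩ := IsAlgClosed.exists_pow_nat_eq (a j)⁻¹ (hw j)
  have hs1 : ‖s ^ w j * a j‖ = 1 := by rw [hs, inv_mul_cancel₀ hj0, norm_one]
  have key : ∀ l, ‖s ^ w l * a l‖ = (‖s‖ * ‖a l‖ ^ ((w l : ℝ)⁻¹)) ^ w l := by
    intro l
    rw [mul_pow, Real.rpow_inv_natCast_pow (norm_nonneg _) (hw l).ne', norm_mul, norm_pow]
  refine ⟨s, fun l => ?_, j, hs1⟩
  have h2 : ‖s‖ * ‖a j‖ ^ ((w j : ℝ)⁻¹) = 1 := by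
    rw [key] at hs1
    exact (pow_eq_one_iff_of_nonneg (by positivity) (hw j).ne').1 hs1
  rw [key]
  refine pow_le_one₀ (by positivity) ?_
  rw [← h2]
  exact mul_le_mul_of_nonneg_left (hj l (Finset.mem_univ _)) (norm_nonneg _)

theorem critical_lift_eq_zero (halg : IsAlgClosed K)
    (hna : ∀ a b : K, ‖a + b‖ ≤ max ‖a‖ ‖b‖) (hpnorm : ‖(p : K)‖ = (p : ℝ)⁻¹)
    (hA : IsBH (AlgebraicClosure (ZMod p)) A) {a : Fin n → K} (ha : ∀ k, pd A k a = 0) :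
    a = 0 := by
  obtain ⟨w, d, hw0, hw⟩ := exists_nat_weights (A := A) hA.2.2.1
  by_contra hne
  obtain ⟨s, h1, j, hj⟩ := exists_scale halg hw0 hne
  have : IsUltrametricDist K := IsUltrametricDist.isUltrametricDist_of_forall_norm_add_le_max_norm
    hna
  have hs : s ≠ 0 := by
    rintro rfl
    rw [zero_pow (hw0 j).ne', zero_mul, norm_zero] at hj
    exact zero_ne_one hj
  have hcrit : ∀ k, pd A k (fun l => s ^ w l * a l) = 0 := fun k => by
    have := pd_scale A hw k s a
    rw [ha k, mul_zero] at this
    exact (mul_eq_zero.1 this).resolve_left (pow_ne_zero _ hs)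
  let v := NormedField.valuation (K := K)
  have hmem : ∀ x : K, x ∈ v.valuationSubring ↔ ‖x‖ ≤ 1 := fun x => by
    rw [Valuation.mem_valuationSubring_iff, NormedField.valuation_apply, ← NNReal.coe_le_coe]
    simp
  have hmax : ∀ x : v.valuationSubring, IsLocalRing.residue v.valuationSubring x = 0 ↔
      ‖(x : K)‖ < 1 := fun x => by
    rw [IsLocalRing.residue_eq_zero_iff, Valuation.mem_maximalIdeal_iff,
      NormedField.valuation_apply, ← NNReal.coe_lt_coe]
    simp
  let b : Fin n → v.valuationSubring := fun l => ⟨s ^ w l * a l, (hmem _).2 (h1 l)⟩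
  have hb : ∀ k, pd A k b = 0 := fun k => by
    have := map_pd A v.valuationSubring.subtype k b
    exact Subtype.ext (this.trans (hcrit k))
  let L := AlgebraicClosure (IsLocalRing.ResidueField v.valuationSubring)
  let φ : v.valuationSubring →+* L := (algebraMap _ L).comp (IsLocalRing.residue _)
  have hφ : ∀ x, φ x = 0 ↔ ‖(x : K)‖ < 1 := fun x => by
    rw [← hmax, RingHom.comp_apply, map_eq_zero]
  have hchar : CharP L p := by
    have h0 : (p : L) = 0 := by
      rw [← map_natCast φ, hφ]
      change ‖((p : v.valuationSubring) : K)‖ < 1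
      push_cast
      rw [hpnorm]
      exact inv_lt_one_of_one_lt₀ (by exact_mod_cast hp.out.one_lt)
    exact (CharP.charP_iff_prime_eq_zero hp.out).2 h0
  let _ : Algebra (ZMod p) L := ZMod.algebra L p
  let f : AlgebraicClosure (ZMod p) →ₐ[ZMod p] L := IsAlgClosed.lift
  have h2 := critical_eq_zero hA (f : AlgebraicClosure (ZMod p) →+* L)
    (a := fun l => φ (b l)) (fun k => by rw [← map_pd, hb k, map_zero])
  have h3 := (hφ (b j)).1 (congrFun h2 j)
  exact absurd hj h3.ne

theorem kosReg (halg : IsAlgClosed K)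
    (hna : ∀ a b : K, ‖a + b‖ ≤ max ‖a‖ ‖b‖) (hpnorm : ‖(p : K)‖ = (p : ℝ)⁻¹)
    (hA : IsBH (AlgebraicClosure (ZMod p)) A) (V : Finset (Fin n)) (lam : Fin n → ℤ)
    (hV : IsMin A V lam) : KosReg K A V := by
  have hdet : (Aq A).det ≠ 0 := hA.1
  intro i hi
  set I : Ideal (MvPolynomial (Fin n) K) := Ideal.span (pdV A V '' V) with hI
  have hX : MvPolynomial.X i ∈ I.radical := by
    rw [← MvPolynomial.vanishingIdeal_zeroLocus_eq_radical (K := K) I,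
      MvPolynomial.mem_vanishingIdeal_iff]
    intro a ha
    rw [MvPolynomial.mem_zeroLocus_iff] at ha
    have h0 : ∀ k, pd A k (fun l => if l ∈ V then a l else 0) = 0 := by
      intro k
      by_cases hk : k ∈ V
      · have h1 := ha _ (Ideal.subset_span ⟨k, hk, rfl⟩)
        rw [pdV, map_sum] at h1
        refine Eq.trans ?_ h1
        rw [pd, ← Finset.sum_subset (Finset.subset_univ (rowsIn A V))]
        · refine Finset.sum_congr rfl fun j hj => ?_
          rw [MvPolynomial.aeval_monomial, Finsupp.prod_fintype _ _ fun _ => pow_zero _,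
            map_natCast]
          congr 1
          refine Finset.prod_congr rfl fun l _ => ?_
          split_ifs with hl
          · rfl
          · have : A j l = 0 := (mem_rowsIn A V).1 hj l hl
            have h2 : (frow A j - Finsupp.single k 1 : Fin n →₀ ℕ) l = 0 := by
              rw [Finsupp.tsub_apply]
              change A j l - _ = 0
              omega
            rw [h2, pow_zero, pow_zero]
        · intro j _ hj
          obtain ⟨l, hl, hl0⟩ : ∃ l, l ∉ V ∧ A j l ≠ 0 := by
            by_contra! h
            exact hj ((mem_rowsIn A V).2 h)
          have h2 : (frow A j - Finsupp.single k 1 : Fin n →₀ ℕ) l ≠ 0 := by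
            rw [Finsupp.tsub_apply, Finsupp.single_eq_of_ne (by rintro rfl; exact hl hk)]
            exact hl0
          rw [Finset.prod_eq_zero (Finset.mem_univ l) (by simp only [if_neg hl, zero_pow h2]),
            mul_zero]
      · refine Finset.sum_eq_zero fun j _ => ?_
        by_cases hjk : A j k = 0
        · simp [hjk]
        by_contra hne
        have hl : ∀ l, l ∉ V → (frow A j - Finsupp.single k 1 : Fin n →₀ ℕ) l = 0 := by
          intro l hl
          by_contra h
          exact hne (by
            rw [Finset.prod_eq_zero (Finset.mem_univ l) (by simp only [if_neg hl, zero_pow h]),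
              mul_zero])
        have h2 := sum_crd_mul (A := Aᵀ) (by rw [Aq_transpose, det_transpose]; exact hdet) lam j
        rw [Finset.sum_eq_single k] at h2
        · have h3 := hl k hk
          rw [Finsupp.tsub_apply, Finsupp.single_eq_same] at h3
          have h4 : A j k = 1 := by
            change A j k - 1 = 0 at h3
            omega
          rw [Matrix.transpose_apply, h4, Nat.cast_one, mul_one] at h2
          have h5 := hV.nonneg k
          have h6 := hV.lt_one k
          rw [h2] at h5 h6
          have h7 : lam j = 0 := by
            have h5' : (0 : ℤ) ≤ lam j := by exact_mod_cast h5
            have h6' : lam j < 1 := by exact_mod_cast h6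
            omega
          exact hk ((hV.mem_iff k).2 (by rw [h2, h7, Int.cast_zero]))
        · intro l _ hlk
          by_cases hlV : l ∈ V
          · rw [(hV.mem_iff l).1 hlV, zero_mul]
          · have h3 := hl l hlV
            rw [Finsupp.tsub_apply, Finsupp.single_eq_of_ne hlk] at h3
            change A j l - 0 = 0 at h3
            rw [Matrix.transpose_apply, show A j l = 0 by omega, Nat.cast_zero, mul_zero]
        · simp
    have h1 := congrFun (critical_lift_eq_zero halg hna hpnorm hA h0) i
    simpa [hi] using h1
  obtain ⟨N, hN⟩ := hX
  obtain ⟨c, hc⟩ := (Submodule.mem_span_image_finset_iff_exists_fun' _).1 hN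
  exact ⟨N, c, hc⟩

end CriticalLift

section PadicNorm

variable {p : ℕ} [hp : Fact p.Prime] {K : Type} [NontriviallyNormedField K]

theorem norm_intCast_le_pow [IsUltrametricDist K] (hpnorm : ‖(p : K)‖ = (p : ℝ)⁻¹) {z : ℤ} {e : ℕ}
    (h : (p : ℤ) ^ e ∣ z) : ‖(z : K)‖ ≤ ((p : ℝ)⁻¹) ^ e := by
  obtain ⟨y, rfl⟩ := h
  push_cast
  rw [norm_mul, norm_pow, hpnorm]
  exact mul_le_of_le_one_right (by positivity) (IsUltrametricDist.norm_intCast_le_one K y)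

theorem norm_intCast_eq_one [IsUltrametricDist K] (hpnorm : ‖(p : K)‖ = (p : ℝ)⁻¹) {z : ℤ}
    (h : IsCoprime z (p : ℤ)) : ‖(z : K)‖ = 1 := by
  refine le_antisymm (IsUltrametricDist.norm_intCast_le_one K z) ?_
  by_contra! hlt
  obtain ⟨u, v, h⟩ := h
  have h1 : ((u * z + v * p : ℤ) : K) = 1 := by rw [h, Int.cast_one]
  have h2 : ‖((u * z + v * p : ℤ) : K)‖ < 1 := by
    push_cast
    refine (IsUltrametricDist.norm_add_le_max _ _).trans_lt (max_lt ?_ ?_)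
    · rw [norm_mul]
      exact (mul_le_of_le_one_left (norm_nonneg _)
        (IsUltrametricDist.norm_intCast_le_one K u)).trans_lt hlt
    · rw [norm_mul, hpnorm]
      refine (mul_le_of_le_one_left (by positivity)
        (IsUltrametricDist.norm_intCast_le_one K v)).trans_lt ?_
      exact inv_lt_one_of_one_lt₀ (by exact_mod_cast hp.out.one_lt)
  rw [h1, norm_one] at h2
  exact lt_irrefl _ h2

theorem pow_dvd_prod_add {a D : ℤ} (hD : IsCoprime D (p : ℤ)) {m e : ℕ}
    (he : p ^ e ∣ m.factorial) :
    (p : ℤ) ^ e ∣ ∏ i ∈ Finset.range m, (a + D * (i + 1)) := by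
  obtain ⟨D', v, h⟩ := hD.pow_right (n := e)
  have hdvd : (p : ℤ) ^ e ∣ ∏ i ∈ Finset.range m, (D' * a + (i + 1)) := by
    refine (by exact_mod_cast he : (p : ℤ) ^ e ∣ (m.factorial : ℤ)).trans ?_
    have := Nat.factorial_coe_dvd_prod m (D' * a + 1)
    simpa only [add_assoc, add_comm (1 : ℤ)] using this
  have h2 : (∏ i ∈ Finset.range m, (a + D * (i + 1)) : ℤ) ≡
      ∏ i ∈ Finset.range m, (D * (D' * a + (i + 1))) [ZMOD (p : ℤ) ^ e] := by
    refine Int.ModEq.prod fun i _ => ?_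
    refine Int.modEq_iff_dvd.2 ⟨-(v * a), ?_⟩
    linear_combination a * h
  rw [Finset.prod_mul_distrib] at h2
  exact (Int.ModEq.dvd_iff h2.symm).1 (Dvd.dvd.mul_left hdvd _) 

theorem norm_pi_pow {π : K} (hpnorm : ‖(p : K)‖ = (p : ℝ)⁻¹) (hπ : π ^ (p - 1) = -(p : K)) :
    ‖π‖ ^ (p - 1) = (p : ℝ)⁻¹ := by
  rw [← norm_pow, hπ, norm_neg, hpnorm]

theorem pi_ne_zero {π : K} (hpnorm : ‖(p : K)‖ = (p : ℝ)⁻¹) (hπ : π ^ (p - 1) = -(p : K)) :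
    π ≠ 0 := by
  rintro rfl
  have := norm_pi_pow hpnorm hπ
  rw [norm_zero, zero_pow (by have := hp.out.two_le; omega)] at this
  exact inv_ne_zero (by exact_mod_cast hp.out.ne_zero) this.symm

theorem norm_pi_lt_one {π : K} (hpnorm : ‖(p : K)‖ = (p : ℝ)⁻¹) (hπ : π ^ (p - 1) = -(p : K)) :
    ‖π‖ < 1 := by
  by_contra! h
  have := one_le_pow₀ h (n := p - 1)
  rw [norm_pi_pow hpnorm hπ] at this
  exact absurd this (not_le.2 (inv_lt_one_of_one_lt₀ (by exact_mod_cast hp.out.one_lt)))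

theorem inv_pow_valuation_factorial_le {π : K} (hpnorm : ‖(p : K)‖ = (p : ℝ)⁻¹)
    (hπ : π ^ (p - 1) = -(p : K)) (m : ℕ) :
    ((p : ℝ)⁻¹) ^ padicValNat p m.factorial ≤ p * (m + 1) * ‖π‖ ^ m := by
  have hp0 : (0 : ℝ) < p := by exact_mod_cast hp.out.pos
  have hpi : 0 < ‖π‖ := norm_pos_iff.2 (pi_ne_zero hpnorm hπ)
  set s := (p.digits m).sum with hs
  have hsm : s ≤ m := Nat.digit_sum_le p m
  have h1 : ((p : ℝ)⁻¹) ^ padicValNat p m.factorial = ‖π‖ ^ (m - s) := by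
    rw [← norm_pi_pow hpnorm hπ, ← pow_mul, sub_one_mul_padicValNat_factorial]
  set L := (p.digits m).length with hL
  have h2 : s ≤ L * (p - 1) := by
    have := List.sum_le_card_nsmul (p.digits m) (p - 1) fun d hd =>
      Nat.le_sub_one_of_lt (Nat.digits_lt_base hp.out.one_lt hd)
    simpa using this
  have h3 : (p : ℝ) ^ L ≤ p * (m + 1) := by
    rcases eq_or_ne m 0 with rfl | hm
    · simp only [hL, Nat.digits_zero, List.length_nil, pow_zero, Nat.cast_zero, zero_add, mul_one]
      exact_mod_cast hp.out.one_lt.le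
    · have := Nat.base_pow_length_digits_le p m hp.out.one_lt hm
      have h : ((p ^ L : ℕ) : ℝ) ≤ ((p * m : ℕ) : ℝ) := by exact_mod_cast this
      push_cast at h
      nlinarith
  have h4 : 1 ≤ (p : ℝ) ^ L * ‖π‖ ^ s := by
    calc (1 : ℝ) = (p : ℝ) ^ L * ‖π‖ ^ (L * (p - 1)) := by
          rw [mul_comm L, pow_mul, norm_pi_pow hpnorm hπ, ← mul_pow, mul_inv_cancel₀ hp0.ne',
            one_pow]
      _ ≤ _ := mul_le_mul_of_nonneg_left
          (pow_le_pow_of_le_one hpi.le (norm_pi_lt_one hpnorm hπ).le h2) (by positivity)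
  rw [h1]
  calc ‖π‖ ^ (m - s) ≤ ‖π‖ ^ (m - s) * ((p : ℝ) ^ L * ‖π‖ ^ s) :=
        le_mul_of_one_le_right (by positivity) h4
    _ = (p : ℝ) ^ L * ‖π‖ ^ m := by
        rw [← pow_sub_mul_pow ‖π‖ hsm]; ring
    _ ≤ _ := mul_le_mul_of_nonneg_right h3 (by positivity)

end PadicNorm

section SysGrowth

variable {p : ℕ} [hp : Fact p.Prime] {K : Type} [NontriviallyNormedField K] [CharZero K]
  {n : ℕ} {π : K} {A : Matrix (Fin n) (Fin n) ℕ}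

/-- The total degree. -/
noncomputable def tdeg (n : ℕ) : (Fin n → ℤ) × (Fin n → ℤ) →+ ℤ where
  toFun z := ∑ i, z.1 i + ∑ i, z.2 i
  map_zero' := by simp
  map_add' z w := by simp [Finset.sum_add_distrib]; ring

theorem one_le_sum_row (hA : (Aq A).det ≠ 0) (j : Fin n) : 1 ≤ ∑ k, row A j k := by
  have h0 : ∀ k, 0 ≤ row A j k := fun k => by simp [row]
  by_contra! h
  have h1 : ∑ k, row A j k = 0 := le_antisymm (by omega) (Finset.sum_nonneg fun k _ => h0 k)
  rw [Finset.sum_eq_zero_iff_of_nonneg fun k _ => h0 k] at h1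
  refine hA (Matrix.det_eq_zero_of_row_eq_zero j fun k => ?_)
  have := h1 k (Finset.mem_univ _)
  simpa [row, Aq] using this

theorem isCoprime_det {A : Matrix (Fin n) (Fin n) ℕ}
    (hdet : 0 < (A.map ((↑) : ℕ → ℤ)).det ∧ (A.map ((↑) : ℕ → ℤ)).det < (p : ℤ)) :
    IsCoprime (A.map ((↑) : ℕ → ℤ)).det (p : ℤ) := by
  rw [isCoprime_comm, Prime.coprime_iff_not_dvd (Nat.prime_iff_prime_int.1 hp.out)]
  intro h
  exact absurd (Int.le_of_dvd hdet.1 h) (not_le.2 hdet.2)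

theorem crd_cast {A : Matrix (Fin n) (Fin n) ℕ} (hA : (Aq A).det ≠ 0) (j : Fin n) (γ : Fin n → ℤ) :
    ((crd A j γ : ℚ) : K) = (adc A j γ : K) / ((A.map ((↑) : ℕ → ℤ)).det : K) := by
  have h := adc_eq hA j γ
  rw [det_Aq] at h
  have h0 : (((A.map ((↑) : ℕ → ℤ)).det : ℤ) : ℚ) ≠ 0 := by rw [← det_Aq]; exact hA
  rw [eq_div_iff (by exact_mod_cast h0), mul_comm]
  have h' := congrArg (Rat.cast : ℚ → K) h
  rw [Rat.cast_mul, Rat.cast_intCast, Rat.cast_intCast] at h'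
  exact h'.symm

theorem crd_growth [IsUltrametricDist K] (hpnorm : ‖(p : K)‖ = (p : ℝ)⁻¹)
    (hπ : π ^ (p - 1) = -(p : K))
    (hdet : 0 < (A.map ((↑) : ℕ → ℤ)).det ∧ (A.map ((↑) : ℕ → ℤ)).det < (p : ℤ)) (j : Fin n)
    (γ : Fin n → ℤ) : ‖((crd A j γ : ℚ) : K)‖ ≤ 1 ∧ ∀ m : ℕ,
      ‖∏ i ∈ Finset.range m, (((crd A j γ : ℚ) : K) + (i + 1))‖ ≤ p * (m + 1) * ‖π‖ ^ m := by
  have hA : (Aq A).det ≠ 0 := by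
    rw [det_Aq]; exact_mod_cast hdet.1.ne'
  set D := (A.map ((↑) : ℕ → ℤ)).det with hD
  have hcop : IsCoprime D (p : ℤ) := isCoprime_det hdet
  have hD1 := norm_intCast_eq_one (K := K) hpnorm hcop
  have hD0 : (D : K) ≠ 0 := by exact_mod_cast hdet.1.ne'
  rw [crd_cast hA, ← hD]
  refine ⟨?_, fun m => ?_⟩
  · rw [norm_div, hD1, div_one]
    exact IsUltrametricDist.norm_intCast_le_one K _
  · have h1 : ∏ i ∈ Finset.range m, ((adc A j γ : K) / (D : K) + (i + 1))
        = ((∏ i ∈ Finset.range m, (adc A j γ + D * (i + 1)) : ℤ) : K) / (D : K) ^ m := by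
      have : (D : K) ^ m = ∏ _i ∈ Finset.range m, (D : K) := by simp
      push_cast
      rw [this, ← Finset.prod_div_distrib]
      refine Finset.prod_congr rfl fun i _ => ?_
      field_simp
    rw [h1, norm_div, norm_pow, hD1, one_pow, div_one]
    exact (norm_intCast_le_pow hpnorm (pow_dvd_prod_add hcop pow_padicValNat_dvd)).trans
      (inv_pow_valuation_factorial_le hpnorm hπ m)

theorem sys_growth [IsUltrametricDist K] (hpnorm : ‖(p : K)‖ = (p : ℝ)⁻¹)
    (hπ : π ^ (p - 1) = -(p : K)) (hπ0 : π ≠ 0) (hA : (Aq A).det ≠ 0)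
    (hdet : 0 < (A.map ((↑) : ℕ → ℤ)).det ∧ (A.map ((↑) : ℕ → ℤ)).det < (p : ℤ)) :
    (sys hπ0 hA).Growth (tdeg n) := by
  have hdet' : 0 < (Aᵀ.map ((↑) : ℕ → ℤ)).det ∧ (Aᵀ.map ((↑) : ℕ → ℤ)).det < (p : ℤ) := by
    have e : Aᵀ.map ((↑) : ℕ → ℤ) = (A.map (↑))ᵀ := rfl
    rwa [e, Matrix.det_transpose]
  refine ⟨?_, ?_, p, ?_⟩
  · rintro (j | i)
    · have := one_le_sum_row hA j
      simpa [sys, tdeg] using this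
    · have := one_le_sum_row (det_Aq_transpose hA) i
      simpa [sys, tdeg] using this
  · rintro (j | i) z
    · exact (crd_growth hpnorm hπ hdet j z.1).1
    · exact (crd_growth hpnorm hπ hdet' i z.2).1
  · rintro (j | i) z m
    · exact (crd_growth hpnorm hπ hdet j z.1).2 m
    · exact (crd_growth hpnorm hπ hdet' i z.2).2 m

end SysGrowth

section SysNonneg

variable {K : Type} [Field K] [CharZero K] {π : K} {n : ℕ} {A : Matrix (Fin n) (Fin n) ℕ}

theorem ok_nonneg {hπ0 : π ≠ 0} {hA : (Aq A).det ≠ 0} {z : (Fin n → ℤ) × (Fin n → ℤ)}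
    (hz : (sys hπ0 hA).ok z) : (∀ k, 0 ≤ z.1 k) ∧ ∀ k, 0 ≤ z.2 k := by
  rw [sys_ok_iff] at hz
  refine ⟨fun k => ?_, fun k => ?_⟩
  · have : (0 : ℚ) ≤ z.1 k := by
      rw [← sum_crd_mul hA]
      exact Finset.sum_nonneg fun j _ => mul_nonneg (hz.1 j) (by positivity)
    exact_mod_cast this
  · have : (0 : ℚ) ≤ z.2 k := by
      rw [← sum_crd_mul (det_Aq_transpose hA)]
      exact Finset.sum_nonneg fun j _ => mul_nonneg (hz.2.1 j) (by positivity)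
    exact_mod_cast this

theorem tdeg_nonneg {hπ0 : π ≠ 0} {hA : (Aq A).det ≠ 0} {z : (Fin n → ℤ) × (Fin n → ℤ)}
    (hz : (sys hπ0 hA).ok z) : 0 ≤ tdeg n z :=
  add_nonneg (Finset.sum_nonneg fun k _ => (ok_nonneg hz).1 k)
    (Finset.sum_nonneg fun k _ => (ok_nonneg hz).2 k)

end SysNonneg

theorem finsum_eq_of_injective {α β M : Type} [AddCommMonoid M] {e : α → β}
    (he : Function.Injective e) (f : β → M) (h : ∀ b, f b ≠ 0 → b ∈ Set.range e) :
    ∑ᶠ b, f b = ∑ᶠ a, f (e a) := by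
  rw [← finsum_mem_range he, finsum_mem_def]
  refine finsum_congr fun b => ?_
  by_cases hb : b ∈ Set.range e
  · rw [Set.indicator_of_mem hb]
  · rw [Set.indicator_of_notMem hb]
    by_contra h0
    exact hb (h b h0)

namespace KSys

variable {K Λ Q Z : Type} [Field K] [CharZero K] [AddCommGroup Λ] [Module K Λ] [Fintype Q]
  [DecidableEq Q] [AddCommGroup Z] (S : KSys K Λ Q Z)

/-- Functions supported where all coordinates are nonnegative. -/
def Nonneg (G : Z → Λ) : Prop := ∀ z, G z ≠ 0 → ∀ κ, 0 ≤ S.x κ z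

/-- The shift attached to a multi-index. -/
def shift (k : Q → ℕ) : Z := ∑ κ, k κ • S.s κ

/-- The product of the series `∑ m, d m t ^ m` over all the shifts `t`, applied to `G`. -/
noncomputable def mulSeries (d : ℕ → K) (G : Z → Λ) (z : Z) : Λ :=
  ∑ᶠ k : Q → ℕ, (∏ κ, d (k κ)) • G (z - S.shift k)

/-- Substitution of `z` by `p z`. -/
noncomputable def dilate (p : ℕ) (F : Z → Λ) : Z → Λ := Function.extend (fun w => p • w) F 0

/-- The Frobenius `z ↦ p z` followed by multiplication by a series in the shifts. -/
noncomputable def frob (d : ℕ → K) (p : ℕ) (F : Z → Λ) (z : Z) : Λ :=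
  if S.ok z then S.mulSeries d (dilate p F) z else 0

variable {S}

theorem x_shift (κ : Q) (k : Q → ℕ) : S.x κ (S.shift k) = k κ := by
  simp [shift, S.x_s]

theorem shift_add_single (k : Q → ℕ) (κ : Q) (m : ℕ) :
    S.shift (k + Pi.single κ m) = S.shift k + m • S.s κ := by
  unfold shift
  simp only [Pi.add_apply, add_smul, Finset.sum_add_distrib]
  congr 1
  rw [Finset.sum_eq_single κ (fun b _ hb => by simp [Pi.single_eq_of_ne hb]) (by simp)]
  simp

theorem Nonneg.le {G : Z → Λ} (hG : S.Nonneg G) {z : Z} {k : Q → ℕ}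
    (h : G (z - S.shift k) ≠ 0) (κ : Q) : (k κ : ℚ) ≤ S.x κ z := by
  have := hG _ h κ
  rw [map_sub, x_shift] at this
  linarith

theorem finite_le (z : Z) : {k : Q → ℕ | ∀ κ, (k κ : ℚ) ≤ S.x κ z}.Finite := by
  refine (Set.Finite.pi' (t := fun κ => Set.Iic ⌊S.x κ z⌋₊) fun κ => Set.finite_Iic _).subset ?_
  intro k hk κ
  exact Nat.le_floor (hk κ)

theorem Nonneg.finite {G : Z → Λ} (hG : S.Nonneg G) (w : (Q → ℕ) → K) (z : Z) :
    (Function.support fun k : Q → ℕ => w k • G (z - S.shift k)).Finite := by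
  refine (finite_le (S := S) z).subset fun k hk => hG.le ?_
  intro h
  exact hk (by simp [h])

theorem mulSeries_comp {G : Z → Λ} (hG : S.Nonneg G) (d : ℕ → K) (T : Λ →ₗ[K] Λ) (z : Z) :
    S.mulSeries d (fun z => T (G z)) z = T (S.mulSeries d G z) := by
  unfold mulSeries
  rw [← LinearMap.toAddMonoidHom_coe, AddMonoidHom.map_finsum _ (hG.finite _ z)]
  simp

theorem mulSeries_add {G H : Z → Λ} (hG : S.Nonneg G) (hH : S.Nonneg H) (d : ℕ → K) (z : Z) :
    S.mulSeries d (fun z => G z + H z) z = S.mulSeries d G z + S.mulSeries d H z := by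
  unfold mulSeries
  rw [← finsum_add_distrib (hG.finite _ z) (hH.finite _ z)]
  simp only [smul_add]

theorem mulSeries_sum {α : Type} (s : Finset α) {G : α → Z → Λ} (hG : ∀ a, S.Nonneg (G a))
    (d : ℕ → K) (z : Z) :
    S.mulSeries d (fun z => ∑ a ∈ s, G a z) z = ∑ a ∈ s, S.mulSeries d (G a) z := by
  unfold mulSeries
  rw [← finsum_sum_comm]
  · simp only [Finset.smul_sum]
  · exact fun a _ => (hG a).finite _ z

/-- Multiplying the `κ`-th series by the `m`-th power of its variable. -/
theorem mulSeries_shift (d : ℕ → K) (G : Z → Λ) (κ : Q) (m : ℕ) (z : Z) :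
    S.mulSeries d G (z - m • S.s κ) = ∑ᶠ k : Q → ℕ, ((if m ≤ k κ then d (k κ - m) else 0) *
      ∏ κ' ∈ Finset.univ.erase κ, d (k κ')) • G (z - S.shift k) := by
  have he : Function.Injective fun k : Q → ℕ => k + Pi.single κ m := add_left_injective _
  rw [finsum_eq_of_injective he]
  · unfold mulSeries
    refine finsum_congr fun k => ?_
    rw [shift_add_single, add_comm (S.shift k), sub_sub]
    congr 1
    rw [← Finset.mul_prod_erase _ _ (Finset.mem_univ κ)]
    simp only [Pi.add_apply, Pi.single_eq_same, le_add_iff_nonneg_left, zero_le, if_true,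
      Nat.add_sub_cancel]
    congr 1
    refine Finset.prod_congr rfl fun κ' h => ?_
    rw [Pi.single_eq_of_ne (Finset.ne_of_mem_erase h), add_zero]
  · intro k hk
    have hm : m ≤ k κ := by
      by_contra h
      exact hk (by simp [h])
    refine ⟨k - Pi.single κ m, ?_⟩
    funext κ'
    rcases eq_or_ne κ' κ with rfl | h
    · simp [Nat.sub_add_cancel hm]
    · simp [Pi.single_eq_of_ne h]

theorem Nonneg.smul {G : Z → Λ} (hG : S.Nonneg G) (a : Z → K) :
    S.Nonneg (fun z => a z • G z) := fun z h => hG z fun h0 => h (by simp [h0])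

theorem Nonneg.shift {G : Z → Λ} (hG : S.Nonneg G) (m : ℕ) (κ : Q) :
    S.Nonneg (fun z => G (z - m • S.s κ)) := fun z h κ' => by
  have := hG _ h κ'
  rw [map_sub, map_nsmul, S.x_s] at this
  have h2 : (0 : ℚ) ≤ m • (if κ' = κ then (1 : ℚ) else 0) := by positivity
  linarith

theorem Nonneg.add {G H : Z → Λ} (hG : S.Nonneg G) (hH : S.Nonneg H) :
    S.Nonneg (fun z => G z + H z) := fun z h => by
  by_cases h0 : G z = 0
  · exact hH z fun h1 => h (by simp [h0, h1])
  · exact hG z h0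

/-- The differential equation satisfied by the Dwork exponential. -/
def IsDwork (S : KSys K Λ Q Z) (p : ℕ) (d : ℕ → K) : Prop :=
  ∀ m : ℕ, (m : K) * d m = S.P * (p * (if p ≤ m then d (m - p) else 0) -
    if 1 ≤ m then d (m - 1) else 0)

theorem L_mulSeries {p : ℕ} {d : ℕ → K} (hd : S.IsDwork p d) {G : Z → Λ} (hG : S.Nonneg G)
    (κ : Q) (z : Z) : S.L κ (S.mulSeries d G) z = S.mulSeries d
      (fun z => ((S.x κ z : K) / S.P) • G z + (p : K) • G (z - p • S.s κ)) z := by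
  have h1 : ((S.x κ z : K) / S.P) • S.mulSeries d G z =
      S.mulSeries d (fun z => ((S.x κ z : K) / S.P) • G z) z +
        ∑ᶠ k : Q → ℕ, (((k κ : K) / S.P) * ∏ κ', d (k κ')) • G (z - S.shift k) := by
    unfold mulSeries
    rw [← finsum_add_distrib ((hG.smul fun z => ((S.x κ z : K) / S.P)).finite _ z)
      (hG.finite _ z), smul_finsum' _ (hG.finite _ z)]
    refine finsum_congr fun k => ?_
    rw [map_sub, x_shift, smul_smul, smul_smul, ← add_smul]
    congr 1
    push_cast
    ring
  have h2 : ∑ᶠ k : Q → ℕ, (((k κ : K) / S.P) * ∏ κ', d (k κ')) • G (z - S.shift k) =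
      (p : K) • S.mulSeries d G (z - p • S.s κ) - S.mulSeries d G (z - 1 • S.s κ) := by
    rw [mulSeries_shift, mulSeries_shift, smul_finsum' _ (hG.finite _ z),
      ← finsum_sub_distrib _ (hG.finite _ z)]
    · refine finsum_congr fun k => ?_
      rw [smul_smul, ← sub_smul, ← Finset.mul_prod_erase _ _ (Finset.mem_univ κ)]
      congr 1
      have := hd (k κ)
      have hP := S.P_ne
      field_simp
      linear_combination (∏ κ' ∈ Finset.univ.erase κ, d (k κ')) * this
    · refine (finite_le (S := S) z).subset fun k hk => hG.le fun h => ?_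
      exact hk (by simp only [h, smul_zero])
  have h3 : S.mulSeries d (fun z => (p : K) • G (z - p • S.s κ)) z =
      (p : K) • S.mulSeries d G (z - p • S.s κ) := by
    have := mulSeries_comp (hG.shift p κ) d ((p : K) • LinearMap.id) z
    simp only [LinearMap.smul_apply, LinearMap.id_apply] at this
    rw [this]
    unfold mulSeries
    simp only [sub_right_comm]
  rw [mulSeries_add (hG.smul _) ((hG.shift p κ).smul _), h3]
  unfold L
  rw [h1, h2, one_smul]
  abel

section Dilate

variable {p : ℕ}

theorem dilate_nsmul (hp : Function.Injective fun w : Z => p • w) (F : Z → Λ) (w : Z) :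
    dilate p F (p • w) = F w := hp.extend_apply _ _ _

theorem dilate_of_not (F : Z → Λ) {z : Z} (h : ¬ ∃ w, p • w = z) : dilate p F z = 0 :=
  Function.extend_apply' _ _ _ h

theorem dilate_nonneg (hp : Function.Injective fun w : Z => p • w) {F : Z → Λ}
    (hF : S.Nonneg F) : S.Nonneg (dilate p F) := by
  intro z h κ
  by_cases hz : ∃ w, p • w = z
  · obtain ⟨w, rfl⟩ := hz
    rw [dilate_nsmul hp] at h
    rw [map_nsmul]
    exact nsmul_nonneg (hF w h κ) p
  · exact absurd (dilate_of_not F hz) h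

theorem dilate_L (hp : Function.Injective fun w : Z => p • w) (F : Z → Λ) (κ : Q) (z : Z) :
    ((S.x κ z : K) / S.P) • dilate p F z + (p : K) • dilate p F (z - p • S.s κ) =
      (p : K) • dilate p (S.L κ F) z := by
  by_cases hz : ∃ w, p • w = z
  · obtain ⟨w, rfl⟩ := hz
    rw [← smul_sub, dilate_nsmul hp, dilate_nsmul hp, dilate_nsmul hp, L, smul_add, smul_smul]
    congr 2
    rw [map_nsmul]
    push_cast [nsmul_eq_mul]
    ring
  · rw [dilate_of_not _ hz, dilate_of_not _ hz, dilate_of_not]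
    · simp
    · rintro ⟨w, hw⟩
      exact hz ⟨w + S.s κ, by rw [smul_add, hw]; abel⟩

end Dilate

theorem Supp.nonneg {F : Z → Λ} (hF : S.Supp F) : S.Nonneg F := fun z h => (hF z h).1

theorem L_nonneg {F : Z → Λ} (hF : S.Nonneg F) (κ : Q) : S.Nonneg (S.L κ F) := by
  have := (hF.smul fun z => (S.x κ z : K) / S.P).add (hF.shift 1 κ)
  simp only [one_smul] at this
  exact this

theorem frob_supp (d : ℕ → K) (p : ℕ) (F : Z → Λ) : S.Supp (S.frob d p F) := fun z h => by
  by_contra hz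
  exact h (if_neg hz)

theorem frob_D {p : ℕ} (hp0 : 0 < p) (hp : Function.Injective fun w : Z => p • w) {d : ℕ → K}
    (hd : S.IsDwork p d) {F : Z → Λ} (hF : S.Supp F) :
    S.D (S.frob d p F) = (p : K) • S.frob d p (S.D F) := by
  funext z
  by_cases hz : S.ok z
  swap
  · simp [D_not_ok _ hz, frob, hz]
  have hG := dilate_nonneg hp hF.nonneg
  have hL : ∀ κ, S.L κ (S.frob d p F) z = S.L κ (S.mulSeries d (dilate p F)) z := by
    intro κ
    unfold L frob
    rw [if_pos hz]
    split_ifs with h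
    · rfl
    · congr 1
      symm
      refine finsum_eq_zero_of_forall_eq_zero fun k => ?_
      by_contra hne
      have h0 : dilate p F (z - S.s κ - S.shift k) ≠ 0 := fun h0 => hne (by rw [h0, smul_zero])
      have h1 := hG.le h0 κ
      rw [x_sub_self] at h1
      have h2 : (0 : ℚ) ≤ k κ := by positivity
      exact h (ok_sub hz (by linarith))
  rw [D_ok _ hz]
  simp only [hL, L_mulSeries hd hG, dilate_L hp]
  have hLn := fun κ => dilate_nonneg hp (L_nonneg (S := S) hF.nonneg κ)
  simp only [← mulSeries_comp ((hLn _).smul _)]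
  rw [← mulSeries_sum]
  · simp only [Pi.smul_apply, frob, if_pos hz]
    have hDn := dilate_nonneg hp (D_supp (S := S) F).nonneg
    have := mulSeries_comp hDn d ((p : K) • LinearMap.id) z
    simp only [LinearMap.smul_apply, LinearMap.id_apply] at this
    rw [← this]
    refine finsum_congr fun k => ?_
    congr 1
    set y := z - S.shift k with hy
    by_cases hyw : ∃ w, p • w = y
    swap
    · simp [dilate_of_not _ hyw]
    obtain ⟨w, hw⟩ := hyw
    rw [← hw]
    simp only [dilate_nsmul hp, map_smul]
    rw [← Finset.smul_sum]
    congr 1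
    by_cases hwok : S.ok w
    · rw [D_ok _ hwok]
    · rw [D_not_ok _ hwok]
      refine Finset.sum_eq_zero fun κ _ => ?_
      by_contra hne
      have h0 : S.L κ F w ≠ 0 := fun h0 => hne (by rw [h0, map_zero])
      have h1 := L_nonneg hF.nonneg κ w h0
      refine hwok ⟨h1, fun a b hab => ?_⟩
      have hle : ∀ a, S.x a z = 0 → S.x a w = 0 := by
        intro a ha
        have h2 : S.x a (p • w) = S.x a z - k a := by rw [hw, hy, map_sub, x_shift]
        rw [map_nsmul, ha, nsmul_eq_mul] at h2
        have h3 : (0 : ℚ) ≤ k a := by positivity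
        have h4 : (0 : ℚ) < p := by exact_mod_cast hp0
        nlinarith [h1 a]
      exact (hz.2 a b hab).imp (hle a) (hle b)
  · intro κ z hz κ'
    exact ((hLn κ).smul fun _ => (p : K)) z (fun h0 => hz (by
      simp only at h0 ⊢; rw [h0, map_zero])) κ'

end KSys

namespace KSys

variable {K Λ Q Z : Type} [NontriviallyNormedField K] [CharZero K]
  [NormedAddCommGroup Λ] [NormedSpace K Λ] [IsUltrametricDist Λ] [Fintype Q]
  [DecidableEq Q] [AddCommGroup Z] {S : KSys K Λ Q Z} {deg : Z →+ ℤ}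

theorem deg_shift_le (hdeg : ∀ κ, 0 ≤ deg (S.s κ)) (k : Q → ℕ) :
    deg (S.shift k) ≤ (∑ κ, deg (S.s κ)) * ∑ κ, (k κ : ℤ) := by
  unfold shift
  rw [map_sum, Finset.mul_sum]
  refine Finset.sum_le_sum fun κ _ => ?_
  rw [map_nsmul, nsmul_eq_mul, mul_comm]
  exact mul_le_mul_of_nonneg_right
    (Finset.single_le_sum (f := fun κ => deg (S.s κ)) (fun a _ => hdeg a) (Finset.mem_univ κ))
    (by positivity)

theorem frob_OC {p : ℕ} (hp0 : 0 < p) (hp : Function.Injective fun w : Z => p • w)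
    (hd : ∀ z, S.ok z → 0 ≤ deg z) (hdeg : ∀ κ, 0 ≤ deg (S.s κ)) {d : ℕ → K}
    (hdw : ∃ r C : ℝ, 0 < r ∧ r < 1 ∧ 0 ≤ C ∧ ∀ m, ‖d m‖ ≤ C * r ^ m) {F : Z → Λ}
    (hF : S.Supp F) (hO : S.OC deg F) : S.OC deg (S.frob d p F) := by
  obtain ⟨r, C, h0, h1, hC, h⟩ := hO
  obtain ⟨r', C', h0', h1', hC', h'⟩ := hdw
  obtain ⟨N, hN⟩ : ∃ N : ℕ, (N : ℤ) = p + ∑ κ, deg (S.s κ) :=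
    ⟨(p + ∑ κ, deg (S.s κ)).toNat, Int.toNat_of_nonneg
      (add_nonneg (by positivity) (Finset.sum_nonneg fun κ _ => hdeg κ))⟩
  have hsum : 0 ≤ ∑ κ, deg (S.s κ) := Finset.sum_nonneg fun κ _ => hdeg κ
  have hN0 : N ≠ 0 := by omega
  set t := max r r' with ht
  have ht0 : 0 < t := lt_max_of_lt_left h0
  have ht1 : t < 1 := max_lt h1 h1'
  set R := t ^ (N : ℝ)⁻¹ with hR
  have hR0 : 0 < R := Real.rpow_pos_of_pos ht0 _
  have hR1 : R < 1 := Real.rpow_lt_one ht0.le ht1 (by positivity)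
  have hRN : R ^ N = t := Real.rpow_inv_natCast_pow ht0.le hN0
  refine ⟨R, C' ^ Fintype.card Q * C, hR0, hR1, by positivity, fun z hz => ?_⟩
  rw [frob, if_pos hz, mulSeries, finsum_def]
  split_ifs with hfin
  swap
  · rw [norm_zero]; positivity
  refine IsUltrametricDist.norm_sum_le_of_forall_le_of_nonneg (by positivity) fun k _ => ?_
  by_cases hw : ∃ w, p • w = z - S.shift k
  swap
  · rw [dilate_of_not _ hw, smul_zero, norm_zero]; positivity
  obtain ⟨w, hw⟩ := hw
  rw [← hw, dilate_nsmul hp]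
  by_cases hok : S.ok w
  swap
  · rw [hF.zero hok, smul_zero, norm_zero]; positivity
  rw [norm_smul, norm_prod]
  have e1 : ∏ κ, ‖d (k κ)‖ ≤ C' ^ Fintype.card Q * t ^ (∑ κ, k κ) := by
    refine (Finset.prod_le_prod (fun _ _ => norm_nonneg _) fun κ _ => h' (k κ)).trans ?_
    rw [Finset.prod_mul_distrib, Finset.prod_pow_eq_pow_sum]
    simp only [Finset.prod_const, Finset.card_univ]
    gcongr
    exact le_max_right _ _
  have e2 : ‖F w‖ ≤ C * t ^ deg w := (h w hok).trans
    (mul_le_mul_of_nonneg_left (zpow_le_zpow_left₀ (hd w hok) h0.le (le_max_left _ _)) hC)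
  refine (mul_le_mul e1 e2 (norm_nonneg _) (by positivity)).trans ?_
  have e3 : deg z ≤ N * (∑ κ, (k κ : ℤ) + deg w) := by
    have h5 : deg z = deg (S.shift k) + p * deg w := by
      have : z = S.shift k + p • w := by rw [hw]; abel
      rw [this, map_add, map_nsmul, nsmul_eq_mul]
    have h6 := deg_shift_le hdeg k
    have h7 := hd w hok
    have h8 : 0 ≤ ∑ κ, (k κ : ℤ) := by positivity
    rw [h5, hN]
    nlinarith [mul_nonneg hsum h7, mul_nonneg (Nat.cast_nonneg (α := ℤ) p) h8]
  have e4 : t ^ (∑ κ, k κ) * t ^ deg w ≤ R ^ deg z := by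
    rw [← zpow_natCast t, ← zpow_add₀ ht0.ne', ← hRN, ← zpow_natCast R N, ← _root_.zpow_mul]
    refine zpow_le_zpow_right_of_le_one₀ hR0 hR1.le ?_
    push_cast
    exact e3
  calc _ = C' ^ Fintype.card Q * C * (t ^ (∑ κ, k κ) * t ^ deg w) := by ring
    _ ≤ _ := mul_le_mul_of_nonneg_left e4 (by positivity)

end KSys

section Recurrence

variable (K : Type) [Field K] [CharZero K] {p : ℕ} (π : K)

/-- The coefficient of `s ^ a t ^ b` in `exp (π (t - s))`. -/
noncomputable def expTerm (a b : ℕ) : K :=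
  ((-1 : K) ^ a * π ^ (a + b)) / ((a.factorial : K) * (b.factorial : K))

theorem succ_mul_expTerm_left (a b : ℕ) :
    ((a + 1 : ℕ) : K) * expTerm K π (a + 1) b = -π * expTerm K π a b := by
  have h1 : ((a.factorial : ℕ) : K) ≠ 0 := by exact_mod_cast a.factorial_ne_zero
  have h2 : ((b.factorial : ℕ) : K) ≠ 0 := by exact_mod_cast b.factorial_ne_zero
  have h3 : ((a : K) + 1) ≠ 0 := by exact_mod_cast a.succ_ne_zero
  unfold expTerm
  rw [Nat.factorial_succ, add_right_comm, pow_succ, pow_succ]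
  push_cast
  field_simp

theorem succ_mul_expTerm_right (a b : ℕ) :
    ((b + 1 : ℕ) : K) * expTerm K π a (b + 1) = π * expTerm K π a b := by
  have h1 : ((a.factorial : ℕ) : K) ≠ 0 := by exact_mod_cast a.factorial_ne_zero
  have h2 : ((b.factorial : ℕ) : K) ≠ 0 := by exact_mod_cast b.factorial_ne_zero
  have h3 : ((b : K) + 1) ≠ 0 := by exact_mod_cast b.succ_ne_zero
  unfold expTerm
  rw [Nat.factorial_succ, ← add_assoc, pow_succ]
  push_cast
  field_simp

theorem finite_pairs (hp : 0 < p) (m : ℕ) (f : ℕ × ℕ → K) :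
    (Function.support fun ab : ℕ × ℕ => if ab.1 + p * ab.2 = m then f ab else 0).Finite := by
  refine (Finset.finite_toSet (Finset.range (m + 1) ×ˢ Finset.range (m + 1))).subset ?_
  intro ab h
  have h1 : ab.1 + p * ab.2 = m := by
    by_contra h1; exact h (if_neg h1)
  have h2 : ab.2 ≤ p * ab.2 := Nat.le_mul_of_pos_left _ hp
  simp only [Finset.coe_product, Finset.coe_range, Set.mem_prod, Set.mem_Iio]
  omega

theorem dworkCoef_eq_finsum (hp : 0 < p) (m : ℕ) : dworkCoef K p π m =
    ∑ᶠ ab : ℕ × ℕ, if ab.1 + p * ab.2 = m then expTerm K π ab.1 ab.2 else 0 := by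
  rw [finsum_eq_sum_of_support_subset]
  · rfl
  · intro ab h
    have h1 : ab.1 + p * ab.2 = m := by
      by_contra h1; exact h (if_neg h1)
    have h2 : ab.2 ≤ p * ab.2 := Nat.le_mul_of_pos_left _ hp
    simp only [Finset.coe_product, Finset.coe_range, Set.mem_prod, Set.mem_Iio]
    omega

theorem dworkCoef_rec (hp : 0 < p) (m : ℕ) : (m : K) * dworkCoef K p π m =
    π * (p * (if p ≤ m then dworkCoef K p π (m - p) else 0) -
      if 1 ≤ m then dworkCoef K p π (m - 1) else 0) := by
  have h1 : ∑ᶠ ab : ℕ × ℕ, (if ab.1 + p * ab.2 = m then (ab.1 : K) * expTerm K π ab.1 ab.2 else 0)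
      = -π * if 1 ≤ m then dworkCoef K p π (m - 1) else 0 := by
    rw [finsum_eq_of_injective (e := fun ab : ℕ × ℕ => (ab.1 + 1, ab.2))]
    · split_ifs with hm
      · rw [dworkCoef_eq_finsum K π hp, mul_finsum' _ _ (finite_pairs K hp _ _)]
        refine finsum_congr fun ab => ?_
        rw [mul_ite, mul_zero, ← succ_mul_expTerm_left]
        exact if_congr (by simp only; omega) rfl rfl
      · rw [mul_zero]
        exact finsum_eq_zero_of_forall_eq_zero fun ab => if_neg (by simp only; omega)
    · intro a b h
      simp only [Prod.mk.injEq, Nat.add_right_cancel_iff] at h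
      exact Prod.ext h.1 h.2
    · rintro ⟨a, b⟩ h
      rcases a with _ | a
      · simp at h
      · exact ⟨(a, b), rfl⟩
  have h2 : ∑ᶠ ab : ℕ × ℕ, (if ab.1 + p * ab.2 = m then (ab.2 : K) * expTerm K π ab.1 ab.2 else 0)
      = π * if p ≤ m then dworkCoef K p π (m - p) else 0 := by
    rw [finsum_eq_of_injective (e := fun ab : ℕ × ℕ => (ab.1, ab.2 + 1))]
    · split_ifs with hm
      · rw [dworkCoef_eq_finsum K π hp, mul_finsum' _ _ (finite_pairs K hp _ _)]
        refine finsum_congr fun ab => ?_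
        rw [mul_ite, mul_zero, ← succ_mul_expTerm_right]
        exact if_congr (by simp only [mul_add]; omega) rfl rfl
      · rw [mul_zero]
        exact finsum_eq_zero_of_forall_eq_zero fun ab => if_neg (by simp only [mul_add]; omega)
    · intro a b h
      simp only [Prod.mk.injEq, Nat.add_right_cancel_iff] at h
      exact Prod.ext h.1 h.2
    · rintro ⟨a, b⟩ h
      rcases b with _ | b
      · simp at h
      · exact ⟨(a, b), rfl⟩
  have h3 : (m : K) * dworkCoef K p π m =
      ∑ᶠ ab : ℕ × ℕ, (if ab.1 + p * ab.2 = m then (ab.1 : K) * expTerm K π ab.1 ab.2 else 0) +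
      p * ∑ᶠ ab : ℕ × ℕ,
        (if ab.1 + p * ab.2 = m then (ab.2 : K) * expTerm K π ab.1 ab.2 else 0) := by
    rw [dworkCoef_eq_finsum K π hp, mul_finsum' _ _ (finite_pairs K hp _ _),
      mul_finsum' _ _ (finite_pairs K hp _ _), ← finsum_add_distrib (finite_pairs K hp _ _)]
    · refine finsum_congr fun ab => ?_
      split_ifs with h
      · rw [← h]; push_cast; ring
      · simp
    · refine (finite_pairs K hp m fun ab => (ab.2 : K) * expTerm K π ab.1 ab.2).subset ?_
      intro ab h h0
      exact h (by simp only [h0, mul_zero])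
  rw [h3, h1, h2]
  ring

end Recurrence

/-- The number of permutations of `m` letters whose `p`-th power is trivial. -/
def permCount (p : ℕ) : ℕ → ℤ
  | 0 => 1
  | m + 1 => permCount p m +
      if p - 1 ≤ m then (m.descFactorial (p - 1) : ℤ) * permCount p (m - (p - 1)) else 0

theorem dworkCoef_mul_factorial {K : Type} [Field K] [CharZero K] {p : ℕ} [hp : Fact p.Prime]
    (hodd : p ≠ 2) {π : K} (hπ : π ^ (p - 1) = -(p : K)) (m : ℕ) :
    dworkCoef K p π m * m.factorial = (-π) ^ m * permCount p m := by
  have hp1 := hp.out.one_lt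
  induction m using Nat.strong_induction_on with
  | _ m ih =>
    rcases m with _ | m
    · simp [dworkCoef, permCount]
    · have h := dworkCoef_rec K π hp.out.pos (m + 1)
      have h1 := ih m (by omega)
      rw [Nat.factorial_succ]
      have hcond : p ≤ m + 1 ↔ p - 1 ≤ m := by omega
      simp only [hcond, le_add_iff_nonneg_left, zero_le, if_true, Nat.add_sub_cancel] at h
      rw [permCount]
      split_ifs at h ⊢ with hm
      · have h2 := ih (m - (p - 1)) (by omega)
        rw [show m + 1 - p = m - (p - 1) by omega] at h
        have h4 : π * p * (-π) ^ (m - (p - 1)) = (-π) ^ (m + 1) := by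
          have e1 : (-π) ^ (m + 1) = (-π) ^ (m - (p - 1)) * (-π) ^ (p - 1 + 1) := by
            rw [← pow_add]; congr 1; omega
          have e2 : Even (p - 1) := hp.out.even_sub_one hodd
          rw [e1, pow_succ (-π) (p - 1), e2.neg_pow, hπ]
          ring
        have h3 : ((m - (p - 1)).factorial : K) * m.descFactorial (p - 1) = m.factorial := by
          exact_mod_cast Nat.factorial_mul_descFactorial hm
        push_cast at h ⊢
        linear_combination (m.factorial : K) * h - π * h1 - π * p *
          dworkCoef K p π (m - (p - 1)) * h3 + π * p * m.descFactorial (p - 1) * h2 +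
          (m.descFactorial (p - 1) * permCount p (m - (p - 1)) : K) * h4
      · push_cast at h ⊢
        linear_combination (m.factorial : K) * h - π * h1

section Divisibility

variable {p : ℕ} [hp : Fact p.Prime]

theorem dvd_descFactorial {m : ℕ} (h : ¬ p ∣ m + 1) : p ∣ m.descFactorial (p - 1) := by
  have h1 : p ∣ (m + 1) * m.descFactorial (p - 1) := by
    rw [← Nat.succ_descFactorial_succ, Nat.sub_add_cancel hp.out.one_lt.le]
    exact (Nat.dvd_factorial hp.out.pos le_rfl).trans (Nat.factorial_dvd_descFactorial _ _)
  exact (hp.out.dvd_mul.1 h1).resolve_left h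

theorem dvd_descFactorial_add_one (q : ℕ) :
    (p : ℤ) ∣ ((p * q + (p - 1)).descFactorial (p - 1) : ℤ) + 1 := by
  rw [Nat.add_descFactorial_eq_ascFactorial, Nat.ascFactorial_eq_prod_range,
    ← ZMod.intCast_zmod_eq_zero_iff_dvd]
  push_cast
  have h : ∀ i ∈ Finset.range (p - 1), ((p : ZMod p) * q + 1 + i) = ((i + 1 : ℕ) : ZMod p) := by
    intro i _
    simp [add_comm]
  rw [Finset.prod_congr rfl h, ← Nat.cast_prod, Finset.prod_range_add_one_eq_factorial,
    ZMod.wilsons_lemma]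
  simp

theorem pow_dvd_permCount (e : ℕ) : ∀ m, 3 * p * e ≤ m → (p : ℤ) ^ e ∣ permCount p m := by
  have hp1 := hp.out.one_lt
  induction e with
  | zero => simp
  | succ e ih =>
    set N := 3 * p * e with hN
    have hA : ∀ m, N + p ≤ m + 1 → ¬ p ∣ m + 1 →
        (p : ℤ) ^ (e + 1) ∣ permCount p (m + 1) - permCount p m := by
      intro m hm h
      rw [permCount, if_pos (by omega), add_sub_cancel_left, pow_succ']
      exact mul_dvd_mul (by exact_mod_cast dvd_descFactorial h) (ih _ (by omega))
    have hB : ∀ q, N + p ≤ p * q → ∀ j < p,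
        (p : ℤ) ^ (e + 1) ∣ permCount p (p * q + j) - permCount p (p * q) := by
      intro q hq j
      induction j with
      | zero => simp
      | succ j ihj =>
        intro hj
        have h1 := hA (p * q + j) (by omega) (by
          rw [add_assoc, Nat.dvd_add_right (dvd_mul_right p q)]
          exact fun h => absurd (Nat.le_of_dvd (by omega) h) (by omega))
        have h2 := dvd_add h1 (ihj (by omega))
        rwa [sub_add_sub_cancel] at h2
    have hC : ∀ q, N + p ≤ p * q → (p : ℤ) ^ (e + 1) ∣ permCount p (p * (q + 1)) := by
      intro q hq
      have h0 : p * (q + 1) = (p * q + (p - 1)) + 1 := by rw [mul_add]; omega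
      rw [h0, permCount, if_pos (by omega), Nat.add_sub_cancel]
      have h1 := hB q hq (p - 1) (by omega)
      have h2 : (p : ℤ) ^ (e + 1) ∣
          (((p * q + (p - 1)).descFactorial (p - 1) : ℤ) + 1) * permCount p (p * q) := by
        rw [pow_succ']
        exact mul_dvd_mul (dvd_descFactorial_add_one q) (ih _ (by omega))
      have h3 := dvd_add h1 h2
      exact h3.trans (dvd_of_eq (by ring))
    intro m hm
    have h1 : 3 * p * (e + 1) = N + 3 * p := by rw [hN]; ring
    have h2 := Nat.div_add_mod m p
    have h3 := Nat.mod_lt m hp.out.pos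
    obtain ⟨q, hq⟩ : ∃ q, m / p = q + 1 := by
      refine Nat.exists_eq_succ_of_ne_zero fun h0 => ?_
      rw [h0] at h2
      omega
    rw [hq] at h2
    have h4 : p * (q + 1) = p * q + p := by ring
    have h5 := dvd_add (hB (q + 1) (by omega) _ h3) (hC q (by omega))
    rwa [sub_add_cancel, h2] at h5

end Divisibility

theorem norm_pow_le_norm_factorial {p : ℕ} [hp : Fact p.Prime] {K : Type}
    [NontriviallyNormedField K] [IsUltrametricDist K] {π : K} (hpnorm : ‖(p : K)‖ = (p : ℝ)⁻¹)
    (hπ : π ^ (p - 1) = -(p : K)) (m : ℕ) : ‖π‖ ^ m ≤ ‖((m.factorial : ℕ) : K)‖ := by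
  have hpi := norm_pi_lt_one hpnorm hπ
  obtain ⟨y, hy⟩ : p ^ padicValNat p m.factorial ∣ m.factorial := pow_padicValNat_dvd
  have hcop : IsCoprime (y : ℤ) (p : ℤ) := by
    rw [Nat.isCoprime_iff_coprime, Nat.coprime_comm, hp.out.coprime_iff_not_dvd]
    rintro ⟨w, hw⟩
    refine pow_succ_padicValNat_not_dvd (p := p) m.factorial_ne_zero ⟨w, ?_⟩
    conv_lhs => rw [hy, hw]
    ring
  have h1 : ‖((m.factorial : ℕ) : K)‖ = ‖π‖ ^ ((p - 1) * padicValNat p m.factorial) := by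
    conv_lhs => rw [hy]
    have h2 := norm_intCast_eq_one (K := K) hpnorm hcop
    rw [Int.cast_natCast] at h2
    rw [Nat.cast_mul, norm_mul, h2, mul_one, Nat.cast_pow, norm_pow, hpnorm, pow_mul,
      norm_pi_pow hpnorm hπ]
  rw [h1, sub_one_mul_padicValNat_factorial]
  exact pow_le_pow_of_le_one (norm_nonneg _) hpi.le (Nat.sub_le _ _)

theorem dworkCoef_decay {p : ℕ} [hp : Fact p.Prime] (hodd : p ≠ 2) {K : Type}
    [NontriviallyNormedField K] [CharZero K] [IsUltrametricDist K] {π : K}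
    (hpnorm : ‖(p : K)‖ = (p : ℝ)⁻¹) (hπ : π ^ (p - 1) = -(p : K)) :
    ∃ r C : ℝ, 0 < r ∧ r < 1 ∧ 0 ≤ C ∧ ∀ m, ‖dworkCoef K p π m‖ ≤ C * r ^ m := by
  have hp0 : (0 : ℝ) < p := by exact_mod_cast hp.out.pos
  have hpinv : (0 : ℝ) < (p : ℝ)⁻¹ := by positivity
  have hpinv1 : (p : ℝ)⁻¹ < 1 := inv_lt_one_of_one_lt₀ (by exact_mod_cast hp.out.one_lt)
  have hN0 : 3 * p ≠ 0 := by have := hp.out.pos; omega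
  set R := (p : ℝ)⁻¹ ^ ((3 * p : ℕ) : ℝ)⁻¹ with hR
  have hR0 : 0 < R := Real.rpow_pos_of_pos hpinv _
  have hR1 : R < 1 := Real.rpow_lt_one hpinv.le hpinv1 (inv_pos.2 (by positivity))
  have hRN : R ^ (3 * p) = (p : ℝ)⁻¹ := Real.rpow_inv_natCast_pow hpinv.le hN0
  refine ⟨R, p, hR0, hR1, hp0.le, fun m => ?_⟩
  have h1 := dworkCoef_mul_factorial hodd hπ m
  have hfac : 0 < ‖((m.factorial : ℕ) : K)‖ :=
    norm_pos_iff.2 (by exact_mod_cast m.factorial_ne_zero)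
  have h2 : ‖dworkCoef K p π m‖ ≤ ‖((permCount p m : ℤ) : K)‖ := by
    have h3 := congrArg norm h1
    rw [norm_mul, norm_mul, norm_pow, norm_neg] at h3
    refine le_of_mul_le_mul_right ?_ hfac
    rw [h3, mul_comm]
    exact mul_le_mul_of_nonneg_left (norm_pow_le_norm_factorial hpnorm hπ m) (norm_nonneg _)
  set e := m / (3 * p) with he
  have h3 := norm_intCast_le_pow (K := K) hpnorm
    (pow_dvd_permCount (p := p) e m (Nat.mul_div_le m (3 * p)))
  refine h2.trans (h3.trans ?_)
  have h4 : m ≤ 3 * p * (e + 1) := (Nat.lt_mul_div_succ m (by omega)).le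
  have h5 : R ^ (3 * p * (e + 1)) ≤ R ^ m := pow_le_pow_of_le_one hR0.le hR1.le h4
  rw [pow_mul, hRN, pow_succ] at h5
  calc (p : ℝ)⁻¹ ^ e = p * ((p : ℝ)⁻¹ ^ e * (p : ℝ)⁻¹) := by field_simp
    _ ≤ _ := mul_le_mul_of_nonneg_left h5 hp0.le

section Twist

variable {K : Type} [Field K] {n : ℕ} (p : ℕ)

/-- The weight `p ^ (|S| + 2 |N \ S|)` on the exterior algebra. -/
noncomputable def gw (K : Type) [Field K] {n : ℕ} (p : ℕ) (N : Finset (Fin n)) :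
    ExtV K (Fin n) →ₗ[K] ExtV K (Fin n) :=
  diagOp fun S => (p : K) ^ (S.card + 2 * (N \ S).card)

theorem gw_apply (N : Finset (Fin n)) (v : ExtV K (Fin n)) (S : Finset (Fin n)) :
    gw K p N v S = (p : K) ^ (S.card + 2 * (N \ S).card) * v S := rfl

theorem gw_mulE {N : Finset (Fin n)} {k : Fin n} (hk : k ∉ N) (v : ExtV K (Fin n)) :
    gw K p N (mulE K k v) = (p : K) • mulE K k (gw K p N v) := by
  funext S
  rw [gw_apply, Pi.smul_apply, mulE_apply, mulE_apply, gw_apply]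
  split_ifs with h
  · have h1 : N \ S.erase k = N \ S := by
      ext i; simp only [Finset.mem_sdiff, Finset.mem_erase]
      exact ⟨fun h => ⟨h.1, fun h' => h.2 ⟨fun e => hk (e ▸ h.1), h'⟩⟩,
        fun h => ⟨h.1, fun h' => h.2 h'.2⟩⟩
    rw [h1, ← Finset.card_erase_add_one h, smul_eq_mul]
    ring
  · simp

theorem gw_contrE {N : Finset (Fin n)} {k : Fin n} (hk : k ∈ N) (v : ExtV K (Fin n)) :
    gw K p N (contrE K k v) = (p : K) • contrE K k (gw K p N v) := by
  funext S
  rw [gw_apply, Pi.smul_apply, contrE_apply, contrE_apply, gw_apply]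
  split_ifs with h
  · simp
  · have h1 : N \ S = insert k (N \ insert k S) := by
      ext i; simp only [Finset.mem_sdiff, Finset.mem_insert]
      by_cases e : i = k
      · subst e; simp [hk, h]
      · simp [e]
    have h2 : k ∉ N \ insert k S := by simp
    rw [h1, Finset.card_insert_of_notMem h2, Finset.card_insert_of_notMem h, smul_eq_mul]
    ring

theorem contrE_gw_insert (N : Finset (Fin n)) (k : Fin n) (v : ExtV K (Fin n)) :
    contrE K k (gw K p (insert k N) v) = contrE K k (gw K p N v) := by
  funext S
  rw [contrE_apply, contrE_apply, gw_apply, gw_apply]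
  have h1 : insert k N \ insert k S = N \ insert k S := by
    ext i; simp only [Finset.mem_sdiff, Finset.mem_insert]; tauto
  rw [h1]

theorem gw_EA (π : K) (A : Matrix (Fin n) (Fin n) ℕ) {N : Finset (Fin n)} {j : Fin n}
    (h : ∀ i, A j i ≠ 0 → i ∉ N) (v : ExtV K (Fin n)) :
    gw K p N (EA K π A j v) = (p : K) • EA K π A j (gw K p N v) := by
  rw [EA_apply, EA_apply, map_smul, map_sum, smul_comm, Finset.smul_sum (r := (p : K))]
  congr 1
  refine Finset.sum_congr rfl fun k _ => ?_
  by_cases hk : A j k = 0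
  · simp [hk]
  · rw [map_smul, gw_mulE p (h k hk), smul_comm]

theorem frs_sub_row {A : Matrix (Fin n) (Fin n) ℕ} (hA : (Aq A).det ≠ 0) (γ : Fin n → ℤ)
    (k : Fin n) : frs A (γ - row A k) = frs A γ := by
  unfold frs
  congr 1
  ext j
  rw [map_sub, crd_row hA]
  refine not_congr ⟨fun ⟨z, hz⟩ => ⟨z + if j = k then 1 else 0, ?_⟩,
    fun ⟨z, hz⟩ => ⟨z - if j = k then 1 else 0, ?_⟩⟩
  · push_cast; rw [← hz]; ring
  · push_cast; rw [← hz]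

/-- The indices at which the second component does not vanish. -/
noncomputable def nzs (A : Matrix (Fin n) (Fin n) ℕ) (z : (Fin n → ℤ) × (Fin n → ℤ)) :
    Finset (Fin n) := Finset.univ.filter fun i => crd Aᵀ i z.2 ≠ 0

/-- The twisting scalar at a monomial. -/
noncomputable def tau (p : ℕ) (ϖ : K) (A : Matrix (Fin n) (Fin n) ℕ)
    (z : (Fin n → ℤ) × (Fin n → ℤ)) : K :=
  ϖ ^ ((((p : ℤ) - 1) / 2) * ((frs A z.1).card - (frs Aᵀ z.2).card))

/-- The twisting scalar together with the weight on the exterior algebra. -/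
noncomputable def twist (p : ℕ) (ϖ : K) (A : Matrix (Fin n) (Fin n) ℕ) :
    ((Fin n → ℤ) × (Fin n → ℤ) → ExtV K (Fin n)) →ₗ[K]
      ((Fin n → ℤ) × (Fin n → ℤ) → ExtV K (Fin n)) where
  toFun F z := tau p ϖ A z • gw K p (nzs A z) (F z)
  map_add' F G := by funext z; simp
  map_smul' a F := by funext z; simp [smul_comm a]

theorem twist_apply (ϖ : K) (A : Matrix (Fin n) (Fin n) ℕ)
    (F : (Fin n → ℤ) × (Fin n → ℤ) → ExtV K (Fin n)) (z : (Fin n → ℤ) × (Fin n → ℤ)) :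
    twist p ϖ A F z = tau p ϖ A z • gw K p (nzs A z) (F z) := rfl

variable [CharZero K] {π : K} (hπ : π ≠ 0) {A : Matrix (Fin n) (Fin n) ℕ} (hA : (Aq A).det ≠ 0)
  (ϖ : K)

theorem twist_supp {F : (Fin n → ℤ) × (Fin n → ℤ) → ExtV K (Fin n)}
    (hF : (sys hπ hA).Supp F) : (sys hπ hA).Supp (twist p ϖ A F) := fun z h =>
  hF z fun h0 => h (by rw [twist_apply, h0, map_zero, smul_zero])

theorem L_eq_zero {F : (Fin n → ℤ) × (Fin n → ℤ) → ExtV K (Fin n)}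
    (hF : (sys hπ hA).Supp F) {k : Fin n ⊕ Fin n} {z : (Fin n → ℤ) × (Fin n → ℤ)}
    (h : (sys hπ hA).x k z = 0) : (sys hπ hA).L k F z = 0 := by
  rw [KSys.L, KSys.Supp.sub_shift hF (by rw [h]; norm_num), h]
  simp

theorem twist_D {F : (Fin n → ℤ) × (Fin n → ℤ) → ExtV K (Fin n)} (hF : (sys hπ hA).Supp F) :
    twist p ϖ A ((sys hπ hA).D F) = (p : K) • (sys hπ hA).D (twist p ϖ A F) := by
  funext z
  by_cases hz : (sys hπ hA).ok z
  swap
  · rw [twist_apply, Pi.smul_apply, KSys.D_not_ok _ hz, KSys.D_not_ok _ hz]; simp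
  rw [twist_apply, Pi.smul_apply, KSys.D_ok _ hz, KSys.D_ok _ hz, map_sum, Finset.smul_sum,
    Finset.smul_sum]
  refine Finset.sum_congr rfl fun k _ => ?_
  by_cases hk : (sys hπ hA).x k z = 0
  · rw [L_eq_zero hπ hA hF hk, L_eq_zero hπ hA (twist_supp p hπ hA ϖ hF) hk]; simp
  obtain ⟨-, -, hadj⟩ := (sys_ok_iff hπ hA z).1 hz
  rcases k with j | i
  · have h1 : (sys hπ hA).L (Sum.inl j) (twist p ϖ A F) z =
        tau p ϖ A z • gw K p (nzs A z) ((sys hπ hA).L (Sum.inl j) F z) := by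
      have hs : (sys hπ hA).s (Sum.inl j) = (row A j, 0) := rfl
      rw [KSys.L, KSys.L, map_add, smul_add, map_smul, smul_comm, twist_apply, twist_apply, hs]
      have e1 : tau p ϖ A (z - (row A j, 0)) = tau p ϖ A z := by
        simp only [tau, Prod.fst_sub, Prod.snd_sub, frs_sub_row hA, sub_zero]
      have e2 : nzs A (z - (row A j, 0)) = nzs A z := by
        simp only [nzs, Prod.snd_sub, sub_zero]
      rw [e1, e2]
    rw [h1]
    change _ • gw K p _ (EA K π A j _) = _ • EA K π A j _
    rw [gw_EA, map_smul, smul_comm]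
    intro i hi
    simpa [nzs] using (hadj j i hi).resolve_left hk
  · change _ • gw K p _ (contrE K i _) = _ • contrE K i _
    have hi : i ∈ nzs A z := Finset.mem_filter.2 ⟨Finset.mem_univ _, hk⟩
    have hs : (sys hπ hA).s (Sum.inr i) = (0, row Aᵀ i) := rfl
    have hAt : (Aq Aᵀ).det ≠ 0 := det_Aq_transpose hA
    have e1 : tau p ϖ A (z - (0, row Aᵀ i)) = tau p ϖ A z := by
      simp only [tau, Prod.fst_sub, Prod.snd_sub, frs_sub_row hAt, sub_zero]
    have e2 : insert i (nzs A (z - (0, row Aᵀ i))) = nzs A z := by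
      ext i'
      simp only [nzs, Prod.snd_sub, map_sub, crd_row hAt, Finset.mem_insert, Finset.mem_filter,
        Finset.mem_univ, true_and]
      by_cases e : i' = i
      · subst e; simpa [nzs] using hi
      · simp [e]
    rw [gw_contrE p hi, KSys.L, KSys.L, twist_apply, twist_apply, hs, e1, map_add, map_add,
      map_add, map_smul (contrE K i) (tau p ϖ A z), ← contrE_gw_insert p (nzs A (z - (0, row Aᵀ i))), e2]
    simp only [map_smul]
    module

end Twist

namespace KSys

variable {K Λ Q Z : Type} [Field K] [CharZero K] [AddCommGroup Λ] [Module K Λ] [Fintype Q]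
  [DecidableEq Q] [AddCommGroup Z] {S : KSys K Λ Q Z} {p : ℕ}

theorem frob_smul (d : ℕ → K) (a : K) (F : Z → Λ) :
    S.frob d p (a • F) = a • S.frob d p F := by
  have h : dilate p (a • F) = a • dilate p F := by
    unfold dilate
    rw [← smul_zero (A := Z → Λ) a, Function.extend_smul, smul_zero]
  funext z
  rw [Pi.smul_apply, frob, frob, h]
  split_ifs
  · unfold mulSeries
    rw [smul_finsum]
    simp only [Pi.smul_apply, smul_comm a]
  · rw [smul_zero]

theorem frob_sub (hp : Function.Injective fun w : Z => p • w) (d : ℕ → K) {F G : Z → Λ}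
    (hF : S.Supp F) (hG : S.Supp G) : S.frob d p (F - G) = S.frob d p F - S.frob d p G := by
  have hd : dilate p F = fun z => dilate p (F - G) z + dilate p G z := by
    funext z
    by_cases h : ∃ w, p • w = z
    · obtain ⟨w, rfl⟩ := h
      simp only [dilate_nsmul hp, Pi.sub_apply, sub_add_cancel]
    · simp only [dilate_of_not _ h, add_zero]
  rw [eq_sub_iff_add_eq]
  funext z
  rw [Pi.add_apply, frob, frob, frob, hd, mulSeries_add (dilate_nonneg hp (hF.sub hG).nonneg)
    (dilate_nonneg hp hG.nonneg)]
  split_ifs <;> simp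

end KSys

section Dual

variable {K : Type} [Field K] [CharZero K] {n : ℕ} {π : K} (hπ : π ≠ 0)
  {A : Matrix (Fin n) (Fin n) ℕ} (hA : (Aq A).det ≠ 0)

theorem starA_EA (hπ : π ≠ 0) (hA : (Aq A).det ≠ 0) (j : Fin n) (v : ExtV K (Fin n)) :
    starA K π A (EA K π A j v) = contrE K j (starA K π A v) := by
  have hA' : IsUnit (Aᵀ.map ((↑) : ℕ → K)).det :=
    isUnit_iff_ne_zero.2 (det_cast (det_Aq_transpose hA))
  rw [EA_apply]
  simp only [map_smul, map_sum, starA_mulE, EAdual_apply, Finset.smul_sum, smul_smul]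
  rw [Finset.sum_comm, Finset.sum_eq_single j]
  · rw [← Finset.sum_smul]
    have := congrFun (congrFun (Matrix.nonsing_inv_mul _ hA') j) j
    rw [Matrix.mul_apply, Matrix.one_apply_eq] at this
    trans (1 : K) • contrE K j (starA K π A v)
    · congr 1
      rw [← this]
      refine Finset.sum_congr rfl fun k _ => ?_
      simp only [Matrix.map_apply, Matrix.transpose_apply]
      field_simp
    · exact one_smul _ _
  · intro l _ hl
    rw [← Finset.sum_smul]
    have := congrFun (congrFun (Matrix.nonsing_inv_mul _ hA') l) j
    rw [Matrix.mul_apply, Matrix.one_apply_ne hl] at this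
    convert zero_smul K _
    rw [← this]
    refine Finset.sum_congr rfl fun k _ => ?_
    simp only [Matrix.map_apply, Matrix.transpose_apply]
    field_simp
  · simp

/-- The duality map. -/
noncomputable def dlt (π : K) (A : Matrix (Fin n) (Fin n) ℕ) :
    ((Fin n → ℤ) × (Fin n → ℤ) → ExtV K (Fin n)) →ₗ[K]
      ((Fin n → ℤ) × (Fin n → ℤ) → ExtV K (Fin n)) where
  toFun F z := starA K π A (F z.swap)
  map_add' F G := by funext z; simp
  map_smul' a F := by funext z; simp

theorem dlt_apply (F : (Fin n → ℤ) × (Fin n → ℤ) → ExtV K (Fin n))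
    (z : (Fin n → ℤ) × (Fin n → ℤ)) : dlt π A F z = starA K π A (F z.swap) := rfl

theorem ok_swap {z : (Fin n → ℤ) × (Fin n → ℤ)} :
    (sys hπ (det_Aq_transpose hA)).ok z ↔ (sys hπ hA).ok z.swap := by
  rw [sys_ok_iff, sys_ok_iff]
  simp only [Matrix.transpose_transpose, Matrix.transpose_apply, Prod.fst_swap, Prod.snd_swap]
  exact ⟨fun ⟨h1, h2, h3⟩ => ⟨h2, h1, fun j i h => (h3 i j h).symm⟩,
    fun ⟨h1, h2, h3⟩ => ⟨h2, h1, fun j i h => (h3 i j h).symm⟩⟩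

theorem dlt_supp {F : (Fin n → ℤ) × (Fin n → ℤ) → ExtV K (Fin n)} (hF : (sys hπ hA).Supp F) :
    (sys hπ (det_Aq_transpose hA)).Supp (dlt π A F) := fun z h =>
  (ok_swap hπ hA).2 (hF _ fun h0 => h (by rw [dlt_apply, h0, map_zero]))

theorem dlt_D (F : (Fin n → ℤ) × (Fin n → ℤ) → ExtV K (Fin n)) :
    (sys hπ (det_Aq_transpose hA)).D (dlt π A F) = dlt π A ((sys hπ hA).D F) := by
  funext z
  by_cases hz : (sys hπ (det_Aq_transpose hA)).ok z
  swap
  · rw [KSys.D_not_ok _ hz, dlt_apply, KSys.D_not_ok _ (mt (ok_swap hπ hA).2 hz), map_zero]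
  rw [KSys.D_ok _ hz, dlt_apply, KSys.D_ok _ ((ok_swap hπ hA).1 hz), map_sum,
    Fintype.sum_sum_type, Fintype.sum_sum_type, add_comm]
  congr 1
  · refine Finset.sum_congr rfl fun j _ => ?_
    have h : (sys hπ (det_Aq_transpose hA)).L (Sum.inr j) (dlt π A F) z =
        starA K π A ((sys hπ hA).L (Sum.inl j) F z.swap) := by
      rw [KSys.L, KSys.L, map_add, map_smul]; rfl
    rw [h]
    exact (starA_EA hπ hA j _).symm
  · refine Finset.sum_congr rfl fun j _ => ?_
    have h : (sys hπ (det_Aq_transpose hA)).L (Sum.inl j) (dlt π A F) z =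
        starA K π A ((sys hπ hA).L (Sum.inr j) F z.swap) := by
      rw [KSys.L, KSys.L, map_add, map_smul]; rfl
    rw [h]
    exact (starA_contrE _ _ hπ (det_cast hA) j _).symm

theorem nsmul_injective {p : ℕ} (hp : 0 < p) :
    Function.Injective fun w : (Fin n → ℤ) × (Fin n → ℤ) => p • w :=
  nsmul_right_injective hp.ne'

theorem dlt_frob {p : ℕ} (hp : 0 < p) (d : ℕ → K)
    {F : (Fin n → ℤ) × (Fin n → ℤ) → ExtV K (Fin n)} (hF : (sys hπ hA).Supp F) :
    dlt π A ((sys hπ hA).frob d p F) = (sys hπ (det_Aq_transpose hA)).frob d p (dlt π A F) := by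
  funext z
  rw [dlt_apply, KSys.frob, KSys.frob, apply_ite (starA K π A), map_zero]
  refine if_congr (ok_swap hπ hA).symm ?_ rfl
  have hd : KSys.dilate p (dlt π A F) = dlt π A (KSys.dilate p F) := by
    funext w
    by_cases h : ∃ u, p • u = w
    · obtain ⟨u, rfl⟩ := h
      rw [KSys.dilate_nsmul (nsmul_injective hp), dlt_apply, dlt_apply,
        show (p • u).swap = p • u.swap from rfl, KSys.dilate_nsmul (nsmul_injective hp)]
    · rw [KSys.dilate_of_not _ h, dlt_apply, KSys.dilate_of_not, map_zero]
      rintro ⟨u, hu⟩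
      exact h ⟨u.swap, by rw [← Prod.swap_swap w, ← hu]; rfl⟩
  rw [← KSys.mulSeries_comp (KSys.dilate_nonneg (nsmul_injective hp) hF.nonneg), hd]
  unfold KSys.mulSeries
  rw [← finsum_comp_equiv (Equiv.arrowCongr (Equiv.sumComm (Fin n) (Fin n)) (Equiv.refl ℕ))]
  refine finsum_congr fun k => ?_
  rw [dlt_apply]
  congr 1
  · simp only [Fintype.prod_sum_type, Equiv.arrowCongr_apply, Equiv.sumComm_symm,
      Function.comp_apply, Equiv.sumComm_apply, Sum.swap_inl, Sum.swap_inr, Equiv.refl_apply]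
    rw [mul_comm]
  · congr 2
    simp only [KSys.shift, Fintype.sum_sum_type, Equiv.arrowCongr_apply, Equiv.sumComm_symm,
      Function.comp_apply, Equiv.sumComm_apply, Sum.swap_inl, Sum.swap_inr, Equiv.refl_apply]
    refine Prod.ext ?_ ?_ <;>
    simp [Prod.fst_sum, Prod.snd_sum, sys]

end Dual

section Middle

variable {K : Type} [Field K] [CharZero K] {n : ℕ} {π : K} (hπ : π ≠ 0)
  {A : Matrix (Fin n) (Fin n) ℕ} (hA : (Aq A).det ≠ 0)

theorem starTop_mem : starTop K π A ∈ formsOn K (fun S : Finset (Fin n) => S.card = n) := by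
  have h : ∀ l : List (Fin n), l.foldr (fun i v => EA K π Aᵀ i v)
      (Pi.single (∅ : Finset (Fin n)) (1 : K)) ∈ formsOn K (fun S => S.card = l.length) := by
    intro l
    induction l with
    | nil =>
      intro S hS
      by_cases h : S = ∅
      · simp [h]
      · exact absurd (Pi.single_eq_of_ne h _) hS
    | cons i l ih =>
      refine EA_mem_formsOn _ _ ih fun k S _ hk hS => ?_
      rw [Finset.card_insert_of_notMem hk, hS, List.length_cons]
  have := h (Finset.univ.sort (· ≤ ·))
  rwa [Finset.length_sort, Finset.card_univ, Fintype.card_fin] at this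

theorem starA_single_mem (V : Finset (Fin n)) : starA K π A (Pi.single V 1) ∈
    formsOn K (fun S : Finset (Fin n) => S.card + V.card = n) := by
  have h : ∀ l : List (Fin n), l.foldr (fun i v => EAdual K π Aᵀ i v) (starTop K π A) ∈
      formsOn K (fun S => S.card + l.length = n) := by
    intro l
    induction l with
    | nil => exact starTop_mem
    | cons i l ih =>
      refine EAdual_mem_formsOn _ _ ih fun k S hk hS => ?_
      rw [Finset.card_insert_of_notMem hk] at hS
      rw [List.length_cons]; omega
  rw [starA_single, ← Finset.length_sort (· ≤ ·)]
  exact h _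

/-- Duality commutes with the twists on the middle part. -/
theorem dlt_twist_mid {p : ℕ} (hp0 : (p : K) ≠ 0) (hp1 : p ≠ 1) (hodd : Odd p) {ϖ : K} (hϖ : ϖ ^ (p - 1) = p)
    {c : (Fin n → ℤ) × (Fin n → ℤ) → ExtV K (Fin n)}
    (hc : ∀ z S, c z S ≠ 0 → (sys hπ hA).ok z ∧ (∀ i, crd Aᵀ i z.2 < 1) ∧
        S = Finset.univ.filter (fun i => crd Aᵀ i z.2 = 0) ∧
        2 * rk A z.1 = S.card + (frs A z.1).card) :
    dlt π A (twist p ϖ A c) = twist p ϖ Aᵀ (dlt π A c) := by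
  funext z
  rw [dlt_apply, twist_apply, twist_apply, dlt_apply]
  by_cases h0 : c z.swap = 0
  · simp [h0]
  obtain ⟨V, hV⟩ := Function.ne_iff.1 h0
  have hcV : c z.swap = c z.swap V • Pi.single V 1 := by
    funext S
    by_cases hS : S = V
    · subst hS; simp
    · rw [Pi.smul_apply, Pi.single_eq_of_ne hS, smul_zero]
      by_contra h
      exact hS ((hc _ _ h).2.2.1.trans (hc _ _ hV).2.2.1.symm)
  obtain ⟨hok, hlt, hVe, hrk⟩ := hc _ _ hV
  obtain ⟨-, hnn, hadj⟩ := (sys_ok_iff hπ hA _).1 hok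
  rw [hcV]
  simp only [map_smul]
  rw [smul_comm, smul_comm (tau p ϖ Aᵀ z)]
  congr 1
  have hnz : nzs A z.swap = Vᶜ := by ext i; simp [nzs, hVe]
  have hfr : frs Aᵀ z.1 = Vᶜ := by
    ext i
    simp only [frs, hVe, Finset.mem_filter, Finset.mem_univ, true_and, Finset.mem_compl]
    refine not_congr ⟨fun ⟨m, hm⟩ => ?_, fun h => ⟨0, by simpa using h⟩⟩
    have h1 := hnn i
    have h2 := hlt i
    simp only [Prod.snd_swap] at h1 h2 ⊢
    rw [hm] at h1 h2 ⊢
    have h3 : m = 0 := by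
      have : 0 ≤ m := by exact_mod_cast h1
      have : m < 1 := by exact_mod_cast h2
      omega
    simp [h3]
  have hVc : Vᶜ.card + V.card = n := by
    rw [Finset.card_compl, Fintype.card_fin]
    have := Finset.card_le_univ V
    rw [Fintype.card_fin] at this
    omega
  have h1 : gw K p (nzs A z.swap) (Pi.single V 1) =
      (p : K) ^ (n + (frs Aᵀ z.1).card) • Pi.single V 1 := by
    funext S
    by_cases hS : S = V
    · subst hS
      rw [gw_apply, hnz, hfr, Pi.smul_apply, smul_eq_mul, Finset.sdiff_eq_self_of_disjoint
        disjoint_compl_left]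
      congr 2; omega
    · simp [gw_apply, Pi.single_eq_of_ne hS]
  have h2 : gw K p (nzs Aᵀ z) (starA K π A (Pi.single V 1)) =
      (p : K) ^ (n + (frs A z.2).card) • starA K π A (Pi.single V 1) := by
    funext S
    rw [gw_apply, Pi.smul_apply, smul_eq_mul]
    by_cases hS : starA K π A (Pi.single V 1) S = 0
    · rw [hS, mul_zero, mul_zero]
    have hcard := starA_single_mem V S hS
    have hdisj : Disjoint (nzs Aᵀ z) S := by
      rw [Finset.disjoint_left]
      intro j hj hjS
      have hj' : crd A j z.2 ≠ 0 := (Finset.mem_filter.1 hj).2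
      have hE : EA K π A j (Pi.single V 1) = 0 := by
        have : EA K π A j (Pi.single V 1) ∈ formsOn K (fun _ => False) := by
          refine EA_mem_formsOn (P := fun S => S = V) _ _ ?_ fun k S hk hkS hSV => ?_
          · intro S hS
            by_contra h
            exact hS (Pi.single_eq_of_ne h _)
          · refine hkS ?_
            rw [hSV, hVe]
            simpa using (hadj j k hk).resolve_left hj'
        funext S
        by_contra h
        exact this S h
      have h3 := starA_EA hπ hA j (Pi.single V (1 : K))
      rw [hE, map_zero] at h3
      have h4 := congrFun h3 (S.erase j)
      rw [contrE_apply, if_neg (Finset.notMem_erase j S), Finset.insert_erase hjS] at h4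
      rcases mul_eq_zero.1 h4.symm with h | h
      · exact absurd h (pow_ne_zero _ (by simp))
      · exact hS h
    rw [Finset.sdiff_eq_self_of_disjoint hdisj]
    congr 2
    have : (nzs Aᵀ z).card = rk A z.2 := rfl
    rw [this]
    simp only [Prod.fst_swap] at hrk
    omega
  rw [h1, h2, map_smul, smul_smul, smul_smul]
  congr 1
  have hϖ0 : ϖ ≠ 0 := by
    rintro rfl
    rw [zero_pow (by have := hodd.pos; omega)] at hϖ
    exact hp0 hϖ.symm
  obtain ⟨m, rfl⟩ := hodd
  have e : (((2 * m + 1 : ℕ) : ℤ) - 1) / 2 = m := by push_cast; omega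
  rw [tau, tau, e]
  simp only [Prod.fst_swap, Prod.snd_swap, Matrix.transpose_transpose]
  rw [← hϖ, show 2 * m + 1 - 1 = 2 * m by omega, ← pow_mul, ← pow_mul, ← zpow_natCast ϖ,
    ← zpow_natCast ϖ, ← zpow_add₀ hϖ0, ← zpow_add₀ hϖ0]
  congr 1
  push_cast
  ring

end Middle

section Model

variable {K : Type} [NontriviallyNormedField K] [CompleteSpace K] [CharZero K] {n : ℕ} {π : K}
  (hπ : π ≠ 0) {A : Matrix (Fin n) (Fin n) ℕ} (hA : (Aq A).det ≠ 0) (p : ℕ) (ϖ : K)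

theorem dlt_OC {F : (Fin n → ℤ) × (Fin n → ℤ) → ExtV K (Fin n)}
    (hF : (sys hπ hA).OC (tdeg n) F) :
    (sys hπ (det_Aq_transpose hA)).OC (tdeg n) (dlt π A F) := by
  obtain ⟨r, C, h0, h1, hC, h⟩ := hF.comp (starA K π A)
  refine ⟨r, C, h0, h1, hC, fun z hz => ?_⟩
  rw [show tdeg n z = tdeg n z.swap from add_comm _ _]
  exact h _ ((ok_swap hπ hA).1 hz)

theorem twist_OC (hp : ‖(p : K)‖ ≤ 1) {F : (Fin n → ℤ) × (Fin n → ℤ) → ExtV K (Fin n)}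
    (hF : (sys hπ hA).OC (tdeg n) F) : (sys hπ hA).OC (tdeg n) (twist p ϖ A F) := by
  obtain ⟨r, C, h0, h1, hC, h⟩ := hF
  let f : Finset (Fin n) × Finset (Fin n) → ℝ := fun I =>
    ‖ϖ ^ ((((p : ℤ) - 1) / 2) * (I.1.card - I.2.card))‖
  refine ⟨r, (∑ I, f I) * C, h0, h1, by positivity, fun z hz => ?_⟩
  have ht : ‖tau p ϖ A z‖ ≤ ∑ I, f I :=
    Finset.single_le_sum (f := f) (fun I _ => norm_nonneg _)
      (Finset.mem_univ (frs A z.1, frs Aᵀ z.2))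
  have hg : ‖gw K p (nzs A z) (F z)‖ ≤ ‖F z‖ := by
    refine (pi_norm_le_iff_of_nonneg (norm_nonneg _)).2 fun S => ?_
    rw [gw_apply, norm_mul, norm_pow]
    exact (mul_le_of_le_one_left (norm_nonneg _) (pow_le_one₀ (norm_nonneg _) hp)).trans
      (norm_le_pi_norm (F z) S)
  rw [twist_apply, norm_smul, mul_assoc]
  exact mul_le_mul ht (hg.trans (h z hz)) (norm_nonneg _) (Finset.sum_nonneg fun I _ => norm_nonneg _)

/-- The twisted Frobenius commutes with the differential. -/
theorem frob_twist_D (hp : 0 < p) {d : ℕ → K} (hd : (sys hπ hA).IsDwork p d)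
    {F : (Fin n → ℤ) × (Fin n → ℤ) → ExtV K (Fin n)} (hF : (sys hπ hA).Supp F) :
    (sys hπ hA).frob d p (twist p ϖ A ((sys hπ hA).D F)) =
      (sys hπ hA).D ((sys hπ hA).frob d p (twist p ϖ A F)) := by
  rw [twist_D p hπ hA ϖ hF, KSys.frob_smul,
    KSys.frob_D hp (nsmul_injective hp) hd (twist_supp p hπ hA ϖ hF)]

variable [IsUltrametricDist K]

theorem frob_dlt_twist_cohomologous (hp : 0 < p) (hp1 : p ≠ 1) (hpn : ‖(p : K)‖ ≤ 1) (hodd : Odd p)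
    (hϖ : ϖ ^ (p - 1) = p) {d : ℕ → K} (hd : (sys hπ (det_Aq_transpose hA)).IsDwork p d)
    (hdw : ∃ r C : ℝ, 0 < r ∧ r < 1 ∧ 0 ≤ C ∧ ∀ m, ‖d m‖ ≤ C * r ^ m)
    (hdet : 0 < (A.map ((↑) : ℕ → ℤ)).det) (hS : (sys hπ hA).Growth (tdeg n))
    (hS' : (sys hπ (det_Aq_transpose hA)).Growth (tdeg n))
    (hq : HasWeights A) (hreg : ∀ V lam, IsMin A V lam → KosReg K A V)
    {c : (Fin n → ℤ) × (Fin n → ℤ) → ExtV K (Fin n)} (hs : (sys hπ hA).Supp c)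
    (hc : (sys hπ hA).OC (tdeg n) c) (hD : (sys hπ hA).D c = 0) :
    ∃ b, (sys hπ (det_Aq_transpose hA)).Supp b ∧
      (sys hπ (det_Aq_transpose hA)).OC (tdeg n) b ∧
      dlt π A ((sys hπ hA).frob d p (twist p ϖ A c)) =
        (sys hπ (det_Aq_transpose hA)).frob d p (twist p ϖ Aᵀ (dlt π A c)) +
          (sys hπ (det_Aq_transpose hA)).D b := by
  have hA' := det_Aq_transpose hA
  have hdeg : ∀ z, (sys hπ hA).ok z → 0 ≤ tdeg n z := fun z hz => tdeg_nonneg hz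
  have hdeg' : ∀ z, (sys hπ hA').ok z → 0 ≤ tdeg n z := fun z hz => tdeg_nonneg hz
  obtain ⟨b, bs, bo, bm⟩ := exists_mid_of_cocycle (hπ := hπ) (hA := hA) (deg := tdeg n) hdet hdeg hS hq
    hreg hs hc hD
  have hmid := dlt_twist_mid hπ hA (by exact_mod_cast hp.ne') hp1 hodd hϖ bm
  have t1 := twist_supp p hπ hA ϖ bs
  have t2 := dlt_supp hπ hA bs
  set b' := dlt π A (twist p ϖ A b) - twist p ϖ Aᵀ (dlt π A b) with hb'
  have b's : (sys hπ hA').Supp b' :=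
    (dlt_supp hπ hA t1).sub (twist_supp p hπ hA' ϖ t2)
  have b'o : (sys hπ hA').OC (tdeg n) b' := by
    rw [hb', sub_eq_add_neg]
    refine KSys.OC.add hdeg' (dlt_OC hπ hA (twist_OC hπ hA p ϖ hpn bo)) ?_
    exact (twist_OC hπ hA' p ϖ hpn (dlt_OC hπ hA bo)).comp (-LinearMap.id)
  have key : dlt π A (twist p ϖ A c) - twist p ϖ Aᵀ (dlt π A c) = (p : K) • (sys hπ hA').D b' := by
    have h1 : dlt π A (twist p ϖ A ((sys hπ hA).D b)) -
        twist p ϖ Aᵀ (dlt π A ((sys hπ hA).D b)) = (p : K) • (sys hπ hA').D b' := by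
      rw [twist_D p hπ hA ϖ bs, map_smul, ← dlt_D, ← dlt_D, twist_D p hπ hA' ϖ t2, hb', map_sub,
        smul_sub]
    simp only [map_sub] at hmid
    rw [← h1]
    exact sub_eq_sub_iff_sub_eq_sub.1 hmid
  refine ⟨(sys hπ hA').frob d p b', KSys.frob_supp _ _ _,
    KSys.frob_OC hp (nsmul_injective hp) hdeg' ?_ hdw b's b'o, ?_⟩
  · exact fun κ => zero_le_one.trans (hS'.deg_s κ)
  · rw [dlt_frob hπ hA hp d (twist_supp p hπ hA ϖ hs), ← sub_eq_iff_eq_add',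
      ← KSys.frob_sub (nsmul_injective hp) d (dlt_supp hπ hA (twist_supp p hπ hA ϖ hs))
        (twist_supp p hπ hA' ϖ (dlt_supp hπ hA hs)), key, KSys.frob_smul,
      KSys.frob_D hp (nsmul_injective hp) hd b's]

end Model

section Translate

variable {K : Type} [Field K] [CharZero K] {n : ℕ} {π : K} (hπ : π ≠ 0)
  {A : Matrix (Fin n) (Fin n) ℕ} (hA : (Aq A).det ≠ 0)

/-- The integral exponents of a monomial. -/
def zof (m : MonIdx (Fin n)) : (Fin n → ℤ) × (Fin n → ℤ) := (fun i => m.1 i, fun i => m.2 i)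

theorem zof_injective : Function.Injective (zof (n := n)) := fun a b h => by
  simp only [zof, Prod.mk.injEq, funext_iff, Nat.cast_inj] at h
  exact Prod.ext (funext h.1) (funext h.2)

theorem exists_zof {z : (Fin n → ℤ) × (Fin n → ℤ)} (h1 : ∀ k, 0 ≤ z.1 k) (h2 : ∀ k, 0 ≤ z.2 k) :
    ∃ m, zof m = z :=
  ⟨(fun i => (z.1 i).toNat, fun i => (z.2 i).toNat),
    Prod.ext (funext fun i => Int.toNat_of_nonneg (h1 i))
      (funext fun i => Int.toNat_of_nonneg (h2 i))⟩

theorem gamRow_eq (m : MonIdx (Fin n)) (j : Fin n) : gamRow A m.1 j = crd A j (zof m).1 := by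
  simp [gamRow, crd_apply, zof]

theorem lamRow_eq (m : MonIdx (Fin n)) (j : Fin n) : lamRow A m.2 j = crd Aᵀ j (zof m).2 := by
  simp [lamRow, crd_apply, zof, Aq_transpose]

theorem ok_zof_iff (m : MonIdx (Fin n)) :
    (sys hπ hA).ok (zof m) ↔ OKA A m ∧ ∀ j, 0 ≤ crd A j (zof m).1 := by
  rw [sys_ok_iff]
  have hdot : (gamRow A m.1 ⬝ᵥ fun i => ((m.2 i : ℚ))) =
      ∑ i, ∑ j, crd A i (zof m).1 * (crd Aᵀ j (zof m).2 * A i j) := by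
    refine Finset.sum_congr rfl fun i _ => ?_
    rw [gamRow_eq, ← Finset.mul_sum]
    congr 1
    exact (sum_crd_mul (det_Aq_transpose hA) (zof m).2 i).symm
  simp only [OKA, hdot, lamRow_eq]
  constructor
  · rintro ⟨h1, h2, h3⟩
    refine ⟨⟨h2, Finset.sum_eq_zero fun i _ => Finset.sum_eq_zero fun j _ => ?_⟩, h1⟩
    by_cases h : A i j = 0
    · simp [h]
    · rcases h3 i j h with e | e <;> simp [e]
  · rintro ⟨⟨h2, h3⟩, h1⟩
    refine ⟨h1, h2, fun i j h => ?_⟩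
    have hn : ∀ i j, 0 ≤ crd A i (zof m).1 * (crd Aᵀ j (zof m).2 * A i j) := fun i j =>
      mul_nonneg (h1 i) (mul_nonneg (h2 j) (Nat.cast_nonneg _))
    rw [Finset.sum_eq_zero_iff_of_nonneg fun i _ => Finset.sum_nonneg fun j _ => hn i j] at h3
    have h4 := h3 i (Finset.mem_univ _)
    rw [Finset.sum_eq_zero_iff_of_nonneg fun j _ => hn i j] at h4
    have h5 := h4 j (Finset.mem_univ _)
    simpa [h] using h5

theorem exists_amon {z : (Fin n → ℤ) × (Fin n → ℤ)} (hz : (sys hπ hA).ok z) :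
    ∃ m : AMon A, zof m.1 = z := by
  obtain ⟨m, hm⟩ := exists_zof (ok_nonneg hz).1 (ok_nonneg hz).2
  rw [← hm] at hz
  exact ⟨⟨m, ((ok_zof_iff hπ hA m).1 hz).1⟩, hm⟩

theorem ok_of_nonneg_sub (m : AMon A) {w : (Fin n → ℤ) × (Fin n → ℤ)}
    (hw : ∀ κ, 0 ≤ (sys hπ hA).x κ w) (h : ∀ κ, (sys hπ hA).x κ w ≤ (sys hπ hA).x κ (zof m.1)) :
    (sys hπ hA).ok (zof m.1) :=
  (ok_zof_iff hπ hA _).2 ⟨m.2, fun j => (hw (Sum.inl j)).trans (h (Sum.inl j))⟩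

/-- The restriction of a function on integral exponents to the allowed monomials. -/
def toB (A : Matrix (Fin n) (Fin n) ℕ) :
    ((Fin n → ℤ) × (Fin n → ℤ) → ExtV K (Fin n)) →ₗ[K] BFull K A where
  toFun F q := F (zof q.1.1) q.2
  map_add' _ _ := rfl
  map_smul' _ _ := rfl

theorem toB_apply (F : (Fin n → ℤ) × (Fin n → ℤ) → ExtV K (Fin n)) (q : BIdx A) :
    toB A F q = F (zof q.1.1) q.2 := rfl

theorem eq_zero_of_toB {F : (Fin n → ℤ) × (Fin n → ℤ) → ExtV K (Fin n)}
    (hF : (sys hπ hA).Supp F) (h : toB A F = 0) : F = 0 := by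
  funext z
  by_contra h0
  obtain ⟨m, rfl⟩ := exists_amon hπ hA (hF z h0)
  exact h0 (funext fun S => congrFun h (m, S))

theorem exists_toB (c : BFull K A) (hc : ∀ q, c q ≠ 0 → gamOK A q) :
    ∃ F, (sys hπ hA).Supp F ∧ toB A F = c := by
  have hinj : Function.Injective fun m : AMon A => zof m.1 :=
    zof_injective.comp Subtype.val_injective
  have he : ∀ m : AMon A, Function.extend (fun m : AMon A => zof m.1)
      (fun m S => c (m, S)) 0 (zof m.1) = fun S => c (m, S) := fun m => hinj.extend_apply _ _ _
  refine ⟨Function.extend (fun m : AMon A => zof m.1) (fun m S => c (m, S)) 0, fun z hz => ?_,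
    funext fun q => congrFun (he q.1) q.2⟩
  by_cases h : ∃ m : AMon A, zof m.1 = z
  · obtain ⟨m, rfl⟩ := h
    rw [he] at hz
    obtain ⟨S, hS⟩ := Function.ne_iff.1 hz
    exact (ok_zof_iff hπ hA _).2 ⟨m.2, fun j => gamRow_eq (A := A) m.1 j ▸ hc _ hS j⟩
  · exact absurd (Function.extend_apply' _ _ _ h) hz

theorem tmap_apply {α β : Type} (T : (α → K) →ₗ[K] (β → K))
    (L : ExtV K (Fin n) →ₗ[K] ExtV K (Fin n)) (c : α × Finset (Fin n) → K)
    (q : β × Finset (Fin n)) : tmap T L c q = L (fun S => T (fun m => c (m, S)) q.1) q.2 := by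
  have h := LinearMap.pi_apply_eq_sum_univ (R := K) (ι := Finset (Fin n))
    (M₂ := Finset (Fin n) → K) L fun S => T (fun m => c (m, S)) q.1
  rw [h]
  change ∑ S, L (Pi.single S 1) q.2 * T (fun m => c (m, S)) q.1 = _
  simp only [Finset.sum_apply, Pi.smul_apply, smul_eq_mul]
  refine Finset.sum_congr rfl fun S _ => ?_
  rw [mul_comm]
  refine congrArg (fun v => T (fun m => c (m, S)) q.1 * L v q.2) (funext fun S' => ?_)
  simp [Pi.single_apply, eq_comm]

theorem DeltaF_toB {F : (Fin n → ℤ) × (Fin n → ℤ) → ExtV K (Fin n)} (hF : (sys hπ hA).Supp F) :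
    DeltaF K π A (toB A F) = toB Aᵀ (dlt π A F) := by
  funext q
  rw [DeltaF, tmap_apply, toB_apply, dlt_apply]
  refine congrArg (fun v => starA K π A v q.2) (funext fun S => ?_)
  change ((if h : OKA A (q.1.1.2, q.1.1.1) then some (⟨(q.1.1.2, q.1.1.1), h⟩ : AMon A)
    else none).map fun m => toB A F (m, S)).getD 0 = _
  split_ifs with h
  · rfl
  · rw [Option.map_none, Option.getD_none]
    by_contra h0
    exact h ((ok_zof_iff hπ hA (q.1.1.2, q.1.1.1)).1
      (hF _ fun e => h0 (by change 0 = F (zof (q.1.1.2, q.1.1.1)) S; rw [e]; rfl))).1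

theorem phiF_toB {F : (Fin n → ℤ) × (Fin n → ℤ) → ExtV K (Fin n)} (hF : (sys hπ hA).Supp F)
    (m : AMon A) (i : Fin n) (S : Finset (Fin n)) :
    phiF K π A i (fun m => toB A F (m, S)) m =
      π * ∑ j, (A j i : K) * F (zof m.1 - (sys hπ hA).s (Sum.inl j)) S := by
  simp only [phiF, LinearMap.smul_apply, LinearMap.sum_apply, Pi.smul_apply, Finset.sum_apply,
    smul_eq_mul]
  congr 1
  refine Finset.sum_congr rfl fun j _ => ?_
  congr 1
  change (Option.map _ (dite _ _ _)).getD 0 = _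
  split_ifs with h
  · rw [Option.map_some, Option.getD_some, toB_apply]
    refine congrArg (fun z => F z S) (Prod.ext (funext fun k => ?_) (funext fun k => ?_))
    · simp [zof, sys, row, Nat.cast_sub (h.1 k)]
    · simp [zof, sys]
  · rw [Option.map_none, Option.getD_none]
    by_contra h0
    obtain ⟨m', hm'⟩ := exists_amon hπ hA (hF _ fun e => h0 (by rw [e]; rfl))
    have e : m'.1.1 + A j = m.1.1 := funext fun k => by
      have := congrFun (congrArg Prod.fst hm') k
      simp only [zof, sys, Prod.fst_sub, Pi.sub_apply, row, Sum.elim_inl] at this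
      change m'.1.1 k + A j k = _
      omega
    have e2 : m'.1.2 = m.1.2 := funext fun k => by
      have := congrFun (congrArg Prod.snd hm') k
      simp only [zof, sys, Prod.snd_sub, Pi.sub_apply, Sum.elim_inl, Pi.zero_apply] at this
      omega
    refine h ⟨fun k => by rw [← e]; exact Nat.le_add_left _ _, ?_⟩
    have e3 : (fun k => m.1.1 k - A j k, m.1.2) = m'.1 := by
      refine Prod.ext (funext fun k => ?_) e2.symm
      change m.1.1 k - A j k = _
      rw [← e]
      exact Nat.add_sub_cancel _ _
    rw [e3]
    exact m'.2

theorem psidualF_toB {F : (Fin n → ℤ) × (Fin n → ℤ) → ExtV K (Fin n)} (hF : (sys hπ hA).Supp F)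
    (m : AMon A) (i : Fin n) (S : Finset (Fin n)) :
    psidualF K A i (fun m => toB A F (m, S)) m =
      F (zof m.1 - (sys hπ hA).s (Sum.inr i)) S := by
  change (Option.map _ (dite _ _ _)).getD 0 = _
  split_ifs with h
  · rw [Option.map_some, Option.getD_some, toB_apply]
    refine congrArg (fun z => F z S) (Prod.ext (funext fun k => ?_) (funext fun k => ?_))
    · simp [zof, sys]
    · simp [zof, sys, row, Nat.cast_sub (h.1 k)]
  · rw [Option.map_none, Option.getD_none]
    by_contra h0
    obtain ⟨m', hm'⟩ := exists_amon hπ hA (hF _ fun e => h0 (by rw [e]; rfl))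
    have e (k : Fin n) : m'.1.2 k + A k i = m.1.2 k := by
      have := congrFun (congrArg Prod.snd hm') k
      simp only [zof, sys, Prod.snd_sub, Pi.sub_apply, row, Sum.elim_inr,
        Matrix.transpose_apply] at this
      omega
    have e2 : m'.1.1 = m.1.1 := funext fun k => by
      have := congrFun (congrArg Prod.fst hm') k
      simp only [zof, sys, Prod.fst_sub, Pi.sub_apply, Sum.elim_inr, Pi.zero_apply] at this
      omega
    refine h ⟨fun k => by rw [← e]; exact Nat.le_add_left _ _, ?_⟩
    have e3 : (m.1.1, fun k => m.1.2 k - A k i) = m'.1 := by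
      refine Prod.ext e2.symm (funext fun k => ?_)
      change m.1.2 k - A k i = _
      rw [← e]
      exact Nat.add_sub_cancel _ _
    rw [e3]
    exact m'.2

theorem D_zof {F : (Fin n → ℤ) × (Fin n → ℤ) → ExtV K (Fin n)} (hF : (sys hπ hA).Supp F)
    (m : AMon A) : (sys hπ hA).D F (zof m.1) =
      ∑ k, (sys hπ hA).ε k ((sys hπ hA).L k F (zof m.1)) := by
  by_cases hz : (sys hπ hA).ok (zof m.1)
  · exact KSys.D_ok _ hz
  rw [KSys.D_not_ok _ hz]
  refine (Finset.sum_eq_zero fun k _ => ?_).symm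
  rw [KSys.L, hF.zero hz, smul_zero, zero_add]
  suffices h : F (zof m.1 - (sys hπ hA).s k) = 0 by rw [h, map_zero]
  by_contra h
  refine hz (ok_of_nonneg_sub hπ hA m (hF _ h).1 fun κ => ?_)
  rw [KSys.x_sub]
  split_ifs <;> linarith

theorem dFull_toB {F : (Fin n → ℤ) × (Fin n → ℤ) → ExtV K (Fin n)} (hF : (sys hπ hA).Supp F) :
    dFull K π A (toB A F) = toB A ((sys hπ hA).D F) := by
  funext q
  obtain ⟨m, S⟩ := q
  rw [toB_apply, D_zof hπ hA hF, Fintype.sum_sum_type]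
  simp only [dFull, LinearMap.add_apply, LinearMap.sum_apply, Pi.add_apply, Finset.sum_apply,
    tmap_apply]
  congr 1
  · have h1 : ∀ i, (fun S => dxF K π A i (fun m => toB A F (m, S)) m) =
        (((zof m.1).1 i : ℤ) : K) • F (zof m.1) +
          π • ∑ j, (A j i : K) • F (zof m.1 - (sys hπ hA).s (Sum.inl j)) := by
      intro i
      funext S
      simp only [dxF, LinearMap.add_apply, Pi.add_apply, phiF_toB hπ hA hF, Pi.smul_apply,
        Finset.sum_apply, smul_eq_mul]
      congr 1
      simp [diagOp, toB, zof]
    have h2 : ∀ j, (sys hπ hA).ε (Sum.inl j) ((sys hπ hA).L (Sum.inl j) F (zof m.1)) =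
        ((crd A j (zof m.1).1 : K) / π) • EA K π A j (F (zof m.1)) +
          EA K π A j (F (zof m.1 - (sys hπ hA).s (Sum.inl j))) := fun j => by
      rw [KSys.L, map_add, map_smul]; rfl
    simp only [h1, h2]
    rw [← Finset.sum_apply, ← Finset.sum_apply, Finset.sum_add_distrib, sum_crd_EA π hA hπ]
    simp only [map_add, map_smul, Finset.sum_add_distrib, map_sum, EA_apply, Finset.smul_sum]
    rw [Finset.sum_comm (f := fun j i => π • (A j i : K) • _)]
  · refine Finset.sum_congr rfl fun i _ => ?_
    refine congrArg (fun v => contrE K i v S) (funext fun S => ?_)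
    simp only [dyF, LinearMap.add_apply, Pi.add_apply, psidualF_toB hπ hA hF, KSys.L]
    congr 1
    change π⁻¹ * ((lamRow A m.1.2 i : ℚ) : K) * F (zof m.1) S = ((crd Aᵀ i (zof m.1).2 : K) / π) * F (zof m.1) S
    rw [lamRow_eq, div_eq_inv_mul]

end Translate

theorem sum_fiber {K X Y D E : Type} [Field K] (P : Finset X) (Q : Finset Y) (B : Finset D)
    (C : Finset E) (f : X → D) (g : Y → E) (a : X → K) (b : Y → K) (h : D → E → K)
    (h0 : ∀ x y, h (f x) (g y) ≠ 0 → f x ∈ B ∧ g y ∈ C) :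
    ∑ δ ∈ B, ∑ ε ∈ C, (∑ x ∈ P, if f x = δ then a x else 0) *
      (∑ y ∈ Q, if g y = ε then b y else 0) * h δ ε =
    ∑ x ∈ P, ∑ y ∈ Q, a x * b y * h (f x) (g y) := by
  have h1 : ∀ x y, a x * b y * h (f x) (g y) = ∑ δ ∈ B, ∑ ε ∈ C,
      (if f x = δ then a x else 0) * (if g y = ε then b y else 0) * h δ ε := fun x y => by
    simp only [ite_mul, mul_ite, zero_mul, mul_zero, Finset.sum_ite_eq]
    by_cases e : h (f x) (g y) = 0
    · simp [e]
    · simp [h0 x y e]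
  simp_rw [h1, Finset.sum_mul_sum, Finset.sum_mul]
  exact (Finset.sum_congr rfl fun _ _ => Finset.sum_comm).trans <| Finset.sum_comm.trans <|
    Finset.sum_congr rfl fun _ _ =>
      (Finset.sum_congr rfl fun _ _ => Finset.sum_comm).trans Finset.sum_comm

theorem zof_add {n : ℕ} (m m' : MonIdx (Fin n)) : zof (m + m') = zof m + zof m' := by
  refine Prod.ext (funext fun k => ?_) (funext fun k => ?_)
  · exact Nat.cast_add _ _
  · exact Nat.cast_add _ _

theorem zof_nsmul {n : ℕ} (p : ℕ) (m : MonIdx (Fin n)) : zof (p • m) = p • zof m := by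
  induction p with
  | zero => rw [zero_smul, zero_smul]; rfl
  | succ p ih => rw [succ_nsmul, succ_nsmul, zof_add, ih]

section TwistedFrobenius

variable {K : Type} [Field K] [CharZero K] {n : ℕ} {π : K} (hπ : π ≠ 0)
  {A : Matrix (Fin n) (Fin n) ℕ} (hA : (Aq A).det ≠ 0) {p : ℕ}

theorem twistDiag_toB (κ : K) (F : (Fin n → ℤ) × (Fin n → ℤ) → ExtV K (Fin n)) :
    pQQdualdiag K p A (TwistDiag K p κ π A (toB A F)) = toB A (twist p (κ * π) A F) := by
  funext q
  have h1 : hashA A q = (frs A (zof q.1.1).1).card := by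
    simp only [hashA, frs, gamRow_eq]
  have h2 : hashAdual A q = (frs Aᵀ (zof q.1.1).2).card := by
    simp only [hashAdual, frs, lamRow_eq]
  have h3 : qexpDual A q = (nzs A (zof q.1.1) \ q.2).card := by
    unfold qexpDual nzs
    congr 1
    ext i
    simp [lamRow_eq, and_comm]
  change (p : K) ^ (qexpQ A q + qexpDual A q) *
    ((κ * π) ^ ((((p : ℤ) - 1) / 2) * (hashA A q - hashAdual A q)) * F (zof q.1.1) q.2) = _
  rw [toB_apply, twist_apply, Pi.smul_apply, gw_apply, tau, qexpQ, h1, h2, h3, smul_eq_mul,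
    add_assoc, ← two_mul]
  ring

theorem OKA_smul (hA : (Aq A).det ≠ 0) (hp : 0 < p) {m : MonIdx (Fin n)} (h : OKA A m) : OKA (p • A) (p • m) := by
  have hp0 : (p : ℚ) ≠ 0 := by exact_mod_cast hp.ne'
  have h1 : Aq (p • A) = (p : ℚ) • Aq A := by
    ext i j
    change ((p • A i j : ℕ) : ℚ) = p * (A i j : ℚ)
    rw [smul_eq_mul, Nat.cast_mul]
  have h2 (M : Matrix (Fin n) (Fin n) ℚ) (hM : M.det ≠ 0) (v : Fin n → ℕ) :
      Matrix.vecMul (fun i => (((p • v) i : ℕ) : ℚ)) ((p : ℚ) • M)⁻¹ =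
        Matrix.vecMul (fun i => (v i : ℚ)) M⁻¹ := by
    have h3 : ((p : ℚ) • M)⁻¹ = (p : ℚ)⁻¹ • M⁻¹ := by
      refine Matrix.inv_eq_right_inv ?_
      rw [Matrix.smul_mul, Matrix.mul_smul, Matrix.mul_nonsing_inv _ (isUnit_iff_ne_zero.2 hM),
        smul_smul, mul_inv_cancel₀ hp0, one_smul]
    have h4 : (fun i => (((p • v) i : ℕ) : ℚ)) = (p : ℚ) • fun i => (v i : ℚ) := by
      funext i
      change ((p • v i : ℕ) : ℚ) = p * (v i : ℚ)
      rw [smul_eq_mul, Nat.cast_mul]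
    rw [h3, h4, Matrix.vecMul_smul, Matrix.smul_vecMul, smul_smul, inv_mul_cancel₀ hp0, one_smul]
  have hg : gamRow (p • A) (p • m.1) = gamRow A m.1 := by
    rw [gamRow, h1, h2 _ hA]; rfl
  have hl : lamRow (p • A) (p • m.2) = lamRow A m.2 := by
    rw [lamRow, h1, Matrix.transpose_smul, h2 _ (by rwa [Matrix.det_transpose])]; rfl
  refine ⟨fun i => by rw [Prod.smul_snd, hl]; exact h.1 i, ?_⟩
  have h5 : (fun i => (((p • m).2 i : ℕ) : ℚ)) = (p : ℚ) • fun i => (m.2 i : ℚ) := by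
    funext i
    change ((p • m.2 i : ℕ) : ℚ) = p * (m.2 i : ℚ)
    rw [smul_eq_mul, Nat.cast_mul]
  rw [Prod.smul_fst, hg, h5, dotProduct_smul, h.2, smul_zero]

theorem ThetaPrimeF_toB (hp : 0 < p) {F : (Fin n → ℤ) × (Fin n → ℤ) → ExtV K (Fin n)}
    (hF : (sys hπ hA).Supp F) (m : AMon (p • A)) (S : Finset (Fin n)) :
    ThetaPrimeF K p A (fun m => toB A F (m, S)) m = KSys.dilate p F (zof m.1) S := by
  change (Option.map _ (dite _ _ _)).getD 0 = _
  split_ifs with h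
  · rw [Option.map_some, Option.getD_some, toB_apply]
    have e : zof m.1 = p • zof (⟨fun i => m.1.1 i / p, fun i => m.1.2 i / p⟩ : MonIdx (Fin n)) := by
      rw [← zof_nsmul]
      refine congrArg zof (Prod.ext (funext fun k => ?_) (funext fun k => ?_))
      · exact (Nat.mul_div_cancel' (h.2 k).1).symm
      · exact (Nat.mul_div_cancel' (h.2 k).2).symm
    rw [e, KSys.dilate_nsmul (nsmul_injective hp)]
  · rw [Option.map_none, Option.getD_none]
    by_contra h0
    by_cases hw : ∃ w, p • w = zof m.1
    swap
    · exact h0 (by rw [KSys.dilate_of_not F hw]; rfl)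
    obtain ⟨w, hw⟩ := hw
    rw [← hw, KSys.dilate_nsmul (nsmul_injective hp)] at h0
    obtain ⟨m', hm'⟩ := exists_amon hπ hA (hF w fun e => h0 (by rw [e]; rfl))
    have e : m.1 = p • m'.1 := zof_injective (by rw [← hw, ← hm', zof_nsmul])
    have e1 : (⟨fun i => m.1.1 i / p, fun i => m.1.2 i / p⟩ : MonIdx (Fin n)) = m'.1 := by
      rw [e]
      refine Prod.ext (funext fun k => ?_) (funext fun k => ?_) <;> simp [hp]
    refine h ⟨by rw [e1]; exact m'.2, fun i => ?_⟩
    rw [e]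
    exact ⟨dvd_mul_right _ _, dvd_mul_right _ _⟩

theorem ZmulF_toB (hp : 0 < p) {F : (Fin n → ℤ) × (Fin n → ℤ) → ExtV K (Fin n)}
    (hF : (sys hπ hA).Supp F) (m : AMon A) (S : Finset (Fin n)) (δ ε : Fin n → ℕ) :
    (if h : (∀ k, δ k ≤ m.1.1 k) ∧ (∀ k, ε k ≤ m.1.2 k) ∧
        OKA (p • A) ((fun k => m.1.1 k - δ k), (fun k => m.1.2 k - ε k))
      then ThetaPrimeF K p A (fun m => toB A F (m, S))
        ⟨((fun k => m.1.1 k - δ k), (fun k => m.1.2 k - ε k)), h.2.2⟩ else 0) =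
      KSys.dilate p F (zof m.1 - zof (δ, ε)) S := by
  split_ifs with h
  · rw [ThetaPrimeF_toB hπ hA hp hF]
    refine congrArg (fun z => KSys.dilate p F z S) (Prod.ext (funext fun k => ?_) (funext fun k => ?_))
    · simp [zof, Nat.cast_sub (h.1 k)]
    · simp [zof, Nat.cast_sub (h.2.1 k)]
  · by_contra h0
    by_cases hw : ∃ w, p • w = zof m.1 - zof (δ, ε)
    swap
    · exact h0 (by rw [KSys.dilate_of_not F hw]; rfl)
    obtain ⟨w, hw⟩ := hw
    rw [← hw, KSys.dilate_nsmul (nsmul_injective hp)] at h0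
    obtain ⟨m', hm'⟩ := exists_amon hπ hA (hF w fun e => h0 (by rw [e]; rfl))
    have e : m.1 = p • m'.1 + (δ, ε) := zof_injective (by
      rw [zof_add, zof_nsmul, hm', hw, sub_add_cancel])
    refine h ⟨fun k => by rw [e]; exact Nat.le_add_left _ _,
      fun k => by rw [e]; exact Nat.le_add_left _ _, ?_⟩
    convert OKA_smul hA hp m'.2 using 1
    rw [e]
    refine Prod.ext (funext fun k => ?_) (funext fun k => ?_) <;> simp

theorem le_sum_vecMul (hA : (Aq A).det ≠ 0) (k : Fin n → ℕ) (i : Fin n) :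
    k i ≤ ∑ j, ∑ i, k i * A i j := by
  have h1 : 1 ≤ ∑ j, A i j := by
    have := one_le_sum_row hA i
    simp only [row] at this
    exact_mod_cast this
  rw [Finset.sum_comm]
  calc k i ≤ ∑ j, k i * A i j := by rw [← Finset.mul_sum]; exact Nat.le_mul_of_pos_right _ h1
    _ ≤ _ := Finset.single_le_sum (f := fun i => ∑ j, k i * A i j) (fun _ _ => Nat.zero_le _)
      (Finset.mem_univ i)

theorem Zcoef_eq (hA : (Aq A).det ≠ 0) {δ : Fin n → ℕ} {N : ℕ} (hN : ∑ j, δ j ≤ N) :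
    Zcoef K p π A δ = ∑ k ∈ Fintype.piFinset fun _ : Fin n => Finset.range (N + 1),
      if (fun j => ∑ i, k i * A i j) = δ then ∏ i, dworkCoef K p π (k i) else 0 := by
  simp only [Zcoef, ← funext_iff (g := δ)]
  refine Finset.sum_subset (fun k hk => ?_) fun k _ hk => if_neg fun h => hk ?_
  · simp only [Fintype.mem_piFinset, Finset.mem_range] at hk ⊢
    exact fun i => (hk i).trans_le (by omega)
  · simp only [Fintype.mem_piFinset, Finset.mem_range]
    exact fun i => Nat.lt_succ_of_le (h ▸ le_sum_vecMul hA k i)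

theorem shift_eq (k : Fin n ⊕ Fin n → ℕ) : (sys hπ hA).shift k =
    zof (fun j => ∑ i, k (Sum.inl i) * A i j, fun j => ∑ i, k (Sum.inr i) * Aᵀ i j) := by
  rw [KSys.shift, Fintype.sum_sum_type]
  refine Prod.ext (funext fun j => ?_) (funext fun j => ?_) <;>
    simp [sys, zof, row, Prod.fst_sum, Prod.snd_sum]

theorem mulSeries_eq {G : (Fin n → ℤ) × (Fin n → ℤ) → ExtV K (Fin n)} (d : ℕ → K)
    (m : MonIdx (Fin n)) (S : Finset (Fin n)) {N : ℕ}
    (h : ∀ k : Fin n ⊕ Fin n → ℕ, G (zof m - (sys hπ hA).shift k) S ≠ 0 → ∀ κ, k κ ≤ N)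
    (hG : (sys hπ hA).Nonneg G) :
    (sys hπ hA).mulSeries d G (zof m) S =
      ∑ k ∈ Fintype.piFinset fun _ : Fin n => Finset.range (N + 1),
      ∑ l ∈ Fintype.piFinset fun _ : Fin n => Finset.range (N + 1),
        (∏ i, d (k i)) * (∏ i, d (l i)) * G (zof m - zof (fun j => ∑ i, k i * A i j,
          fun j => ∑ i, l i * Aᵀ i j)) S := by
  have h1 : (sys hπ hA).mulSeries d G (zof m) S = ∑ᶠ k : Fin n ⊕ Fin n → ℕ,
      (∏ κ, d (k κ)) * G (zof m - (sys hπ hA).shift k) S := by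
    have := (Pi.evalAddMonoidHom (fun _ : Finset (Fin n) => K) S).map_finsum
      (hG.finite (fun k => ∏ κ, d (k κ)) (zof m))
    exact this
  rw [h1, ← finsum_comp_equiv (Equiv.sumArrowEquivProdArrow (Fin n) (Fin n) ℕ).symm,
    ← Finset.sum_product', finsum_eq_sum_of_support_subset]
  · refine Finset.sum_congr rfl fun k _ => ?_
    rw [shift_eq, Fintype.prod_sum_type]
    rfl
  · intro k hk
    have := h _ (right_ne_zero_of_mul hk)
    simp only [Finset.coe_product, Set.mem_prod, Finset.mem_coe, Fintype.mem_piFinset,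
      Finset.mem_range]
    exact ⟨fun i => Nat.lt_succ_of_le (this (Sum.inl i)),
      fun i => Nat.lt_succ_of_le (this (Sum.inr i))⟩

theorem frob_zof (hp : 0 < p) {d : ℕ → K} {F : (Fin n → ℤ) × (Fin n → ℤ) → ExtV K (Fin n)}
    (hF : (sys hπ hA).Supp F) (m : AMon A) : (sys hπ hA).frob d p F (zof m.1) =
      (sys hπ hA).mulSeries d (KSys.dilate p F) (zof m.1) := by
  by_cases hz : (sys hπ hA).ok (zof m.1)
  · exact if_pos hz
  rw [KSys.frob, if_neg hz]
  refine (finsum_eq_zero_of_forall_eq_zero fun k => ?_).symm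
  suffices h : KSys.dilate p F (zof m.1 - (sys hπ hA).shift k) = 0 by rw [h, smul_zero]
  by_contra h
  have hG := KSys.dilate_nonneg (nsmul_injective hp) hF.nonneg
  refine hz (ok_of_nonneg_sub hπ hA m (hG _ h) fun κ => ?_)
  rw [map_sub, KSys.x_shift]
  have : (0 : ℚ) ≤ k κ := Nat.cast_nonneg _
  linarith

theorem TFrFull_toB (hp : 0 < p) (κ : K) {F : (Fin n → ℤ) × (Fin n → ℤ) → ExtV K (Fin n)}
    (hF : (sys hπ hA).Supp F) : TFrFull K p κ π A (toB A F) =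
      toB A ((sys hπ hA).frob (dworkCoef K p π) p (twist p (κ * π) A F)) := by
  have hA' := det_Aq_transpose hA
  have hF' := twist_supp p hπ hA (κ * π) hF
  set G := twist p (κ * π) A F with hGdef
  have hG := KSys.dilate_nonneg (S := sys hπ hA) (nsmul_injective hp) hF'.nonneg
  funext q
  obtain ⟨m, S⟩ := q
  rw [toB_apply, frob_zof hπ hA hp hF']
  change tmap _ LinearMap.id (pQQdualdiag K p A (TwistDiag K p κ π A (toB A F))) (m, S) = _
  rw [twistDiag_toB, ← hGdef, tmap_apply]
  set a := ∑ j, m.1.1 j with ha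
  set b := ∑ j, m.1.2 j with hb
  have hle : ∀ δ ε : Fin n → ℕ, KSys.dilate p G (zof m.1 - zof (δ, ε)) S ≠ 0 →
      (∀ k, δ k ≤ m.1.1 k) ∧ ∀ k, ε k ≤ m.1.2 k := fun δ ε h => by
    rw [← ZmulF_toB hπ hA hp hF'] at h
    by_contra h'
    exact h (dif_neg fun h'' => h' ⟨h''.1, h''.2.1⟩)
  have hbox : ∀ (v w : Fin n → ℕ), (∀ k, v k ≤ w k) →
      v ∈ Fintype.piFinset fun _ : Fin n => Finset.range (∑ j, w j + 1) := fun v w h => by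
    simp only [Fintype.mem_piFinset, Finset.mem_range]
    exact fun i => Nat.lt_succ_of_le ((h i).trans
      (Finset.single_le_sum (fun _ _ => Nat.zero_le _) (Finset.mem_univ i)))
  have hsum : ∀ (v : Fin n → ℕ) (c : ℕ),
      v ∈ (Fintype.piFinset fun _ : Fin n => Finset.range (c + 1)) → ∑ j, v j ≤ n * c :=
    fun v c h => by
    simp only [Fintype.mem_piFinset, Finset.mem_range] at h
    simpa using Finset.sum_le_card_nsmul Finset.univ v c fun i _ => Nat.le_of_lt_succ (h i)
  rw [mulSeries_eq hπ hA _ _ _ (N := n * a + n * b) ?_ hG]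
  · change ∑ δ ∈ _, ∑ ε ∈ _, _ * _ * (dite _ _ _) = _
    simp only [ZmulF_toB hπ hA hp hF']
    refine Eq.trans ?_ (sum_fiber _ _ (Fintype.piFinset fun _ : Fin n => Finset.range (a + 1))
      (Fintype.piFinset fun _ : Fin n => Finset.range (b + 1))
      (fun k : Fin n → ℕ => fun j => ∑ i, k i * A i j)
      (fun l : Fin n → ℕ => fun j => ∑ i, l i * Aᵀ i j)
      (fun k => ∏ i, dworkCoef K p π (k i)) (fun l => ∏ i, dworkCoef K p π (l i))
      (fun δ ε => KSys.dilate p G (zof m.1 - zof (δ, ε)) S)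
      fun k l h => ⟨hbox _ _ (hle _ _ h).1, hbox _ _ (hle _ _ h).2⟩)
    refine Finset.sum_congr rfl fun δ hδ => Finset.sum_congr rfl fun ε hε => ?_
    rw [Zcoef_eq hA ((hsum δ a hδ).trans (Nat.le_add_right _ (n * b))),
      Zcoef_eq hA' ((hsum ε b hε).trans (Nat.le_add_left _ (n * a)))]
    refine congrArg₂ _ (congrArg₂ _ ?_ ?_) rfl <;>
      exact Finset.sum_congr rfl fun _ _ => by congr
  · intro k h κ
    rw [shift_eq] at h
    have h1 := hle _ _ h
    rcases κ with i | i
    · exact (le_sum_vecMul hA (fun i => k (Sum.inl i)) i).trans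
        ((hsum _ a (hbox _ _ h1.1)).trans (Nat.le_add_right _ _))
    · exact (le_sum_vecMul hA' (fun i => k (Sum.inr i)) i).trans
        ((hsum _ b (hbox _ _ h1.2)).trans (Nat.le_add_left _ _))

end TwistedFrobenius

section Overconvergent

variable {p : ℕ} {K : Type} [NontriviallyNormedField K] [CharZero K] {n : ℕ} {π : K}
  (hπ : π ≠ 0) {A : Matrix (Fin n) (Fin n) ℕ} (hA : (Aq A).det ≠ 0)

theorem tdeg_zof (m : MonIdx (Fin n)) : tdeg n (zof m) = degMon m := by
  simp [tdeg, zof, degMon]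

theorem finite_degMon_lt (A : Matrix (Fin n) (Fin n) ℕ) (N : ℕ) :
    {q : BIdx A | degMon q.1.1 < N}.Finite := by
  have h1 : {m : MonIdx (Fin n) | degMon m < N}.Finite := by
    refine (Set.finite_Iic ((fun _ => N, fun _ => N) : MonIdx (Fin n))).subset fun m hm => ?_
    have hm : ∑ i, m.1 i + ∑ i, m.2 i < N := hm
    have h (v : Fin n → ℕ) (i : Fin n) : v i ≤ ∑ i, v i :=
      Finset.single_le_sum (fun _ _ => Nat.zero_le _) (Finset.mem_univ i)
    exact ⟨fun i => (h m.1 i).trans (by change _ ≤ N; omega),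
      fun i => (h m.2 i).trans (by change _ ≤ N; omega)⟩
  refine ((h1.prod Set.finite_univ).preimage (f := fun q : BIdx A => (q.1.1, q.2)) ?_).subset
    fun q hq => ⟨hq, trivial⟩
  rintro ⟨m, S⟩ _ ⟨m', S'⟩ _ h
  simp only [Prod.mk.injEq] at h
  exact Prod.ext (Subtype.ext h.1) h.2

theorem cover_toB (hp : 1 < p) {F : (Fin n → ℤ) × (Fin n → ℤ) → ExtV K (Fin n)}
    (hF : (sys hπ hA).Supp F) (hO : (sys hπ hA).OC (tdeg n) F) : COver p (toB A F) := by
  have hok : ∀ q, toB A F q ≠ 0 → (sys hπ hA).ok (zof q.1.1) := fun q hq =>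
    hF _ fun e => hq (by rw [toB_apply, e]; rfl)
  refine ⟨?_, fun q hq j => (gamRow_eq (A := A) q.1.1 j).symm ▸
    ((ok_zof_iff hπ hA _).1 (hok q hq)).2 j⟩
  obtain ⟨r, C, h0, h1, hC, h⟩ := hO
  have hp1 : (1 : ℝ) < p := by exact_mod_cast hp
  set s := √r with hs
  have hs0 : 0 < s := Real.sqrt_pos.2 h0
  have hs1 : s < 1 := by rw [hs, Real.sqrt_lt' one_pos]; simpa using h1
  have hsr : s * s = r := Real.mul_self_sqrt h0.le
  have hpow : ∀ k : ℕ, (p : ℝ) ^ (-(-Real.logb p s * (k : ℝ))) = s ^ k := fun k => by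
    rw [neg_mul, neg_neg, Real.rpow_mul (by positivity),
      Real.rpow_logb (by positivity) hp1.ne' hs0, Real.rpow_natCast]
  refine ⟨-Real.logb p s, neg_pos.2 (Real.logb_neg hp1 hs0 hs1), ?_⟩
  obtain ⟨N, hN⟩ : ∃ N : ℕ, C * s ^ N ≤ 1 := by
    have := (tendsto_pow_atTop_nhds_zero_of_lt_one hs0.le hs1).const_mul C
    rw [mul_zero] at this
    obtain ⟨N, hN⟩ := (this.eventually (ge_mem_nhds one_pos)).exists
    exact ⟨N, hN⟩
  refine (finite_degMon_lt A N).subset fun q hq => ?_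
  by_contra hlt
  refine hq ?_
  have hlt : N ≤ degMon q.1.1 := not_lt.1 hlt
  rw [hpow]
  by_cases hz : (sys hπ hA).ok (zof q.1.1)
  swap
  · rw [show toB A F q = 0 from by_contra fun h => hz (hok q h), norm_zero]
    positivity
  calc ‖toB A F q‖ ≤ ‖F (zof q.1.1)‖ := norm_le_pi_norm (F (zof q.1.1)) q.2
    _ ≤ C * r ^ degMon q.1.1 := by
      have := h _ hz
      rwa [tdeg_zof, zpow_natCast] at this
    _ = C * s ^ degMon q.1.1 * s ^ degMon q.1.1 := by rw [← hsr, mul_pow]; ring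
    _ ≤ 1 * s ^ degMon q.1.1 := by
      refine mul_le_mul_of_nonneg_right (le_trans ?_ hN) (by positivity)
      exact mul_le_mul_of_nonneg_left (pow_le_pow_of_le_one hs0.le hs1.le hlt) hC
    _ = _ := one_mul _

theorem exists_toB_OC (hp : 1 < p) {c : BFull K A} (hc : COver p c) :
    ∃ F, (sys hπ hA).Supp F ∧ (sys hπ hA).OC (tdeg n) F ∧ toB A F = c := by
  obtain ⟨F, hF, rfl⟩ := exists_toB hπ hA c hc.2
  refine ⟨F, hF, ?_, rfl⟩
  obtain ⟨M, hM, hfin⟩ := hc.1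
  have hp1 : (1 : ℝ) < p := by exact_mod_cast hp
  set r := (p : ℝ) ^ (-M) with hr
  have hr0 : 0 < r := Real.rpow_pos_of_pos (by positivity) _
  have hpow : ∀ k : ℕ, (p : ℝ) ^ (-(M * (k : ℝ))) = r ^ k := fun k => by
    rw [← neg_mul, Real.rpow_mul (by positivity), Real.rpow_natCast]
  have hterm : ∀ q : BIdx A, 0 ≤ ‖toB A F q‖ / r ^ degMon q.1.1 := fun q => by positivity
  refine ⟨r, 1 + ∑ q ∈ hfin.toFinset, ‖toB A F q‖ / r ^ degMon q.1.1, hr0,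
    Real.rpow_lt_one_of_one_lt_of_neg hp1 (neg_neg_of_pos hM),
    add_nonneg zero_le_one (Finset.sum_nonneg fun q _ => hterm q), fun z hz => ?_⟩
  obtain ⟨m, rfl⟩ := exists_amon hπ hA hz
  have hC := Finset.sum_nonneg fun q (_ : q ∈ hfin.toFinset) => hterm q
  rw [tdeg_zof, zpow_natCast, pi_norm_le_iff_of_nonneg (by positivity)]
  intro S
  change ‖toB A F (m, S)‖ ≤ _
  by_cases h : ‖toB A F (m, S)‖ ≤ (p : ℝ) ^ (-(M * (degMon m.1 : ℝ)))
  · rw [hpow] at h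
    exact h.trans (le_mul_of_one_le_left (by positivity) (by linarith))
  · have h2 := Finset.single_le_sum (f := fun q : BIdx A => ‖toB A F q‖ / r ^ degMon q.1.1)
      (fun q _ => hterm q) (hfin.mem_toFinset.2 h)
    simp only at h2
    rw [div_le_iff₀ (by positivity)] at h2
    exact h2.trans (mul_le_mul_of_nonneg_right (by linarith) (by positivity))

end Overconvergent

end BH

/-- Theorem 9.5: for `p` odd and `κ` with `(κπ)^{p-1} = p`, the twisted Frobenius
`TFr_A = Fr_A ∘ (κπ)^{(p−1)(#_A − #^∨_A)/2}` is a chain map `C^†_A(K) → C^†_A(K)`,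
and on cohomology `H(Δ^A) ∘ H(TFr_A) = H(TFr_{Aᵀ}) ∘ H(Δ^A)` as maps
`H(C^†_A(K)) → H(C^†_{Aᵀ}(K))` (expressed elementwise: on every cocycle of `C^†_A(K)`
the two composites differ by a coboundary of `C^†_{Aᵀ}(K)`). -/
theorem twisted_Frobenius_commutes_with_duality_in_cohomology
    (p : ℕ) [hp : Fact p.Prime] (hodd : p ≠ 2)
    (K : Type) [NontriviallyNormedField K] [CompleteSpace K]
    [CharZero K] (halg : IsAlgClosed K)
    (hna : ∀ a b : K, ‖a + b‖ ≤ max ‖a‖ ‖b‖) (hpnorm : ‖(p : K)‖ = (p : ℝ)⁻¹)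
    (π : K) (hπ : π ^ (p - 1) = -(p : K))
    (κ : K) (hκ : (κ * π) ^ (p - 1) = (p : K))
    (n : ℕ) (A : Matrix (Fin n) (Fin n) ℕ)
    (hdet : 0 < (A.map ((↑) : ℕ → ℤ)).det ∧ (A.map ((↑) : ℕ → ℤ)).det < (p : ℤ))
    (hABH : IsBH (AlgebraicClosure (ZMod p)) A) :
    (∀ c : BFull K A, COver p c → COver p (dFull K π A c)) ∧
    (∀ c : BFull K A, COver p c → COver p (TFrFull K p κ π A c)) ∧
    (∀ c : BFull K A, COver p c →
      TFrFull K p κ π A (dFull K π A c) = dFull K π A (TFrFull K p κ π A c)) ∧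
    (∀ c : BFull K A, COver p c → dFull K π A c = 0 →
      ∃ b : BFull K Aᵀ, COver p b ∧
        DeltaF K π A (TFrFull K p κ π A c)
          = TFrFull K p κ π Aᵀ (DeltaF K π A c) + dFull K π Aᵀ b) := by
  have hna' : IsUltrametricDist K :=
    IsUltrametricDist.isUltrametricDist_of_forall_norm_add_le_max_norm hna
  have hp1 : 1 < p := hp.out.one_lt
  have hp0 : 0 < p := hp.out.pos
  have hpn : ‖(p : K)‖ ≤ 1 := hpnorm ▸ inv_le_one_of_one_le₀ (by exact_mod_cast hp1.le)
  have hπ0 : π ≠ 0 := BH.pi_ne_zero hpnorm hπ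
  have hA : (Aq A).det ≠ 0 := hABH.1
  have hA' := BH.det_Aq_transpose hA
  have hdet' : 0 < (Aᵀ.map ((↑) : ℕ → ℤ)).det ∧ (Aᵀ.map ((↑) : ℕ → ℤ)).det < (p : ℤ) := by
    have e : Aᵀ.map ((↑) : ℕ → ℤ) = (A.map (↑))ᵀ := rfl
    rwa [e, Matrix.det_transpose]
  have hS := BH.sys_growth hpnorm hπ hπ0 hA hdet
  have hS' := BH.sys_growth hpnorm hπ hπ0 hA' hdet'
  have hdeg : ∀ z, (BH.sys hπ0 hA).ok z → 0 ≤ BH.tdeg n z := fun _ => BH.tdeg_nonneg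
  have hdeg' : ∀ k, 0 ≤ BH.tdeg n ((BH.sys hπ0 hA).s k) := fun k => zero_le_one.trans (hS.deg_s k)
  have hdw := BH.dworkCoef_decay hodd hpnorm hπ
  refine ⟨fun c hc => ?_, fun c hc => ?_, fun c hc => ?_, fun c hc hd => ?_⟩
  all_goals obtain ⟨F, hF, hO, rfl⟩ := BH.exists_toB_OC hπ0 hA hp1 hc
  · rw [BH.dFull_toB hπ0 hA hF]
    exact BH.cover_toB hπ0 hA hp1 (BH.KSys.D_supp _)
      (BH.KSys.OC.D hdeg hS hO hF)
  · rw [BH.TFrFull_toB hπ0 hA hp0 κ hF]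
    exact BH.cover_toB hπ0 hA hp1 (BH.KSys.frob_supp _ _ _)
      (BH.KSys.frob_OC hp0 (BH.nsmul_injective hp0) hdeg hdeg' hdw
        (BH.twist_supp p hπ0 hA (κ * π) hF)
        (BH.twist_OC hπ0 hA p (κ * π) hpn hO))
  · rw [BH.dFull_toB hπ0 hA hF, BH.TFrFull_toB hπ0 hA hp0 κ (BH.KSys.D_supp _),
      BH.TFrFull_toB hπ0 hA hp0 κ hF, BH.dFull_toB hπ0 hA (BH.KSys.frob_supp _ _ _),
      BH.frob_twist_D hπ0 hA p (κ * π) hp0 (fun m => BH.dworkCoef_rec K π hp0 m) hF]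
  · rw [BH.dFull_toB hπ0 hA hF] at hd
    obtain ⟨b, hb, hbO, h⟩ := BH.frob_dlt_twist_cohomologous hπ0 hA p (κ * π) hp0 hp1.ne' hpn
      (hp.out.odd_of_ne_two hodd) hκ (fun m => BH.dworkCoef_rec K π hp0 m) hdw hdet.1 hS hS'
      hABH.2.2.1 (fun V lam hV => BH.kosReg halg hna hpnorm hABH V lam hV) hF hO
      (BH.eq_zero_of_toB hπ0 hA (BH.KSys.D_supp _) hd)
    refine ⟨BH.toB Aᵀ b, BH.cover_toB hπ0 hA' hp1 hb hbO, ?_⟩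
    rw [BH.TFrFull_toB hπ0 hA hp0 κ hF, BH.DeltaF_toB hπ0 hA (BH.KSys.frob_supp _ _ _),
      BH.DeltaF_toB hπ0 hA hF, BH.TFrFull_toB hπ0 hA' hp0 κ (BH.dlt_supp hπ0 hA hF),
      BH.dFull_toB hπ0 hA' hb, h, map_add]
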